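/- For each ε ∈ (0, 1/100) there exists L₀ such that for every integer L ≥ L₀ and every positive integer q with Σ_{p prime, p∣q} 1/p ≤ (1−ε) Σ_{p prime, p≤L} 1/p, there exists M₀ = M₀(q,L) such that for all M ≥ M₀ there exists an integer z with 0 ≤ z < Lq for which Σ_{j=0}^{⌊M/(Lq)⌋} Σ_{a=0}^{q−1} | Σ_{m ∈ [z+jLq, z+(j+1)Lq), m ≡ a (mod q)} μ(m) | ≤ ε·M. -/

import Mathlib

open Filter Topology

noncomputable def mobius (n : ℕ) : ℝ := (ArithmeticFunction.moebius n : ℤ)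

noncomputable def primeVol (q : ℕ) : ℝ := ∑ p ∈ q.primeFactors, (1 : ℝ) / p

/-- sum of 1/p over primes p ≤ L -/
noncomputable def primeSumUpToNat (L : ℕ) : ℝ :=
  ∑ p ∈ (Finset.Iic L).filter Nat.Prime, (1 : ℝ) / p

set_option linter.all false
section MR
open Complex hiding arctan cos cos_two_mul exp exp_add exp_log exp_nat_mul exp_neg exp_sub exp_sum exp_zero hasDerivAt_log log log_exp log_mul sin sin_neg sin_sq_add_cos_sq sqrt sqrt_one sqrt_zero
open Real Finset MeasureTheory Filter Topology

/-- triangle function -/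
noncomputable def tri (D x:ℝ):ℝ := max 0 (D - |x|)
/-- Fourier transform of the triangle function -/
noncomputable def triHat (D t:ℝ):ℝ := D ^ 2*sinc (D*t / 2) ^ 2
/-- the phase `e^{-itx}` -/
noncomputable def ph (t x:ℝ):ℂ := cexp (-(t*x:ℝ)*I)

lemma tri_nonneg (D x:ℝ) : 0 ≤ tri D x := le_max_left _ _
lemma tri_le {D:ℝ} (hD : 0 ≤ D) (x:ℝ) : tri D x ≤ D := by
  unfold tri; exact max_le hD (by linarith [abs_nonneg x])
lemma tri_neg (D x:ℝ) : tri D (-x) = tri D x := by simp [tri]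
lemma tri_eq_zero {D x:ℝ} (h : D ≤ |x|) : tri D x = 0 := by
  unfold tri; exact max_eq_left (by linarith)
lemma tri_continuous (D:ℝ) : Continuous (tri D) := by unfold tri; fun_prop
lemma tri_lip (D x y:ℝ) : |tri D x - tri D y| ≤ |x - y| := by
  unfold tri
  have h1 := abs_max_sub_max_le_abs (D - |x|) (D - |y|) 0
  rw [max_comm, max_comm 0 (D - |y|)]
  refine h1.trans ?_
  have := abs_abs_sub_abs_le x y
  rw [show D - |x| - (D - |y|) = -(|x| - |y|) by ring, abs_neg]; exact this
lemma tri_support {D:ℝ} : Function.support (tri D) ⊆ Set.Icc (-D) D := by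
  intro x hx
  by_contra h
  apply hx
  apply tri_eq_zero
  by_contra h2
  exact h (by rw [not_le] at h2; exact ⟨(abs_lt.mp h2).1.le, (abs_lt.mp h2).2.le⟩)
lemma tri_compact (D:ℝ) : HasCompactSupport (tri D) :=
  HasCompactSupport.of_support_subset_isCompact isCompact_Icc tri_support

lemma triHat_nonneg (D t:ℝ) : 0 ≤ triHat D t := by unfold triHat; positivity
lemma triHat_le (D t:ℝ) : triHat D t ≤ D ^ 2 := by
  unfold triHat
  have := abs_sinc_le_one (D*t / 2)
  have h2 : sinc (D*t / 2) ^ 2 ≤ 1 := by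
    rw [← sq_abs]; nlinarith [abs_nonneg (sinc (D*t/2))]
  nlinarith [sq_nonneg D]
lemma triHat_mul_sq (D t:ℝ) : triHat D t*t ^ 2 = 2 - 2*cos (D*t) := by
  unfold triHat
  have h : sinc (D*t / 2)*(D*t / 2) = sin (D*t / 2) := by
    by_cases h0 : D*t / 2 = 0
    · rw [h0]; simp
    · rw [sinc_of_ne_zero h0]; exact div_mul_cancel₀ _ h0
  have h2 : cos (D*t) = 1 - 2*sin (D*t / 2) ^ 2 := by
    have := cos_two_mul (D*t / 2)
    rw [show 2*(D*t / 2) = D*t by ring] at this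
    rw [this]; nlinarith [sin_sq_add_cos_sq (D*t / 2)]
  rw [h2, ← h]; ring
lemma triHat_le_inv (D:ℝ) {t:ℝ} (ht : t ≠ 0) : triHat D t ≤ 4 / t ^ 2 := by
  have hp : 0 < t ^ 2 := by positivity
  rw [le_div_iff₀ hp, triHat_mul_sq]; linarith [neg_one_le_cos (D*t)]
lemma triHat_continuous (D:ℝ) : Continuous (triHat D) := by
  unfold triHat
  have := continuous_sinc
  fun_prop
lemma triHat_neg (D t:ℝ) : triHat D (-t) = triHat D t := by
  unfold triHat; rw [show D*-t / 2 = -(D*t / 2) by ring, sinc_neg]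

lemma triHat_le_const (D t:ℝ) : triHat D t ≤ (D ^ 2 + 4)*(1 + t ^ 2)⁻¹ := by
  rw [← div_eq_mul_inv, le_div_iff₀ (by positivity), mul_add, triHat_mul_sq]
  linarith [neg_one_le_cos (D*t), triHat_le D t]

lemma triHat_integrable (D:ℝ) : Integrable (triHat D) := by
  refine (integrable_inv_one_add_sq.const_mul (D ^ 2 + 4)).mono'
    (triHat_continuous D).aestronglyMeasurable (Eventually.of_forall fun t => ?_)
  rw [norm_of_nonneg (triHat_nonneg _ _)]; exact triHat_le_const D t

lemma ph_norm (t x:ℝ) : ‖ph t x‖ = 1 := by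
  unfold ph; rw [← ofReal_neg, norm_exp_ofReal_mul_I]
lemma ph_add (t x y:ℝ) : ph t (x + y) = ph t x*ph t y := by
  unfold ph; rw [← Complex.exp_add]; congr 1; push_cast; ring
lemma ph_add' (t s x:ℝ) : ph (t + s) x = ph t x*ph s x := by
  unfold ph; rw [← Complex.exp_add]; congr 1; push_cast; ring
lemma ph_conj (t x:ℝ) : (starRingEnd ℂ) (ph t x) = ph (-t) x := by
  unfold ph; rw [← exp_conj]; simp
lemma ph_conj' (t x:ℝ) : (starRingEnd ℂ) (ph t x) = ph t (-x) := by
  unfold ph; rw [← exp_conj]; simp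
lemma ph_zero (t:ℝ) : ph t 0 = 1 := by simp [ph]
lemma ph_zero' (x:ℝ) : ph 0 x = 1 := by simp [ph]
lemma ph_continuous (x:ℝ) : Continuous (fun t => ph t x) := by unfold ph; fun_prop
lemma ph_continuous' (t:ℝ) : Continuous (fun x => ph t x) := by unfold ph; fun_prop
lemma ph_cont2 : Continuous (fun z:ℝ × ℝ => ph z.1 z.2) := by unfold ph; fun_prop

lemma tri_integrable (D:ℝ) : Integrable (tri D) :=
  (tri_continuous D).integrable_of_hasCompactSupport (tri_compact D)

lemma fourier_tri {D:ℝ} (hD : 0 ≤ D) (t:ℝ) : ∫ x, (tri D x:ℂ)*ph t x = triHat D t := by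
  have hInt : ∀ a b, IntervalIntegrable (fun x => (tri D x:ℂ)*ph t x) volume a b := fun a b =>
    (((continuous_ofReal.comp (tri_continuous D)).mul (ph_continuous' t))).intervalIntegrable a b
  have h1 : ∫ x, (tri D x:ℂ)*ph t x = ∫ x in (-D)..D, (tri D x:ℂ)*ph t x := by
    rw [intervalIntegral.integral_of_le (by linarith), ← integral_Icc_eq_integral_Ioc]
    rw [setIntegral_eq_integral_of_forall_compl_eq_zero]
    intro x hx
    rw [show tri D x = 0 by
      by_contra h; exact hx (tri_support h)]; simp
  rw [h1, ← intervalIntegral.integral_add_adjacent_intervals (hInt (-D) 0) (hInt 0 D)]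
  by_cases ht : t = 0
  · subst ht
    have e1 : ∫ x in (-D)..0, (tri D x:ℂ)*ph 0 x = ∫ x in (-D)..0, ((D + x:ℝ):ℂ) := by
      apply intervalIntegral.integral_congr
      intro x hx
      rw [Set.uIcc_of_le (by linarith)] at hx
      simp only [ph_zero', mul_one]
      congr 1; unfold tri; rw [abs_of_nonpos hx.2, max_eq_right (by linarith [hx.1])]; ring
    have e2 : ∫ x in (0:ℝ)..D, (tri D x:ℂ)*ph 0 x = ∫ x in (0:ℝ)..D, ((D - x:ℝ):ℂ) := by
      apply intervalIntegral.integral_congr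
      intro x hx
      rw [Set.uIcc_of_le (by linarith)] at hx
      simp only [ph_zero', mul_one]
      congr 1; unfold tri; rw [abs_of_nonneg hx.1, max_eq_right (by linarith [hx.2])]
    rw [e1, e2, intervalIntegral.integral_ofReal, intervalIntegral.integral_ofReal, ← ofReal_add]
    congr 1
    rw [intervalIntegral.integral_add (by simp) (by simp), intervalIntegral.integral_sub (by simp) (by simp)]
    simp [triHat]; ring
  · set c:ℂ := -(t:ℂ)*I with hc
    have hc0 : c ≠ 0 := by simp [hc, ht]
    have hph : ∀ x:ℝ, ph t x = cexp (c*x) := by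
      intro x; unfold ph; rw [hc]; congr 1; push_cast; ring
    have hd : ∀ x:ℝ, HasDerivAt (fun x:ℝ => cexp (c*x)) (cexp (c*x)*c) x := by
      intro x
      have := ((hasDerivAt_id (x:ℂ)).const_mul c).cexp.comp_ofReal
      simpa using this
    have hi : ∀ x:ℝ, HasDerivAt (fun x:ℝ => (x:ℂ)) 1 x := fun x => hasDerivAt_id (x:ℂ) |>.comp_ofReal
    have e1 : ∫ x in (-D)..0, (tri D x:ℂ)*ph t x =
       ((D + (0:ℝ))*cexp (c*(0:ℝ)) / c - cexp (c*(0:ℝ)) / c ^ 2) -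
       ((D + ((-D:ℝ):ℂ))*cexp (c*(-D:ℝ)) / c - cexp (c*(-D:ℝ)) / c ^ 2) := by
      refine intervalIntegral.integral_eq_sub_of_hasDerivAt
        (f := fun x:ℝ => ((D:ℂ) + x)*cexp (c*x) / c - cexp (c*x) / c ^ 2) ?_ (hInt _ _)
      intro x hx
      rw [Set.uIcc_of_le (by linarith)] at hx
      have : tri D x = D + x := by
        unfold tri; rw [abs_of_nonpos hx.2, max_eq_right (by linarith [hx.1])]; ring
      rw [this, hph]
      have := ((((hi x).const_add (D:ℂ)).mul (hd x)).div_const c).sub ((hd x).div_const (c^2))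
      refine this.congr_deriv ?_
      push_cast; field_simp; ring
    have e2 : ∫ x in (0:ℝ)..D, (tri D x:ℂ)*ph t x =
       ((D - ((D:ℝ):ℂ))*cexp (c*(D:ℝ)) / c + cexp (c*(D:ℝ)) / c ^ 2) -
       ((D - ((0:ℝ):ℂ))*cexp (c*(0:ℝ)) / c + cexp (c*(0:ℝ)) / c ^ 2) := by
      refine intervalIntegral.integral_eq_sub_of_hasDerivAt
        (f := fun x:ℝ => ((D:ℂ) - x)*cexp (c*x) / c + cexp (c*x) / c ^ 2) ?_ (hInt _ _)
      intro x hx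
      rw [Set.uIcc_of_le (by linarith)] at hx
      have : tri D x = D - x := by
        unfold tri; rw [abs_of_nonneg hx.1, max_eq_right (by linarith [hx.2])]
      rw [this, hph]
      have := ((((hi x).const_sub (D:ℂ)).mul (hd x)).div_const c).add ((hd x).div_const (c^2))
      refine this.congr_deriv ?_
      push_cast; field_simp; ring
    rw [e1, e2]
    have hc2 : c ^ 2 = -(t:ℂ) ^ 2 := by rw [hc]; ring_nf; simp
    have key : cexp (c*(D:ℝ)) + cexp (c*(-D:ℝ)) = 2*(cos (D*t):ℂ) := by
      rw [ofReal_cos, Complex.cos, hc]; push_cast; ring_nf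
    have ht2 : (t:ℂ)^2 ≠ 0 := by simp [ht]
    have hm : ((triHat D t:ℝ):ℂ) = (2 - 2*(cos (D*t):ℂ)) / (t:ℂ) ^ 2 := by
      rw [eq_div_iff ht2]; exact_mod_cast triHat_mul_sq D t
    rw [hm, ← key]
    have : ((D + (0:ℝ))*cexp (c*(0:ℝ)) / c - cexp (c*(0:ℝ)) / c ^ 2) -
       ((D + ((-D:ℝ):ℂ))*cexp (c*(-D:ℝ)) / c - cexp (c*(-D:ℝ)) / c ^ 2) + (((D - ((D:ℝ):ℂ))*cexp (c*(D:ℝ)) / c + cexp (c*(D:ℝ)) / c ^ 2) -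
       ((D - ((0:ℝ):ℂ))*cexp (c*(0:ℝ)) / c + cexp (c*(0:ℝ)) / c ^ 2)) = (cexp (c*(D:ℝ)) + cexp (c*(-D:ℝ)) - 2) / c ^ 2 := by
      simp only [ofReal_zero, mul_zero, Complex.exp_zero, ofReal_neg]; field_simp; ring
    rw [this, hc2]; field_simp; ring

lemma tri_inv {D:ℝ} (hD : 0 ≤ D) (x:ℝ) :
    ∫ t, (triHat D t:ℂ)*ph t x = 2*Real.pi*tri D x := by
  have hF : ∀ ξ:ℝ, FourierTransform.fourier (fun x => (tri D x:ℂ)) ξ = (triHat D (2*Real.pi*ξ):ℂ) := by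
    intro ξ
    rw [← fourier_tri hD, fourier_eq']
    congr 1; ext v; rw [smul_eq_mul, mul_comm]; congr 1; unfold ph; congr 1
    simp only [RCLike.inner_apply, conj_trivial]; push_cast; ring
  have hFi : Integrable (FourierTransform.fourier (fun x => (tri D x:ℂ))) := by
    have : FourierTransform.fourier (fun x => (tri D x:ℂ)) = fun ξ:ℝ => (triHat D (2*Real.pi*ξ):ℂ) := funext hF
    rw [this]
    exact ((triHat_integrable D).comp_mul_left' (by positivity : 2*Real.pi ≠ 0)).ofReal
  have hinv := Continuous.fourierInv_fourier_eq (f := fun x => (tri D x:ℂ))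
    (continuous_ofReal.comp (tri_continuous D)) (tri_integrable D).ofReal hFi
  have h2 := congrFun hinv (-x)
  rw [fourierInv_eq'] at h2
  simp only [tri_neg] at h2
  rw [← h2]
  have h3 := Measure.integral_comp_mul_left (fun t => (triHat D t:ℂ)*ph t x) (2*Real.pi)
  rw [abs_of_pos (by positivity)] at h3
  have h4 : ∫ v:ℝ, cexp (((2*Real.pi*inner ℝ v (-x):ℝ):ℂ)*I) • FourierTransform.fourier (fun x => (tri D x:ℂ)) v
     = ∫ v:ℝ, (triHat D (2*Real.pi*v):ℂ)*ph (2*Real.pi*v) x := by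
    congr 1; ext v; rw [hF, smul_eq_mul, mul_comm]; congr 1; unfold ph; congr 1
    simp only [RCLike.inner_apply, conj_trivial]; push_cast; ring
  rw [h4, h3, real_smul]
  push_cast
  have : (Real.pi:ℂ) ≠ 0 := mod_cast pi_ne_zero
  field_simp

/-- overlap of two windows -/
lemma window_overlap {δ:ℝ} (hδ : 0 < δ) (x y:ℝ) :
    ∫ u, (Set.Ico (x - δ) x).indicator (fun _ => (1:ℝ)) u*(Set.Ico (y - δ) y).indicator (fun _ => (1:ℝ)) u
      = tri δ (x - y) := by
  have : ∀ u, (Set.Ico (x - δ) x).indicator (fun _ => (1:ℝ)) u*(Set.Ico (y - δ) y).indicator (fun _ => (1:ℝ)) u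
      = (Set.Ico (x - δ) x ∩ Set.Ico (y - δ) y).indicator (fun _ => (1:ℝ)) u := by
    intro u; simp only [Set.indicator, Set.mem_inter_iff]; split_ifs <;> simp_all
  simp_rw [this]
  rw [Set.Ico_inter_Ico, integral_indicator measurableSet_Ico]
  simp only [integral_const, MeasurableSet.univ, measureReal_restrict_apply, Set.univ_inter, volume_real_Ico, smul_eq_mul, mul_one]
  unfold tri
  rcases le_total x y with h | h
  · rw [abs_of_nonpos (by linarith), max_comm]; congr 1
    rw [min_eq_left h, max_eq_right (by linarith : x - δ ≤ y - δ)]; ring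
  · rw [abs_of_nonneg (by linarith), max_comm]; congr 1
    rw [min_eq_right h, max_eq_left (by linarith : y - δ ≤ x - δ)]; ring

lemma normSq_sum_expand {ι : Type*} (s : Finset ι) (z : ι → ℂ) :
    ((‖∑ i ∈ s, z i‖ ^ 2:ℝ):ℂ) = ∑ i ∈ s, ∑ j ∈ s, z i*(starRingEnd ℂ) (z j) := by
  push_cast
  rw [← mul_conj', map_sum, sum_mul_sum]

lemma plancherel_double {ι : Type*} (s : Finset ι) (c : ι → ℂ) (x : ι → ℝ) {δ:ℝ} (hδ : 0 < δ) :
    ((∫ t, ‖∑ i ∈ s, c i*ph t (x i)‖ ^ 2*triHat δ t:ℝ):ℂ) =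
      2*Real.pi*∑ i ∈ s, ∑ j ∈ s, c i*(starRingEnd ℂ) (c j)*tri δ (x i - x j) := by
  rw [← integral_complex_ofReal]
  have h1 : ∀ t:ℝ, ((‖∑ i ∈ s, c i*ph t (x i)‖ ^ 2*triHat δ t:ℝ):ℂ) =
      ∑ i ∈ s, ∑ j ∈ s, (c i*(starRingEnd ℂ) (c j))*((triHat δ t:ℂ)*ph t (x i - x j)) := by
    intro t
    rw [ofReal_mul, normSq_sum_expand, sum_mul]
    refine sum_congr rfl fun i _ => ?_
    rw [sum_mul]
    refine sum_congr rfl fun j _ => ?_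
    rw [map_mul, ph_conj', sub_eq_add_neg, ph_add]; ring
  simp_rw [h1]
  have hInt : ∀ y, Integrable (fun t:ℝ => (triHat δ t:ℂ)*ph t y) := fun y =>
    ((triHat_integrable δ).ofReal).mul_bdd (c := 1) (ph_continuous y).aestronglyMeasurable
      (Eventually.of_forall fun t => (ph_norm t y).le)
  rw [integral_finset_sum _ fun i _ => integrable_finset_sum _ fun j _ => (hInt _).const_mul _, mul_sum]
  refine sum_congr rfl fun i _ => ?_
  rw [integral_finset_sum _ fun j _ => (hInt _).const_mul _, mul_sum]
  refine sum_congr rfl fun j _ => ?_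
  rw [integral_const_mul, tri_inv hδ.le]; ring

lemma plancherel_window {ι : Type*} (s : Finset ι) (c : ι → ℂ) (x : ι → ℝ) {δ:ℝ} (hδ : 0 < δ) :
    ∫ t, ‖∑ i ∈ s, c i*ph t (x i)‖ ^ 2*triHat δ t =
      2*Real.pi*∫ u, ‖∑ i ∈ s, (if x i - δ ≤ u ∧ u < x i then c i else 0)‖ ^ 2 := by
  have key : ((∫ u, ‖∑ i ∈ s, (if x i - δ ≤ u ∧ u < x i then c i else 0)‖ ^ 2:ℝ):ℂ) =
     ∑ i ∈ s, ∑ j ∈ s, c i*(starRingEnd ℂ) (c j)*tri δ (x i - x j) := by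
    rw [← integral_complex_ofReal]
    have h1 : ∀ u:ℝ, ((‖∑ i ∈ s, (if x i - δ ≤ u ∧ u < x i then c i else 0)‖ ^ 2:ℝ):ℂ) =
        ∑ i ∈ s, ∑ j ∈ s, (c i*(starRingEnd ℂ) (c j)) *
         (((Set.Ico (x i - δ) (x i)).indicator (fun _ => (1:ℝ)) u*(Set.Ico (x j - δ) (x j)).indicator (fun _ => (1:ℝ)) u:ℝ):ℂ) := by
      intro u
      rw [normSq_sum_expand]
      refine sum_congr rfl fun i _ => sum_congr rfl fun j _ => ?_
      simp only [Set.indicator, Set.mem_Ico]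
      split_ifs <;> simp
    simp_rw [h1]
    have hInt : ∀ i j, Integrable (fun u:ℝ => (((Set.Ico (x i - δ) (x i)).indicator (fun _ => (1:ℝ)) u*(Set.Ico (x j - δ) (x j)).indicator (fun _ => (1:ℝ)) u:ℝ):ℂ)) := by
      intro i j
      apply Integrable.ofReal
      have h0 : ∀ k, Integrable ((Set.Ico (x k - δ) (x k)).indicator (fun _ => (1:ℝ))) := fun k => by
        rw [integrable_indicator_iff measurableSet_Ico]
        exact integrableOn_const (by simp)
      refine (h0 i).mul_bdd (c := 1) (h0 j).aestronglyMeasurable (Eventually.of_forall fun t => ?_)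
      simp only [Set.indicator]; split_ifs <;> simp
    rw [integral_finset_sum _ fun i _ => integrable_finset_sum _ fun j _ => (hInt _ _).const_mul _]
    refine sum_congr rfl fun i _ => ?_
    rw [integral_finset_sum _ fun j _ => (hInt _ _).const_mul _]
    refine sum_congr rfl fun j _ => ?_
    rw [integral_const_mul, integral_complex_ofReal, window_overlap hδ]
  have h2 := plancherel_double s c x hδ
  rw [← key] at h2
  exact_mod_cast h2

/-- Mean value theorem: if every window contains at most `B` points. -/
lemma mvt_abstract {ι : Type*} (s : Finset ι) (c : ι → ℂ) (x : ι → ℝ) {δ B:ℝ} (hδ : 0 < δ)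
    (hB : ∀ i ∈ s, ∑ j ∈ s, tri δ (x i - x j) ≤ δ*B) :
    ∫ t, ‖∑ i ∈ s, c i*ph t (x i)‖ ^ 2*triHat δ t ≤ 2*Real.pi*(δ*B*∑ i ∈ s, ‖c i‖ ^ 2) := by
  have h := plancherel_double s c x hδ
  have h1 : (∫ t, ‖∑ i ∈ s, c i*ph t (x i)‖ ^ 2*triHat δ t:ℝ) ≤
     ‖2*(Real.pi:ℂ)*∑ i ∈ s, ∑ j ∈ s, c i*(starRingEnd ℂ) (c j)*tri δ (x i - x j)‖ := by
    rw [← h, norm_real]; exact le_abs_self _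
  refine h1.trans ?_
  rw [norm_mul, norm_mul, norm_real, norm_of_nonneg pi_pos.le, Complex.norm_ofNat]
  refine mul_le_mul_of_nonneg_left ?_ (by positivity)
  calc ‖∑ i ∈ s, ∑ j ∈ s, c i*(starRingEnd ℂ) (c j)*tri δ (x i - x j)‖
      ≤ ∑ i ∈ s, ∑ j ∈ s, (‖c i‖ ^ 2 / 2*tri δ (x i - x j) + ‖c j‖ ^ 2 / 2*tri δ (x j - x i)) := by
        refine (norm_sum_le _ _).trans (sum_le_sum fun i _ => (norm_sum_le _ _).trans (sum_le_sum fun j _ => ?_))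
        rw [norm_mul, norm_mul, RCLike.norm_conj, norm_real, norm_of_nonneg (tri_nonneg _ _),
          show x j - x i = -(x i - x j) by ring, tri_neg, ← add_mul]
        refine mul_le_mul_of_nonneg_right ?_ (tri_nonneg _ _)
        nlinarith [sq_nonneg (‖c i‖ - ‖c j‖)]
    _ = ∑ i ∈ s, ‖c i‖ ^ 2*∑ j ∈ s, tri δ (x i - x j) := by
        simp_rw [sum_add_distrib]
        rw [sum_comm (f := fun i j => ‖c j‖ ^ 2 / 2*tri δ (x j - x i)), ← sum_add_distrib]
        refine sum_congr rfl fun i _ => ?_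
        rw [← sum_add_distrib, mul_sum]
        exact sum_congr rfl fun j _ => by ring
    _ ≤ ∑ i ∈ s, ‖c i‖ ^ 2*(δ*B) := sum_le_sum fun i hi =>
        mul_le_mul_of_nonneg_left (hB i hi) (by positivity)
    _ = _ := by rw [← sum_mul]; ring

section chars
variable {q:ℕ} [NeZero q]

/-- character kernel -/
noncomputable def kk (χ : DirichletCharacter ℂ q) (a : ZMod q) (m : ZMod q):ℂ :=
  (q.totient:ℂ)⁻¹*∑ g : (ZMod q)ˣ, if (g : ZMod q)*m = a then χ ((g⁻¹ : (ZMod q)ˣ) : ZMod q) else 0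

/-- the `χ`-component -/
noncomputable def EE (χ : DirichletCharacter ℂ q) (a : ZMod q) (t:ℝ) : (ℕ →₀ ℂ) →ₗ[ℂ] ℂ :=
  Finsupp.linearCombination ℂ (fun m:ℕ => ph t (log m)*kk χ a (m : ZMod q))

lemma EE_apply (χ : DirichletCharacter ℂ q) (a : ZMod q) (t:ℝ) (c:ℕ →₀ ℂ) :
    EE χ a t c = ∑ m ∈ c.support, c m*(ph t (log m)*kk χ a (m : ZMod q)) := by
  simp [EE, Finsupp.linearCombination_apply, Finsupp.sum]

lemma kk_mul (χ : DirichletCharacter ℂ q) (a : ZMod q) {p:ℕ} (hp : p.Coprime q) (m : ZMod q) :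
    kk χ a ((p : ZMod q)*m) = χ (p : ZMod q)*kk χ a m := by
  unfold kk
  set u := ZMod.unitOfCoprime p hp with hu
  have hup : (u : ZMod q) = p := ZMod.coe_unitOfCoprime p hp
  rw [mul_left_comm]
  congr 1
  rw [mul_sum]
  refine Fintype.sum_equiv (Equiv.mulRight u) _ _ fun g => ?_
  simp only [Equiv.coe_mulRight, Units.val_mul, mul_inv_rev, ← hup, mul_assoc]
  rw [mul_ite, mul_zero]
  congr 1
  rw [← map_mul]; congr 1
  rw [← Units.val_mul, ← Units.val_mul]; congr 1
  simp

lemma char_unit_norm (χ : DirichletCharacter ℂ q) (g : (ZMod q)ˣ) : ‖χ (g : ZMod q)‖ = 1 :=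
  DirichletCharacter.unit_norm_eq_one χ g

lemma totient_pos' : 0 < q.totient := Nat.totient_pos.mpr (NeZero.pos q)

lemma card_units' : (Fintype.card (ZMod q)ˣ) = q.totient := ZMod.card_units_eq_totient q

lemma kk_norm (χ : DirichletCharacter ℂ q) (a m : ZMod q) : ‖kk χ a m‖ ≤ 1 := by
  unfold kk
  rw [norm_mul, norm_inv, Complex.norm_natCast]
  have h : ‖∑ g : (ZMod q)ˣ, if (g : ZMod q)*m = a then χ ((g⁻¹ : (ZMod q)ˣ) : ZMod q) else 0‖ ≤ q.totient := by
    refine (norm_sum_le _ _).trans ?_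
    calc _ ≤ ∑ g : (ZMod q)ˣ, (1:ℝ) := sum_le_sum fun g _ => by
            split_ifs
            · rw [char_unit_norm]
            · simp
      _ = _ := by rw [sum_const, card_univ, card_units', nsmul_eq_mul, mul_one]
  have hp : (0:ℝ) < q.totient := mod_cast totient_pos'
  rw [inv_mul_le_iff₀ hp]; linarith

/-- residue class component -/
noncomputable def XX (c:ℕ →₀ ℂ) (t:ℝ) (b : ZMod q):ℂ :=
  ∑ m ∈ c.support with ((m:ℕ) : ZMod q) = b, c m*ph t (log m)

lemma EE_eq_XX (χ : DirichletCharacter ℂ q) (a : ZMod q) (t:ℝ) (c:ℕ →₀ ℂ) :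
    EE χ a t c = (q.totient:ℂ)⁻¹*∑ g : (ZMod q)ˣ, χ ((g⁻¹ : (ZMod q)ˣ) : ZMod q) *
      XX c t (((g⁻¹ : (ZMod q)ˣ) : ZMod q)*a) := by
  rw [EE_apply]
  unfold XX kk
  simp_rw [mul_sum, sum_filter]
  rw [sum_comm]
  refine sum_congr rfl fun g _ => ?_
  refine sum_congr rfl fun m _ => ?_
  have : ((g : ZMod q)*m = a) ↔ ((m : ZMod q) = ((g⁻¹ : (ZMod q)ˣ) : ZMod q)*a) := by
    rw [Units.eq_inv_mul_iff_mul_eq]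
  by_cases h : (g : ZMod q)*m = a
  · rw [if_pos h, if_pos (this.mp h)]; ring
  · rw [if_neg h, if_neg (fun h2 => h (this.mpr h2))]; ring

lemma char_conj_inv (χ : DirichletCharacter ℂ q) (h : (ZMod q)ˣ) :
    (starRingEnd ℂ) (χ ((h⁻¹ : (ZMod q)ˣ) : ZMod q)) = χ (h : ZMod q) := by
  have h1 : χ ((h⁻¹ : (ZMod q)ˣ) : ZMod q)*χ (h : ZMod q) = 1 := by
    rw [← map_mul, ← Units.val_mul]; simp
  have h2 : χ ((h⁻¹ : (ZMod q)ˣ) : ZMod q)*(starRingEnd ℂ) (χ ((h⁻¹ : (ZMod q)ˣ) : ZMod q)) = 1 := by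
    rw [mul_conj', char_unit_norm]; simp
  have h0 : χ ((h⁻¹ : (ZMod q)ˣ) : ZMod q) ≠ 0 := fun h => by rw [h, zero_mul] at h1; exact zero_ne_one h1
  exact mul_left_cancel₀ h0 (h2.trans h1.symm)

lemma char_parseval (x : (ZMod q)ˣ → ℂ) :
    ∑ χ : DirichletCharacter ℂ q, ‖∑ g : (ZMod q)ˣ, χ ((g⁻¹ : (ZMod q)ˣ) : ZMod q)*x g‖ ^ 2
      = q.totient*∑ g : (ZMod q)ˣ, ‖x g‖ ^ 2 := by
  have : ((∑ χ : DirichletCharacter ℂ q, ‖∑ g : (ZMod q)ˣ, χ ((g⁻¹ : (ZMod q)ˣ) : ZMod q)*x g‖ ^ 2:ℝ):ℂ)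
      = ((q.totient*∑ g : (ZMod q)ˣ, ‖x g‖ ^ 2:ℝ):ℂ) := by
    rw [ofReal_sum]
    simp_rw [normSq_sum_expand]
    rw [sum_comm]
    rw [ofReal_mul, ofReal_sum, mul_sum]
    refine sum_congr rfl fun g _ => ?_
    rw [sum_comm]
    have : ∀ h : (ZMod q)ˣ, ∑ χ : DirichletCharacter ℂ q, χ ((g⁻¹ : (ZMod q)ˣ) : ZMod q)*x g *
        (starRingEnd ℂ) (χ ((h⁻¹ : (ZMod q)ˣ) : ZMod q)*x h) =
        (x g*(starRingEnd ℂ) (x h))*(if g = h then (q.totient:ℂ) else 0) := by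
      intro h
      have h3 := DirichletCharacter.sum_char_inv_mul_char_eq ℂ (a := (g : ZMod q)) g.isUnit (h : ZMod q)
      have h4 : (if (g : ZMod q) = (h : ZMod q) then (q.totient:ℂ) else 0) = if g = h then (q.totient:ℂ) else 0 := by
        congr 1; simp [Units.ext_iff]
      rw [h4] at h3
      rw [← h3, mul_sum]
      refine sum_congr rfl fun χ _ => ?_
      rw [map_mul, char_conj_inv]
      have : ((g⁻¹ : (ZMod q)ˣ) : ZMod q) = (g : ZMod q)⁻¹ := ZMod.inv_coe_unit g |>.symm
      rw [this]; ring
    simp_rw [this]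
    simp only [mul_ite, mul_zero, sum_ite_eq, mem_univ, if_true]
    rw [mul_conj']; push_cast; ring
  exact_mod_cast this

lemma EE_parseval (t:ℝ) (c:ℕ →₀ ℂ) :
    ∑ χ : DirichletCharacter ℂ q, ∑ a : ZMod q, ‖EE χ a t c‖ ^ 2 = ∑ b : ZMod q, ‖XX c t b‖ ^ 2 := by
  rw [sum_comm]
  have hp : (0:ℝ) < q.totient := mod_cast totient_pos'
  have : ∀ a : ZMod q, ∑ χ : DirichletCharacter ℂ q, ‖EE χ a t c‖ ^ 2 =
      (q.totient:ℝ)⁻¹*∑ g : (ZMod q)ˣ, ‖XX c t (((g⁻¹ : (ZMod q)ˣ) : ZMod q)*a)‖ ^ 2 := by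
    intro a
    simp_rw [EE_eq_XX, norm_mul, mul_pow]
    rw [← mul_sum, char_parseval, norm_inv, Complex.norm_natCast]
    field_simp
  simp_rw [this]
  rw [← mul_sum, sum_comm]
  have h2 : ∀ g : (ZMod q)ˣ, ∑ a : ZMod q, ‖XX c t (((g⁻¹ : (ZMod q)ˣ) : ZMod q)*a)‖ ^ 2 = ∑ b : ZMod q, ‖XX c t b‖ ^ 2 := by
    intro g
    exact Fintype.sum_equiv (Units.mulLeft g⁻¹) _ _ fun a => by simp
  simp_rw [h2]
  rw [sum_const, card_univ, card_units', nsmul_eq_mul]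
  field_simp

lemma EE_continuous (χ : DirichletCharacter ℂ q) (a : ZMod q) (c:ℕ →₀ ℂ) :
    Continuous (fun t => EE χ a t c) := by
  simp_rw [EE_apply]
  refine continuous_finset_sum _ fun m _ => ?_
  exact continuous_const.mul ((ph_continuous _).mul continuous_const)

lemma EE_norm_le (χ : DirichletCharacter ℂ q) (a : ZMod q) (t:ℝ) (c:ℕ →₀ ℂ) :
    ‖EE χ a t c‖ ≤ ∑ m ∈ c.support, ‖c m‖ := by
  rw [EE_apply]
  refine (norm_sum_le _ _).trans (sum_le_sum fun m _ => ?_)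
  rw [norm_mul, norm_mul, ph_norm, one_mul]
  exact mul_le_of_le_one_right (norm_nonneg _) (kk_norm _ _ _)

lemma EE_int (δ:ℝ) (χ : DirichletCharacter ℂ q) (a : ZMod q) (c:ℕ →₀ ℂ) :
    Integrable (fun t => ‖EE χ a t c‖ ^ 2*triHat δ t) := by
  refine (triHat_integrable δ).bdd_mul (c := (∑ m ∈ c.support, ‖c m‖) ^ 2) ?_ (Eventually.of_forall fun t => ?_)
  · exact ((EE_continuous χ a c).norm.pow 2).aestronglyMeasurable
  · rw [norm_of_nonneg (by positivity)]
    exact pow_le_pow_left₀ (norm_nonneg _) (EE_norm_le _ _ _ _) 2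

/-- the weighted second moment over a family of sets -/
noncomputable def IS (δ:ℝ) (S : DirichletCharacter ℂ q → Set ℝ) (c:ℕ →₀ ℂ):ℝ :=
  q / (2*Real.pi*δ ^ 2)*∑ χ : DirichletCharacter ℂ q, ∑ a : ZMod q, ∫ t in S χ, ‖EE χ a t c‖ ^ 2*triHat δ t

lemma IS_fac_nonneg (δ:ℝ) : 0 ≤ (q:ℝ) / (2*Real.pi*δ ^ 2) := by positivity

lemma IS_int_nonneg (δ:ℝ) (χ : DirichletCharacter ℂ q) (a : ZMod q) (c:ℕ →₀ ℂ) (t:ℝ) :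
    0 ≤ ‖EE χ a t c‖ ^ 2*triHat δ t := mul_nonneg (by positivity) (triHat_nonneg _ _)

lemma IS_nonneg (δ:ℝ) (S : DirichletCharacter ℂ q → Set ℝ) (c:ℕ →₀ ℂ) : 0 ≤ IS δ S c :=
  mul_nonneg (IS_fac_nonneg δ) (sum_nonneg fun χ _ => sum_nonneg fun a _ =>
    integral_nonneg fun t => IS_int_nonneg _ _ _ _ _)

lemma IS_mono (δ:ℝ) {S S' : DirichletCharacter ℂ q → Set ℝ} (h : ∀ χ, S χ ⊆ S' χ) (c:ℕ →₀ ℂ) :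
    IS δ S c ≤ IS δ S' c := by
  refine mul_le_mul_of_nonneg_left (sum_le_sum fun χ _ => sum_le_sum fun a _ => ?_) (IS_fac_nonneg δ)
  exact setIntegral_mono_set (EE_int _ _ _ _).integrableOn
    (Eventually.of_forall fun t => IS_int_nonneg _ _ _ _ _) (h χ).eventuallyLE

lemma IS_dom (δ:ℝ) {S : DirichletCharacter ℂ q → Set ℝ} (hS : ∀ χ, MeasurableSet (S χ)) {ι : Type*} (s : Finset ι)
    (B : ι → ℝ) (c:ℕ →₀ ℂ) (d : ι → ℕ →₀ ℂ)
    (h : ∀ χ, ∀ t ∈ S χ, ∀ a, ‖EE χ a t c‖ ^ 2 ≤ ∑ i ∈ s, B i*‖EE χ a t (d i)‖ ^ 2) :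
    IS δ S c ≤ ∑ i ∈ s, B i*IS δ S (d i) := by
  unfold IS
  have e : ∑ i ∈ s, B i*(q / (2*Real.pi*δ ^ 2)*∑ χ : DirichletCharacter ℂ q, ∑ a : ZMod q, ∫ t in S χ, ‖EE χ a t (d i)‖ ^ 2*triHat δ t)
    = q / (2*Real.pi*δ ^ 2)*∑ χ : DirichletCharacter ℂ q, ∑ a : ZMod q, ∑ i ∈ s, B i*∫ t in S χ, ‖EE χ a t (d i)‖ ^ 2*triHat δ t := by
    rw [mul_sum]
    simp_rw [mul_sum]
    rw [sum_comm]
    refine sum_congr rfl fun χ _ => ?_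
    rw [sum_comm]
    exact sum_congr rfl fun a _ => sum_congr rfl fun i _ => by ring
  rw [e]
  refine mul_le_mul_of_nonneg_left (sum_le_sum fun χ _ => sum_le_sum fun a _ => ?_) (IS_fac_nonneg δ)
  simp_rw [← integral_const_mul]
  rw [← integral_finset_sum _ fun i _ => ((EE_int _ _ _ _).integrableOn.const_mul _)]
  refine setIntegral_mono_on (EE_int _ _ _ _).integrableOn
    (integrable_finset_sum _ fun i _ => ((EE_int _ _ _ _).integrableOn.const_mul _)) (hS χ) fun t ht => ?_
  calc _ ≤ (∑ i ∈ s, B i*‖EE χ a t (d i)‖ ^ 2)*triHat δ t :=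
        mul_le_mul_of_nonneg_right (h χ t ht a) (triHat_nonneg _ _)
    _ = _ := by rw [sum_mul]; exact sum_congr rfl fun i _ => by ring

lemma IS_union (δ:ℝ) {S : DirichletCharacter ℂ q → Set ℝ} {ι : Type*} (s : Finset ι)
    (S' : ι → DirichletCharacter ℂ q → Set ℝ) (hS' : ∀ i ∈ s, ∀ χ, MeasurableSet (S' i χ))
    (hS : ∀ χ, ∀ t ∈ S χ, ∃ i ∈ s, t ∈ S' i χ)
    (c:ℕ →₀ ℂ) : IS δ S c ≤ ∑ i ∈ s, IS δ (S' i) c := by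
  unfold IS
  rw [← mul_sum, sum_comm (s := s)]
  refine mul_le_mul_of_nonneg_left (sum_le_sum fun χ _ => ?_) (IS_fac_nonneg δ)
  rw [sum_comm (s := s)]
  refine sum_le_sum fun a _ => ?_
  set f := fun t => ‖EE χ a t c‖ ^ 2*triHat δ t with hf
  have hf0 : ∀ t, 0 ≤ f t := fun t => IS_int_nonneg _ _ _ _ _
  have hfi : Integrable f := EE_int _ _ _ _
  calc ∫ t in S χ, f t ≤ ∫ t in (⋃ i ∈ s, S' i χ), f t :=
        setIntegral_mono_set hfi.integrableOn (Eventually.of_forall hf0)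
          (HasSubset.Subset.eventuallyLE fun t ht => by
            obtain ⟨i, hi, hti⟩ := hS χ t ht
            exact Set.mem_biUnion hi hti)
    _ ≤ ∫ t, ∑ i ∈ s, (S' i χ).indicator f t := by
        rw [← integral_indicator (measurableSet_biUnion s fun i hi => hS' i hi χ)]
        refine integral_mono (hfi.indicator (measurableSet_biUnion s fun i hi => hS' i hi χ))
          (integrable_finset_sum _ fun i hi => hfi.indicator (hS' i hi χ)) fun t => ?_
        by_cases ht : t ∈ ⋃ i ∈ s, S' i χ
        · simp only [Set.indicator_of_mem ht]
          simp only [Set.mem_iUnion] at ht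
          obtain ⟨i, hi, hti⟩ := ht
          have := single_le_sum (f := fun i => (S' i χ).indicator f t)
            (fun j _ => Set.indicator_nonneg (fun t _ => hf0 t) t) hi
          simpa [Set.indicator_of_mem hti] using this
        · simp only [Set.indicator_of_notMem ht]
          exact sum_nonneg fun j _ => Set.indicator_nonneg (fun t _ => hf0 t) t
    _ = _ := by
        rw [integral_finset_sum _ fun i hi => hfi.indicator (hS' i hi χ)]
        exact sum_congr rfl fun i hi => integral_indicator (hS' i hi χ)

lemma log_sub_ge {Y:ℝ} {i j:ℕ} (hi : 1 ≤ i) (hj : 1 ≤ j) (hiY : (i:ℝ) ≤ Y) (hjY : (j:ℝ) ≤ Y) :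
    |(i:ℝ) - j| / Y ≤ |log i - log j| := by
  wlog h : j ≤ i generalizing i j with H
  · have := H hj hi hjY hiY (by omega)
    rwa [abs_sub_comm, abs_sub_comm (log i)]
  have hi0 : (0:ℝ) < i := mod_cast hi
  have hj0 : (0:ℝ) < j := mod_cast hj
  have hij : (j:ℝ) ≤ i := mod_cast h
  rw [abs_of_nonneg (by linarith), abs_of_nonneg (by linarith [log_le_log hj0 hij])]
  have h1 := log_le_sub_one_of_pos (show (0:ℝ) < j / i by positivity)
  rw [log_div hj0.ne' hi0.ne'] at h1
  have h2 : ((i:ℝ) - j) / Y ≤ (i - j) / i :=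
    div_le_div_of_nonneg_left (by linarith) hi0 hiY
  have h3 : ((i:ℝ) - j) / i = 1 - j / i := by field_simp
  linarith

lemma count_ap {q:ℕ} (hq : 0 < q) (s : Finset ℕ) (i:ℕ) {R:ℝ} (hR : 0 ≤ R)
    (h : ∀ j ∈ s, ((j:ℕ) : ZMod q) = (i : ZMod q) ∧ |(i:ℝ) - j| ≤ R) : (s.card:ℝ) ≤ 2*R / q + 1 := by
  have hq' : (0:ℝ) < q := mod_cast hq
  set K:ℤ := ⌊R / q⌋ with hK
  have hK0 : 0 ≤ K := Int.floor_nonneg.mpr (by positivity)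
  have hex : ∀ j ∈ s, ∃ k:ℤ, (j:ℤ) = i + q*k ∧ k ∈ Icc (-K) K := by
    intro j hj
    obtain ⟨h1, h2⟩ := h j hj
    have h3 : ((j:ℤ) : ZMod q) = ((i:ℤ) : ZMod q) := by push_cast; exact h1
    rw [ZMod.intCast_eq_intCast_iff_dvd_sub] at h3
    obtain ⟨k, hk⟩ := h3
    refine ⟨-k, by linarith, ?_⟩
    have hk' : (i:ℝ) - j = q*k := mod_cast hk
    rw [hk', abs_mul, abs_of_pos hq'] at h2
    have h4 : |(k:ℝ)| ≤ R / q := by rw [le_div_iff₀ hq']; linarith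
    have h5 : |k| ≤ K := Int.le_floor.mpr (by push_cast; exact h4)
    rw [abs_le] at h5
    simp only [mem_Icc]; omega
  choose! k hk1 hk2 using hex
  have hcard : s.card ≤ (Icc (-K) K).card := by
    refine card_le_card_of_injOn k (fun j hj => hk2 j hj) ?_
    intro a ha b hb hab
    have := hk1 a ha
    have := hk1 b hb
    rw [hab] at *
    omega
  rw [Int.card_Icc] at hcard
  have h6 : ((K + 1 - -K).toNat:ℝ) = 2*K + 1 := by
    have : ((K + 1 - -K).toNat:ℤ) = 2*K + 1 := by omega
    exact_mod_cast this
  have h7 : (K:ℝ) ≤ R / q := Int.floor_le _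
  calc (s.card:ℝ) ≤ ((K + 1 - -K).toNat:ℝ) := mod_cast hcard
    _ = 2*K + 1 := h6
    _ ≤ _ := by rw [mul_div_assoc]; linarith

lemma XX_mvt {δ Y:ℝ} (hδ : 0 < δ) (hY : 0 < Y) (c:ℕ →₀ ℂ)
    (hc : ∀ m ∈ c.support, 1 ≤ m ∧ (m:ℝ) ≤ Y) (b : ZMod q) :
    ∫ t, ‖XX c t b‖ ^ 2*triHat δ t ≤
      2*Real.pi*(δ*(2*(δ*Y) / q + 1)*∑ m ∈ c.support with ((m:ℕ) : ZMod q) = b, ‖c m‖ ^ 2) := by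
  unfold XX
  refine mvt_abstract (s := c.support.filter (fun m:ℕ => (m : ZMod q) = b)) c (fun m => log m) hδ ?_
  intro i hi
  rw [mem_filter] at hi
  set s := c.support.filter (fun m:ℕ => (m : ZMod q) = b)
  have hs : ∀ j ∈ s, j ∈ c.support ∧ (j : ZMod q) = b := fun j hj => mem_filter.mp hj
  clear_value s
  set s' := s.filter (fun j:ℕ => |log i - log j| < δ)
  have h1 : ∑ j ∈ s, tri δ (log i - log j) ≤ ∑ j ∈ s', δ := by
    rw [sum_filter]
    refine sum_le_sum fun j _ => ?_
    split_ifs with h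
    · exact tri_le hδ.le _
    · rw [tri_eq_zero (not_lt.mp h)]
  have h2 : (s'.card:ℝ) ≤ 2*(δ*Y) / q + 1 := by
    refine count_ap (NeZero.pos q) s' i (by positivity) fun j hj => ?_
    simp only [s', mem_filter] at hj
    have hj1 := hs j hj.1
    refine ⟨hj1.2.trans hi.2.symm, ?_⟩
    have := log_sub_ge (hc i hi.1).1 (hc j hj1.1).1 (hc i hi.1).2 (hc j hj1.1).2
    rw [div_le_iff₀ hY] at this
    nlinarith [hj.2]
  rw [sum_const, nsmul_eq_mul] at h1
  nlinarith

lemma IS_parseval (δ:ℝ) (c:ℕ →₀ ℂ) :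
    ∑ χ : DirichletCharacter ℂ q, ∑ a : ZMod q, ∫ t, ‖EE χ a t c‖ ^ 2*triHat δ t
      = ∑ b : ZMod q, ∫ t, ‖XX c t b‖ ^ 2*triHat δ t := by
  have hx : ∀ b : ZMod q, Integrable (fun t => ‖XX c t b‖ ^ 2*triHat δ t) := by
    intro b
    refine (triHat_integrable δ).bdd_mul (c := (∑ m ∈ c.support with ((m:ℕ) : ZMod q) = b, ‖c m‖) ^ 2) ?_ (Eventually.of_forall fun t => ?_)
    · unfold XX
      refine ((continuous_finset_sum _ fun m _ => ?_).norm.pow 2).aestronglyMeasurable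
      exact continuous_const.mul (ph_continuous _)
    · rw [norm_of_nonneg (by positivity)]
      refine pow_le_pow_left₀ (norm_nonneg _) ?_ 2
      unfold XX
      refine (norm_sum_le _ _).trans (sum_le_sum fun m _ => ?_)
      rw [norm_mul, ph_norm, mul_one]
  simp_rw [← integral_finset_sum univ (fun a _ => EE_int δ _ a c)]
  rw [← integral_finset_sum univ (fun χ _ => integrable_finset_sum _ fun a _ => EE_int δ χ a c),
    ← integral_finset_sum univ (fun b _ => hx b)]
  congr 1; ext t
  simp_rw [← sum_mul]
  rw [EE_parseval]

lemma IS_all {δ Y:ℝ} (hδ : 0 < δ) (hY : 0 < Y) (c:ℕ →₀ ℂ)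
    (hc : ∀ m ∈ c.support, 1 ≤ m ∧ (m:ℝ) ≤ Y) (S : DirichletCharacter ℂ q → Set ℝ) :
    IS δ S c ≤ (2*Y + q / δ)*∑ m ∈ c.support, ‖c m‖ ^ 2 := by
  refine (IS_mono δ (S' := fun _ => Set.univ) (fun χ => Set.subset_univ _) c).trans ?_
  unfold IS
  simp only [Measure.restrict_univ]
  rw [IS_parseval]
  have h2 : ∑ b : ZMod q, ∫ t, ‖XX c t b‖ ^ 2*triHat δ t ≤
      2*Real.pi*(δ*(2*(δ*Y) / q + 1)*∑ m ∈ c.support, ‖c m‖ ^ 2) := by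
    rw [← sum_fiberwise c.support (fun m:ℕ => (m : ZMod q)) (fun m => ‖c m‖ ^ 2), mul_sum, mul_sum]
    exact sum_le_sum (f := fun b : ZMod q => ∫ t, ‖XX c t b‖ ^ 2*triHat δ t) fun b _ => XX_mvt hδ hY c hc b
  refine (mul_le_mul_of_nonneg_left h2 (IS_fac_nonneg δ)).trans (le_of_eq ?_)
  have hq' : (q:ℝ) ≠ 0 := mod_cast NeZero.ne q
  have := pi_ne_zero
  field_simp

/-- convolution with primes weighted by `1/p` -/
noncomputable def Pc (P : Finset ℕ) (c:ℕ →₀ ℂ):ℕ →₀ ℂ :=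
  ∑ p ∈ P, ((p:ℂ)⁻¹) • Finsupp.mapDomain (fun m => p*m) c

/-- prime Dirichlet polynomial -/
noncomputable def QQ (P : Finset ℕ) (χ : DirichletCharacter ℂ q) (t:ℝ):ℂ :=
  ∑ p ∈ P, (p:ℂ)⁻¹*(χ (p : ZMod q)*ph t (log p))

lemma QQ_continuous (P : Finset ℕ) (χ : DirichletCharacter ℂ q) : Continuous (QQ P χ) := by
  unfold QQ
  exact continuous_finset_sum _ fun p _ => continuous_const.mul (continuous_const.mul (ph_continuous _))

lemma EE_mapDomain {p:ℕ} (hp : 0 < p) (hpq : p.Coprime q) (χ : DirichletCharacter ℂ q) (a : ZMod q) (t:ℝ)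
    (c:ℕ →₀ ℂ) (hc : c 0 = 0) :
    EE χ a t (Finsupp.mapDomain (fun m => p*m) c) = (χ (p : ZMod q)*ph t (log p))*EE χ a t c := by
  unfold EE
  rw [Finsupp.linearCombination_mapDomain, Finsupp.linearCombination_apply, Finsupp.linearCombination_apply,
    Finsupp.sum, Finsupp.sum, mul_sum]
  refine sum_congr rfl fun m hm => ?_
  have hm0 : m ≠ 0 := by rintro rfl; exact (Finsupp.mem_support_iff.mp hm) hc
  simp only [Function.comp, smul_eq_mul]
  push_cast
  rw [kk_mul χ a hpq, log_mul (by positivity) (by positivity), ph_add]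
  ring

lemma EE_Pc (P : Finset ℕ) (hP : ∀ p ∈ P, 0 < p ∧ p.Coprime q) (χ : DirichletCharacter ℂ q) (a : ZMod q) (t:ℝ)
    (c:ℕ →₀ ℂ) (hc : c 0 = 0) : EE χ a t (Pc P c) = QQ P χ t*EE χ a t c := by
  unfold Pc QQ
  rw [map_sum, sum_mul]
  refine sum_congr rfl fun p hp => ?_
  rw [map_smul, EE_mapDomain (hP p hp).1 (hP p hp).2 χ a t c hc, smul_eq_mul]; ring

end chars

lemma mapDomain_mul_apply {p:ℕ} (hp : 0 < p) (c:ℕ →₀ ℂ) (n:ℕ) :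
    Finsupp.mapDomain (fun m => p*m) c n = if p ∣ n then c (n / p) else 0 := by
  have hinj : Function.Injective (fun m:ℕ => p*m) := fun a b h => Nat.eq_of_mul_eq_mul_left hp h
  split_ifs with h
  · obtain ⟨k, rfl⟩ := h
    rw [Nat.mul_div_cancel_left _ hp]
    exact Finsupp.mapDomain_apply hinj c k
  · refine Finsupp.mapDomain_notin_range c n ?_
    rintro ⟨k, rfl⟩; exact h (dvd_mul_right _ _)

lemma Pc_apply (P : Finset ℕ) (hP : ∀ p ∈ P, 0 < p) (c:ℕ →₀ ℂ) (n:ℕ) :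
    Pc P c n = ∑ p ∈ P, if p ∣ n then (p:ℂ)⁻¹*c (n / p) else 0 := by
  unfold Pc
  rw [Finsupp.finset_sum_apply]
  refine sum_congr rfl fun p hp => ?_
  rw [Finsupp.smul_apply, mapDomain_mul_apply (hP p hp), smul_eq_mul, mul_ite, mul_zero]

lemma Pc_zero (P : Finset ℕ) (hP : ∀ p ∈ P, 0 < p) (c:ℕ →₀ ℂ) (hc : c 0 = 0) : Pc P c 0 = 0 := by
  rw [Pc_apply P hP]; simp [hc]

lemma card_mult (N d:ℕ) : (∑ n ∈ Ioc 0 N, if d ∣ n then (1:ℝ) else 0) = ((N / d:ℕ):ℝ) := by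
  rw [sum_boole, Nat.Ioc_filter_dvd_card_eq_div]

lemma card_mult_le (N d:ℕ) : (∑ n ∈ Ioc 0 N, if d ∣ n then (1:ℝ) else 0) ≤ N*(d:ℝ)⁻¹ := by
  rw [card_mult]; exact Nat.cast_div_le.trans (le_of_eq (div_eq_mul_inv _ _))

lemma card_mult_ge (N d:ℕ) (hd : 0 < d) : N*(d:ℝ)⁻¹ - 1 ≤ (∑ n ∈ Ioc 0 N, if d ∣ n then (1:ℝ) else 0) := by
  rw [card_mult]
  have hd' : (0:ℝ) < d := mod_cast hd
  have h : N < (N / d + 1)*d := by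
    have := Nat.lt_div_mul_add (a := N) hd
    nlinarith
  have h2 : (N:ℝ) < ((N / d:ℕ) + 1)*d := mod_cast h
  have : N*(d:ℝ)⁻¹ < (N / d:ℕ) + 1 := by rwa [← div_eq_mul_inv, div_lt_iff₀ hd']
  linarith

lemma tk_second (P : Finset ℕ) (f:ℕ → ℕ) (hf : ∀ p ∈ P, 0 < f p)
    (hco : ∀ p ∈ P, ∀ p' ∈ P, p ≠ p' → (f p).Coprime (f p')) (N:ℕ) :
    ∑ n ∈ Ioc 0 N, (∑ p ∈ P, if f p ∣ n then (1:ℝ) else 0) ^ 2 ≤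
      N*((∑ p ∈ P, ((f p:ℕ):ℝ)⁻¹) ^ 2 + ∑ p ∈ P, ((f p:ℕ):ℝ)⁻¹) := by
  have h1 : ∀ n, (∑ p ∈ P, if f p ∣ n then (1:ℝ) else 0) ^ 2 =
      ∑ p ∈ P, ∑ p' ∈ P, if f p ∣ n ∧ f p' ∣ n then (1:ℝ) else 0 := by
    intro n
    rw [sq, sum_mul_sum]
    refine sum_congr rfl fun p _ => sum_congr rfl fun p' _ => ?_
    split_ifs <;> simp_all
  simp_rw [h1]
  rw [sum_comm]
  simp_rw [sum_comm (s := Ioc 0 N)]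
  have h2 : ∀ p ∈ P, ∀ p' ∈ P, (∑ n ∈ Ioc 0 N, if f p ∣ n ∧ f p' ∣ n then (1:ℝ) else 0) ≤
      N*(((f p:ℕ):ℝ)⁻¹*((f p':ℕ):ℝ)⁻¹) + if p = p' then N*((f p:ℕ):ℝ)⁻¹ else 0 := by
    intro p hp p' hp'
    by_cases hpp : p = p'
    · subst hpp
      simp only [and_self, if_true]
      have := card_mult_le N (f p)
      have : (0:ℝ) ≤ N*(((f p:ℕ):ℝ)⁻¹*((f p:ℕ):ℝ)⁻¹) := by positivity
      linarith
    · rw [if_neg hpp, add_zero]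
      have : ∀ n, (f p ∣ n ∧ f p' ∣ n) ↔ f p*f p' ∣ n := fun n =>
        ⟨fun h => (hco p hp p' hp' hpp).mul_dvd_of_dvd_of_dvd h.1 h.2,
          fun h => ⟨dvd_of_mul_right_dvd h, dvd_of_mul_left_dvd h⟩⟩
      simp_rw [this]
      refine (card_mult_le N _).trans (le_of_eq ?_)
      push_cast; rw [mul_inv]
  refine (sum_le_sum fun p hp => sum_le_sum fun p' hp' => h2 p hp p' hp').trans (le_of_eq ?_)
  simp_rw [sum_add_distrib]
  have : ∀ p ∈ P, (∑ p' ∈ P, if p = p' then N*((f p:ℕ):ℝ)⁻¹ else 0) = N*((f p:ℕ):ℝ)⁻¹ := by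
    intro p hp; rw [sum_ite_eq, if_pos hp]
  rw [sum_congr rfl this, mul_add, sq, sum_mul_sum]
  simp_rw [mul_sum]

lemma tk_first (P : Finset ℕ) (hP : ∀ p ∈ P, 0 < p) (N:ℕ) :
    N*(∑ p ∈ P, (p:ℝ)⁻¹) - P.card ≤ ∑ n ∈ Ioc 0 N, (∑ p ∈ P, if p ∣ n then (1:ℝ) else 0) := by
  rw [sum_comm]
  calc _ = ∑ p ∈ P, (N*(p:ℝ)⁻¹ - 1) := by rw [sum_sub_distrib, mul_sum]; simp
    _ ≤ _ := sum_le_sum fun p hp => card_mult_ge N p (hP p hp)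

lemma tk (P : Finset ℕ) (hP : ∀ p ∈ P, p.Prime) (N:ℕ) (hN : P.card ≤ N) :
    ∑ n ∈ Ioc 0 N, ((∑ p ∈ P, if p ∣ n then (1:ℝ) else 0) - ∑ p ∈ P, (p:ℝ)⁻¹) ^ 2 ≤
      3*N*∑ p ∈ P, (p:ℝ)⁻¹ := by
  set W := ∑ p ∈ P, (p:ℝ)⁻¹ with hW
  have hW0 : 0 ≤ W := sum_nonneg fun p _ => by positivity
  have h2 := tk_second P id (fun p hp => (hP p hp).pos)
    (fun p hp p' hp' h => (Nat.coprime_primes (hP p hp) (hP p' hp')).mpr h) N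
  have h1 := tk_first P (fun p hp => (hP p hp).pos) N
  simp only [id] at h2
  rw [← hW] at h1 h2
  have e : ∑ n ∈ Ioc 0 N, ((∑ p ∈ P, if p ∣ n then (1:ℝ) else 0) - W) ^ 2 =
     ∑ n ∈ Ioc 0 N, (∑ p ∈ P, if p ∣ n then (1:ℝ) else 0) ^ 2 -
      2*W*∑ n ∈ Ioc 0 N, (∑ p ∈ P, if p ∣ n then (1:ℝ) else 0) + N*W ^ 2 := by
    rw [mul_sum, ← sum_sub_distrib]
    have : (N:ℝ)*W ^ 2 = ∑ n ∈ Ioc 0 N, W ^ 2 := by simp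
    rw [this, ← sum_add_distrib]
    exact sum_congr rfl fun n _ => by ring
  rw [e]
  have hN' : (P.card:ℝ) ≤ N := mod_cast hN
  nlinarith

/-- the basic coefficient sequence -/
noncomputable def bfun (A V:ℝ) (m:ℕ):ℂ :=
  ((ArithmeticFunction.moebius m:ℤ):ℂ)*(tri A (log m - V):ℂ)*(m:ℂ)⁻¹

lemma bfun_support {A V:ℝ} {m:ℕ} (h : bfun A V m ≠ 0) :
    1 ≤ m ∧ exp (V - A) ≤ m ∧ (m:ℝ) ≤ exp (V + A) := by
  have hm : m ≠ 0 := by rintro rfl; simp [bfun] at h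
  have hm1 : 1 ≤ m := Nat.one_le_iff_ne_zero.mpr hm
  have hm0 : (0:ℝ) < m := mod_cast hm1
  have h1 : tri A (log m - V) ≠ 0 := by
    intro h0; apply h; simp [bfun, h0]
  have h2 : |log m - V| ≤ A := by
    by_contra h3; exact h1 (tri_eq_zero (not_le.mp h3).le)
  rw [abs_le] at h2
  refine ⟨hm1, ?_, ?_⟩
  · rw [← le_log_iff_exp_le hm0]; linarith
  · rw [← log_le_iff_le_exp hm0]; linarith

lemma bfun_fin (A V:ℝ) (m:ℕ) (h : bfun A V m ≠ 0) : m ∈ Ioc 0 ⌊exp (V + A)⌋₊ := by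
  obtain ⟨h1, _, h3⟩ := bfun_support h
  rw [mem_Ioc]; exact ⟨h1, Nat.le_floor h3⟩

noncomputable def bV (A V:ℝ):ℕ →₀ ℂ := Finsupp.onFinset (Ioc 0 ⌊exp (V + A)⌋₊) (bfun A V) (bfun_fin A V)

lemma bV_apply (A V:ℝ) (m:ℕ) : bV A V m = bfun A V m := rfl
lemma bV_zero (A V:ℝ) : bV A V 0 = 0 := by simp [bV_apply, bfun]

lemma bV_support {A V:ℝ} {m:ℕ} (h : m ∈ (bV A V).support) :
    1 ≤ m ∧ exp (V - A) ≤ m ∧ (m:ℝ) ≤ exp (V + A) :=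
  bfun_support (by rwa [Finsupp.mem_support_iff, bV_apply] at h)

lemma mu_norm_le (m:ℕ) : ‖((ArithmeticFunction.moebius m:ℤ):ℂ)‖ ≤ 1 := by
  rw [norm_intCast]
  have := ArithmeticFunction.abs_moebius_le_one (n := m)
  exact_mod_cast this

lemma bfun_norm {A:ℝ} (hA : 0 ≤ A) (V:ℝ) (m:ℕ) : ‖bfun A V m‖ ≤ A*(m:ℝ)⁻¹ := by
  unfold bfun
  rw [norm_mul, norm_mul, norm_inv, Complex.norm_natCast, norm_real, norm_of_nonneg (tri_nonneg _ _)]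
  have := mu_norm_le m
  refine mul_le_mul_of_nonneg_right ?_ (by positivity)
  calc _ ≤ 1*A := mul_le_mul this (tri_le hA _) (tri_nonneg _ _) (by norm_num)
    _ = A := one_mul A

/-- the primes of `P` in class `v` -/
noncomputable def cls (P : Finset ℕ) (H v:ℕ) : Finset ℕ := P.filter (fun p:ℕ => ⌊(H:ℝ)*log p⌋₊ = v)
noncomputable def vset (P : Finset ℕ) (H:ℕ) : Finset ℕ := P.image (fun p:ℕ => ⌊(H:ℝ)*log p⌋₊)

lemma cls_log {P : Finset ℕ} {H v p:ℕ} (hH : 0 < H) (hp : p ∈ cls P H v) :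
    (v:ℝ) / H ≤ log p ∧ log p ≤ v / H + 1 / H := by
  have hH' : (0:ℝ) < H := mod_cast hH
  unfold cls at hp
  rw [mem_filter] at hp
  have h0 : 0 ≤ (H:ℝ)*log p := mul_nonneg hH'.le (log_natCast_nonneg p)
  have h1 := Nat.floor_le h0
  have h2 := Nat.lt_floor_add_one ((H:ℝ)*log p)
  rw [hp.2] at h1 h2
  constructor
  · rw [div_le_iff₀ hH']; linarith
  · rw [← add_div, le_div_iff₀ hH']; linarith

lemma sum_cls (P : Finset ℕ) (H:ℕ) {M : Type*} [AddCommMonoid M] (f:ℕ → ℕ → M) :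
    ∑ v ∈ vset P H, ∑ p ∈ cls P H v, f v p = ∑ p ∈ P, f ⌊(H:ℝ)*log p⌋₊ p := by
  rw [← sum_fiberwise_of_maps_to (g := fun p:ℕ => ⌊(H:ℝ)*log p⌋₊) (t := vset P H)
    (fun p hp => mem_image_of_mem _ hp)]
  refine sum_congr rfl fun v _ => ?_
  unfold cls
  refine sum_congr rfl fun p hp => ?_
  rw [(mem_filter.mp hp).2]

/-- main part of the decoupling -/
noncomputable def dec (A V:ℝ) (P : Finset ℕ) (H:ℕ):ℕ →₀ ℂ :=
  ∑ v ∈ vset P H, Pc (cls P H v) (bV A (V - v / H))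

lemma dec_apply (A V:ℝ) (P : Finset ℕ) (hP : ∀ p ∈ P, p.Prime) (H:ℕ) (n:ℕ) :
    dec A V P H n = ∑ p ∈ P, if p ∣ n then (p:ℂ)⁻¹*bfun A (V - (⌊(H:ℝ)*log p⌋₊ : ℕ) / H) (n / p) else 0 := by
  unfold dec
  rw [Finsupp.finset_sum_apply, ← sum_cls P H (fun v p => if p ∣ n then (p:ℂ)⁻¹*bfun A (V - v / H) (n / p) else 0)]
  refine sum_congr rfl fun v _ => ?_
  rw [Pc_apply (cls P H v) (fun p hp => (hP p (mem_filter.mp hp).1).pos)]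
  rfl

lemma moebius_div {n p:ℕ} (hp : p.Prime) (hpn : p ∣ n) (hn : ¬ p ^ 2 ∣ n) :
    ArithmeticFunction.moebius (n / p) = - ArithmeticFunction.moebius n := by
  obtain ⟨k, rfl⟩ := hpn
  rw [Nat.mul_div_cancel_left _ hp.pos]
  have hk : p.Coprime k := by
    rw [Nat.Prime.coprime_iff_not_dvd hp]
    rintro ⟨j, rfl⟩; exact hn ⟨j, by ring⟩
  rw [ArithmeticFunction.isMultiplicative_moebius.map_mul_of_coprime hk, ArithmeticFunction.moebius_apply_prime hp]; ring

lemma dec_term {A V:ℝ} (hA : 0 ≤ A) {H p n:ℕ} (hH : 0 < H) (hp : p.Prime) (hn : 0 < n) (hpn : p ∣ n) (v:ℕ)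
    (h1 : (v:ℝ) / H ≤ log p) (h2 : log p ≤ v / H + 1 / H) :
    ‖bfun A V n + (p:ℂ)⁻¹*bfun A (V - v / H) (n / p)‖ ≤ (1 / H + A*(if p ^ 2 ∣ n then 1 else 0))*(n:ℝ)⁻¹ := by
  have hn0 : (0:ℝ) < n := mod_cast hn
  have hp0 : (0:ℝ) < p := mod_cast hp.pos
  have hH' : (0:ℝ) < H := mod_cast hH
  have hcast : ((n / p:ℕ):ℂ) = (n:ℂ) / p := Nat.cast_div hpn (mod_cast hp.ne_zero)
  have hcastR : ((n / p:ℕ):ℝ) = (n:ℝ) / p := Nat.cast_div hpn (mod_cast hp.ne_zero)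
  have hlog : log ((n / p:ℕ):ℝ) = log n - log p := by
    rw [hcastR, log_div hn0.ne' hp0.ne']
  have hpc : (p:ℂ) ≠ 0 := mod_cast hp.ne_zero
  have e : bfun A V n + (p:ℂ)⁻¹*bfun A (V - v / H) (n / p) =
     (((ArithmeticFunction.moebius n:ℤ):ℂ)*(tri A (log n - V):ℂ) + ((ArithmeticFunction.moebius (n/p):ℤ):ℂ)*(tri A (log n - log p - (V - v / H)):ℂ))*(n:ℂ)⁻¹ := by
    unfold bfun; rw [hlog, hcast]; field_simp
  rw [e, norm_mul, norm_inv, Complex.norm_natCast]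
  refine mul_le_mul_of_nonneg_right ?_ (by positivity)
  split_ifs with h
  · have : ArithmeticFunction.moebius n = 0 := by
      apply ArithmeticFunction.moebius_eq_zero_of_not_squarefree
      intro hs; have := hs p (by rwa [← sq]); exact hp.one_lt.ne' (Nat.isUnit_iff.mp this)
    rw [this]; simp only [Int.cast_zero, zero_mul, zero_add, mul_one]
    rw [norm_mul, norm_real, norm_of_nonneg (tri_nonneg _ _)]
    have := mul_le_mul (mu_norm_le (n/p)) (tri_le hA (log n - log p - (V - v / H))) (tri_nonneg _ _) (by norm_num)
    have : (0:ℝ) < 1 / H := by positivity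
    linarith
  · rw [moebius_div hp hpn h]
    push_cast
    rw [neg_mul, ← sub_eq_add_neg, ← mul_sub, ← ofReal_sub, norm_mul, norm_real, norm_eq_abs]
    have h3 := tri_lip A (log n - V) (log n - log p - (V - v / H))
    rw [show log n - V - (log n - log p - (V - v / H)) = log p - v / H by ring, abs_of_nonneg (show 0 ≤ log p - v / H by linarith)] at h3
    have := mul_le_mul (mu_norm_le n) (h3.trans (by linarith : log p - v / H ≤ 1 / H)) (abs_nonneg _) (by norm_num)
    linarith

noncomputable def decErr (A V:ℝ) (P : Finset ℕ) (H:ℕ):ℕ →₀ ℂ :=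
  bV A V + (((∑ p ∈ P, (p:ℝ)⁻¹:ℝ):ℂ)⁻¹) • dec A V P H

lemma decErr_pt {A V:ℝ} (hA : 0 ≤ A) {P : Finset ℕ} (hP : ∀ p ∈ P, p.Prime) {H:ℕ} (hH : 0 < H)
    (hW : 0 < ∑ p ∈ P, (p:ℝ)⁻¹) {n:ℕ} (hn : 0 < n) :
    ‖decErr A V P H n‖*((∑ p ∈ P, (p:ℝ)⁻¹)*n) ≤
      A * |(∑ p ∈ P, if p ∣ n then (1:ℝ) else 0) - ∑ p ∈ P, (p:ℝ)⁻¹| + (1 / H)*(∑ p ∈ P, if p ∣ n then (1:ℝ) else 0)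
        + A*(∑ p ∈ P, if p ^ 2 ∣ n then (1:ℝ) else 0) := by
  set W := ∑ p ∈ P, (p:ℝ)⁻¹ with hWdef
  have hn0 : (0:ℝ) < n := mod_cast hn
  have hWc : (W:ℂ) ≠ 0 := mod_cast hW.ne'
  have hH' : (0:ℝ) < H := mod_cast hH
  set om:ℝ := ∑ p ∈ P, if p ∣ n then (1:ℝ) else 0 with hom
  have e : decErr A V P H n*W = -(((om - W:ℝ)):ℂ)*bfun A V n +
     ∑ p ∈ P, (if p ∣ n then bfun A V n + (p:ℂ)⁻¹*bfun A (V - (⌊(H:ℝ)*log p⌋₊ : ℕ) / H) (n / p) else 0) := by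
    unfold decErr
    rw [Finsupp.add_apply, Finsupp.smul_apply, dec_apply A V P hP, bV_apply, smul_eq_mul, ← hWdef]
    have : ∑ p ∈ P, (if p ∣ n then bfun A V n + (p:ℂ)⁻¹*bfun A (V - (⌊(H:ℝ)*log p⌋₊ : ℕ) / H) (n / p) else 0)
       = (om:ℂ)*bfun A V n + ∑ p ∈ P, (if p ∣ n then (p:ℂ)⁻¹*bfun A (V - (⌊(H:ℝ)*log p⌋₊ : ℕ) / H) (n / p) else 0) := by
      rw [hom, ofReal_sum, sum_mul, ← sum_add_distrib]
      refine sum_congr rfl fun p _ => ?_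
      split_ifs <;> simp
    rw [this]; push_cast; field_simp; ring
  have e2 : ‖decErr A V P H n‖*(W*n) = ‖decErr A V P H n*W‖*n := by
    rw [norm_mul, norm_real, norm_of_nonneg hW.le]; ring
  rw [e2, e]
  have h1 : ‖-(((om - W:ℝ)):ℂ)*bfun A V n‖ ≤ |om - W| * (A*(n:ℝ)⁻¹) := by
    rw [norm_mul, norm_neg, norm_real, norm_eq_abs]
    exact mul_le_mul_of_nonneg_left (bfun_norm hA V n) (abs_nonneg _)
  have h2 : ‖∑ p ∈ P, (if p ∣ n then bfun A V n + (p:ℂ)⁻¹*bfun A (V - (⌊(H:ℝ)*log p⌋₊ : ℕ) / H) (n / p) else 0)‖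
     ≤ ((1 / H)*om + A*(∑ p ∈ P, if p ^ 2 ∣ n then (1:ℝ) else 0))*(n:ℝ)⁻¹ := by
    refine (norm_sum_le _ _).trans ?_
    rw [hom, mul_sum, mul_sum, ← sum_add_distrib, sum_mul]
    refine sum_le_sum fun p hp => ?_
    have hpcls : p ∈ cls P H ⌊(H:ℝ)*log p⌋₊ := mem_filter.mpr ⟨hp, rfl⟩
    obtain ⟨l1, l2⟩ := cls_log hH hpcls
    by_cases hpn : p ∣ n
    · simp only [if_pos hpn]
      refine (dec_term hA hH (hP p hp) hn hpn _ l1 l2).trans (le_of_eq (by ring))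
    · simp only [if_neg hpn, norm_zero]
      split_ifs <;> positivity
  have h3 := (norm_add_le _ _).trans (add_le_add h1 h2)
  calc _ ≤ (|om - W| * (A*(n:ℝ)⁻¹) + ((1 / H)*om + A*(∑ p ∈ P, if p ^ 2 ∣ n then (1:ℝ) else 0))*(n:ℝ)⁻¹)*n :=
        mul_le_mul_of_nonneg_right h3 hn0.le
    _ = _ := by field_simp; ring

lemma decErr_support {A V:ℝ} {P : Finset ℕ} (hP : ∀ p ∈ P, p.Prime) {H:ℕ} (hH : 0 < H)
    {n:ℕ} (hn : n ∈ (decErr A V P H).support) :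
    1 ≤ n ∧ exp (V - A - 1) ≤ n ∧ (n:ℝ) ≤ exp (V + A + 1) := by
  rw [Finsupp.mem_support_iff] at hn
  have hH' : (1:ℝ) ≤ H := mod_cast hH
  have hH1 : 1 / (H:ℝ) ≤ 1 := by rw [div_le_one (by linarith)]; exact hH'
  by_cases hb : bfun A V n = 0
  · have hd : dec A V P H n ≠ 0 := by
      intro h0; apply hn; simp [decErr, bV_apply, hb, h0]
    rw [dec_apply A V P hP] at hd
    obtain ⟨p, hp, hne⟩ := exists_ne_zero_of_sum_ne_zero hd
    have hpcls : p ∈ cls P H ⌊(H:ℝ)*log p⌋₊ := mem_filter.mpr ⟨hp, rfl⟩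
    obtain ⟨l1, l2⟩ := cls_log hH hpcls
    split_ifs at hne with hpn
    swap
    · exact absurd rfl hne
    have hb2 := bfun_support (right_ne_zero_of_mul hne)
    have hp0 : (0:ℝ) < p := mod_cast (hP p hp).pos
    have hcastR : ((n / p:ℕ):ℝ) = (n:ℝ) / p := Nat.cast_div hpn hp0.ne'
    rw [hcastR] at hb2
    have hpos : (0:ℝ) < n / p := (exp_pos _).trans_le hb2.2.1
    have hn0 : (0:ℝ) < n := by
      rcases Nat.eq_zero_or_pos n with h | h
      · subst h; simp at hpos
      · exact_mod_cast h
    have g1 := (le_log_iff_exp_le hpos).mpr hb2.2.1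
    have g2 := (log_le_iff_le_exp hpos).mpr hb2.2.2
    rw [log_div hn0.ne' hp0.ne'] at g1 g2
    refine ⟨by exact_mod_cast hn0, ?_, ?_⟩
    · rw [← le_log_iff_exp_le hn0]; linarith
    · rw [← log_le_iff_le_exp hn0]; linarith
  · obtain ⟨h1, h2, h3⟩ := bfun_support hb
    exact ⟨h1, (exp_le_exp.mpr (by linarith)).trans h2, h3.trans (exp_le_exp.mpr (by linarith))⟩

lemma decErr_l2 {A V:ℝ} (hA : 1 ≤ A) {P : Finset ℕ} (hP : ∀ p ∈ P, p.Prime) {H:ℕ} (hH : 0 < H)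
    (hW : 1 ≤ ∑ p ∈ P, (p:ℝ)⁻¹) {P0:ℝ} (hP0 : 1 ≤ P0) (hPP : ∀ p ∈ P, P0 ≤ p)
    (hcard : (P.card:ℝ) ≤ exp (V + A + 1)) :
    ∑ n ∈ (decErr A V P H).support, ‖decErr A V P H n‖ ^ 2 ≤
      9*A ^ 2*exp (3*A + 3)*exp (-V)*(1 / (∑ p ∈ P, (p:ℝ)⁻¹) + 1 / (H:ℝ) ^ 2 + 1 / P0) := by
  set W := ∑ p ∈ P, (p:ℝ)⁻¹ with hWdef
  set N := ⌊exp (V + A + 1)⌋₊ with hN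
  have hNle : (N:ℝ) ≤ exp (V + A + 1) := Nat.floor_le (exp_pos _).le
  have hcardN : P.card ≤ N := Nat.le_floor hcard
  set om:ℕ → ℝ := fun n => ∑ p ∈ P, if p ∣ n then (1:ℝ) else 0 with hom
  set ka:ℕ → ℝ := fun n => ∑ p ∈ P, if p ^ 2 ∣ n then (1:ℝ) else 0 with hka
  have hW0 : 0 < W := by linarith
  have hH' : (0:ℝ) < H := mod_cast hH
  set y := exp (V - A - 1) with hy
  have hy0 : 0 < y := exp_pos _
  have hpt : ∀ n ∈ (decErr A V P H).support, ‖decErr A V P H n‖ ^ 2 ≤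
      (W*y)⁻¹ ^ 2*(3*(A ^ 2*(om n - W) ^ 2 + (1 / H) ^ 2*om n ^ 2 + A ^ 2*ka n ^ 2)) := by
    intro n hn
    obtain ⟨h1, h2, h3⟩ := decErr_support hP hH hn
    have h4 := decErr_pt (V := V) (by linarith : 0 ≤ A) hP hH hW0 (by omega : 0 < n)
    have h5 : ‖decErr A V P H n‖*(W*y) ≤ ‖decErr A V P H n‖*(W*n) := by gcongr
    have h6 := h5.trans h4
    have h7 : ‖decErr A V P H n‖ ≤ (W*y)⁻¹*(A * |om n - W| + (1 / H)*om n + A*ka n) := by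
      rw [inv_mul_eq_div, le_div_iff₀ (by positivity)]; exact h6
    refine (pow_le_pow_left₀ (norm_nonneg _) h7 2).trans ?_
    rw [mul_pow]
    refine mul_le_mul_of_nonneg_left ?_ (by positivity)
    rw [← sq_abs (om n - W)]
    nlinarith [sq_nonneg (A * |om n - W| - (1 / H)*om n), sq_nonneg (A * |om n - W| - A*ka n), sq_nonneg ((1 / H)*om n - A*ka n)]
  have hsub : (decErr A V P H).support ⊆ Ioc 0 N := by
    intro n hn
    obtain ⟨h1, h2, h3⟩ := decErr_support hP hH hn
    rw [mem_Ioc]; exact ⟨h1, Nat.le_floor h3⟩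
  have t1 := tk P hP N hcardN
  have t2 := tk_second P id (fun p hp => (hP p hp).pos)
    (fun p hp p' hp' h => (Nat.coprime_primes (hP p hp) (hP p' hp')).mpr h) N
  have t3 := tk_second P (fun p => p ^ 2) (fun p hp => pow_pos (hP p hp).pos 2)
    (fun p hp p' hp' h => ((Nat.coprime_primes (hP p hp) (hP p' hp')).mpr h).pow 2 2) N
  simp only [id] at t2
  have hs2 : ∑ p ∈ P, ((p ^ 2:ℕ):ℝ)⁻¹ ≤ W / P0 := by
    rw [hWdef, sum_div]
    refine sum_le_sum fun p hp => ?_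
    have hp0 : (0:ℝ) < p := mod_cast (hP p hp).pos
    have := hPP p hp
    push_cast
    rw [sq, mul_inv, div_eq_mul_inv]
    gcongr
  have hs0 : 0 ≤ ∑ p ∈ P, ((p ^ 2:ℕ):ℝ)⁻¹ := sum_nonneg fun p _ => by positivity
  set s2 := ∑ p ∈ P, ((p ^ 2:ℕ):ℝ)⁻¹ with hs2def
  have t3' : ∑ n ∈ Ioc 0 N, ka n ^ 2 ≤ N*(2*W ^ 2 / P0) := by
    refine t3.trans (mul_le_mul_of_nonneg_left ?_ (by positivity))
    have a1 : s2 ^ 2 ≤ W ^ 2 / P0 := by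
      calc s2 ^ 2 ≤ (W / P0) ^ 2 := pow_le_pow_left₀ hs0 hs2 2
        _ = W ^ 2 / P0*(1 / P0) := by rw [div_pow]; field_simp
        _ ≤ W ^ 2 / P0*1 := by gcongr; rw [div_le_one (by linarith)]; exact hP0
        _ = _ := mul_one _
    have a2 : W / P0 ≤ W ^ 2 / P0 := by gcongr; nlinarith
    rw [mul_div_assoc]; linarith
  have t2' : ∑ n ∈ Ioc 0 N, om n ^ 2 ≤ N*(2*W ^ 2) := by
    refine t2.trans (mul_le_mul_of_nonneg_left ?_ (by positivity))
    nlinarith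
  calc ∑ n ∈ (decErr A V P H).support, ‖decErr A V P H n‖ ^ 2
      ≤ ∑ n ∈ (decErr A V P H).support, (W*y)⁻¹ ^ 2*(3*(A ^ 2*(om n - W) ^ 2 + (1 / H) ^ 2*om n ^ 2 + A ^ 2*ka n ^ 2)) :=
        sum_le_sum hpt
    _ ≤ ∑ n ∈ Ioc 0 N, (W*y)⁻¹ ^ 2*(3*(A ^ 2*(om n - W) ^ 2 + (1 / H) ^ 2*om n ^ 2 + A ^ 2*ka n ^ 2)) :=
        sum_le_sum_of_subset_of_nonneg hsub fun n _ _ => by positivity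
    _ = (W*y)⁻¹ ^ 2*(3*(A ^ 2*(∑ n ∈ Ioc 0 N, (om n - W) ^ 2) + (1 / H) ^ 2*(∑ n ∈ Ioc 0 N, om n ^ 2) + A ^ 2*(∑ n ∈ Ioc 0 N, ka n ^ 2))) := by
        rw [← mul_sum, ← mul_sum, sum_add_distrib, sum_add_distrib, mul_sum, mul_sum, mul_sum]
    _ ≤ (W*y)⁻¹ ^ 2*(3*(A ^ 2*(3*N*W) + (1 / H) ^ 2*(N*(2*W ^ 2)) + A ^ 2*(N*(2*W ^ 2 / P0)))) := by
        gcongr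
    _ = (y⁻¹ ^ 2*N)*(3*(3*A ^ 2 / W + 2 / (H:ℝ) ^ 2 + 2*A ^ 2 / P0)) := by
        field_simp
    _ ≤ (exp (3*A + 3)*exp (-V))*(9*A ^ 2*(1 / W + 1 / (H:ℝ) ^ 2 + 1 / P0)) := by
        have b1 : y⁻¹ ^ 2*N ≤ exp (3*A + 3)*exp (-V) := by
          calc y⁻¹ ^ 2*N ≤ y⁻¹ ^ 2*exp (V + A + 1) := by gcongr
            _ = _ := by rw [hy, ← exp_neg, ← exp_nat_mul, ← exp_add, ← exp_add]; congr 1; push_cast; ring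
        have b2 : 3*(3*A ^ 2 / W + 2 / (H:ℝ) ^ 2 + 2*A ^ 2 / P0) ≤ 9*A ^ 2*(1 / W + 1 / (H:ℝ) ^ 2 + 1 / P0) := by
          have c1 : 2 / (H:ℝ) ^ 2 ≤ 3*A ^ 2*(1 / (H:ℝ) ^ 2) := by
            rw [div_eq_mul_one_div]; gcongr; nlinarith
          have c2 : 2*A ^ 2 / P0 ≤ 3*A ^ 2*(1 / P0) := by
            rw [div_eq_mul_one_div]; gcongr; nlinarith
          have c3 : 3*A ^ 2 / W = 3*A ^ 2*(1 / W) := by rw [div_eq_mul_one_div]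
          nlinarith
        exact mul_le_mul b1 b2 (by positivity) (by positivity)
    _ = _ := by ring

noncomputable def om (P : Finset ℕ) (n:ℕ):ℝ := ∑ p ∈ P, if p ∣ n then (1:ℝ) else 0

lemma om_nonneg (P : Finset ℕ) (n:ℕ) : 0 ≤ om P n := sum_nonneg fun p _ => by split_ifs <;> norm_num

lemma om_mono (P : Finset ℕ) {m n:ℕ} (h : m ∣ n) : om P m ≤ om P n := by
  refine sum_le_sum fun p _ => ?_
  by_cases h1 : p ∣ m
  · rw [if_pos h1, if_pos (h1.trans h)]
  · rw [if_neg h1]; split_ifs <;> norm_num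

lemma Pc_iter_zero (P : Finset ℕ) (hP : ∀ p ∈ P, 0 < p) (c:ℕ →₀ ℂ) (hc : c 0 = 0) (l:ℕ) :
    ((Pc P)^[l] c) 0 = 0 := by
  induction l with
  | zero => simpa using hc
  | succ l ih => rw [Function.iterate_succ_apply']; exact Pc_zero P hP _ ih

lemma Pc_iter_pt (P : Finset ℕ) (hP : ∀ p ∈ P, 0 < p) (c:ℕ →₀ ℂ) {B:ℝ} (hB : 0 ≤ B)
    (hc : ∀ n, ‖c n‖ ≤ B*(n:ℝ)⁻¹) (l n:ℕ) :
    ‖((Pc P)^[l] c) n‖ ≤ om P n ^ l*(B*(n:ℝ)⁻¹) := by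
  induction l generalizing n with
  | zero => simpa using hc n
  | succ l ih =>
    rw [Function.iterate_succ_apply', Pc_apply P hP]
    refine (norm_sum_le _ _).trans ?_
    rw [pow_succ', mul_assoc]
    conv_rhs => rw [om, sum_mul]
    refine sum_le_sum fun p hp => ?_
    by_cases h : p ∣ n
    · rw [if_pos h, if_pos h, one_mul, norm_mul, norm_inv, Complex.norm_natCast]
      have hp0 : (0:ℝ) < p := mod_cast hP p hp
      have h1 := ih (n / p)
      have hcast : ((n / p:ℕ):ℝ) = (n:ℝ) / p := Nat.cast_div h hp0.ne'
      rw [hcast] at h1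
      have h2 : om P (n / p) ^ l ≤ om P n ^ l := pow_le_pow_left₀ (om_nonneg _ _) (om_mono P (Nat.div_dvd_of_dvd h)) l
      calc (p:ℝ)⁻¹*_ ≤ (p:ℝ)⁻¹*(om P n ^ l*(B*((n:ℝ) / p)⁻¹)) := by
            refine mul_le_mul_of_nonneg_left (h1.trans ?_) (by positivity)
            exact mul_le_mul_of_nonneg_right h2 (by positivity)
        _ = om P n ^ l*(B*(n:ℝ)⁻¹) := by
            rw [inv_div]; field_simp
    · rw [if_neg h, if_neg h]; simp

lemma Pc_iter_support (P : Finset ℕ) (hP : ∀ p ∈ P, 0 < p) {N1 N2 Y1 Y2:ℝ} (hN1 : 0 ≤ N1) (hY1 : 0 ≤ Y1)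
    (hN : ∀ p ∈ P, N1 ≤ p ∧ (p:ℝ) ≤ N2) (c:ℕ →₀ ℂ) (hc : ∀ n, c n ≠ 0 → 1 ≤ n ∧ Y1 ≤ n ∧ (n:ℝ) ≤ Y2)
    (l:ℕ) : ∀ n, ((Pc P)^[l] c) n ≠ 0 → 1 ≤ n ∧ Y1*N1 ^ l ≤ n ∧ (n:ℝ) ≤ Y2*N2 ^ l := by
  induction l with
  | zero => intro n hn; simpa using hc n hn
  | succ l ih =>
    intro n hn
    rw [Function.iterate_succ_apply', Pc_apply P hP] at hn
    obtain ⟨p, hp, hne⟩ := exists_ne_zero_of_sum_ne_zero hn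
    split_ifs at hne with h
    swap
    · exact absurd rfl hne
    obtain ⟨h1, h2, h3⟩ := ih _ (right_ne_zero_of_mul hne)
    have hp0 : (0:ℝ) < p := mod_cast hP p hp
    have hcast : ((n / p:ℕ):ℝ) = (n:ℝ) / p := Nat.cast_div h hp0.ne'
    rw [hcast] at h2 h3
    rw [le_div_iff₀ hp0] at h2
    rw [div_le_iff₀ hp0] at h3
    have hn1 : 1 ≤ n := h1.trans (Nat.div_le_self n p)
    obtain ⟨g1, g2⟩ := hN p hp
    have hn0 : (0:ℝ) < n := mod_cast hn1
    refine ⟨hn1, ?_, ?_⟩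
    · refine le_trans ?_ h2
      rw [pow_succ, ← mul_assoc]
      exact mul_le_mul_of_nonneg_left g1 (by positivity)
    · refine h3.trans ?_
      rw [pow_succ, ← mul_assoc]
      refine mul_le_mul_of_nonneg_left g2 ?_
      by_contra hh
      push Not at hh
      have := mul_neg_of_neg_of_pos hh hp0
      linarith

lemma pow_le_exp {x:ℝ} (hx : 0 ≤ x) (l:ℕ) : x ^ l ≤ (l:ℝ) ^ l*exp x := by
  rcases Nat.eq_zero_or_pos l with h | h
  · subst h; simp [one_le_exp hx]
  · have hl : (0:ℝ) < l := mod_cast h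
    have h1 : x / l ≤ exp (x / l) := by linarith [add_one_le_exp (x / l)]
    have h2 := pow_le_pow_left₀ (by positivity) h1 l
    rw [← exp_nat_mul, mul_div_cancel₀ _ hl.ne', div_pow, div_le_iff₀ (by positivity)] at h2
    linarith

lemma exp_om (P : Finset ℕ) (n:ℕ) : exp (2*om P n) =
    ∑ D ∈ P.powerset, ∏ p ∈ D, ((exp 2 - 1)*if p ∣ n then (1:ℝ) else 0) := by
  rw [← prod_one_add, om, mul_sum, exp_sum]
  refine prod_congr rfl fun p _ => ?_
  split_ifs <;> simp

lemma exp_om_sum (P : Finset ℕ) (hP : ∀ p ∈ P, p.Prime) (N:ℕ) :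
    ∑ n ∈ Ioc 0 N, exp (2*om P n) ≤ N*exp (exp 2*∑ p ∈ P, (p:ℝ)⁻¹) := by
  simp_rw [exp_om]
  rw [sum_comm]
  have he : 0 ≤ exp 2 - 1 := by linarith [one_le_exp (by norm_num : (0:ℝ) ≤ 2)]
  have h1 : ∀ D ∈ P.powerset, ∑ n ∈ Ioc 0 N, ∏ p ∈ D, ((exp 2 - 1)*if p ∣ n then (1:ℝ) else 0) ≤
      N*∏ p ∈ D, ((exp 2 - 1)*(p:ℝ)⁻¹) := by
    intro D hD
    rw [mem_powerset] at hD
    simp_rw [prod_mul_distrib]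
    rw [← mul_sum, mul_left_comm]
    refine mul_le_mul_of_nonneg_left ?_ (prod_nonneg fun _ _ => he)
    have : ∀ n, (∏ p ∈ D, if p ∣ n then (1:ℝ) else 0) ≤ if (∏ p ∈ D, p) ∣ n then (1:ℝ) else 0 := by
      intro n
      by_cases h : ∀ p ∈ D, p ∣ n
      · rw [if_pos, prod_congr rfl fun p hp => if_pos (h p hp)]
        · simp
        · exact prod_primes_dvd n (fun p hp => (hP p (hD hp)).prime) h
      · push Not at h
        obtain ⟨p, hp, hpn⟩ := h
        rw [prod_eq_zero hp (if_neg hpn)]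
        split_ifs <;> norm_num
    refine (sum_le_sum fun n _ => this n).trans ((card_mult_le N _).trans (le_of_eq ?_))
    push_cast; rw [prod_inv_distrib]
  refine (sum_le_sum h1).trans ?_
  rw [← mul_sum, ← prod_one_add, mul_sum, exp_sum]
  refine mul_le_mul_of_nonneg_left (Finset.prod_le_prod (fun p _ => by positivity) fun p _ => ?_) (by positivity)
  have : (0:ℝ) ≤ (p:ℝ)⁻¹ := by positivity
  refine le_trans ?_ (add_one_le_exp _)
  nlinarith

lemma moment_l2 (P : Finset ℕ) (hP : ∀ p ∈ P, p.Prime) {N1 N2 Y1 Y2 B:ℝ} (hN1 : 0 < N1) (hY1 : 0 < Y1) (hB : 0 ≤ B)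
    (hN : ∀ p ∈ P, N1 ≤ p ∧ (p:ℝ) ≤ N2) (c:ℕ →₀ ℂ) (hc : ∀ n, c n ≠ 0 → 1 ≤ n ∧ Y1 ≤ n ∧ (n:ℝ) ≤ Y2)
    (hcB : ∀ n, ‖c n‖ ≤ B*(n:ℝ)⁻¹) (hN2 : 0 ≤ N2) (hY2 : 0 ≤ Y2) (l:ℕ) :
    ∑ n ∈ ((Pc P)^[l] c).support, ‖((Pc P)^[l] c) n‖ ^ 2 ≤
      B ^ 2*((l:ℝ) ^ l) ^ 2*((Y1*N1 ^ l)⁻¹) ^ 2*(Y2*N2 ^ l)*exp (exp 2*∑ p ∈ P, (p:ℝ)⁻¹) := by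
  have hP0 : ∀ p ∈ P, 0 < p := fun p hp => (hP p hp).pos
  set Y := Y1*N1 ^ l with hY
  have hY0 : 0 < Y := by positivity
  have hsup := Pc_iter_support P hP0 hN1.le hY1.le hN c hc l
  have h1 : ∀ n ∈ ((Pc P)^[l] c).support, ‖((Pc P)^[l] c) n‖ ^ 2 ≤
      B ^ 2*((l:ℝ) ^ l) ^ 2*(Y⁻¹) ^ 2*exp (2*om P n) := by
    intro n hn
    rw [Finsupp.mem_support_iff] at hn
    obtain ⟨g1, g2, g3⟩ := hsup n hn
    have h2 := Pc_iter_pt P hP0 c hB hcB l n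
    have h3 := pow_le_exp (om_nonneg P n) l
    have h4 : ‖((Pc P)^[l] c) n‖ ≤ ((l:ℝ) ^ l*exp (om P n))*(B*Y⁻¹) := by
      refine h2.trans (mul_le_mul h3 ?_ (by positivity) (by positivity))
      gcongr
    refine (pow_le_pow_left₀ (norm_nonneg _) h4 2).trans (le_of_eq ?_)
    rw [two_mul, exp_add]; ring
  refine (sum_le_sum h1).trans ?_
  rw [← mul_sum, mul_assoc (B ^ 2*((l:ℝ) ^ l) ^ 2*(Y⁻¹) ^ 2)]
  refine mul_le_mul_of_nonneg_left ?_ (by positivity)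
  have hsub : ((Pc P)^[l] c).support ⊆ Ioc 0 ⌊Y2*N2 ^ l⌋₊ := by
    intro n hn
    rw [Finsupp.mem_support_iff] at hn
    obtain ⟨g1, g2, g3⟩ := hsup n hn
    rw [mem_Ioc]; exact ⟨g1, Nat.le_floor g3⟩
  refine (sum_le_sum_of_subset_of_nonneg hsub fun n _ _ => (exp_pos _).le).trans ?_
  refine (exp_om_sum P hP _).trans (mul_le_mul_of_nonneg_right (Nat.floor_le (by positivity)) (exp_pos _).le)

section
variable {q:ℕ} [NeZero q]

lemma EE_Pc_iter (P : Finset ℕ) (hP : ∀ p ∈ P, 0 < p ∧ p.Coprime q) (χ : DirichletCharacter ℂ q) (a : ZMod q) (t:ℝ)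
    (c:ℕ →₀ ℂ) (hc : c 0 = 0) (l:ℕ) : EE χ a t ((Pc P)^[l] c) = QQ P χ t ^ l*EE χ a t c := by
  induction l with
  | zero => simp
  | succ l ih =>
    rw [Function.iterate_succ_apply', EE_Pc P hP _ _ _ _ (Pc_iter_zero P (fun p hp => (hP p hp).1) c hc l), ih]; ring

lemma moment_IS (P : Finset ℕ) (hP : ∀ p ∈ P, p.Prime) {N1 N2 Y1 Y2 B δ:ℝ} (hN1 : 0 < N1) (hY1 : 0 < Y1) (hB : 0 ≤ B)
    (hN : ∀ p ∈ P, N1 ≤ p ∧ (p:ℝ) ≤ N2) (c:ℕ →₀ ℂ) (hc : ∀ n, c n ≠ 0 → 1 ≤ n ∧ Y1 ≤ n ∧ (n:ℝ) ≤ Y2)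
    (hcB : ∀ n, ‖c n‖ ≤ B*(n:ℝ)⁻¹) (hN2 : 0 < N2) (hY2 : 0 < Y2) (l:ℕ) (hδ : 0 < δ)
    (hq : (q:ℝ) / δ ≤ Y2*N2 ^ l) (S : DirichletCharacter ℂ q → Set ℝ) :
    IS δ S ((Pc P)^[l] c) ≤
      3*B ^ 2*((l:ℝ) ^ l) ^ 2*((Y2*N2 ^ l) / (Y1*N1 ^ l)) ^ 2*exp (exp 2*∑ p ∈ P, (p:ℝ)⁻¹) := by
  have h1 := moment_l2 P hP hN1 hY1 hB hN c hc hcB hN2.le hY2.le l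
  have hsup := Pc_iter_support P (fun p hp => (hP p hp).pos) hN1.le hY1.le hN c hc l
  have h2 := IS_all (q := q) hδ (by positivity : 0 < Y2*N2 ^ l) ((Pc P)^[l] c)
    (fun m hm => ⟨(hsup m (Finsupp.mem_support_iff.mp hm)).1, (hsup m (Finsupp.mem_support_iff.mp hm)).2.2⟩) S
  have h3 : 0 ≤ ∑ n ∈ ((Pc P)^[l] c).support, ‖((Pc P)^[l] c) n‖ ^ 2 := sum_nonneg fun _ _ => by positivity
  have h4 : (2*(Y2*N2 ^ l) + q / δ) ≤ 3*(Y2*N2 ^ l) := by linarith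
  refine h2.trans ((mul_le_mul h4 h1 h3 (by positivity)).trans (le_of_eq ?_))
  rw [div_pow, inv_pow]; field_simp
end

open ArithmeticFunction in
lemma log_fact_vonM (N:ℕ) : ∑ n ∈ Ioc 0 N, Real.log n =
    ∑ d ∈ Ioc 0 N, vonMangoldt d*∑ n ∈ Ioc 0 N, if d ∣ n then (1:ℝ) else 0 := by
  simp_rw [mul_sum]
  rw [sum_comm]
  refine sum_congr rfl fun n hn => ?_
  rw [mem_Ioc] at hn
  rw [← vonMangoldt_sum]
  simp_rw [mul_ite, mul_one, mul_zero]
  rw [← sum_filter]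
  refine sum_congr ?_ fun _ _ => rfl
  ext d
  simp only [Nat.mem_divisors, mem_filter, mem_Ioc]
  constructor
  · rintro ⟨h1, h2⟩
    exact ⟨⟨Nat.pos_of_dvd_of_pos h1 hn.1, (Nat.le_of_dvd hn.1 h1).trans hn.2⟩, h1⟩
  · rintro ⟨_, h⟩; exact ⟨h, by omega⟩

lemma log_fact_bounds (N:ℕ) (hN : 0 < N) : N*Real.log N - N ≤ ∑ n ∈ Ioc 0 N, Real.log n ∧
    ∑ n ∈ Ioc 0 N, Real.log n ≤ N*Real.log N := by
  have hN0 : (0:ℝ) < N := mod_cast hN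
  have e : ∑ n ∈ Ioc 0 N, Real.log n = Real.log (N.factorial) := by
    clear hN0 hN
    induction N with
    | zero => simp
    | succ n ih =>
      rw [sum_Ioc_succ_top (by omega), ih, Nat.factorial_succ, Nat.cast_mul, log_mul (by positivity) (by positivity), add_comm]
  constructor
  · rw [e]
    have h := pow_div_factorial_le_exp (x := (N:ℝ)) hN0.le N
    have h2 := log_le_log (by positivity) h
    rw [log_exp, log_div (by positivity) (by positivity), log_pow] at h2
    linarith
  · calc _ ≤ ∑ n ∈ Ioc 0 N, Real.log N := sum_le_sum fun n hn => by
          rw [mem_Ioc] at hn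
          exact log_le_log (mod_cast hn.1) (mod_cast hn.2)
      _ = _ := by simp

open ArithmeticFunction in
lemma mertens_vonM : ∃ C:ℝ, ∀ N:ℕ, 0 < N → |∑ d ∈ Ioc 0 N, vonMangoldt d*(d:ℝ)⁻¹ - Real.log N| ≤ C := by
  refine ⟨Real.log 4 + 4 + 1, fun N hN => ?_⟩
  have hN0 : (0:ℝ) < N := mod_cast hN
  obtain ⟨b1, b2⟩ := log_fact_bounds N hN
  rw [log_fact_vonM] at b1 b2
  have hpsi := Chebyshev.psi_le_const_mul_self hN0.le
  unfold Chebyshev.psi at hpsi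
  rw [Nat.floor_natCast] at hpsi
  set S := ∑ d ∈ Ioc 0 N, vonMangoldt d*(d:ℝ)⁻¹ with hS
  have u1 : ∑ d ∈ Ioc 0 N, vonMangoldt d*∑ n ∈ Ioc 0 N, (if d ∣ n then (1:ℝ) else 0) ≤ N*S := by
    rw [hS, mul_sum]
    refine sum_le_sum fun d _ => ?_
    have := mul_le_mul_of_nonneg_left (card_mult_le N d) (vonMangoldt_nonneg (n := d))
    linarith
  have u2 : N*S - ∑ d ∈ Ioc 0 N, vonMangoldt d ≤ ∑ d ∈ Ioc 0 N, vonMangoldt d*∑ n ∈ Ioc 0 N, (if d ∣ n then (1:ℝ) else 0) := by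
    rw [hS, mul_sum, ← sum_sub_distrib]
    refine sum_le_sum fun d hd => ?_
    rw [mem_Ioc] at hd
    have := mul_le_mul_of_nonneg_left (card_mult_ge N d hd.1) (vonMangoldt_nonneg (n := d))
    linarith
  have hl : 0 ≤ Real.log 4 := log_nonneg (by norm_num)
  rw [abs_le]
  constructor
  · have : N*(Real.log N - 1) ≤ N*S := by linarith
    have := le_of_mul_le_mul_left this hN0
    linarith
  · have : N*S ≤ N*(Real.log N + (Real.log 4 + 4)) := by linarith
    have := le_of_mul_le_mul_left this hN0
    linarith

open ArithmeticFunction in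
lemma nonprime_vonM : ∃ C:ℝ, ∀ N:ℕ, ∑ d ∈ (Ioc 0 N).filter (fun n => ¬ n.Prime), vonMangoldt d*(d:ℝ)⁻¹ ≤ C := by
  obtain ⟨C, hC⟩ := Chebyshev.psi_sub_theta_le_mul_sqrt
  have hC0 : 0 ≤ C := by
    have := hC 1; have h2 := Chebyshev.theta_le_psi 1
    rw [sqrt_one] at this; linarith
  set g:ℕ → ℝ := fun N => ∑ d ∈ (Ioc 0 N).filter (fun n => ¬ n.Prime), vonMangoldt d with hg
  have hgC : ∀ N:ℕ, g N ≤ C*sqrt N := by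
    intro N
    have := hC N
    rwa [Chebyshev.psi_sub_theta_eq_sum_not_prime, Nat.floor_natCast] at this
  have key : ∀ N:ℕ, ∑ d ∈ (Ioc 0 N).filter (fun n => ¬ n.Prime), vonMangoldt d*(d:ℝ)⁻¹ ≤
      g N / (N + 1) + C*(3 - 2 / sqrt (N + 1)) := by
    intro N
    induction N with
    | zero => simp [hg]; nlinarith
    | succ n ih =>
      have e1 : ∀ f:ℕ → ℝ, ∑ d ∈ (Ioc 0 (n+1)).filter (fun n => ¬ n.Prime), f d =
         ∑ d ∈ (Ioc 0 n).filter (fun n => ¬ n.Prime), f d + if ¬ (n+1).Prime then f (n+1) else 0 := by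
        intro f
        rw [sum_filter, sum_filter, sum_Ioc_succ_top (by omega)]
      have e2 : g (n+1) = g n + if ¬ (n+1).Prime then vonMangoldt (n+1) else 0 := e1 _
      rw [e1]
      set a:ℝ := if ¬ (n+1).Prime then vonMangoldt (n+1) else 0 with ha
      have e3 : (if ¬ (n+1).Prime then vonMangoldt (n+1)*(((n+1:ℕ):ℝ))⁻¹ else 0) = a / (n + 1) := by
        rw [ha]; split_ifs <;> simp [div_eq_mul_inv]
      rw [e3]
      have hn1 : (0:ℝ) < n + 1 := by positivity
      have hg1 := hgC (n+1)
      push_cast at hg1 ⊢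
      set r := sqrt ((n:ℝ) + 1) with hr
      set r' := sqrt ((n:ℝ) + 1 + 1) with hr'
      have hr0 : 0 < r := sqrt_pos.mpr hn1
      have hr0' : 0 < r' := sqrt_pos.mpr (by positivity)
      have hrs : r ^ 2 = n + 1 := sq_sqrt hn1.le
      have hrs' : r' ^ 2 = n + 1 + 1 := sq_sqrt (by positivity)
      have hrr : r ≤ r' := sqrt_le_sqrt (by linarith)
      have f1 : 1 / (r*r' ^ 2) ≤ 2 / r - 2 / r' := by
        have hd : (r' - r)*(r' + r) = 1 := by nlinarith
        have : 2 / r - 2 / r' = 2*(r' - r) / (r*r') := by field_simp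
        rw [this, div_le_div_iff₀ (by positivity) (by positivity)]
        have h5 : r' ≤ 2*(r' - r)*r' ^ 2 := by
          have : 1 ≤ 2*(r' - r)*r' := by nlinarith
          nlinarith
        nlinarith
      have f2 : g (n+1) / (r ^ 2*r' ^ 2) ≤ C*(1 / (r*r' ^ 2)) := by
        rw [div_le_iff₀ (by positivity)]
        calc g (n+1) ≤ C*r := hg1
          _ = _ := by field_simp
      have f3 : g n / (r^2) + a / r^2 = g (n+1) / r'^2 + g (n+1) / (r ^ 2*r' ^ 2) := by
        have : g n = g (n+1) - a := by linarith
        rw [this]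
        have : r' ^ 2 = r ^ 2 + 1 := by linarith
        rw [this]
        field_simp
        ring
      rw [← hrs'] 
      rw [← hrs] at ih ⊢
      nlinarith
  refine ⟨C + 3*C, fun N => (key N).trans ?_⟩
  have h1 : g N / (N + 1) ≤ C := by
    rw [div_le_iff₀ (by positivity)]
    refine (hgC N).trans (mul_le_mul_of_nonneg_left ?_ hC0)
    rw [sqrt_le_left (by positivity)]
    have : (0:ℝ) ≤ N := by positivity
    nlinarith
  have h2 : 0 ≤ 2 / sqrt (N + 1) := by positivity
  nlinarith

open ArithmeticFunction in
lemma mertens_log : ∃ C:ℝ, ∀ N:ℕ, 0 < N → |∑ p ∈ (Ioc 0 N).filter Nat.Prime, Real.log p*(p:ℝ)⁻¹ - Real.log N| ≤ C := by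
  obtain ⟨C1, h1⟩ := mertens_vonM
  obtain ⟨C2, h2⟩ := nonprime_vonM
  refine ⟨C1 + C2, fun N hN => ?_⟩
  have a1 := h1 N hN
  have a2 := h2 N
  have a3 : 0 ≤ ∑ d ∈ (Ioc 0 N).filter (fun n => ¬ n.Prime), vonMangoldt d*(d:ℝ)⁻¹ :=
    sum_nonneg fun d _ => mul_nonneg vonMangoldt_nonneg (by positivity)
  rw [← sum_filter_add_sum_filter_not _ Nat.Prime] at a1
  have e : ∑ p ∈ (Ioc 0 N).filter Nat.Prime, vonMangoldt p*(p:ℝ)⁻¹ = ∑ p ∈ (Ioc 0 N).filter Nat.Prime, Real.log p*(p:ℝ)⁻¹ :=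
    sum_congr rfl fun p hp => by rw [vonMangoldt_apply_prime (mem_filter.mp hp).2]
  rw [e] at a1
  rw [abs_le] at a1 ⊢
  constructor <;> linarith

lemma mertens_nat : ∃ C:ℝ, 0 < C ∧ ∀ N:ℕ, 2 ≤ N →
    |∑ p ∈ (Ioc 0 N).filter Nat.Prime, (p:ℝ)⁻¹ - Real.log (Real.log N)| ≤ C := by
  obtain ⟨C, hC⟩ := mertens_log
  have hC0 : 0 ≤ C := (abs_nonneg _).trans (hC 1 one_pos)
  set S:ℕ → ℝ := fun N => ∑ p ∈ (Ioc 0 N).filter Nat.Prime, (p:ℝ)⁻¹ with hS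
  set r:ℕ → ℝ := fun N => ∑ p ∈ (Ioc 0 N).filter Nat.Prime, Real.log p*(p:ℝ)⁻¹ - Real.log N with hr
  set D:ℕ → ℝ := fun N => S N - Real.log (Real.log N) - r N / Real.log N with hD
  have key : ∀ N:ℕ, 2 ≤ N → |D N - D 2| ≤ (1 + C)*(1 / Real.log 2 - 1 / Real.log N) := by
    intro N hN
    induction N, hN using Nat.le_induction with
    | base => simp
    | succ n hn ih =>
      have e1 : ∀ f:ℕ → ℝ, ∑ d ∈ (Ioc 0 (n+1)).filter Nat.Prime, f d =
         ∑ d ∈ (Ioc 0 n).filter Nat.Prime, f d + if (n+1).Prime then f (n+1) else 0 := by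
        intro f
        rw [sum_filter, sum_filter, sum_Ioc_succ_top (by omega)]
      have hn2 : (2:ℝ) ≤ n := mod_cast hn
      set l := Real.log n with hl
      set l' := Real.log ((n+1:ℕ):ℝ) with hl'
      have hl0 : 0 < l := log_pos (by linarith)
      have hll : l ≤ l' := log_le_log (by linarith) (by push_cast; linarith)
      have hl1 : l' - l ≤ 1 := by
        have h5 : Real.log (((n+1:ℕ):ℝ) / n) ≤ ((n+1:ℕ):ℝ) / n - 1 := log_le_sub_one_of_pos (by positivity)
        rw [log_div (by positivity) (by positivity)] at h5
        have : ((n+1:ℕ):ℝ) / n - 1 ≤ 1 := by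
          rw [tsub_le_iff_right, div_le_iff₀ (by linarith)]; push_cast; linarith
        linarith
      have hl0' : 0 < l' := by linarith
      have es : S (n+1) = S n + if (n+1).Prime then (((n+1:ℕ):ℝ))⁻¹ else 0 := e1 _
      have er : r (n+1) + l' = r n + l + l'*(if (n+1).Prime then (((n+1:ℕ):ℝ))⁻¹ else 0) := by
        have := e1 (fun p => Real.log p*(p:ℝ)⁻¹)
        simp only [hr]
        rw [this, ← hl, ← hl']; split_ifs <;> ring
      set a:ℝ := if (n+1).Prime then (((n+1:ℕ):ℝ))⁻¹ else 0
      have eD : D (n+1) - D n = (l' - l) / l' - (Real.log l' - Real.log l) + r n*(1 / l - 1 / l') := by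
        have hx : D (n+1) - D n = (S (n+1) - S n) - (Real.log l' - Real.log l) - r (n+1) / l' + r n / l := by simp only [hD]; ring
        rw [hx, es, show r (n+1) = r n + l + l'*a - l' by linarith]
        field_simp; ring
      have g1 : (l' - l) / l' ≤ Real.log l' - Real.log l := by
        have := log_le_sub_one_of_pos (show 0 < l / l' by positivity)
        rw [log_div hl0.ne' hl0'.ne'] at this
        have e : (l' - l) / l' = 1 - l / l' := by field_simp
        linarith
      have g2 : Real.log l' - Real.log l ≤ (l' - l) / l := by
        have := log_le_sub_one_of_pos (show 0 < l' / l by positivity)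
        rw [log_div hl0'.ne' hl0.ne'] at this
        have e : (l' - l) / l = l' / l - 1 := by field_simp
        linarith
      have g3 : (l' - l) / l - (l' - l) / l' ≤ 1 / l - 1 / l' := by
        have : (l' - l) / l - (l' - l) / l' = (l' - l)*(1 / l - 1 / l') := by field_simp
        rw [this]
        have : 0 ≤ 1 / l - 1 / l' := by rw [sub_nonneg]; exact one_div_le_one_div_of_le hl0 hll
        nlinarith
      have g0 : 0 ≤ 1 / l - 1 / l' := by rw [sub_nonneg]; exact one_div_le_one_div_of_le hl0 hll
      have g4 : |r n*(1 / l - 1 / l')| ≤ C*(1 / l - 1 / l') := by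
        rw [abs_mul, abs_of_nonneg g0]
        exact mul_le_mul_of_nonneg_right (hC n (by omega)) g0
      have g5 : |D (n+1) - D n| ≤ (1 + C)*(1 / l - 1 / l') := by
        rw [eD]; rw [abs_le] at g4 ⊢
        constructor <;> linarith
      have : D (n+1) - D 2 = (D (n+1) - D n) + (D n - D 2) := by ring
      rw [this]
      refine (abs_add_le _ _).trans ?_
      linarith
  have hl2 : 0 < Real.log 2 := log_pos (by norm_num)
  refine ⟨(1 + C)*(1 / Real.log 2) + |D 2| + C / Real.log 2 + 1, by positivity, fun N hN => ?_⟩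
  have hk := key N hN
  have hN2 : (2:ℝ) ≤ N := mod_cast hN
  have hlN : Real.log 2 ≤ Real.log N := log_le_log (by norm_num) hN2
  have e : S N - Real.log (Real.log N) = (D N - D 2) + D 2 + r N / Real.log N := by simp only [hD]; ring
  show |S N - Real.log (Real.log N)| ≤ _
  rw [e]
  have h1 : |r N / Real.log N| ≤ C / Real.log 2 := by
    rw [abs_div, abs_of_pos (show 0 < Real.log N by linarith)]
    exact div_le_div₀ hC0 (hC N (by omega)) hl2 hlN
  have h2 : (1 + C)*(1 / Real.log 2 - 1 / Real.log N) ≤ (1 + C)*(1 / Real.log 2) := by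
    refine mul_le_mul_of_nonneg_left ?_ (by linarith)
    have : 0 ≤ 1 / Real.log N := by positivity
    linarith
  have := abs_add_le (D N - D 2 + D 2) (r N / Real.log N)
  have := abs_add_le (D N - D 2) (D 2)
  linarith

/-- the primes in `(e^y, e^z]` -/
noncomputable def prI (y z:ℝ) : Finset ℕ := (Ioc ⌊exp y⌋₊ ⌊exp z⌋₊).filter Nat.Prime

lemma mem_prI {y z:ℝ} {p:ℕ} : p ∈ prI y z ↔ p.Prime ∧ exp y < p ∧ (p:ℝ) ≤ exp z := by
  unfold prI
  rw [mem_filter, mem_Ioc, Nat.floor_lt (exp_pos _).le, Nat.le_floor_iff (exp_pos _).le]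
  tauto

lemma mertens_prI : ∃ C:ℝ, 0 < C ∧ ∀ y z:ℝ, 1 ≤ y → y ≤ z →
    |∑ p ∈ prI y z, (p:ℝ)⁻¹ - Real.log (z / y)| ≤ C := by
  obtain ⟨C, hC0, hC⟩ := mertens_nat
  refine ⟨2*C + 2, by linarith, fun y z hy hyz => ?_⟩
  have hfl : ∀ w:ℝ, 1 ≤ w → 2 ≤ ⌊exp w⌋₊ ∧ |Real.log (Real.log (⌊exp w⌋₊:ℝ)) - Real.log w| ≤ 1 := by
    intro w hw
    have h1 : (2.7:ℝ) ≤ exp w := by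
      have := exp_one_gt_d9; have := exp_le_exp.mpr hw; linarith
    have h2 : 2 ≤ ⌊exp w⌋₊ := Nat.le_floor (by norm_num; linarith)
    refine ⟨h2, ?_⟩
    have h2' : (2:ℝ) ≤ (⌊exp w⌋₊:ℝ) := mod_cast h2
    set N:ℝ := (⌊exp w⌋₊:ℝ)
    have h3 : N ≤ exp w := Nat.floor_le (exp_pos _).le
    have h4 : exp w < N + 1 := Nat.lt_floor_add_one _
    have l1 : Real.log N ≤ w := by rw [log_le_iff_le_exp (by linarith)]; exact h3
    have l2 : w / 2 ≤ Real.log N := by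
      rw [le_log_iff_exp_le (by linarith)]
      have : exp (w / 2) ^ 2 = exp w := by rw [← exp_nat_mul]; congr 1; push_cast; ring
      nlinarith [exp_pos (w/2)]
    have lp : 0 < Real.log N := by linarith
    have m1 : Real.log (Real.log N) ≤ Real.log w := log_le_log lp l1
    have m2 : Real.log (w / 2) ≤ Real.log (Real.log N) := log_le_log (by linarith) l2
    rw [log_div (by linarith) (by norm_num)] at m2
    have : Real.log 2 ≤ 1 := by linarith [log_two_lt_d9]
    rw [abs_le]; constructor <;> linarith
  have hz : 1 ≤ z := hy.trans hyz
  obtain ⟨a1, a2⟩ := hfl y hy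
  obtain ⟨b1, b2⟩ := hfl z hz
  have c1 := hC _ a1
  have c2 := hC _ b1
  have hle : ⌊exp y⌋₊ ≤ ⌊exp z⌋₊ := Nat.floor_le_floor (exp_le_exp.mpr hyz)
  have e : ∑ p ∈ (Ioc 0 ⌊exp z⌋₊).filter Nat.Prime, (p:ℝ)⁻¹ =
     ∑ p ∈ (Ioc 0 ⌊exp y⌋₊).filter Nat.Prime, (p:ℝ)⁻¹ + ∑ p ∈ prI y z, (p:ℝ)⁻¹ := by
    unfold prI
    rw [sum_filter, sum_filter, sum_filter, sum_Ioc_consecutive _ (Nat.zero_le _) hle]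
  rw [e] at c2
  rw [log_div (by linarith) (by linarith)]
  rw [abs_le] at *
  constructor <;> linarith

noncomputable def Rf : List ℕ → ℕ → ℝ → ℝ
  | [], s, x => (x ^ s)⁻¹
  | h :: hs, s, x => Rf hs s x - Rf hs s (x + h)

noncomputable def Lf : List ℕ → ℝ → ℝ
  | [], x => log x
  | h :: hs, x => Lf hs (x + h) - Lf hs x

lemma Rf_deriv (hs : List ℕ) (s:ℕ) : ∀ x:ℝ, 0 < x → HasDerivAt (Rf hs s) (-(s:ℝ)*Rf hs (s+1) x) x := by
  induction hs with
  | nil =>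
    intro x hx
    have h := (hasDerivAt_pow s x).inv (pow_ne_zero s hx.ne')
    refine HasDerivAt.congr_deriv (f := Rf [] s) h ?_
    simp only [Rf]
    rcases Nat.eq_zero_or_pos s with h0 | h0
    · subst h0; simp
    · have e : x ^ s = x ^ (s-1)*x := by rw [← pow_succ]; congr 1; omega
      have e2 : x ^ (s+1) = x^(s-1)*x ^ 2 := by rw [← pow_add]; congr 1; omega
      rw [e, e2]; field_simp
  | cons h hs ih =>
    intro x hx
    have h1 := ih x hx
    have h2 := (ih (x + h) (by positivity)).comp_add_const x (h:ℝ)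
    refine HasDerivAt.congr_deriv (f := Rf (h :: hs) s) (h1.sub h2) ?_
    simp only [Rf]; ring

lemma Lf_deriv (hs : List ℕ) : ∀ x:ℝ, 0 < x → HasDerivAt (Lf hs) ((-1) ^ hs.length*Rf hs 1 x) x := by
  induction hs with
  | nil =>
    intro x hx
    refine HasDerivAt.congr_deriv (f := Lf []) (hasDerivAt_log hx.ne') ?_
    simp [Rf]
  | cons h hs ih =>
    intro x hx
    have h1 := ih x hx
    have h2 := (ih (x + h) (by positivity)).comp_add_const x (h:ℝ)
    refine HasDerivAt.congr_deriv (f := Lf (h :: hs)) (h2.sub h1) ?_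
    simp only [Rf, List.length_cons, pow_succ]; ring

lemma Rf_mean (hs : List ℕ) (hpos : ∀ h ∈ hs, 1 ≤ h) (s:ℕ) (x:ℝ) (hx : 0 < x) :
    ∃ ξ:ℝ, x ≤ ξ ∧ ξ ≤ x + hs.sum ∧ Rf hs s x = hs.prod*s.ascFactorial hs.length*(ξ ^ (s + hs.length))⁻¹ := by
  induction hs generalizing s x with
  | nil => exact ⟨x, le_rfl, by simp, by simp [Rf]⟩
  | cons h hs ih =>
    have hh : (1:ℝ) ≤ h := mod_cast hpos h (by simp)
    have hlt : x < x + h := by linarith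
    obtain ⟨c, hc, he⟩ := exists_hasDerivAt_eq_slope (Rf hs s) (fun y => -(s:ℝ)*Rf hs (s+1) y) hlt
      (fun y hy => (Rf_deriv hs s y (hx.trans_le hy.1)).continuousAt.continuousWithinAt)
      (fun y hy => Rf_deriv hs s y (hx.trans hy.1))
    obtain ⟨ξ, h1, h2, h3⟩ := ih (fun k hk => hpos k (by simp [hk])) (s+1) c (hx.trans hc.1)
    refine ⟨ξ, by linarith [hc.1], ?_, ?_⟩
    · rw [List.sum_cons, Nat.cast_add]; linarith [hc.2]
    · have e : Rf (h :: hs) s x = h*(s*Rf hs (s+1) c) := by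
        simp only [Rf]
        rw [eq_div_iff (by linarith)] at he
        linarith
      rw [e, h3]
      have e2 : (s:ℝ)*(s+1).ascFactorial hs.length = s.ascFactorial (hs.length + 1) := by
        have := Nat.succ_ascFactorial s hs.length
        rw [Nat.ascFactorial_succ]; exact_mod_cast this
      simp only [List.prod_cons, List.length_cons]
      rw [← e2, Nat.cast_mul]
      rw [show s + 1 + hs.length = s + (hs.length + 1) by ring]; ring

lemma Lf_diff (hs : List ℕ) (hpos : ∀ h ∈ hs, 1 ≤ h) (h:ℕ) (hh : 1 ≤ h) (x:ℝ) (hx : 0 < x) :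
    ∃ ξ:ℝ, x ≤ ξ ∧ ξ ≤ x + h + hs.sum ∧ |Lf (h :: hs) x| = h*(hs.prod*hs.length.factorial*(ξ ^ (hs.length + 1))⁻¹) := by
  have hh' : (1:ℝ) ≤ h := mod_cast hh
  have hlt : x < x + h := by linarith
  obtain ⟨c, hc, he⟩ := exists_hasDerivAt_eq_slope (Lf hs) (fun y => (-1) ^ hs.length*Rf hs 1 y) hlt
      (fun y hy => (Lf_deriv hs y (hx.trans_le hy.1)).continuousAt.continuousWithinAt)
      (fun y hy => Lf_deriv hs y (hx.trans hy.1))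
  obtain ⟨ξ, h1, h2, h3⟩ := Rf_mean hs hpos 1 c (hx.trans hc.1)
  refine ⟨ξ, by linarith [hc.1], by linarith [hc.2], ?_⟩
  have e : Lf (h :: hs) x = (-1) ^ hs.length*(h*Rf hs 1 c) := by
    simp only [Lf]
    rw [eq_div_iff (by linarith)] at he
    linarith
  have hξ : 0 < ξ := by linarith [hc.1]
  rw [e, h3, abs_mul, abs_pow, abs_neg, abs_one, one_pow, one_mul, Nat.one_ascFactorial, abs_of_nonneg (by positivity), add_comm 1]

/-- Kusmin–Landau type estimate -/
lemma kusmin (g:ℕ → ℝ) (M:ℕ) {θ C:ℝ} (hθ : 0 < θ) (hC : 0 ≤ C)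
    (h1 : ∀ n ≤ M, θ ≤ |g (n+1) - g n|) (h2 : ∀ n ≤ M, |g (n+1) - g n| ≤ 1)
    (h3 : ∀ n < M, |g (n+2) - g (n+1) - (g (n+1) - g n)| * M ≤ C*θ) :
    ‖∑ n ∈ range M, cexp ((g n:ℝ)*I)‖ ≤ (4 + 4*C) / θ := by
  set D:ℕ → ℝ := fun n => g (n+1) - g n with hD
  set z:ℕ → ℂ := fun n => cexp ((g n:ℝ)*I) with hz
  set w:ℕ → ℂ := fun n => (cexp ((D n:ℝ)*I) - 1)⁻¹ with hw
  have hz1 : ∀ n, ‖z n‖ = 1 := fun n => norm_exp_ofReal_mul_I _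
  have low : ∀ n ≤ M, θ / 2 ≤ ‖cexp ((D n:ℝ)*I) - 1‖ := by
    intro n hn
    rw [mul_comm, norm_exp_I_mul_ofReal_sub_one, norm_eq_abs, abs_mul, abs_two]
    have a1 := h1 n hn
    have a2 := h2 n hn
    change θ ≤ |D n| at a1
    change |D n| ≤ 1 at a2
    have e : |sin (D n / 2)| = sin (|D n| / 2) := by
      rcases abs_cases (D n) with ⟨h, h'⟩ | ⟨h, h'⟩
      · rw [h, abs_of_nonneg]; apply sin_nonneg_of_nonneg_of_le_pi (by linarith); linarith [pi_gt_three]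
      · rw [h, neg_div, sin_neg, abs_of_nonpos]
        apply sin_nonpos_of_nonpos_of_neg_pi_le (by linarith); linarith [pi_gt_three]
    rw [e]
    have := mul_le_sin (x := |D n| / 2) (by positivity) (by linarith [pi_gt_three])
    have hp : 1 / 4 ≤ 1 / Real.pi := one_div_le_one_div_of_le pi_pos pi_le_four
    have : |D n| / Real.pi ≤ sin (|D n| / 2) := by
      refine le_trans (le_of_eq ?_) this; ring
    have : |D n| * (1 / 4) ≤ |D n| / Real.pi := by
      exact (mul_le_mul_of_nonneg_left hp (abs_nonneg (D n))).trans (le_of_eq (by ring))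
    linarith
  have hne : ∀ n ≤ M, cexp ((D n:ℝ)*I) - 1 ≠ 0 := by
    intro n hn h
    have := low n hn; rw [h, norm_zero] at this; linarith
  have hwn : ∀ n ≤ M, ‖w n‖ ≤ 2 / θ := by
    intro n hn
    rw [hw]; simp only [norm_inv]
    rw [inv_le_comm₀ (lt_of_lt_of_le (by linarith) (low n hn)) (by positivity), inv_div]
    exact low n hn
  have hzz : ∀ n ≤ M, z n = (z (n+1) - z n)*w n := by
    intro n hn
    have : z (n+1) = z n*cexp ((D n:ℝ)*I) := by
      simp only [hz, hD, ← Complex.exp_add]; congr 1; push_cast; ring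
    rw [this, hw]
    have := hne n hn
    field_simp
  have hww : ∀ n < M, ‖w (n+1) - w n‖*M ≤ 4*C / θ := by
    intro n hn
    have e : w (n+1) - w n = (cexp ((D n:ℝ)*I) - cexp ((D (n+1):ℝ)*I))*w n*w (n+1) := by
      have a1 := hne n hn.le
      have a2 := hne (n+1) hn
      have gen : ∀ a b:ℂ, a - 1 ≠ 0 → b - 1 ≠ 0 → (b-1)⁻¹ - (a-1)⁻¹ = (a - b)*(a-1)⁻¹*(b-1)⁻¹ := by
        intro a b ha hb; field_simp; ring
      exact gen _ _ a1 a2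
    have a3 : ‖cexp ((D n:ℝ)*I) - cexp ((D (n+1):ℝ)*I)‖ ≤ |D (n+1) - D n| := by
      have : cexp ((D n:ℝ)*I) - cexp ((D (n+1):ℝ)*I) = -(cexp ((D n:ℝ)*I)*(cexp (I*((D (n+1) - D n:ℝ))) - 1)) := by
        rw [mul_sub, ← Complex.exp_add, mul_one, neg_sub]; congr 2; push_cast; ring
      rw [this, norm_neg, norm_mul, norm_exp_ofReal_mul_I, one_mul]
      exact norm_exp_I_mul_ofReal_sub_one_le
    rw [e, norm_mul, norm_mul]
    have a4 := hwn n hn.le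
    have a5 := hwn (n+1) hn
    have a6 := h3 n hn
    calc _ ≤ |D (n+1) - D n| * (2 / θ)*(2 / θ)*M := by gcongr
      _ = (|D (n+1) - D n| * M)*(4 / θ ^ 2) := by field_simp; ring
      _ ≤ (C*θ)*(4 / θ ^ 2) := mul_le_mul_of_nonneg_right a6 (by positivity)
      _ = _ := by field_simp
  have abel : ∀ m ≤ M, ∑ n ∈ range m, z n = z m*w m - z 0*w 0 - ∑ n ∈ range m, z (n+1)*(w (n+1) - w n) := by
    intro m hm
    induction m with
    | zero => simp
    | succ m ih =>
      rw [sum_range_succ, sum_range_succ, ih (by omega)]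
      have := hzz m (by omega)
      linear_combination this
  show ‖∑ n ∈ range M, z n‖ ≤ _
  rw [abel M le_rfl]
  have b1 : ‖z M*w M‖ ≤ 2 / θ := by rw [norm_mul, hz1, one_mul]; exact hwn M le_rfl
  have b2 : ‖z 0*w 0‖ ≤ 2 / θ := by rw [norm_mul, hz1, one_mul]; exact hwn 0 (Nat.zero_le _)
  have b3 : ‖∑ n ∈ range M, z (n+1)*(w (n+1) - w n)‖ ≤ 4*C / θ := by
    rcases Nat.eq_zero_or_pos M with h | h
    · subst h; simp; positivity
    have hM : (0:ℝ) < M := mod_cast h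
    refine (norm_sum_le _ _).trans ?_
    calc _ ≤ ∑ n ∈ range M, (4*C / θ) / M := sum_le_sum fun n hn => by
          rw [norm_mul, hz1, one_mul, le_div_iff₀ hM]; exact hww n (mem_range.mp hn)
      _ = _ := by rw [sum_const, card_range, nsmul_eq_mul]; field_simp
  have := norm_sub_le (z M*w M - z 0*w 0) (∑ n ∈ range M, z (n+1)*(w (n+1) - w n))
  have := norm_sub_le (z M*w M) (z 0*w 0)
  have e : (4 + 4*C) / θ = 2 / θ + 2 / θ + 4*C / θ := by ring
  rw [e]; linarith

lemma sum_sqrt_aux (h n:ℕ) : ∑ k ∈ range n, sqrt (1 / ((k - h:ℕ):ℝ)) ≤ 2*sqrt ((n - 1 - h:ℕ):ℝ) := by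
  induction n with
  | zero => simp
  | succ n ih =>
    rw [sum_range_succ]
    rcases Nat.eq_zero_or_pos (n - h) with h0 | h0
    · rw [h0, Nat.cast_zero, div_zero, sqrt_zero, add_zero]; refine ih.trans ?_
      gcongr; omega
    · obtain ⟨k, hk⟩ : ∃ k, n - h = k + 1 := ⟨n - h - 1, by omega⟩
      have e1 : n - 1 - h = k := by omega
      have e2 : n + 1 - 1 - h = k + 1 := by omega
      rw [e1] at ih; rw [hk, e2]
      have : sqrt (1 / ((k+1:ℕ):ℝ)) ≤ 2*(sqrt ((k+1:ℕ):ℝ) - sqrt k) := by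
        have p : 0 < sqrt ((k+1:ℕ):ℝ) := sqrt_pos.mpr (by positivity)
        rw [sqrt_div zero_le_one, sqrt_one, div_le_iff₀ p]
        have q1 := sq_sqrt (show (0:ℝ) ≤ ((k+1:ℕ):ℝ) by positivity)
        have q2 := sq_sqrt (show (0:ℝ) ≤ (k:ℝ) by positivity)
        push_cast at *
        nlinarith [sq_nonneg (sqrt ((k:ℝ)+1) - sqrt k)]
      linarith

lemma sum_sqrt_aux2 (h H:ℕ) : ∑ k ∈ range H, sqrt ((H:ℝ) / ((k - h:ℕ):ℝ)) ≤ 2*H := by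
  have e : ∀ k, sqrt ((H:ℝ) / ((k - h:ℕ):ℝ)) = sqrt H*sqrt (1 / ((k - h:ℕ):ℝ)) := by
    intro k; rw [← sqrt_mul (by positivity)]; congr 1; ring
  simp_rw [e, ← mul_sum]
  calc _ ≤ sqrt H*(2*sqrt ((H - 1 - h:ℕ):ℝ)) := by gcongr; exact sum_sqrt_aux h H
    _ ≤ sqrt H*(2*sqrt H) := by gcongr; omega
    _ = _ := by have := mul_self_sqrt (show (0:ℝ) ≤ H by positivity); linarith

lemma shift_sum (z:ℕ → ℂ) (hz : ∀ n, ‖z n‖ ≤ 1) (M h:ℕ) :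
    ‖∑ n ∈ range M, z n - ∑ n ∈ range M, z (n + h)‖ ≤ 2*h := by
  induction h with
  | zero => simp
  | succ h ih =>
    have e : ∑ n ∈ range M, z (n + h) - ∑ n ∈ range M, z (n + (h+1)) = z h - z (M + h) := by
      have := sum_range_sub' (fun n => z (n + h)) M
      rw [← sum_sub_distrib]; rw [zero_add] at this; rw [← this]
      refine sum_congr rfl fun n _ => ?_
      rw [show n + (h+1) = n + 1 + h by ring]
    have : ∑ n ∈ range M, z n - ∑ n ∈ range M, z (n + (h+1)) = (∑ n ∈ range M, z n - ∑ n ∈ range M, z (n + h)) + (z h - z (M + h)) := by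
      rw [← e]; ring
    rw [this]
    have := norm_add_le (∑ n ∈ range M, z n - ∑ n ∈ range M, z (n + h)) (z h - z (M + h))
    have := norm_sub_le (z h) (z (M+h))
    have := hz h; have := hz (M+h)
    push_cast; linarith

lemma vdc (z:ℕ → ℂ) (hz : ∀ n, ‖z n‖ ≤ 1) (M H:ℕ) (N a b:ℝ) (hM : (M:ℝ) ≤ N) (hH : 1 ≤ H)
    (ha : 0 ≤ a) (hb : 0 ≤ b)
    (hyp : ∀ h' d:ℕ, 1 ≤ d → h' + d < H → ‖∑ n ∈ range M, z (n + (h' + d))*star (z (n + h'))‖ ≤ N*(a + b*sqrt ((H:ℝ) / d))) :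
    ‖∑ n ∈ range M, z n‖ ≤ H + N*sqrt (1 / H + a + 4*b) := by
  have hN : 0 ≤ N := (Nat.cast_nonneg M).trans hM
  have hH0 : (0:ℝ) < H := mod_cast hH
  set g:ℕ → ℝ := fun k => sqrt ((H:ℝ) / k) with hg
  have g0 : ∀ k, 0 ≤ g k := fun k => sqrt_nonneg _
  have pair : ∀ h ∈ range H, ∀ h' ∈ range H,
      ‖∑ n ∈ range M, z (n + h)*star (z (n + h'))‖ ≤ N*((if h = h' then 1 else 0) + a + b*(g (h - h') + g (h' - h))) := by
    intro h hh h' hh'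
    rw [mem_range] at hh hh'
    rcases lt_trichotomy h h' with hlt | heq | hgt
    · have := hyp h (h' - h) (by omega) (by omega)
      rw [show h + (h' - h) = h' by omega] at this
      rw [← norm_star, star_sum]
      simp only [star_mul', star_star]
      rw [sum_congr rfl (fun n _ => mul_comm _ _)]
      refine this.trans ?_
      rw [if_neg hlt.ne, zero_add]
      have := g0 (h - h')
      gcongr N*(a + b*?_)
      show g (h' - h) ≤ _
      linarith
    · subst heq
      rw [if_pos rfl]
      refine (norm_sum_le _ _).trans ?_
      have : ∑ n ∈ range M, ‖z (n + h)*star (z (n + h))‖ ≤ ∑ n ∈ range M, (1:ℝ) := sum_le_sum fun n _ => by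
        rw [norm_mul, norm_star]; nlinarith [hz (n+h), norm_nonneg (z (n+h))]
      refine this.trans ?_
      have := g0 (h - h)
      simp only [sum_const, card_range, nsmul_eq_mul, mul_one]
      calc (M:ℝ) ≤ N*1 := by linarith
        _ ≤ _ := by gcongr; have : 0 ≤ b*(g (h-h) + g (h-h)) := by positivity
                    linarith
    · have := hyp h' (h - h') (by omega) (by omega)
      rw [show h' + (h - h') = h by omega] at this
      refine this.trans ?_
      rw [if_neg hgt.ne', zero_add]
      have := g0 (h' - h)
      gcongr N*(a + b*?_)
      show g (h - h') ≤ _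
      linarith
  -- the averaged sum
  set T:ℂ := ∑ n ∈ range M, ∑ h ∈ range H, z (n + h) with hT
  have sq : ‖T‖ ^ 2 ≤ (N*H) ^ 2*(1 / H + a + 4*b) := by
    have c1 : ‖T‖ ^ 2 ≤ M*∑ n ∈ range M, ‖∑ h ∈ range H, z (n + h)‖ ^ 2 := by
      have c := (pow_le_pow_left₀ (norm_nonneg T) (norm_sum_le (range M) (fun n => ∑ h ∈ range H, z (n + h))) 2)
      refine c.trans ?_
      have := sq_sum_le_card_mul_sum_sq (s := range M) (f := fun n => ‖∑ h ∈ range H, z (n + h)‖)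
      rwa [card_range] at this
    have c2 : ((∑ n ∈ range M, ‖∑ h ∈ range H, z (n + h)‖ ^ 2:ℝ):ℂ) = ∑ h ∈ range H, ∑ h' ∈ range H, ∑ n ∈ range M, z (n + h)*star (z (n + h')) := by
      push_cast
      have : ∀ n, ((‖∑ h ∈ range H, z (n + h)‖ : ℝ):ℂ) ^ 2 = ∑ h ∈ range H, ∑ h' ∈ range H, z (n + h)*star (z (n + h')) := by
        intro n
        rw [← mul_conj', ← sum_mul_sum, map_sum]; rfl
      simp_rw [this]
      rw [sum_comm]
      refine sum_congr rfl fun h _ => sum_comm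
    have c3 : ∑ n ∈ range M, ‖∑ h ∈ range H, z (n + h)‖ ^ 2 ≤ N*(H ^ 2*(1 / H + a + 4*b)) := by
      have : ∑ n ∈ range M, ‖∑ h ∈ range H, z (n + h)‖ ^ 2 = ‖((∑ n ∈ range M, ‖∑ h ∈ range H, z (n + h)‖ ^ 2:ℝ):ℂ)‖ := by
        rw [norm_real, norm_of_nonneg (sum_nonneg fun _ _ => by positivity)]
      rw [this, c2]
      calc _ ≤ ∑ h ∈ range H, ∑ h' ∈ range H, N*((if h = h' then 1 else 0) + a + b*(g (h - h') + g (h' - h))) := by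
            refine (norm_sum_le _ _).trans (sum_le_sum fun h hh => (norm_sum_le _ _).trans (sum_le_sum fun h' hh' => pair h hh h' hh'))
        _ = N*(H + H*(H*a) + b*(∑ h ∈ range H, ∑ h' ∈ range H, g (h - h') + ∑ h ∈ range H, ∑ h' ∈ range H, g (h' - h))) := by
            simp_rw [← mul_sum, sum_add_distrib, ← mul_sum, sum_add_distrib]
            congr 1
            congr 1
            congr 1
            · rw [sum_congr rfl (g := fun _ => (1:ℝ))]
              · simp
              · intro h hh; rw [sum_ite_eq, if_pos hh]
            · simp
        _ ≤ N*(H + H*(H*a) + b*(H*(2*H) + H*(2*H))) := by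
            have k1 : ∑ h ∈ range H, ∑ h' ∈ range H, g (h' - h) ≤ H*(2*H) := by
              calc _ ≤ ∑ h ∈ range H, (2*H:ℝ) := sum_le_sum fun h _ => sum_sqrt_aux2 h H
                _ = _ := by simp
            have k2 : ∑ h ∈ range H, ∑ h' ∈ range H, g (h - h') ≤ H*(2*H) := by
              rw [sum_comm]; exact k1
            gcongr
        _ = _ := by field_simp; ring
    calc ‖T‖ ^ 2 ≤ M*(N*(H ^ 2*(1 / H + a + 4*b))) := c1.trans (by gcongr)
      _ ≤ N*(N*(H ^ 2*(1 / H + a + 4*b))) := by gcongr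
      _ = _ := by ring
  have hTn : ‖T‖ ≤ N*H*sqrt (1 / H + a + 4*b) := by
    have := sqrt_le_sqrt sq
    rwa [sqrt_sq (norm_nonneg _), sqrt_mul (by positivity), sqrt_sq (by positivity)] at this
  have diff : ‖(H:ℂ)*∑ n ∈ range M, z n - T‖ ≤ H*H := by
    have : (H:ℂ)*∑ n ∈ range M, z n - T = ∑ h ∈ range H, (∑ n ∈ range M, z n - ∑ n ∈ range M, z (n + h)) := by
      rw [sum_sub_distrib, hT, sum_comm]; simp
    rw [this]
    refine (norm_sum_le _ _).trans ((sum_le_sum fun h _ => shift_sum z hz M h).trans ?_)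
    rw [← mul_sum]
    have := sum_range_id_mul_two H
    have e : (∑ i ∈ range H, (i:ℝ))*2 = H*((H - 1:ℕ):ℝ) := by rw [← Nat.cast_mul, ← this]; push_cast; ring
    have : ((H - 1:ℕ):ℝ) ≤ H := mod_cast Nat.sub_le H 1
    nlinarith
  have fin : (H:ℝ)*‖∑ n ∈ range M, z n‖ ≤ H*(H + N*sqrt (1 / H + a + 4*b)) := by
    have e : (H:ℝ)*‖∑ n ∈ range M, z n‖ = ‖((H:ℂ)*∑ n ∈ range M, z n - T) + T‖ := by
      rw [sub_add_cancel, norm_mul, Complex.norm_natCast]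
    rw [e]
    refine (norm_add_le _ _).trans ?_
    nlinarith
  exact le_of_mul_le_mul_left fin hH0

noncomputable def Ck (k:ℕ):ℝ := (4 + 4*((k + 1)*6 ^ (k+1)))*6 ^ (k+1)

lemma Ck_pos (k:ℕ) : 0 < Ck k := by unfold Ck; positivity

lemma prod_le_pow' (hs : List ℕ) (H:ℕ) (h : ∀ x ∈ hs, x ≤ H) : hs.prod ≤ H ^ hs.length := by
  exact List.prod_le_pow_card hs H h

lemma weyl_base (k:ℕ) (N u:ℝ) (H:ℕ) (hH : 1 ≤ H) (hN : 1 ≤ N) (hkH : 2*k*(H:ℝ) ≤ N) (hu : u ≠ 0)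
    (hu2 : |u| * H ^ k*k.factorial ≤ N ^ (k+1)) (hs : List ℕ) (hlen : hs.length = k)
    (hpos : ∀ h ∈ hs, 1 ≤ h) (hle : ∀ h ∈ hs, h ≤ H) (x0:ℝ) (hx : N ≤ x0) (hx2 : x0 ≤ 2*N + k*H) (M:ℕ) (hM : (M:ℝ) ≤ N) :
    ‖∑ n ∈ range M, ph u (Lf hs (x0 + n))‖ ≤ N*(Ck k*N ^ k / |u| / hs.prod) := by
  have hu' : 0 < |u| := abs_pos.mpr hu
  have hprod : 1 ≤ hs.prod := List.one_le_prod hpos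
  have hprod' : (1:ℝ) ≤ (hs.prod:ℕ) := mod_cast hprod
  have hpH : ((hs.prod:ℕ):ℝ) ≤ H ^ k := by rw [← hlen]; exact_mod_cast prod_le_pow' hs H hle
  have hsum : ((hs.sum:ℕ):ℝ) ≤ k*H := by
    have := List.sum_le_card_nsmul hs H hle
    rw [hlen, smul_eq_mul] at this; exact_mod_cast this
  have hx00 : 0 < x0 := by linarith
  have hf : (1:ℝ) ≤ k.factorial := mod_cast k.factorial_pos
  set P:ℝ := ((hs.prod:ℕ):ℝ) with hP
  set θ:ℝ := |u| * (P*k.factorial / (6*N) ^ (k+1)) with hθ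
  have hθ0 : 0 < θ := by positivity
  have hd1 : ∀ n:ℕ, (fun n:ℕ => -(u*Lf hs (x0 + n))) (n+1) - (fun n:ℕ => -(u*Lf hs (x0 + n))) n = -(u*Lf (1 :: hs) (x0 + n)) := by
    intro n; simp only [Lf]; push_cast; ring_nf
  have key := kusmin (fun n => -(u*Lf hs (x0 + n))) M (θ := θ) (C := (k+1)*6 ^ (k+1)) hθ0 (by positivity) ?_ ?_ ?_
  · have e : ∑ n ∈ range M, ph u (Lf hs (x0 + n)) = ∑ n ∈ range M, cexp (((fun n:ℕ => -(u*Lf hs (x0 + n))) n:ℝ)*I) := by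
      refine sum_congr rfl fun n _ => ?_
      simp only [ph]; push_cast; rfl
    rw [e]
    refine key.trans ?_
    have : (4 + 4*(((k:ℝ)+1)*6 ^ (k+1))) / θ = N*(Ck k*N ^ k / |u| / P) / k.factorial := by
      rw [hθ, Ck, mul_pow]; field_simp; ring
    rw [this]
    have := Ck_pos k
    exact div_le_self (by positivity) hf
  · intro n hn
    rw [hd1, abs_neg, abs_mul]
    obtain ⟨ξ, h1, h2, h3⟩ := Lf_diff hs hpos 1 le_rfl (x0 + n) (by positivity)
    rw [h3, hlen, Nat.cast_one, one_mul]
    have hn' : (n:ℝ) ≤ N := le_trans (mod_cast hn) hM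
    have hξ : 0 < ξ := by linarith [Nat.cast_nonneg (α := ℝ) n]
    have : ξ ≤ 6*N := by rw [Nat.cast_one] at h2; linarith
    rw [hθ, div_eq_mul_inv]
    gcongr
  · intro n hn
    rw [hd1, abs_neg, abs_mul]
    obtain ⟨ξ, h1, h2, h3⟩ := Lf_diff hs hpos 1 le_rfl (x0 + n) (by positivity)
    rw [h3, hlen, Nat.cast_one, one_mul]
    have hξ : N ≤ ξ := by linarith [Nat.cast_nonneg (α := ℝ) n]
    have hξ0 : 0 < ξ := by linarith
    calc _ ≤ |u| * (H ^ k*k.factorial*(N ^ (k+1))⁻¹) := by gcongr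
      _ = (|u| * H ^ k*k.factorial) / N ^ (k+1) := by ring
      _ ≤ 1 := by rw [div_le_one (by positivity)]; exact hu2
  · intro n hn
    have e := hd1 (n+1)
    rw [show n + 2 = n + 1 + 1 by ring, e, hd1]
    have e2 : -(u*Lf (1 :: hs) (x0 + (n+1:ℕ))) - -(u*Lf (1 :: hs) (x0 + n)) = -(u*Lf (1 :: 1 :: hs) (x0 + n)) := by
      conv_rhs => rw [Lf]
      push_cast; ring_nf
    rw [e2, abs_neg, abs_mul]
    obtain ⟨ξ, h1, h2, h3⟩ := Lf_diff (1 :: hs) (by simpa using hpos) 1 le_rfl (x0 + n) (by positivity)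
    rw [h3, List.prod_cons, List.length_cons, hlen, Nat.cast_one, one_mul, one_mul]
    have hξ : N ≤ ξ := by linarith [Nat.cast_nonneg (α := ℝ) n]
    calc _ ≤ |u| * (P*(k+1).factorial*(N ^ (k+1+1))⁻¹)*N := by gcongr
      _ = (k+1)*6 ^ (k+1)*θ := by
        rw [hθ, Nat.factorial_succ, mul_pow]; push_cast; field_simp; ring

lemma weyl_step (k:ℕ) (N u:ℝ) (H:ℕ) (hH : 1 ≤ H) (hN : 1 ≤ N) (hHN : (H:ℝ) ^ 2 ≤ N) (hkH : 2*k*(H:ℝ) ≤ N) (hu : u ≠ 0)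
    (hu2 : |u| * H ^ k*k.factorial ≤ N ^ (k+1)) (j:ℕ) : ∀ (hs : List ℕ), hs.length + j = k →
    (∀ h ∈ hs, 1 ≤ h) → (∀ h ∈ hs, h ≤ H) → ∀ x0:ℝ, N ≤ x0 → x0 ≤ 2*N + hs.length*H → ∀ M:ℕ, (M:ℝ) ≤ N →
    ‖∑ n ∈ range M, ph u (Lf hs (x0 + n))‖ ≤ N*(9*((H:ℝ)⁻¹) ^ ((1/2:ℝ)^j) + 8*(Ck k*N ^ k / |u| / H ^ j / hs.prod) ^ ((1/2:ℝ)^(j+1))) := by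
  have hH0 : (0:ℝ) < H := mod_cast hH
  have hC := Ck_pos k
  have hu' : 0 < |u| := abs_pos.mpr hu
  induction j with
  | zero =>
    intro hs hl hpos hle x0 hx hx2 M hM
    simp only [add_zero] at hl
    have hprod : (1:ℝ) ≤ (hs.prod:ℕ) := mod_cast List.one_le_prod hpos
    have b := weyl_base k N u H hH hN hkH hu hu2 hs hl hpos hle x0 hx (by rwa [hl] at hx2) M hM
    have tr : ‖∑ n ∈ range M, ph u (Lf hs (x0 + n))‖ ≤ N*1 := by
      refine (norm_sum_le _ _).trans ?_
      simp only [ph_norm]; simpa using hM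
    set Y := Ck k*N ^ k / |u| / hs.prod with hY
    have hY0 : 0 < Y := by positivity
    have : ‖∑ n ∈ range M, ph u (Lf hs (x0 + n))‖ ≤ N*Y ^ (1/2:ℝ) := by
      rcases le_total Y 1 with h | h
      · refine b.trans ?_
        gcongr
        calc Y = Y ^ (1:ℝ) := (rpow_one _).symm
          _ ≤ _ := rpow_le_rpow_of_exponent_ge hY0 h (by norm_num)
      · refine tr.trans ?_
        gcongr
        exact one_le_rpow h (by norm_num)
    refine this.trans ?_
    rw [pow_zero (H:ℝ), div_one, ← hY, zero_add, pow_one]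
    have h1 : 0 ≤ ((H:ℝ)⁻¹) ^ ((1/2:ℝ)^0) := by positivity
    have h2 : 0 ≤ Y ^ (1/2:ℝ) := by positivity
    gcongr N*?_
    linarith
  | succ j ih =>
    intro hs hl hpos hle x0 hx hx2 M hM
    have hprod : (1:ℝ) ≤ (hs.prod:ℕ) := mod_cast List.one_le_prod hpos
    set s:ℝ := (1/2:ℝ)^(j+1) with hs_def
    have hs0 : 0 < s := by positivity
    have hs1 : s ≤ 1/2 := by
      rw [hs_def, pow_succ]
      have := pow_le_one₀ (n := j) (show (0:ℝ) ≤ 1/2 by norm_num) (by norm_num)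
      linarith
    set Y := Ck k*N ^ k / |u| / H ^ (j+1) / hs.prod with hY
    have hY0 : 0 < Y := by positivity
    have v := vdc (fun n => ph u (Lf hs (x0 + n))) (fun n => (ph_norm _ _).le) M H N (9*((H:ℝ)⁻¹) ^ ((1/2:ℝ)^j)) (8*Y ^ s) hM hH
      (by positivity) (by positivity) ?_
    · refine v.trans ?_
      have e1 : sqrt (((H:ℝ)⁻¹) ^ ((1/2:ℝ)^j)) = ((H:ℝ)⁻¹) ^ s := by
        rw [sqrt_eq_rpow, ← rpow_mul (by positivity), hs_def, pow_succ]
      have e2 : sqrt (Y ^ s) = Y ^ ((1/2:ℝ)^(j+1+1)) := by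
        rw [sqrt_eq_rpow, ← rpow_mul hY0.le, hs_def, ← pow_succ]
      have hi1 : (H:ℝ)⁻¹ ≤ 1 := inv_le_one_of_one_le₀ (mod_cast hH)
      have h0 : sqrt (1 / H + 9*((H:ℝ)⁻¹) ^ ((1/2:ℝ)^j) + 4*(8*Y ^ s)) ≤ ((H:ℝ)⁻¹)^s + 3*((H:ℝ)⁻¹)^s + 6*Y ^ ((1/2:ℝ)^(j+1+1)) := by
        refine sqrt_le_iff.mpr ⟨by positivity, ?_⟩
        have a1 : ((H:ℝ)⁻¹) ^ ((1/2:ℝ)^j) = (((H:ℝ)⁻¹)^s) ^ 2 := by rw [← e1, sq_sqrt (by positivity)]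
        have a2 : Y ^ s = (Y ^ ((1/2:ℝ)^(j+1+1))) ^ 2 := by rw [← e2, sq_sqrt (by positivity)]
        have a3 : 1 / (H:ℝ) ≤ (((H:ℝ)⁻¹)^s) ^ 2 := by
          rw [← a1, one_div]
          calc (H:ℝ)⁻¹ = ((H:ℝ)⁻¹) ^ (1:ℝ) := (rpow_one _).symm
            _ ≤ _ := rpow_le_rpow_of_exponent_ge (by positivity) hi1 (pow_le_one₀ (by norm_num) (by norm_num))
        rw [a1, a2]
        have p1 : 0 ≤ ((H:ℝ)⁻¹)^s := by positivity
        have p2 : 0 ≤ Y ^ ((1/2:ℝ)^(j+1+1)) := by positivity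
        nlinarith [mul_nonneg p1 p2]
      have h1 : (H:ℝ) ≤ N*((H:ℝ)⁻¹)^s := by
        have : (H:ℝ)⁻¹ ≤ ((H:ℝ)⁻¹)^s := by
          calc (H:ℝ)⁻¹ = ((H:ℝ)⁻¹) ^ (1:ℝ) := (rpow_one _).symm
            _ ≤ _ := rpow_le_rpow_of_exponent_ge (by positivity) hi1 (by linarith)
        calc (H:ℝ) = H ^ 2*(H:ℝ)⁻¹ := by field_simp
          _ ≤ _ := by gcongr
      have p1 : 0 ≤ ((H:ℝ)⁻¹)^s := by positivity
      have p2 : 0 ≤ Y ^ ((1/2:ℝ)^(j+1+1)) := by positivity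
      calc _ ≤ N*((H:ℝ)⁻¹)^s + N*(((H:ℝ)⁻¹)^s + 3*((H:ℝ)⁻¹)^s + 6*Y ^ ((1/2:ℝ)^(j+1+1))) := by gcongr
        _ = N*(5*((H:ℝ)⁻¹)^s + 6*Y ^ ((1/2:ℝ)^(j+1+1))) := by ring
        _ ≤ _ := by gcongr <;> norm_num
    · intro h' d hd hhd
      have hd0 : (0:ℝ) < d := mod_cast hd
      have hhd' : ((h':ℝ)) ≤ H := mod_cast (show h' ≤ H by omega)
      have i := ih (d :: hs) (by rw [List.length_cons]; omega) (by simpa using ⟨hd, hpos⟩)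
        (by simpa using ⟨by omega, hle⟩) (x0 + h') (by linarith [Nat.cast_nonneg (α := ℝ) h']) (by rw [List.length_cons]; push_cast; linarith) M hM
      have e : ∀ n:ℕ, ph u (Lf hs (x0 + (n + (h' + d):ℕ)))*star (ph u (Lf hs (x0 + (n + h':ℕ)))) = ph u (Lf (d :: hs) (x0 + h' + n)) := by
        intro n
        rw [show star (ph u (Lf hs (x0 + (n + h':ℕ)))) = _ from ph_conj' _ _, ← ph_add]
        congr 1
        simp only [Lf]; push_cast; rw [sub_eq_add_neg]; ring_nf
      simp only [e]
      refine i.trans ?_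
      have e3 : (Ck k*N ^ k / |u| / H ^ j / (d :: hs).prod) ^ s ≤ Y ^ s*sqrt (H / d) := by
        have : Ck k*N ^ k / |u| / H ^ j / ((d :: hs).prod:ℕ) = Y*(H / d) := by
          rw [hY, List.prod_cons, Nat.cast_mul, pow_succ]; field_simp
        rw [this, mul_rpow hY0.le (by positivity), sqrt_eq_rpow]
        gcongr
        · rw [le_div_iff₀ hd0, one_mul]; exact_mod_cast (show d ≤ H by omega)
      have hN0 : 0 ≤ N := by linarith
      gcongr N*(_ + ?_)
      linarith

lemma weyl_window (k:ℕ) : ∃ c:ℝ, 0 < c ∧ c ≤ 1 ∧ ∃ C:ℝ, 0 < C ∧ ∀ (N u x0:ℝ) (M:ℕ), 1 ≤ N →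
    N ^ (3*(k:ℝ) / 4 + 1 / 12) ≤ |u| → |u| ≤ N ^ (3*(k:ℝ) / 4 + 11 / 12) → N ≤ x0 → x0 ≤ 2*N → (M:ℝ) ≤ N →
    ‖∑ n ∈ range M, ph u (log (x0 + n))‖ ≤ C*N ^ (1 - c) := by
  have hC := Ck_pos k
  set s:ℝ := (1/2:ℝ)^(k+1) with hs
  have hs0 : 0 < s := by positivity
  have hs1 : s ≤ 1 := pow_le_one₀ (by norm_num) (by norm_num)
  have hs' : (1/2:ℝ)^k = 2*s := by rw [hs, pow_succ]; ring
  set F:ℝ := (k.factorial + 2*k:ℝ) with hF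
  have hF1 : 1 ≤ F := by
    have : (1:ℝ) ≤ k.factorial := mod_cast k.factorial_pos
    have : (0:ℝ) ≤ k := by positivity
    linarith
  refine ⟨s / 12, by positivity, by linarith, F + (36 + 8*(Ck k*2 ^ k) ^ s), by positivity, ?_⟩
  intro N u x0 M hN hu1 hu2 hx hx2 hM
  have hN0 : 0 < N := by linarith
  have hu0 : 0 < |u| := lt_of_lt_of_le (by positivity) hu1
  have tr : ‖∑ n ∈ range M, ph u (log (x0 + n))‖ ≤ N := by
    refine (norm_sum_le _ _).trans ?_
    simp only [ph_norm]; simpa using hM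
  have split : ∀ x:ℝ, x ≤ N ^ (1 - s/12)*0 + x := fun x => by linarith
  have eN : N = N ^ (s/12)*N ^ (1 - s/12) := by
    rw [← rpow_add hN0]; conv_lhs => rw [← rpow_one N]
    congr 1; ring
  have hP : 0 < N ^ (1 - s/12) := by positivity
  by_cases hbig : F ≤ N ^ (1/12:ℝ)
  · set H := ⌊N ^ (1/4:ℝ)⌋₊ with hH
    have hN4 : 1 ≤ N ^ (1/4:ℝ) := one_le_rpow hN (by norm_num)
    have hH1 : 1 ≤ H := Nat.one_le_floor_iff _ |>.mpr hN4
    have hHle : (H:ℝ) ≤ N ^ (1/4:ℝ) := Nat.floor_le (by positivity)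
    have hHge : N ^ (1/4:ℝ) / 2 ≤ H := by
      have := Nat.lt_floor_add_one (N ^ (1/4:ℝ))
      have h1 : (1:ℝ) ≤ H := mod_cast hH1
      linarith
    have hH0 : (0:ℝ) < H := by linarith
    have hkf : (k.factorial:ℝ) ≤ N ^ (1/12:ℝ) := by
      have : (0:ℝ) ≤ k := by positivity
      linarith
    have h2k : 2*(k:ℝ) ≤ N ^ (1/12:ℝ) := by
      have : (0:ℝ) ≤ k.factorial := by positivity
      linarith
    have w := weyl_step k N u H hH1 hN ?_ ?_ (abs_pos.mp hu0) ?_ k [] (by simp) (by simp) (by simp) x0 hx (by simpa using hx2) M hM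
    · simp only [Lf, List.prod_nil, Nat.cast_one, div_one] at w
      refine w.trans ?_
      rw [hs', ← hs]
      have a1 : ((H:ℝ)⁻¹) ^ (2*s) ≤ 4*N ^ (-(s/12)) := by
        have : (H:ℝ)⁻¹ ≤ 2*N ^ (-(1/4:ℝ)) := by
          rw [rpow_neg hN0.le, inv_le_comm₀ hH0 (by positivity), mul_inv, inv_inv]; linarith
        calc _ ≤ (2*N ^ (-(1/4:ℝ))) ^ (2*s) := by gcongr
          _ = 2 ^ (2*s)*N ^ (-(1/4:ℝ)*(2*s)) := by
            rw [mul_rpow (by norm_num) (by positivity), ← rpow_mul hN0.le]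
          _ ≤ 2 ^ (2:ℝ)*N ^ (-(s/12)) := by
            gcongr
            · norm_num
            · linarith
            · linarith
          _ = _ := by norm_num
      have a2 : (Ck k*N ^ k / |u| / H ^ k) ^ s ≤ (Ck k*2 ^ k) ^ s*N ^ (-(s/12)) := by
        have : Ck k*N ^ k / |u| / H ^ k ≤ Ck k*2 ^ k*N ^ (-(1/12:ℝ)) := by
          calc _ ≤ Ck k*N ^ k / N ^ (3*(k:ℝ) / 4 + 1 / 12) / (N ^ (1/4:ℝ) / 2) ^ k := by gcongr
            _ = Ck k*2 ^ k*(N ^ (k:ℝ) / N ^ (3*(k:ℝ) / 4 + 1 / 12) / N ^ ((1/4:ℝ)*k)) := by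
              rw [div_pow, rpow_mul hN0.le, rpow_natCast, rpow_natCast]; field_simp
            _ = _ := by
              rw [← rpow_sub hN0, ← rpow_sub hN0]; congr 2; ring
        calc _ ≤ (Ck k*2 ^ k*N ^ (-(1/12:ℝ))) ^ s := by gcongr
          _ = (Ck k*2 ^ k) ^ s*N ^ (-(1/12:ℝ)*s) := by
            rw [mul_rpow (by positivity) (by positivity), ← rpow_mul hN0.le]
          _ = _ := by congr 2; ring
      have e3 : N*N ^ (-(s/12)) = N ^ (1 - s/12) := by
        rw [sub_eq_add_neg, rpow_add hN0, rpow_one]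
      calc _ ≤ N*(9*(4*N ^ (-(s/12))) + 8*((Ck k*2 ^ k) ^ s*N ^ (-(s/12)))) := by gcongr
        _ = (36 + 8*(Ck k*2 ^ k) ^ s)*(N*N ^ (-(s/12))) := by ring
        _ ≤ _ := by
          rw [e3]
          exact mul_le_mul_of_nonneg_right (by linarith) hP.le
    · calc (H:ℝ)^2 ≤ (N ^ (1/4:ℝ)) ^ 2 := by gcongr
        _ = N ^ (1/2:ℝ) := by rw [← rpow_natCast, ← rpow_mul hN0.le]; norm_num
        _ ≤ N ^ (1:ℝ) := rpow_le_rpow_of_exponent_le hN (by norm_num)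
        _ = N := rpow_one N
    · calc 2*(k:ℝ)*H ≤ N ^ (1/12:ℝ)*N ^ (1/4:ℝ) := by gcongr
        _ = N ^ (1/3:ℝ) := by rw [← rpow_add hN0]; norm_num
        _ ≤ N ^ (1:ℝ) := rpow_le_rpow_of_exponent_le hN (by norm_num)
        _ = N := rpow_one N
    · calc |u| * (H:ℝ) ^ k*k.factorial ≤ N ^ (3*(k:ℝ) / 4 + 11 / 12)*(N ^ (1/4:ℝ)) ^ k*N ^ (1/12:ℝ) := by gcongr
        _ = N ^ (k+1) := by
          rw [← rpow_natCast, ← rpow_natCast, ← rpow_mul hN0.le, ← rpow_add hN0, ← rpow_add hN0]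
          congr 1; push_cast; ring
  · push Not at hbig
    refine tr.trans ?_
    have : N ^ (s/12) ≤ F := by
      refine le_trans ?_ hbig.le
      exact rpow_le_rpow_of_exponent_le hN (by linarith)
    calc N = N ^ (s/12)*N ^ (1 - s/12) := eN
      _ ≤ F*N ^ (1 - s/12) := by gcongr
      _ ≤ _ := by gcongr; have : 0 ≤ 36 + 8*(Ck k*2 ^ k) ^ s := by positivity
                  linarith

lemma weyl_aux (k:ℕ) : ∃ c:ℝ, 0 < c ∧ c ≤ 1 ∧ ∃ C:ℝ, 0 < C ∧ ∀ (N u x0:ℝ) (M:ℕ), 1 ≤ N →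
    N ^ (1 / 12:ℝ) ≤ |u| → |u| ≤ N ^ (3*(k:ℝ) / 4 + 11 / 12) → N ≤ x0 → x0 ≤ 2*N → (M:ℝ) ≤ N →
    ‖∑ n ∈ range M, ph u (log (x0 + n))‖ ≤ C*N ^ (1 - c) := by
  induction k with
  | zero => simpa using weyl_window 0
  | succ k ih =>
    obtain ⟨c1, hc1, hc1', C1, hC1, h1⟩ := ih
    obtain ⟨c2, hc2, hc2', C2, hC2, h2⟩ := weyl_window (k+1)
    refine ⟨min c1 c2, lt_min hc1 hc2, (min_le_left _ _).trans hc1', C1 + C2, by positivity, ?_⟩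
    intro N u x0 M hN hu1 hu2 hx hx2 hM
    have hN0 : 0 < N := by linarith
    rcases le_total |u| (N ^ (3*(k:ℝ) / 4 + 11 / 12)) with h | h
    · refine (h1 N u x0 M hN hu1 h hx hx2 hM).trans ?_
      gcongr
      · linarith
      · exact min_le_left _ _
    · refine (h2 N u x0 M hN ?_ hu2 hx hx2 hM).trans ?_
      · refine le_trans (rpow_le_rpow_of_exponent_le hN ?_) h
        push_cast; linarith
      · gcongr
        · linarith
        · exact min_le_right _ _

theorem weyl (K:ℝ) : ∃ c:ℝ, 0 < c ∧ c ≤ 1 ∧ ∃ C:ℝ, 0 < C ∧ ∀ (N u x0:ℝ) (M:ℕ), 1 ≤ N →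
    N ^ (1 / 12:ℝ) ≤ |u| → |u| ≤ N ^ K → N ≤ x0 → x0 ≤ 2*N → (M:ℝ) ≤ N →
    ‖∑ n ∈ range M, ph u (log (x0 + n))‖ ≤ C*N ^ (1 - c) := by
  obtain ⟨k, hk⟩ := exists_nat_ge (2*K)
  obtain ⟨c, hc, hc', C, hC, h⟩ := weyl_aux k
  refine ⟨c, hc, hc', C, hC, fun N u x0 M hN h1 h2 => h N u x0 M hN h1 (h2.trans ?_)⟩
  refine rpow_le_rpow_of_exponent_le hN ?_
  have : (0:ℝ) ≤ k := by positivity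
  linarith

/-- Σ_{n<M} (x0+n)^{-1-iu} minus the corresponding integral, as a sum of local errors -/
noncomputable def Er (u x:ℝ):ℂ := ((x⁻¹:ℝ):ℂ)*ph u (log x) - ∫ y in (log x)..(log (x+1)), ph u y

lemma ph_ii (u a b:ℝ) : IntervalIntegrable (ph u) volume a b := (ph_continuous' u).intervalIntegrable _ _

lemma log_add_one_sub (x:ℝ) (hx : 0 < x) : 0 ≤ log (x+1) - log x ∧ log (x+1) - log x ≤ x⁻¹ := by
  constructor
  · have := log_le_log hx (show x ≤ x + 1 by linarith); linarith
  · rw [← log_div (by positivity) hx.ne']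
    have := log_le_sub_one_of_pos (show 0 < (x+1)/x by positivity)
    have e : (x+1)/x - 1 = x⁻¹ := by field_simp; ring
    linarith

lemma ph_lip (u a b:ℝ) : ‖ph u a - ph u b‖ ≤ |u| * |a - b| := by
  have : ph u a - ph u b = ph u b*(cexp (I*((-(u*(a - b)):ℝ))) - 1) := by
    simp only [ph]; rw [mul_sub, ← Complex.exp_add, mul_one]; congr 2; push_cast; ring
  rw [this, norm_mul, ph_norm, one_mul]
  refine norm_exp_I_mul_ofReal_sub_one_le.trans ?_
  rw [norm_eq_abs, abs_neg, abs_mul]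

lemma Er_small (u x:ℝ) (hx : 1 ≤ x) : ‖Er u x‖ ≤ (1 + |u|)*(x⁻¹) ^ 2 := by
  have hx0 : 0 < x := by linarith
  obtain ⟨h1, h2⟩ := log_add_one_sub x hx0
  set d := log (x+1) - log x with hd
  have hlow : x⁻¹ - (x⁻¹)^2 ≤ d := by
    rw [hd, ← log_div (by positivity) hx0.ne']
    have := one_sub_inv_le_log_of_pos (show 0 < (x+1)/x by positivity)
    refine le_trans ?_ this
    rw [inv_div, ← sub_nonneg]
    have : 1 - x / (x+1) - (x⁻¹ - x⁻¹^2) = 1 / (x^2*(x+1)) := by field_simp; ring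
    rw [this]; positivity
  have e : Er u x = ((x⁻¹ - d:ℝ):ℂ)*ph u (log x) - ∫ y in (log x)..(log (x+1)), (ph u y - ph u (log x)) := by
    rw [intervalIntegral.integral_sub (ph_ii _ _ _) (by simp), intervalIntegral.integral_const, Er, ← hd]
    simp only [real_smul]; push_cast; ring
  rw [e]
  refine (norm_sub_le _ _).trans ?_
  have b1 : ‖((x⁻¹ - d:ℝ):ℂ)*ph u (log x)‖ ≤ (x⁻¹)^2 := by
    rw [norm_mul, ph_norm, mul_one, norm_real, norm_eq_abs, abs_le]; constructor <;> nlinarith [sq_nonneg x⁻¹]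
  have b2 : ‖∫ y in (log x)..(log (x+1)), (ph u y - ph u (log x))‖ ≤ |u| * d * |d| := by
    refine intervalIntegral.norm_integral_le_of_norm_le_const fun y hy => ?_
    rw [Set.uIoc_of_le (by linarith)] at hy
    refine (ph_lip _ _ _).trans ?_
    gcongr
    rw [abs_of_nonneg (by linarith [hy.1])]; linarith [hy.2]
  rw [abs_of_nonneg h1] at b2
  have : |u| * d*d ≤ |u| * x⁻¹*x⁻¹ := by gcongr
  nlinarith

lemma Er_int (u x0:ℝ) (h : 0 < x0) (M:ℕ) : ∑ n ∈ range M, Er u (x0 + n) = ∑ n ∈ range M, (((x0 + n)⁻¹:ℝ):ℂ)*ph u (log (x0 + n)) - ∫ y in (log x0)..(log (x0+M)), ph u y := by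
  simp only [Er, sum_sub_distrib]
  congr 1
  have := intervalIntegral.sum_integral_adjacent_intervals (f := ph u) (μ := volume) (a := fun n:ℕ => log (x0 + n)) (n := M) (fun k _ => ph_ii _ _ _)
  simp only [Nat.cast_zero, add_zero] at this
  rw [← this]
  refine sum_congr rfl fun n _ => ?_
  push_cast; rw [add_assoc]

lemma abel_bound (w:ℕ → ℝ) (z:ℕ → ℂ) (M:ℕ) (B V:ℝ) (hB : ∀ m ≤ M, ‖∑ n ∈ range m, z n‖ ≤ B)
    (hw : |w M| + ∑ n ∈ range M, |w (n+1) - w n| ≤ V) :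
    ‖∑ n ∈ range M, (w n:ℂ)*z n‖ ≤ V*B := by
  have hB0 : 0 ≤ B := (norm_nonneg _).trans (hB 0 (Nat.zero_le _))
  have e : ∀ m, ∑ n ∈ range m, (w n:ℂ)*z n = w m*∑ n ∈ range m, z n - ∑ n ∈ range m, ((w (n+1) - w n:ℝ):ℂ)*∑ k ∈ range (n+1), z k := by
    intro m
    induction m with
    | zero => simp
    | succ m ih =>
      rw [sum_range_succ, ih, sum_range_succ (fun n => ((w (n+1) - w n:ℝ):ℂ)*∑ k ∈ range (n+1), z k), sum_range_succ z]
      push_cast; ring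
  rw [e M]
  refine (norm_sub_le _ _).trans ?_
  have b1 : ‖(w M:ℂ)*∑ n ∈ range M, z n‖ ≤ |w M| * B := by
    rw [norm_mul, norm_real, norm_eq_abs]; gcongr; exact hB M le_rfl
  have b2 : ‖∑ n ∈ range M, ((w (n+1) - w n:ℝ):ℂ)*∑ k ∈ range (n+1), z k‖ ≤ (∑ n ∈ range M, |w (n+1) - w n|)*B := by
    rw [sum_mul]
    refine (norm_sum_le _ _).trans (sum_le_sum fun n hn => ?_)
    rw [norm_mul, norm_real, norm_eq_abs]; gcongr
    exact hB _ (mem_range.mp hn)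
  nlinarith

lemma ph_int_bound (u a b:ℝ) (hu : u ≠ 0) : ‖∫ y in a..b, ph u y‖ ≤ 2 / |u| := by
  have e : ∀ y, ph u y = cexp ((-u*I:ℂ)*y) := by intro y; simp only [ph]; congr 1; push_cast; ring
  simp_rw [e]
  have hc : (-u*I:ℂ) ≠ 0 := by simp [hu]
  rw [integral_exp_mul_complex hc, norm_div]
  have : ‖(-u*I:ℂ)‖ = |u| := by simp
  rw [this]
  gcongr
  refine (norm_sub_le _ _).trans ?_
  rw [← e, ← e, ph_norm, ph_norm]; norm_num

lemma Er_block (K:ℝ) : ∃ c:ℝ, 0 < c ∧ c ≤ 1 ∧ ∃ C:ℝ, 0 < C ∧ ∀ (x0 u:ℝ) (M:ℕ), 1 ≤ x0 →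
    |u| ≤ x0 ^ K → (M:ℝ) ≤ x0 → ‖∑ n ∈ range M, Er u (x0 + n)‖ ≤ C*x0 ^ (-c) := by
  obtain ⟨c, hc, hc', C, hC, h⟩ := weyl K
  refine ⟨c/12, by positivity, by linarith, C + 4, by positivity, ?_⟩
  intro x0 u M hx hu hM
  have hx0 : 0 < x0 := by linarith
  have hmono : ∀ a:ℝ, c / 12 ≤ a → x0 ^ (-a) ≤ x0 ^ (-(c/12)) := fun a ha => rpow_le_rpow_of_exponent_le hx (by linarith)
  have hpos : 0 < x0 ^ (-(c/12)) := by positivity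
  rcases le_total |u| (x0 ^ (1/12:ℝ)) with hs | hl
  · have b : ‖∑ n ∈ range M, Er u (x0 + n)‖ ≤ ∑ n ∈ range M, (1 + |u|)*(x0⁻¹) ^ 2 := by
      refine (norm_sum_le _ _).trans (sum_le_sum fun n _ => ?_)
      have hn : (0:ℝ) ≤ n := by positivity
      refine (Er_small u (x0 + n) (by linarith)).trans ?_
      gcongr; linarith
    refine b.trans ?_
    rw [sum_const, card_range, nsmul_eq_mul]
    have h1 : 1 ≤ x0 ^ (1/12:ℝ) := one_le_rpow hx (by norm_num)
    calc (M:ℝ)*((1 + |u|)*(x0⁻¹)^2) ≤ x0*((2*x0 ^ (1/12:ℝ))*(x0⁻¹)^2) := by gcongr; linarith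
      _ = 2*x0 ^ (-(11/12:ℝ)) := by
        have : x0 ^ (-(11/12:ℝ)) = x0 ^ (1/12:ℝ)*x0⁻¹ := by
          rw [← rpow_neg_one, ← rpow_add hx0]; norm_num
        rw [this]; field_simp
      _ ≤ 2*x0 ^ (-(c/12)) := by gcongr 2*?_; exact hmono _ (by linarith)
      _ ≤ _ := by nlinarith
  · have hu0 : 0 < |u| := lt_of_lt_of_le (by positivity) hl
    rw [Er_int u x0 hx0]
    refine (norm_sub_le _ _).trans ?_
    have b1 : ‖∑ n ∈ range M, (((x0 + n)⁻¹:ℝ):ℂ)*ph u (log (x0 + n))‖ ≤ x0⁻¹*(C*x0 ^ (1 - c)) := by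
      refine abel_bound (fun n => (x0 + n)⁻¹) (fun n => ph u (log (x0 + n))) M _ _ (fun m hm => h x0 u x0 m hx hl hu le_rfl (by linarith) ?_) ?_
      · exact le_trans (mod_cast hm) hM
      · have : ∀ n ∈ range M, |(x0 + ((n+1:ℕ):ℝ))⁻¹ - (x0 + (n:ℝ))⁻¹| = (x0 + (n:ℝ))⁻¹ - (x0 + ((n+1:ℕ):ℝ))⁻¹ := by
          intro n _
          rw [abs_sub_comm, abs_of_nonneg]
          rw [sub_nonneg]; gcongr; linarith
        rw [sum_congr rfl this, sum_range_sub' (fun n:ℕ => (x0 + (n:ℝ))⁻¹), abs_of_nonneg (by positivity)]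
        simp
    have b2 := ph_int_bound u (log x0) (log (x0 + M)) (abs_pos.mp hu0)
    have b3 : 2 / |u| ≤ 2*x0 ^ (-(1/12:ℝ)) := by
      rw [rpow_neg hx0.le, ← div_eq_mul_inv]; gcongr
    have e : x0⁻¹*(C*x0 ^ (1 - c)) = C*x0 ^ (-c) := by
      rw [sub_eq_add_neg, rpow_add hx0, rpow_one]; field_simp
    rw [e] at b1
    have b4 := hmono c (by linarith)
    have b5 := hmono (1/12) (by linarith)
    nlinarith

theorem Er_sum (K:ℝ) (hK : 0 ≤ K) : ∃ c:ℝ, 0 < c ∧ c ≤ 1 ∧ ∃ C:ℝ, 0 < C ∧ ∀ (M:ℕ) (x0 u:ℝ), 1 ≤ x0 →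
    |u| ≤ x0 ^ K → ‖∑ n ∈ range M, Er u (x0 + n)‖ ≤ C*x0 ^ (-c) := by
  obtain ⟨c, hc, hc', C, hC, h⟩ := Er_block K
  set r:ℝ := (3/2:ℝ) ^ (-c) with hr
  have hr1 : r < 1 := rpow_lt_one_of_one_lt_of_neg (by norm_num) (by linarith)
  have hr0 : 0 < 1 - r := by linarith
  refine ⟨c, hc, hc', C / (1 - r), by positivity, ?_⟩
  intro M
  induction M using Nat.strong_induction_on with
  | _ M ih =>
    intro x0 u hx hu
    have hx0 : 0 < x0 := by linarith
    have hp : 0 < x0 ^ (-c) := by positivity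
    have hCr : C ≤ C / (1 - r) := by
      rw [le_div_iff₀ hr0]
      have : 0 < r := by positivity
      nlinarith
    rcases le_or_gt (M:ℝ) x0 with hM | hM
    · refine (h x0 u M hx hu hM).trans ?_
      gcongr
    · set m := ⌊x0⌋₊ with hm
      have hm1 : 1 ≤ m := Nat.one_le_floor_iff _ |>.mpr hx
      have hmx : (m:ℝ) ≤ x0 := Nat.floor_le hx0.le
      have hmM : m < M := mod_cast hmx.trans_lt hM
      have hm2 : x0 < m + 1 := Nat.lt_floor_add_one x0
      have hm1' : (1:ℝ) ≤ m := mod_cast hm1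
      obtain ⟨l, hl⟩ : ∃ l, M = m + l := ⟨M - m, by omega⟩
      rw [hl, sum_range_add]
      refine (norm_add_le _ _).trans ?_
      have b1 := h x0 u m hx hu hmx
      have b2 := ih l (by omega) (x0 + m) u (by linarith) (hu.trans (by gcongr; linarith))
      have b3 : (x0 + m) ^ (-c) ≤ r*x0 ^ (-c) := by
        rw [hr, ← mul_rpow (by norm_num) hx0.le]
        refine rpow_le_rpow_of_nonpos (by positivity) (by linarith) (by linarith)
      have e : ∀ n:ℕ, x0 + ((m + n:ℕ):ℝ) = x0 + m + n := by intro n; push_cast; ring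
      simp_rw [e]
      have : C / (1 - r)*x0 ^ (-c) = C*x0 ^ (-c) + C / (1 - r)*(r*x0 ^ (-c)) := by
        field_simp; ring
      rw [this]
      have : C / (1-r)*(x0 + m) ^ (-c) ≤ C / (1-r)*(r*x0 ^ (-c)) := by gcongr
      linarith

lemma tri_int_shift (D u y0:ℝ) (hD : 0 ≤ D) : ∫ x, (tri D (x - y0):ℂ)*ph u x = ph u y0*triHat D u := by
  rw [← fourier_tri hD u, ← integral_const_mul]
  rw [← integral_sub_right_eq_self (fun x => ph u y0*((tri D x:ℂ)*ph u x)) y0]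
  refine integral_congr_ae (Eventually.of_forall fun x => ?_)
  have : ph u x = ph u y0*ph u (x - y0) := by rw [← ph_add]; congr 1; ring
  simp only [this]; ring

theorem kernel_bound (D K:ℝ) (hD : 0 < D) (hK : 0 ≤ K) : ∃ c:ℝ, 0 < c ∧ ∃ C:ℝ, 0 < C ∧ ∀ y0 u:ℝ, 2*D + 2 ≤ y0 →
    |u| ≤ exp (K*y0) →
    ‖∑ m ∈ range ⌈exp (y0 + D)⌉₊, ((tri D (log m - y0)*(m:ℝ)⁻¹:ℝ):ℂ)*ph u (log m) - ph u y0*triHat D u‖ ≤ C*exp (-c*y0) := by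
  obtain ⟨c, hc, hc1, C, hC, h⟩ := Er_sum (2*K) (by positivity)
  refine ⟨c/2, by positivity, (2*D + 2)*(C + 1), by positivity, ?_⟩
  intro y0 u hy hu
  set n0 := ⌊exp (y0 - D)⌋₊ with hn0
  set n1 := ⌈exp (y0 + D)⌉₊ with hn1
  have n0le : (n0:ℝ) ≤ exp (y0 - D) := Nat.floor_le (by positivity)
  have n1ge : exp (y0 + D) ≤ n1 := Nat.le_ceil _
  have n1le : (n1:ℝ) ≤ exp (y0 + D) + 1 := (Nat.ceil_lt_add_one (by positivity)).le
  have e1 : (1:ℝ) ≤ exp (y0 - D) := one_le_exp (by linarith)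
  have hn01 : 1 ≤ n0 := Nat.one_le_floor_iff _ |>.mpr e1
  have hn01' : (1:ℝ) ≤ n0 := mod_cast hn01
  have n0lt : exp (y0 - D) < n0 + 1 := Nat.lt_floor_add_one _
  have n0ge : exp (y0 - D - 1) ≤ n0 := by
    have : exp (y0 - D) = exp (y0 - D - 1)*exp 1 := by rw [← exp_add]; congr 1; ring
    have h2 := add_one_le_exp (1:ℝ)
    have : exp (y0 - D - 1)*2 ≤ exp (y0 - D) := by
      rw [this]; gcongr; linarith
    linarith
  have n0ge2 : exp (y0 / 2) ≤ n0 := le_trans (exp_le_exp.mpr (by linarith)) n0ge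
  have hn0pos : (0:ℝ) < n0 := by linarith
  have n0n1 : n0 ≤ n1 := by
    have : (n0:ℝ) ≤ n1 := n0le.trans (le_trans (exp_le_exp.mpr (by linarith)) n1ge)
    exact_mod_cast this
  obtain ⟨M, hM⟩ := Nat.exists_eq_add_of_le n0n1
  have hn0M : ((n1:ℕ):ℝ) = n0 + M := by rw [hM]; push_cast; rfl
  have log0 : log n0 ≤ y0 - D := by
    rw [log_le_iff_le_exp hn0pos]; exact n0le
  have log1 : y0 + D ≤ log n1 := by
    rw [le_log_iff_exp_le (lt_of_lt_of_le (by positivity) n1ge)]; exact n1ge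
  have loglen : log n1 - log n0 ≤ 2*D + 2 := by
    have a1 : log n1 ≤ y0 + D + 1 := by
      rw [log_le_iff_le_exp (lt_of_lt_of_le (by positivity) n1ge), exp_add (y0 + D)]
      have h2 := add_one_le_exp (1:ℝ)
      have h3 : 1 ≤ exp (y0 + D) := one_le_exp (by linarith)
      nlinarith
    have a2 : y0 - D - 1 ≤ log n0 := by
      rw [le_log_iff_exp_le hn0pos]; exact n0ge
    linarith
  have hlx : ∀ n:ℕ, 0 ≤ log (n0 + (n+1:ℕ)) - log (n0 + n) ∧ log (n0 + (n+1:ℕ)) - log (n0 + n) ≤ (n0:ℝ)⁻¹ := by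
    intro n
    have := log_add_one_sub (n0 + n) (by positivity)
    push_cast; rw [← add_assoc]
    refine ⟨this.1, this.2.trans ?_⟩
    gcongr; linarith [Nat.cast_nonneg (α := ℝ) n]
  have hsumlog : ∑ n ∈ range M, (log (n0 + (n+1:ℕ)) - log (n0 + n)) ≤ 2*D + 2 := by
    rw [sum_range_sub (fun n:ℕ => log ((n0:ℝ) + n)), ← hn0M]; simpa using loglen
  set w:ℕ → ℝ := fun n => tri D (log (n0 + n) - y0) with hw
  have hwlip : ∀ n:ℕ, |w (n+1) - w n| ≤ log (n0 + (n+1:ℕ)) - log (n0 + n) := by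
    intro n
    refine (tri_lip _ _ _).trans ?_
    rw [show log (n0 + (n+1:ℕ)) - y0 - (log (n0 + n) - y0) = log (n0 + (n+1:ℕ)) - log (n0 + n) by ring]
    rw [abs_of_nonneg (hlx n).1]
  -- step 1 : rewrite sum
  have s1 : ∑ m ∈ range n1, ((tri D (log m - y0)*(m:ℝ)⁻¹:ℝ):ℂ)*ph u (log m) = ∑ n ∈ range M, (w n:ℂ)*((((n0 + n:ℝ)⁻¹:ℝ):ℂ)*ph u (log (n0 + n))) := by
    rw [hM, sum_range_add]
    rw [sum_eq_zero, zero_add]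
    · refine sum_congr rfl fun n _ => ?_
      rw [hw]; push_cast; ring
    · intro m hm
      rw [mem_range] at hm
      rcases Nat.eq_zero_or_pos m with h0 | h0
      · subst h0; simp
      · have : log m ≤ log n0 := log_le_log (mod_cast h0) (mod_cast hm.le)
        rw [tri_eq_zero]
        · simp
        · rw [abs_of_nonpos (by linarith)]; linarith
  have s2 : ∑ n ∈ range M, (w n:ℂ)*((((n0 + n:ℝ)⁻¹:ℝ):ℂ)*ph u (log (n0 + n))) =
      ∑ n ∈ range M, (w n:ℂ)*Er u (n0 + n) + ∑ n ∈ range M, ∫ y in (log (n0 + n))..(log (n0 + (n+1:ℕ))), (w n:ℂ)*ph u y := by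
    rw [← sum_add_distrib]
    refine sum_congr rfl fun n _ => ?_
    rw [intervalIntegral.integral_const_mul, ← mul_add, Er]
    congr 1; push_cast; rw [add_assoc]; ring
  have hcont : Continuous (fun x => (tri D (x - y0):ℂ)*ph u x) := by
    have := tri_continuous D
    have := ph_continuous' u
    fun_prop
  have s3 : ph u y0*triHat D u = ∑ n ∈ range M, ∫ y in (log (n0 + n))..(log (n0 + (n+1:ℕ))), (tri D (y - y0):ℂ)*ph u y := by
    rw [← tri_int_shift D u y0 hD.le]
    have a := intervalIntegral.sum_integral_adjacent_intervals (f := fun x => (tri D (x - y0):ℂ)*ph u x) (μ := volume) (a := fun n:ℕ => log ((n0:ℝ) + n)) (n := M) (fun k _ => hcont.intervalIntegrable _ _)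
    rw [a, ← hn0M]
    simp only [Nat.cast_zero, add_zero]
    symm
    apply intervalIntegral.integral_eq_integral_of_support_subset
    intro x hx
    rw [Function.mem_support] at hx
    have hlt : |x - y0| < D := by
      by_contra hcon; push Not at hcon
      exact hx (by rw [tri_eq_zero hcon]; simp)
    rw [abs_lt] at hlt
    exact ⟨by linarith, by linarith⟩
  rw [s1, s2, s3, add_sub_assoc, ← sum_sub_distrib]
  refine (norm_add_le _ _).trans ?_
  have b1 : ‖∑ n ∈ range M, (w n:ℂ)*Er u (n0 + n)‖ ≤ (2*D + 2)*(C*(n0:ℝ) ^ (-c)) := by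
    refine abel_bound w (fun n => Er u (n0 + n)) M _ _ (fun m _ => h m n0 u hn01' ?_) ?_
    · refine hu.trans ?_
      calc exp (K*y0) = (exp (y0/2)) ^ (2*K) := by rw [← exp_mul]; congr 1; ring
        _ ≤ _ := by gcongr
    · have : w M = 0 := by
        rw [hw]; simp only; rw [← hn0M]
        apply tri_eq_zero; rw [abs_of_nonneg (by linarith)]; linarith
      rw [this, abs_zero, zero_add]
      exact (sum_le_sum fun n _ => hwlip n).trans hsumlog
  have b2 : ‖∑ n ∈ range M, ((∫ y in (log (n0 + n))..(log (n0 + (n+1:ℕ))), (w n:ℂ)*ph u y) - ∫ y in (log (n0 + n))..(log (n0 + (n+1:ℕ))), (tri D (y - y0):ℂ)*ph u y)‖ ≤ (n0:ℝ)⁻¹*(2*D + 2) := by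
    refine (norm_sum_le _ _).trans ?_
    refine le_trans (sum_le_sum fun n _ => ?_) (le_trans (le_of_eq (mul_sum _ _ _).symm) (mul_le_mul_of_nonneg_left hsumlog (by positivity)))
    rw [← intervalIntegral.integral_sub ((ph_ii u _ _).const_mul (w n:ℂ)) (hcont.intervalIntegrable _ _)]
    refine (intervalIntegral.norm_integral_le_of_norm_le_const (C := (n0:ℝ)⁻¹) fun y hy => ?_).trans ?_
    · rw [Set.uIoc_of_le (by linarith [(hlx n).1])] at hy
      rw [← sub_mul, norm_mul, ph_norm, mul_one, ← ofReal_sub, norm_real, norm_eq_abs]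
      refine (tri_lip _ _ _).trans ?_
      rw [show log (n0 + n) - y0 - (y - y0) = -(y - log (n0 + n)) by ring, abs_neg, abs_of_nonneg (by linarith [hy.1])]
      linarith [hy.2, (hlx n).2]
    · rw [abs_of_nonneg (hlx n).1]
  have p1 : (n0:ℝ) ^ (-c) ≤ exp (-(c/2)*y0) := by
    calc (n0:ℝ) ^ (-c) ≤ (exp (y0/2)) ^ (-c) := rpow_le_rpow_of_nonpos (by positivity) n0ge2 (by linarith)
      _ = _ := by rw [← exp_mul]; congr 1; ring
  have p2 : (n0:ℝ)⁻¹ ≤ exp (-(c/2)*y0) := by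
    refine le_trans ?_ p1
    rw [← rpow_neg_one]
    exact rpow_le_rpow_of_exponent_le hn01' (by linarith)
  calc _ ≤ (2*D + 2)*(C*exp (-(c/2)*y0)) + exp (-(c/2)*y0)*(2*D + 2) := by
        refine add_le_add (b1.trans ?_) (b2.trans ?_)
        · gcongr
        · gcongr
    _ = (2*D + 2)*(C + 1)*exp (-(c/2)*y0) := by ring

lemma halasz (s : Finset ℕ) (ρ:ℕ → ℝ) (hρ : ∀ n, 0 ≤ ρ n) (d:ℕ → ℂ) (hd : ∀ n ∈ s, d n ≠ 0 → 0 < ρ n)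
    (U : Set ℝ) (hU : volume U ≠ ⊤) (hUm : MeasurableSet U) (κ:ℝ) (hκ0 : 0 ≤ κ)
    (hκ : ∀ t ∈ U, ∫ t' in U, ‖∑ n ∈ s, (ρ n:ℂ)*ph (t - t') (log n)‖ ≤ κ) :
    ∫ t in U, ‖∑ n ∈ s, d n*ph t (log n)‖ ^ 2 ≤ κ*∑ n ∈ s, ‖d n‖ ^ 2 / ρ n := by
  set ν := volume.restrict U with hν
  haveI : IsFiniteMeasure ν := ⟨by rw [hν, Measure.restrict_apply_univ]; exact hU.lt_top⟩
  set F:ℝ → ℂ := fun t => ∑ n ∈ s, d n*ph t (log n) with hF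
  set Kf:ℝ → ℂ := fun u => ∑ n ∈ s, (ρ n:ℂ)*ph u (log n) with hKf
  have hFc : Continuous F := continuous_finset_sum _ fun n _ => continuous_const.mul (ph_continuous _)
  have hKc : Continuous Kf := continuous_finset_sum _ fun n _ => continuous_const.mul (ph_continuous _)
  have hFb : ∀ t, ‖F t‖ ≤ ∑ n ∈ s, ‖d n‖ := fun t => by
    refine (norm_sum_le _ _).trans (sum_le_sum fun n _ => ?_)
    rw [norm_mul, ph_norm, mul_one]
  have hKb : ∀ t, ‖Kf t‖ ≤ ∑ n ∈ s, ρ n := fun t => by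
    refine (norm_sum_le _ _).trans (sum_le_sum fun n _ => ?_)
    rw [norm_mul, ph_norm, mul_one, norm_real, norm_of_nonneg (hρ n)]
  have hKsym : ∀ u, ‖Kf (-u)‖ = ‖Kf u‖ := fun u => by
    rw [← norm_conj, hKf]; simp only [map_sum, map_mul, conj_ofReal, ph_conj, neg_neg]
  set B := ∑ n ∈ s, ‖d n‖ with hB
  set R := ∑ n ∈ s, ρ n with hR
  have hB0 : 0 ≤ B := sum_nonneg fun _ _ => norm_nonneg _
  have hR0 : 0 ≤ R := sum_nonneg fun n _ => hρ n
  set G:ℕ → ℂ := fun n => ∫ t, star (F t)*ph t (log n) ∂ν with hG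
  set J := ∫ t, ‖F t‖ ^ 2 ∂ν with hJ
  have hJ0 : 0 ≤ J := integral_nonneg fun t => by positivity
  have gint : ∀ n:ℕ, Integrable (fun t => star (F t)*ph t (log n)) ν := fun n =>
    Integrable.of_bound ((hFc.star.mul (ph_continuous _)).aestronglyMeasurable) B (Eventually.of_forall fun t => by
      rw [norm_mul, ph_norm, mul_one, norm_star]; exact hFb t)
  have h1 : (J:ℂ) = ∑ n ∈ s, d n*G n := by
    have : ∀ t, ((‖F t‖ ^ 2:ℝ):ℂ) = ∑ n ∈ s, d n*(star (F t)*ph t (log n)) := by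
      intro t
      have : ((‖F t‖ ^ 2:ℝ):ℂ) = star (F t)*F t := by
        push_cast; rw [← conj_mul']; rfl
      rw [this]; conv_lhs => rw [hF]
      rw [mul_sum]; exact sum_congr rfl fun n _ => by ring
    rw [hJ, ← integral_complex_ofReal]
    simp_rw [this]
    rw [integral_finset_sum _ fun n _ => (gint n).const_mul _]
    simp_rw [integral_const_mul]; rfl
  have h2 : J ≤ ∑ n ∈ s, ‖d n‖*‖G n‖ := by
    have : J = ‖(J:ℂ)‖ := by rw [norm_real, norm_of_nonneg hJ0]
    rw [this, h1]
    refine (norm_sum_le _ _).trans (le_of_eq ?_)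
    simp
  set S := ∑ n ∈ s, ‖d n‖ ^ 2 / ρ n with hS
  have hS0 : 0 ≤ S := sum_nonneg fun n _ => div_nonneg (by positivity) (hρ n)
  have h3 : (∑ n ∈ s, ‖d n‖*‖G n‖) ^ 2 ≤ S*∑ n ∈ s, ρ n*‖G n‖ ^ 2 := by
    refine sum_sq_le_sum_mul_sum_of_sq_eq_mul s (fun n _ => div_nonneg (by positivity) (hρ n)) (fun n _ => mul_nonneg (hρ n) (by positivity)) fun n hn => ?_
    by_cases h0 : d n = 0
    · simp [h0]
    · have := (hd n hn h0).ne'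
      field_simp
  have h4 : ((∑ n ∈ s, ρ n*‖G n‖ ^ 2:ℝ):ℂ) = ∫ z, star (F z.1)*F z.2*Kf (z.1 - z.2) ∂(ν.prod ν) := by
    have e : ∀ n, ((ρ n*‖G n‖ ^ 2:ℝ):ℂ) = ∫ z, (ρ n:ℂ)*((star (F z.1)*ph z.1 (log n))*(F z.2*ph (-z.2) (log n))) ∂(ν.prod ν) := by
      intro n
      rw [integral_const_mul, integral_prod_mul (fun t => star (F t)*ph t (log n)) (fun t => F t*ph (-t) (log n))]
      have : ∫ t, F t*ph (-t) (log n) ∂ν = star (G n) := by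
        rw [hG]; simp only
        rw [show star (∫ t, star (F t)*ph t (log n) ∂ν) = _ from (integral_conj (μ := ν) (f := fun t => star (F t)*ph t (log n))).symm]
        refine integral_congr_ae (Eventually.of_forall fun t => ?_)
        simp only [map_mul, ph_conj]; congr 1
        exact (star_star (F t)).symm
      rw [this]; push_cast
      rw [← mul_conj']; rfl
    rw [ofReal_sum]
    simp_rw [e]
    rw [← integral_finset_sum]
    · refine integral_congr_ae (Eventually.of_forall fun z => ?_)
      simp only [hKf, mul_sum]
      refine sum_congr rfl fun n _ => ?_
      rw [sub_eq_add_neg, ph_add']; ring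
    · intro n _
      refine Integrable.of_bound ?_ (ρ n*(B*B)) (Eventually.of_forall fun z => ?_)
      · refine Continuous.aestronglyMeasurable ?_
        have c1 : Continuous fun z:ℝ × ℝ => ph z.1 (log n) := (ph_continuous _).comp continuous_fst
        have c2 : Continuous fun z:ℝ × ℝ => ph (-z.2) (log n) := (ph_continuous _).comp continuous_snd.neg
        have c3 : Continuous fun z:ℝ × ℝ => star (F z.1) := (hFc.comp continuous_fst).star
        have c4 : Continuous fun z:ℝ × ℝ => F z.2 := hFc.comp continuous_snd
        exact continuous_const.mul ((c3.mul c1).mul (c4.mul c2))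
      · rw [norm_mul, norm_mul, norm_mul, norm_mul, ph_norm, ph_norm, norm_star, norm_real, norm_of_nonneg (hρ n), mul_one, mul_one]
        gcongr
        · exact hρ n
        · exact hFb _
        · exact hFb _
  have hKc2 : Continuous fun z:ℝ × ℝ => ‖Kf (z.1 - z.2)‖ := (hKc.comp (continuous_fst.sub continuous_snd)).norm
  have i1 : Integrable (fun z:ℝ × ℝ => ‖F z.1‖ ^ 2*‖Kf (z.1 - z.2)‖) (ν.prod ν) := by
    refine Integrable.of_bound ((((hFc.comp continuous_fst).norm.pow 2).mul hKc2).aestronglyMeasurable) (B ^ 2*R) (Eventually.of_forall fun z => ?_)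
    rw [norm_of_nonneg (by positivity)]
    gcongr
    · exact hFb _
    · exact hKb _
  have i2 : Integrable (fun z:ℝ × ℝ => ‖F z.2‖ ^ 2*‖Kf (z.1 - z.2)‖) (ν.prod ν) := by
    refine Integrable.of_bound ((((hFc.comp continuous_snd).norm.pow 2).mul hKc2).aestronglyMeasurable) (B ^ 2*R) (Eventually.of_forall fun z => ?_)
    rw [norm_of_nonneg (by positivity)]
    gcongr
    · exact hFb _
    · exact hKb _
  have fint : Integrable (fun t => ‖F t‖ ^ 2) ν :=
    Integrable.of_bound ((hFc.norm.pow 2).aestronglyMeasurable) (B ^ 2) (Eventually.of_forall fun t => by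
      rw [norm_of_nonneg (by positivity)]; gcongr; exact hFb t)
  have v1 : ∫ z, ‖F z.1‖ ^ 2*‖Kf (z.1 - z.2)‖ ∂(ν.prod ν) ≤ κ*J := by
    rw [integral_prod _ i1, hJ, ← integral_const_mul]
    refine integral_mono_ae i1.integral_prod_left (fint.const_mul κ) ?_
    filter_upwards [ae_restrict_mem hUm] with t ht
    rw [integral_const_mul, mul_comm]
    gcongr; exact hκ t ht
  have v2 : ∫ z, ‖F z.2‖ ^ 2*‖Kf (z.1 - z.2)‖ ∂(ν.prod ν) ≤ κ*J := by
    rw [integral_prod_symm _ i2, hJ, ← integral_const_mul]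
    refine integral_mono_ae i2.integral_prod_right (fint.const_mul κ) ?_
    filter_upwards [ae_restrict_mem hUm] with t ht
    rw [integral_const_mul, mul_comm]
    gcongr
    refine le_trans (le_of_eq ?_) (hκ t ht)
    refine integral_congr_ae (Eventually.of_forall fun t' => ?_)
    simp only; rw [← hKsym, neg_sub]
  have h5 : ∑ n ∈ s, ρ n*‖G n‖ ^ 2 ≤ κ*J := by
    have : ∑ n ∈ s, ρ n*‖G n‖ ^ 2 = ‖((∑ n ∈ s, ρ n*‖G n‖ ^ 2:ℝ):ℂ)‖ := by
      rw [norm_real, norm_of_nonneg (sum_nonneg fun n _ => mul_nonneg (hρ n) (by positivity))]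
    rw [this, h4]
    refine (norm_integral_le_integral_norm _).trans ?_
    calc _ ≤ ∫ z, (1/2)*(‖F z.1‖ ^ 2*‖Kf (z.1 - z.2)‖ + ‖F z.2‖ ^ 2*‖Kf (z.1 - z.2)‖) ∂(ν.prod ν) := by
          refine integral_mono_of_nonneg (Eventually.of_forall fun z => norm_nonneg _) ((i1.add i2).const_mul _) (Eventually.of_forall fun z => ?_)
          simp only [norm_mul, norm_star]
          nlinarith [mul_nonneg (sq_nonneg (‖F z.1‖ - ‖F z.2‖)) (norm_nonneg (Kf (z.1 - z.2)))]
      _ = (1/2)*(∫ z, ‖F z.1‖ ^ 2*‖Kf (z.1 - z.2)‖ ∂(ν.prod ν) + ∫ z, ‖F z.2‖ ^ 2*‖Kf (z.1 - z.2)‖ ∂(ν.prod ν)) := by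
          rw [integral_const_mul, integral_add i1 i2]
      _ ≤ _ := by linarith
  have h6 : J ^ 2 ≤ S*(κ*J) := by
    calc J ^ 2 ≤ (∑ n ∈ s, ‖d n‖*‖G n‖) ^ 2 := by gcongr
      _ ≤ _ := h3.trans (by gcongr)
  show J ≤ κ*S
  rcases hJ0.eq_or_lt with h0 | h0
  · rw [← h0]; positivity
  · have : J*J ≤ (κ*S)*J := by nlinarith
    exact le_of_mul_le_mul_right this h0

theorem HM (D K:ℝ) (hD : 1 < D) (hK : 0 ≤ K) : ∃ c:ℝ, 0 < c ∧ ∃ C:ℝ, 0 < C ∧ ∀ (V T:ℝ) (U : Set ℝ) (d:ℕ → ℂ) (s : Finset ℕ),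
    2*D + 2 ≤ V → U ⊆ Set.Icc (-T) T → MeasurableSet U → 2*T ≤ exp (K*V) →
    (∀ n ∈ s, 1 ≤ n ∧ |log n - V| ≤ D - 1) →
    ∫ t in U, ‖∑ n ∈ s, d n*ph t (log n)‖ ^ 2 ≤
      (2*Real.pi*D + C*exp (-c*V)*(volume U).toReal)*exp (V + D)*∑ n ∈ s, ‖d n‖ ^ 2 := by
  obtain ⟨c, hc, C, hC, h⟩ := kernel_bound D K (by linarith) hK
  refine ⟨c, hc, C, hC, ?_⟩
  intro V T U d s hV hUT hUm hT hs
  have hUfin : volume U ≠ ⊤ := ne_top_of_le_ne_top (by simp) (measure_mono hUT)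
  haveI : IsFiniteMeasure (volume.restrict U) := ⟨by rw [Measure.restrict_apply_univ]; exact hUfin.lt_top⟩
  set r := range ⌈exp (V + D)⌉₊ with hr
  set ρ:ℕ → ℝ := fun n => tri D (log n - V)*(n:ℝ)⁻¹ with hρ
  have hρ0 : ∀ n, 0 ≤ ρ n := fun n => mul_nonneg (tri_nonneg _ _) (by positivity)
  set d':ℕ → ℂ := fun n => if n ∈ s then d n else 0 with hd'
  have hsle : ∀ n ∈ s, (n:ℝ) < exp (V + D) ∧ (n:ℝ)⁻¹ ≤ ρ n := by
    intro n hn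
    obtain ⟨h1, h2⟩ := hs n hn
    have hn0 : (0:ℝ) < n := mod_cast h1
    constructor
    · rw [← log_lt_iff_lt_exp hn0]; linarith [le_abs_self (log n - V)]
    · rw [hρ]; simp only
      have : 1 ≤ tri D (log n - V) := by unfold tri; exact le_max_of_le_right (by linarith)
      have hp : 0 < (n:ℝ)⁻¹ := by positivity
      nlinarith
  have hsr : s ⊆ r := by
    intro n hn
    rw [hr, mem_range, Nat.lt_ceil]; exact (hsle n hn).1
  set κ := 2*Real.pi*D + C*exp (-c*V)*(volume U).toReal with hκ
  have hκ0 : 0 ≤ κ := by positivity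
  have triint : ∀ t:ℝ, ∫ t', triHat D (t - t') = 2*Real.pi*D := by
    intro t
    rw [integral_sub_left_eq_self (triHat D)]
    have := tri_inv (D := D) (by linarith) 0
    simp only [ph_zero, mul_one] at this
    have e : tri D 0 = D := by unfold tri; simp; linarith
    rw [e] at this
    have e2 : ((∫ t, triHat D t:ℝ):ℂ) = ((2*Real.pi*D:ℝ):ℂ) := by
      rw [← integral_complex_ofReal, this]; push_cast; rfl
    exact_mod_cast e2
  have triI : ∀ t:ℝ, Integrable (fun t' => triHat D (t - t')) := fun t => (triHat_integrable D).comp_sub_left t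
  -- kernel is only controlled for t in U
  have hker : ∀ t ∈ U, ∀ t' ∈ U, ‖∑ n ∈ r, (ρ n:ℂ)*ph (t - t') (log n)‖ ≤ triHat D (t - t') + C*exp (-c*V) := by
    intro t ht t' ht'
    have hu : |t - t'| ≤ exp (K*V) := by
      have a := hUT ht; have b := hUT ht'
      rw [abs_le]; constructor <;> linarith [a.1, a.2, b.1, b.2]
    have := h V (t - t') hV hu
    have e := norm_sub_norm_le (∑ n ∈ r, (ρ n:ℂ)*ph (t - t') (log n)) (ph (t - t') V*triHat D (t - t'))
    rw [norm_mul, ph_norm, one_mul, norm_real, norm_of_nonneg (triHat_nonneg _ _)] at e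
    linarith
  have key := halasz r ρ hρ0 d' ?_ U hUfin hUm κ hκ0 ?_
  · have e1 : ∀ t, ∑ n ∈ s, d n*ph t (log n) = ∑ n ∈ r, d' n*ph t (log n) := by
      intro t
      rw [← sum_subset hsr]
      · refine sum_congr rfl fun n hn => ?_
        simp [hd', hn]
      · intro n _ hn; simp [hd', hn]
    simp_rw [e1]
    refine key.trans ?_
    rw [mul_assoc]
    gcongr
    rw [← sum_subset hsr (fun n _ hn => by simp [hd', hn]), mul_sum]
    refine sum_le_sum fun n hn => ?_
    obtain ⟨a1, a2⟩ := hsle n hn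
    have hn0 : (0:ℝ) < n := mod_cast (hs n hn).1
    have hρp : 0 < ρ n := lt_of_lt_of_le (by positivity) a2
    simp only [hd', if_pos hn]
    rw [div_eq_inv_mul]
    gcongr
    rw [inv_le_comm₀ hρp (by positivity)]
    refine le_trans ?_ a2
    gcongr
  · intro n _ hdn
    have hn : n ∈ s := by by_contra hn; simp [hd', hn] at hdn
    have hn0 : (0:ℝ) < n := mod_cast (hs n hn).1
    exact lt_of_lt_of_le (by positivity) (hsle n hn).2
  · intro t ht
    have hKc : Continuous fun t' => ‖∑ n ∈ r, (ρ n:ℂ)*ph (t - t') (log n)‖ := by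
      refine Continuous.norm (continuous_finset_sum _ fun n _ => continuous_const.mul ?_)
      exact (ph_continuous _).comp (continuous_const.sub continuous_id)
    have ci : IntegrableOn (fun _:ℝ => C*exp (-c*V)) U := integrableOn_const hUfin
    have hKi : IntegrableOn (fun t' => ‖∑ n ∈ r, (ρ n:ℂ)*ph (t - t') (log n)‖) U :=
      (hKc.continuousOn.integrableOn_Icc (a := -T) (b := T)).mono_set hUT
    calc _ ≤ ∫ t' in U, (triHat D (t - t') + C*exp (-c*V)) :=
          setIntegral_mono_on hKi ((triI t).integrableOn.add ci) hUm fun t' ht' => hker t ht t' ht'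
      _ = (∫ t' in U, triHat D (t - t')) + C*exp (-c*V)*(volume U).toReal := by
          rw [integral_add (triI t).integrableOn ci]
          congr 1
          rw [setIntegral_const, smul_eq_mul, mul_comm]; rfl
      _ ≤ _ := by
          rw [hκ]
          gcongr
          rw [← triint t]
          exact setIntegral_le_integral (triI t) (Eventually.of_forall fun _ => triHat_nonneg _ _)

/-- Halasz-Montgomery for the twisted sums. -/
theorem HM_EE (D K:ℝ) (hD : 1 < D) (hK : 0 ≤ K) : ∃ c:ℝ, 0 < c ∧ ∃ C:ℝ, 0 < C ∧
    ∀ (q:ℕ) [NeZero q] (χ : DirichletCharacter ℂ q) (a : ZMod q) (V T:ℝ) (U : Set ℝ) (d:ℕ →₀ ℂ),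
    2*D + 2 ≤ V → U ⊆ Set.Icc (-T) T → MeasurableSet U → 2*T ≤ exp (K*V) →
    (∀ n ∈ d.support, 1 ≤ n ∧ |log n - V| ≤ D - 1) →
    ∫ t in U, ‖EE χ a t d‖ ^ 2 ≤
      (2*Real.pi*D + C*exp (-c*V)*(volume U).toReal)*exp (V + D)*∑ n ∈ d.support, ‖d n‖ ^ 2 := by
  obtain ⟨c, hc, C, hC, h⟩ := HM D K hD hK
  refine ⟨c, hc, C, hC, ?_⟩
  intro q _ χ a V T U d hV hU hUm hT hs
  have := h V T U (fun n => d n*kk χ a n) d.support hV hU hUm hT hs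
  have e : ∀ t, EE χ a t d = ∑ n ∈ d.support, d n*kk χ a n*ph t (log n) := by
    intro t; rw [EE_apply]; exact sum_congr rfl fun n _ => by ring
  simp_rw [e]
  refine this.trans ?_
  gcongr with n _
  rw [norm_mul]
  exact mul_le_of_le_one_right (norm_nonneg _) (kk_norm _ _ _)

lemma gcd_diag (x:ℕ → ℝ) (R:ℕ) :
    ∑ d ∈ Icc 1 R, ∑ e ∈ Icc 1 R, x d*x e*(Nat.gcd d e:ℝ) =
    ∑ g ∈ Icc 1 R, (Nat.totient g:ℝ)*(∑ d ∈ (Icc 1 R).filter (fun d => g ∣ d), x d) ^ 2 := by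
  have h1 : ∀ d ∈ Icc 1 R, ∀ e ∈ Icc 1 R, (Nat.gcd d e:ℝ) =
      ∑ g ∈ Icc 1 R, if g ∣ d ∧ g ∣ e then (Nat.totient g:ℝ) else 0 := by
    intro d hd e he
    rw [mem_Icc] at hd he
    have hpos : 0 < Nat.gcd d e := Nat.gcd_pos_of_pos_left _ hd.1
    conv_lhs => rw [← Nat.sum_totient (Nat.gcd d e)]
    rw [Nat.cast_sum, ← sum_filter]
    refine sum_congr ?_ fun _ _ => rfl
    ext g
    simp only [Nat.mem_divisors, mem_filter, mem_Icc]
    constructor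
    · rintro ⟨h, _⟩
      have h1 := h.trans (Nat.gcd_dvd_left d e)
      have h2 := h.trans (Nat.gcd_dvd_right d e)
      exact ⟨⟨Nat.pos_of_dvd_of_pos h1 hd.1, (Nat.le_of_dvd hd.1 h1).trans hd.2⟩, h1, h2⟩
    · rintro ⟨_, h1, h2⟩
      exact ⟨Nat.dvd_gcd h1 h2, hpos.ne'⟩
  calc _ = ∑ d ∈ Icc 1 R, ∑ e ∈ Icc 1 R, ∑ g ∈ Icc 1 R, x d*x e*(if g ∣ d ∧ g ∣ e then (Nat.totient g:ℝ) else 0) := by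
        refine sum_congr rfl fun d hd => sum_congr rfl fun e he => ?_
        rw [h1 d hd e he, mul_sum]
    _ = ∑ g ∈ Icc 1 R, ∑ d ∈ Icc 1 R, ∑ e ∈ Icc 1 R, x d*x e*(if g ∣ d ∧ g ∣ e then (Nat.totient g:ℝ) else 0) := by
        rw [sum_comm' (t' := Icc 1 R) (s' := fun _ => Icc 1 R) (by tauto)]
        rw [sum_comm]
        conv_rhs => rw [sum_comm]
        refine sum_congr rfl fun d hd => ?_
        rw [sum_comm]
    _ = _ := by
        refine sum_congr rfl fun g hg => ?_
        rw [sq, sum_mul_sum, mul_sum, sum_filter]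
        refine sum_congr rfl fun d hd => ?_
        by_cases hgd : g ∣ d
        · simp only [hgd, true_and, if_true]
          rw [mul_sum, sum_filter]
          refine sum_congr rfl fun e he => ?_
          split_ifs <;> ring
        · simp [hgd]

noncomputable def sfc (R q:ℕ) : Finset ℕ := (Icc 1 R).filter (fun l => Squarefree l ∧ l.Coprime q)

noncomputable def selS (R q:ℕ):ℝ := ∑ l ∈ sfc R q, (l:ℝ)⁻¹

noncomputable def lam (R q d:ℕ):ℝ :=
  (ArithmeticFunction.moebius d:ℝ)*d*(∑ l ∈ (sfc R q).filter (fun l => d ∣ l), (l:ℝ)⁻¹) / selS R q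

lemma selS_pos {R:ℕ} (hR : 1 ≤ R) (q:ℕ) : 0 < selS R q := by
  unfold selS
  refine sum_pos' (fun l _ => by positivity) ⟨1, ?_, by norm_num⟩
  simp [sfc, hR]

lemma lam_one {R:ℕ} (hR : 1 ≤ R) (q:ℕ) : lam R q 1 = 1 := by
  have := selS_pos hR q
  unfold lam
  simp only [one_dvd, filter_true, ArithmeticFunction.moebius_apply_one]
  rw [← selS]; field_simp; simp

lemma lam_supp {R q d:ℕ} (h : lam R q d ≠ 0) : d ∈ Icc 1 R ∧ d.Coprime q := by
  unfold lam at h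
  have h2 : (∑ l ∈ (sfc R q).filter (fun l => d ∣ l), (l:ℝ)⁻¹) ≠ 0 := by
    intro h0; rw [h0] at h; simp at h
  obtain ⟨l, hl, _⟩ := exists_ne_zero_of_sum_ne_zero h2
  simp only [sfc, mem_filter, mem_Icc] at hl
  obtain ⟨⟨⟨a, b⟩, _, c⟩, e⟩ := hl
  refine ⟨mem_Icc.mpr ⟨Nat.pos_of_dvd_of_pos e a, (Nat.le_of_dvd a e).trans b⟩, Nat.Coprime.coprime_dvd_left e c⟩

lemma lam_le {R:ℕ} (hR : 1 ≤ R) (q d:ℕ) : |lam R q d| ≤ 1 := by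
  have hS := selS_pos hR q
  by_cases hd : d ∈ Icc 1 R
  swap
  · have : lam R q d = 0 := by by_contra h; exact hd (lam_supp h).1
    rw [this]; simp
  rw [mem_Icc] at hd
  unfold lam
  rw [abs_div, abs_of_pos hS, div_le_one hS, abs_mul, abs_mul]
  have hmu : |(ArithmeticFunction.moebius d:ℝ)| ≤ 1 := by
    have := ArithmeticFunction.abs_moebius_le_one (n := d)
    exact_mod_cast this
  have h0 : 0 ≤ ∑ l ∈ (sfc R q).filter (fun l => d ∣ l), (l:ℝ)⁻¹ := sum_nonneg fun _ _ => by positivity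
  rw [abs_of_nonneg h0, Nat.abs_cast]
  calc _ ≤ 1*(d:ℝ)*∑ l ∈ (sfc R q).filter (fun l => d ∣ l), (l:ℝ)⁻¹ := by gcongr
    _ = ∑ l ∈ (sfc R q).filter (fun l => d ∣ l), ((l / d:ℕ):ℝ)⁻¹ := by
        rw [one_mul, mul_sum]
        refine sum_congr rfl fun l hl => ?_
        obtain ⟨k, rfl⟩ := (mem_filter.mp hl).2
        have hd0 : (d:ℝ) ≠ 0 := mod_cast (by omega : d ≠ 0)
        rw [Nat.mul_div_cancel_left _ hd.1]
        push_cast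
        rw [mul_inv, ← mul_assoc, mul_inv_cancel₀ hd0, one_mul]
    _ = ∑ k ∈ ((sfc R q).filter (fun l => d ∣ l)).image (fun l => l / d), (k:ℝ)⁻¹ := by
        rw [sum_image]
        intro a ha b hb hab
        simp only [coe_filter, Set.mem_setOf_eq] at ha hb
        simp only at hab
        rw [← Nat.div_mul_cancel ha.2, ← Nat.div_mul_cancel hb.2, hab]
    _ ≤ _ := by
        unfold selS
        refine sum_le_sum_of_subset_of_nonneg ?_ fun _ _ _ => by positivity
        intro k hk
        simp only [mem_image, mem_filter] at hk
        obtain ⟨l, ⟨hl, hdl⟩, rfl⟩ := hk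
        simp only [sfc, mem_filter, mem_Icc] at hl ⊢
        have hdv := Nat.div_dvd_of_dvd hdl
        refine ⟨⟨Nat.div_pos (Nat.le_of_dvd hl.1.1 hdl) hd.1, (Nat.div_le_self _ _).trans hl.1.2⟩, hl.2.1.squarefree_of_dvd hdv, Nat.Coprime.coprime_dvd_left hdv hl.2.2⟩

lemma mu_sum_mult {l m:ℕ} (hm : Squarefree m) (hlm : l ∣ m) :
    ∑ d ∈ m.divisors.filter (fun d => l ∣ d), (ArithmeticFunction.moebius d:ℤ) = if m = l then ArithmeticFunction.moebius l else 0 := by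
  obtain ⟨k, rfl⟩ := hlm
  have hlk : Nat.Coprime l k := Nat.coprime_of_squarefree_mul hm
  have hl0 : l ≠ 0 := by rintro rfl; simp at hm
  have hk0 : k ≠ 0 := by rintro rfl; simp at hm
  have e : (l*k).divisors.filter (fun d => l ∣ d) = k.divisors.image (fun d => l*d) := by
    ext d
    simp only [mem_filter, Nat.mem_divisors, mem_image]
    constructor
    · rintro ⟨⟨h1, _⟩, j, rfl⟩
      exact ⟨j, ⟨Nat.dvd_of_mul_dvd_mul_left (Nat.pos_of_ne_zero hl0) h1, hk0⟩, rfl⟩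
    · rintro ⟨j, ⟨h1, _⟩, rfl⟩
      exact ⟨⟨Nat.mul_dvd_mul_left l h1, mul_ne_zero hl0 hk0⟩, Dvd.intro _ rfl⟩
  rw [e, sum_image (fun a _ b _ h => Nat.eq_of_mul_eq_mul_left (Nat.pos_of_ne_zero hl0) h)]
  have : ∑ d ∈ k.divisors, (ArithmeticFunction.moebius (l*d):ℤ) = ArithmeticFunction.moebius l*∑ d ∈ k.divisors, (ArithmeticFunction.moebius d:ℤ) := by
    rw [mul_sum]
    refine sum_congr rfl fun d hd => ?_
    exact ArithmeticFunction.isMultiplicative_moebius.map_mul_of_coprime (Nat.Coprime.coprime_dvd_right (Nat.dvd_of_mem_divisors hd) hlk)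
  have hz : ∑ d ∈ k.divisors, (ArithmeticFunction.moebius d:ℤ) = if k = 1 then 1 else 0 := by
    rw [← ArithmeticFunction.coe_zeta_mul_apply, ArithmeticFunction.coe_zeta_mul_moebius, ArithmeticFunction.one_apply]
  rw [this, hz]
  by_cases hk : k = 1
  · simp [hk]
  · rw [if_neg hk, if_neg, mul_zero]
    intro h
    exact hk (Nat.eq_of_mul_eq_mul_left (Nat.pos_of_ne_zero hl0) (by rw [h, mul_one]))

lemma lam_y {R:ℕ} (hR : 1 ≤ R) (q l:ℕ) (hl : l ∈ Icc 1 R) :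
    ∑ d ∈ (Icc 1 R).filter (fun d => l ∣ d), lam R q d*(d:ℝ)⁻¹ =
      if l ∈ sfc R q then (ArithmeticFunction.moebius l:ℝ)*(l:ℝ)⁻¹ / selS R q else 0 := by
  have h1 : ∀ d ∈ (Icc 1 R).filter (fun d => l ∣ d), lam R q d*(d:ℝ)⁻¹ =
      ∑ m ∈ sfc R q, if d ∣ m then (ArithmeticFunction.moebius d:ℝ)*(m:ℝ)⁻¹ / selS R q else 0 := by
    intro d hd
    have hd0 : (d:ℝ) ≠ 0 := by
      have := (mem_Icc.mp (mem_filter.mp hd).1).1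
      exact_mod_cast (by omega : d ≠ 0)
    unfold lam
    rw [← sum_filter, ← sum_div, ← mul_sum]
    field_simp
  rw [sum_congr rfl h1, sum_comm]
  have h2 : ∀ m ∈ sfc R q, (∑ d ∈ (Icc 1 R).filter (fun d => l ∣ d), if d ∣ m then (ArithmeticFunction.moebius d:ℝ)*(m:ℝ)⁻¹ / selS R q else 0)
      = if m = l then (ArithmeticFunction.moebius l:ℝ)*(l:ℝ)⁻¹ / selS R q else 0 := by
    intro m hm
    simp only [sfc, mem_filter, mem_Icc] at hm
    rw [← sum_filter, ← sum_div, ← sum_mul]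
    by_cases hlm : l ∣ m
    · have e : (((Icc 1 R).filter (fun d => l ∣ d)).filter (fun d => d ∣ m)) = m.divisors.filter (fun d => l ∣ d) := by
        ext d
        simp only [mem_filter, mem_Icc, Nat.mem_divisors]
        constructor
        · rintro ⟨⟨_, a⟩, b⟩; exact ⟨⟨b, by omega⟩, a⟩
        · rintro ⟨⟨b, _⟩, a⟩; exact ⟨⟨⟨Nat.pos_of_dvd_of_pos b hm.1.1, (Nat.le_of_dvd hm.1.1 b).trans hm.1.2⟩, a⟩, b⟩
      rw [e]
      have := mu_sum_mult hm.2.1 hlm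
      have h3 : (∑ d ∈ m.divisors.filter (fun d => l ∣ d), (ArithmeticFunction.moebius d:ℝ)) = if m = l then (ArithmeticFunction.moebius l:ℝ) else 0 := by
        have := congrArg (fun z:ℤ => (z:ℝ)) this
        simp only [Int.cast_sum] at this
        rw [this]; split_ifs <;> simp
      rw [h3]
      split_ifs with h
      · rw [h]
      · simp
    · have e : (((Icc 1 R).filter (fun d => l ∣ d)).filter (fun d => d ∣ m)) = ∅ := by
        rw [filter_eq_empty_iff]
        intro d hd h
        exact hlm ((mem_filter.mp hd).2.trans h)
      rw [e, if_neg]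
      · simp
      · rintro rfl; exact hlm dvd_rfl
  rw [sum_congr rfl h2, sum_ite_eq']

lemma inv_lcm {d e:ℕ} (hd : 1 ≤ d) (he : 1 ≤ e) : ((Nat.lcm d e:ℕ):ℝ)⁻¹ = (d:ℝ)⁻¹*(e:ℝ)⁻¹*(Nat.gcd d e:ℝ) := by
  have h : (Nat.gcd d e:ℝ)*(Nat.lcm d e:ℝ) = d*e := mod_cast Nat.gcd_mul_lcm d e
  have h1 : (d:ℝ) ≠ 0 := mod_cast (by omega : d ≠ 0)
  have h2 : (e:ℝ) ≠ 0 := mod_cast (by omega : e ≠ 0)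
  have h3 : (Nat.lcm d e:ℝ) ≠ 0 := mod_cast Nat.lcm_ne_zero (by omega) (by omega)
  field_simp
  linarith

lemma sel_quad {R:ℕ} (hR : 1 ≤ R) (q:ℕ) :
    0 ≤ ∑ d ∈ Icc 1 R, ∑ e ∈ Icc 1 R, lam R q d*lam R q e*((Nat.lcm d e:ℕ):ℝ)⁻¹ ∧
    ∑ d ∈ Icc 1 R, ∑ e ∈ Icc 1 R, lam R q d*lam R q e*((Nat.lcm d e:ℕ):ℝ)⁻¹ ≤ 1 / selS R q := by
  have hS := selS_pos hR q
  have h := gcd_diag (fun d => lam R q d*(d:ℝ)⁻¹) R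
  have e1 : ∑ d ∈ Icc 1 R, ∑ e ∈ Icc 1 R, lam R q d*lam R q e*((Nat.lcm d e:ℕ):ℝ)⁻¹ =
     ∑ d ∈ Icc 1 R, ∑ e ∈ Icc 1 R, lam R q d*(d:ℝ)⁻¹*(lam R q e*(e:ℝ)⁻¹)*(Nat.gcd d e:ℝ) := by
    refine sum_congr rfl fun d hd => sum_congr rfl fun e he => ?_
    rw [inv_lcm (mem_Icc.mp hd).1 (mem_Icc.mp he).1]; ring
  rw [e1, h]
  refine ⟨sum_nonneg fun _ _ => by positivity, ?_⟩
  calc _ ≤ ∑ l ∈ Icc 1 R, if l ∈ sfc R q then (l:ℝ)⁻¹ / selS R q ^ 2 else 0 := by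
        refine sum_le_sum fun l hl => ?_
        rw [lam_y hR q l hl]
        split_ifs with hm
        · simp only [sfc, mem_filter, mem_Icc] at hm
          have hl0 : (0:ℝ) < l := mod_cast hm.1.1
          have hmu : (ArithmeticFunction.moebius l:ℝ) ^ 2 = 1 := mod_cast ArithmeticFunction.moebius_sq_eq_one_of_squarefree hm.2.1
          rw [div_pow, mul_pow, hmu, one_mul, ← mul_div_assoc]
          have ht : (Nat.totient l:ℝ) ≤ l := mod_cast Nat.totient_le l
          gcongr
          calc (Nat.totient l:ℝ)*((l:ℝ)⁻¹) ^ 2 ≤ l*((l:ℝ)⁻¹) ^ 2 := by gcongr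
            _ = _ := by field_simp
        · simp
    _ = 1 / selS R q := by
        rw [← sum_filter, ← sum_div]
        have : (Icc 1 R).filter (fun l => l ∈ sfc R q) = sfc R q := by
          ext l; simp only [sfc, mem_filter]; tauto
        rw [this, ← selS]; field_simp

lemma lcm_sum (R:ℕ) :
    ∑ d ∈ Icc 1 R, ∑ e ∈ Icc 1 R, ((Nat.lcm d e:ℕ):ℝ)⁻¹ ≤ (∑ d ∈ Icc 1 R, (d:ℝ)⁻¹) ^ 3 := by
  have h := gcd_diag (fun d => (d:ℝ)⁻¹) R
  have e1 : ∑ d ∈ Icc 1 R, ∑ e ∈ Icc 1 R, ((Nat.lcm d e:ℕ):ℝ)⁻¹ =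
     ∑ d ∈ Icc 1 R, ∑ e ∈ Icc 1 R, (d:ℝ)⁻¹*(e:ℝ)⁻¹*(Nat.gcd d e:ℝ) := by
    refine sum_congr rfl fun d hd => sum_congr rfl fun e he => ?_
    rw [inv_lcm (mem_Icc.mp hd).1 (mem_Icc.mp he).1]
  rw [e1, h]
  set T := ∑ d ∈ Icc 1 R, (d:ℝ)⁻¹ with hT
  have hT0 : 0 ≤ T := sum_nonneg fun _ _ => by positivity
  have key : ∀ g ∈ Icc 1 R, ∑ d ∈ (Icc 1 R).filter (fun d => g ∣ d), (d:ℝ)⁻¹ ≤ (g:ℝ)⁻¹*T := by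
    intro g hg
    have hg1 := (mem_Icc.mp hg).1
    calc _ ≤ ∑ d ∈ (Icc 1 R).image (fun k => g*k), (d:ℝ)⁻¹ := by
          refine sum_le_sum_of_subset_of_nonneg ?_ fun _ _ _ => by positivity
          intro d hd
          simp only [mem_filter, mem_Icc, mem_image] at hd ⊢
          obtain ⟨⟨a, b⟩, k, rfl⟩ := hd
          exact ⟨k, ⟨Nat.pos_of_mul_pos_left a, (Nat.le_mul_of_pos_left k hg1).trans b⟩, rfl⟩
      _ = _ := by
          rw [sum_image (fun a _ b _ h => Nat.eq_of_mul_eq_mul_left hg1 h), hT, mul_sum]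
          refine sum_congr rfl fun k _ => ?_
          push_cast; rw [mul_inv]
  calc _ ≤ ∑ g ∈ Icc 1 R, (g:ℝ)*((g:ℝ)⁻¹*T) ^ 2 := by
        refine sum_le_sum fun g hg => ?_
        have ht : (Nat.totient g:ℝ) ≤ g := mod_cast Nat.totient_le g
        have h0 : 0 ≤ ∑ d ∈ (Icc 1 R).filter (fun d => g ∣ d), (d:ℝ)⁻¹ := sum_nonneg fun _ _ => by positivity
        gcongr
        exact key g hg
    _ = T ^ 3 := by
        rw [show T ^ 3 = T*T ^ 2 by ring]
        conv_rhs => rw [hT, sum_mul]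
        refine sum_congr rfl fun g hg => ?_
        have : (g:ℝ) ≠ 0 := by
          have := (mem_Icc.mp hg).1
          exact_mod_cast (by omega : g ≠ 0)
        rw [← hT]; field_simp

lemma selS_lower (R:ℕ) {q:ℕ} (hq : 0 < q) : ∑ n ∈ Icc 1 R, (n:ℝ)⁻¹ ≤ 2*q*selS R q := by
  have hmap : ∀ n ∈ Icc 1 R, ∃ s g l:ℕ, n = s ^ 2*(g*l) ∧ s ∈ Icc 1 R ∧ g ∈ Icc 1 q ∧ l ∈ sfc R q := by
    intro n hn
    rw [mem_Icc] at hn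
    obtain ⟨a, b, hab, ha⟩ := Nat.sq_mul_squarefree n
    have hb0 : 0 < b := by rcases Nat.eq_zero_or_pos b with h | h; · subst h; simp at hab; omega
                           · exact h
    have ha0 : 0 < a := by rcases Nat.eq_zero_or_pos a with h | h; · subst h; simp at hab; omega
                           · exact h
    refine ⟨b, a.gcd q, a / a.gcd q, ?_, ?_, ?_, ?_⟩
    · rw [Nat.mul_div_cancel' (Nat.gcd_dvd_left a q), hab]
    · rw [mem_Icc]; refine ⟨hb0, ?_⟩
      nlinarith
    · rw [mem_Icc]; exact ⟨Nat.gcd_pos_of_pos_right _ hq, Nat.gcd_le_right _ hq⟩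
    · have hg := Nat.gcd_dvd_left a q
      have hdv : a / a.gcd q ∣ a := Nat.div_dvd_of_dvd hg
      simp only [sfc, mem_filter, mem_Icc]
      refine ⟨⟨Nat.div_pos (Nat.le_of_dvd ha0 hg) (Nat.gcd_pos_of_pos_right _ hq), (Nat.div_le_self _ _).trans ?_⟩, ha.squarefree_of_dvd hdv, ?_⟩
      · nlinarith [Nat.one_le_pow 2 b hb0]
      · have hc : Nat.Coprime (a.gcd q) (a / a.gcd q) := by
          apply Nat.coprime_of_squarefree_mul
          rw [Nat.mul_div_cancel' hg]; exact ha
        rw [Nat.coprime_iff_gcd_eq_one]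
        set k := Nat.gcd (a / a.gcd q) q with hk
        have h1 : k ∣ a / a.gcd q := Nat.gcd_dvd_left _ _
        have h2 : k ∣ a.gcd q := Nat.dvd_gcd (h1.trans hdv) (Nat.gcd_dvd_right _ _)
        exact Nat.eq_one_of_dvd_coprimes hc h2 h1
  have hsq : ∑ s ∈ Icc 1 R, ((s:ℝ)⁻¹) ^ 2 ≤ 2 := by
    have := sum_Ioc_inv_sq_le_sub (α := ℝ) (k := 1) (n := R)
    rcases Nat.eq_zero_or_pos R with h | h
    · subst h; simp
    · have h2 := this one_ne_zero h
      rw [← Ioc_insert_left h, sum_insert (by simp)]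
      have h3 : (0:ℝ) ≤ (R:ℝ)⁻¹ := by positivity
      simp only [inv_pow]
      simp only [Nat.cast_one, inv_one] at h2
      norm_num
      linarith
  choose! s g l h using hmap
  calc _ = ∑ n ∈ Icc 1 R, ((s n:ℝ)⁻¹) ^ 2*((g n:ℝ)⁻¹*(l n:ℝ)⁻¹) := by
        refine sum_congr rfl fun n hn => ?_
        conv_lhs => rw [(h n hn).1]
        push_cast; rw [mul_inv, mul_inv, inv_pow]
    _ = ∑ x ∈ (Icc 1 R).image (fun n => (s n, g n, l n)), ((x.1:ℝ)⁻¹) ^ 2*((x.2.1:ℝ)⁻¹*(x.2.2:ℝ)⁻¹) := by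
        rw [sum_image]
        intro a ha b hb hab
        simp only [Prod.mk.injEq] at hab
        rw [(h a ha).1, (h b hb).1, hab.1, hab.2.1, hab.2.2]
    _ ≤ ∑ x ∈ (Icc 1 R) ×ˢ ((Icc 1 q) ×ˢ sfc R q), ((x.1:ℝ)⁻¹) ^ 2*((x.2.1:ℝ)⁻¹*(x.2.2:ℝ)⁻¹) := by
        refine sum_le_sum_of_subset_of_nonneg ?_ fun _ _ _ => by positivity
        intro x hx
        obtain ⟨n, hn, rfl⟩ := mem_image.mp hx
        obtain ⟨_, a, b, c⟩ := h n hn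
        simp only [mem_product]; exact ⟨a, b, c⟩
    _ = (∑ s ∈ Icc 1 R, ((s:ℝ)⁻¹) ^ 2)*((∑ g ∈ Icc 1 q, (g:ℝ)⁻¹)*selS R q) := by
        rw [sum_product, sum_mul]
        refine sum_congr rfl fun s _ => ?_
        rw [sum_product, selS, sum_mul_sum, mul_sum]
        refine sum_congr rfl fun g _ => ?_
        rw [mul_sum]
    _ ≤ 2*(q*selS R q) := by
        have hS : 0 ≤ selS R q := sum_nonneg fun _ _ => by positivity
        have hg : ∑ g ∈ Icc 1 q, (g:ℝ)⁻¹ ≤ q := by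
          calc _ ≤ ∑ g ∈ Icc 1 q, (1:ℝ) := sum_le_sum fun g hg => inv_le_one_of_one_le₀ (mod_cast (mem_Icc.mp hg).1)
            _ = q := by simp
        gcongr
    _ = _ := by ring

lemma mem_Ico_ceil {N N':ℝ} {m:ℕ} : m ∈ Ico ⌈N⌉₊ ⌈N'⌉₊ ↔ N ≤ m ∧ (m:ℝ) < N' := by
  rw [mem_Ico, Nat.ceil_le, Nat.lt_ceil]

lemma ap_shift (K:ℝ) (hK : 0 ≤ K) : ∃ c:ℝ, 0 < c ∧ c ≤ 1 ∧ ∃ C:ℝ, 0 < C ∧ ∀ (s Z Z' u:ℝ), 0 ≤ s → s < 1 → 1 ≤ Z → Z ≤ Z' →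
    |u| ≤ Z ^ K → ‖∑ n ∈ Ico ⌈Z - s⌉₊ ⌈Z' - s⌉₊, (((n + s)⁻¹:ℝ):ℂ)*ph u (log (n + s)) - ∫ y in (log Z)..(log Z'), ph u y‖ ≤ C*Z ^ (-c) := by
  obtain ⟨c, hc, hc1, C, hC, h⟩ := Er_sum K hK
  refine ⟨c, hc, hc1, C + 2, by linarith, ?_⟩
  intro s Z Z' u hs hs1 hZ hZZ hu
  set n0 := ⌈Z - s⌉₊ with hn0
  set n1 := ⌈Z' - s⌉₊ with hn1
  have hle : n0 ≤ n1 := Nat.ceil_mono (by linarith)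
  have a1 : Z ≤ n0 + s := by have := Nat.le_ceil (Z - s); linarith
  have a2 : (n0:ℝ) + s ≤ Z + 1 := by have := Nat.ceil_lt_add_one (show 0 ≤ Z - s by linarith); linarith
  have b1 : Z' ≤ n1 + s := by have := Nat.le_ceil (Z' - s); linarith
  have b2 : (n1:ℝ) + s ≤ Z' + 1 := by have := Nat.ceil_lt_add_one (show 0 ≤ Z' - s by linarith); linarith
  set x0:ℝ := n0 + s with hx0
  have hx1 : 1 ≤ x0 := by linarith
  have e1 : ∑ n ∈ Ico n0 n1, (((n + s)⁻¹:ℝ):ℂ)*ph u (log (n + s)) = ∑ n ∈ range (n1 - n0), (((x0 + n)⁻¹:ℝ):ℂ)*ph u (log (x0 + n)) := by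
    rw [sum_Ico_eq_sum_range]
    refine sum_congr rfl fun n _ => ?_
    have : ((n0 + n:ℕ):ℝ) + s = x0 + n := by push_cast; rw [hx0]; ring
    rw [this]
  have e2 : x0 + ((n1 - n0:ℕ):ℝ) = n1 + s := by rw [Nat.cast_sub hle, hx0]; ring
  have k1 := h (n1 - n0) x0 u hx1 (hu.trans (rpow_le_rpow (by linarith) a1 hK))
  rw [Er_int u x0 (by linarith), ← e1, e2] at k1
  have hpow : x0 ^ (-c) ≤ Z ^ (-c) := rpow_le_rpow_of_nonpos (by linarith) a1 (by linarith)
  have hinv : Z⁻¹ ≤ Z ^ (-c) := by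
    rw [← rpow_neg_one]
    exact rpow_le_rpow_of_exponent_le hZ (by linarith)
  have small : ∀ w w':ℝ, Z ≤ w → w ≤ w' → w' ≤ w + 1 → ‖∫ y in (log w)..(log w'), ph u y‖ ≤ Z ^ (-c) := by
    intro w w' h1 h2 h3
    have := intervalIntegral.norm_integral_le_of_norm_le_const (f := ph u) (a := log w) (b := log w') (C := 1) (fun y _ => (ph_norm _ _).le)
    refine this.trans ?_
    rw [one_mul]
    have l1 := log_le_log (by linarith : 0 < w) h2
    have l2 := log_le_log (by linarith : 0 < w') h3
    have l3 := (log_add_one_sub w (by linarith)).2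
    rw [abs_of_nonneg (by linarith)]
    have : w⁻¹ ≤ Z⁻¹ := inv_anti₀ (by linarith) h1
    linarith
  have s1 := small Z x0 le_rfl a1 a2
  have s2 := small Z' (n1 + s) hZZ b1 b2
  have e3 : ∫ y in (log Z)..(log Z'), ph u y = (∫ y in (log Z)..(log x0), ph u y) + (∫ y in (log x0)..(log (n1 + s)), ph u y) - ∫ y in (log Z')..(log (n1 + s)), ph u y := by
    rw [intervalIntegral.integral_add_adjacent_intervals (ph_ii _ _ _) (ph_ii _ _ _), ← intervalIntegral.integral_add_adjacent_intervals (ph_ii u (log Z) (log Z')) (ph_ii u (log Z') (log (n1 + s)))]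
    ring
  rw [e3]
  set A := ∑ n ∈ Ico n0 n1, (((n + s)⁻¹:ℝ):ℂ)*ph u (log (n + s))
  calc _ = ‖(A - ∫ y in (log x0)..(log (n1 + s)), ph u y) - (∫ y in (log Z)..(log x0), ph u y) + ∫ y in (log Z')..(log (n1 + s)), ph u y‖ := by congr 1; ring
    _ ≤ ‖A - ∫ y in (log x0)..(log (n1 + s)), ph u y‖ + ‖∫ y in (log Z)..(log x0), ph u y‖ + ‖∫ y in (log Z')..(log (n1 + s)), ph u y‖ :=
        (norm_add_le _ _).trans (by gcongr; exact norm_sub_le _ _)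
    _ ≤ C*Z ^ (-c) + Z ^ (-c) + Z ^ (-c) := by
        gcongr
        exact k1.trans (by gcongr)
    _ = _ := by ring

lemma ph_int_shift (u a b d:ℝ) : ph u d*∫ y in (a - d)..(b - d), ph u y = ∫ y in a..b, ph u y := by
  rw [← intervalIntegral.integral_const_mul, ← intervalIntegral.integral_comp_sub_right (fun y => ph u d*ph u y)]
  refine intervalIntegral.integral_congr fun y _ => ?_
  rw [← ph_add]; ring_nf

lemma ap_per (K:ℝ) (hK : 0 ≤ K) : ∃ c:ℝ, 0 < c ∧ c ≤ 1 ∧ ∃ C:ℝ, 0 < C ∧ ∀ (q:ℕ) [NeZero q] (f : ZMod q → ℂ) (Y Y' u:ℝ), (∀ x, ‖f x‖ ≤ 1) → q ≤ Y → Y ≤ Y' →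
    |u| ≤ (Y/q) ^ K → ‖∑ n ∈ Ico ⌈Y⌉₊ ⌈Y'⌉₊, f n*((((n:ℝ))⁻¹:ℝ)*ph u (log n)) - ((q:ℂ)⁻¹*∑ x, f x)*∫ y in (log Y)..(log Y'), ph u y‖ ≤ C*(Y/q) ^ (-c) := by
  obtain ⟨c, hc, hc1, C, hC, h⟩ := ap_shift K hK
  refine ⟨c, hc, hc1, C, hC, ?_⟩
  intro q _ f Y Y' u hf hY hYY hu
  have hq : (0:ℝ) < q := mod_cast NeZero.pos q
  have hq1 : (1:ℝ) ≤ q := mod_cast NeZero.pos q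
  have hqn : 0 < q := NeZero.pos q
  set J := ∫ y in (log Y)..(log Y'), ph u y with hJ
  have hsumx : ∑ x, f x = ∑ a ∈ range q, f (a : ZMod q) := by
    rw [sum_range]
    obtain ⟨k, rfl⟩ := Nat.exists_eq_succ_of_ne_zero hqn.ne'
    refine sum_congr rfl fun a _ => ?_
    congr 1
    exact (Fin.cast_val_eq_self a).symm
  have hres : ∀ a ∈ range q, ‖∑ n ∈ (Ico ⌈Y⌉₊ ⌈Y'⌉₊).filter (fun n => n % q = a), f n*((((n:ℝ))⁻¹:ℝ)*ph u (log n)) - f a*((q:ℂ)⁻¹*J)‖ ≤ (q:ℝ)⁻¹*(C*(Y/q) ^ (-c)) := by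
    intro a ha
    have haq : a < q := mem_range.mp ha
    have haq' : (a:ℝ) < q := mod_cast haq
    have hk := h (a/q) (Y/q) (Y'/q) u (by positivity) (by rwa [div_lt_one hq]) (by rwa [le_div_iff₀ hq, one_mul]) (by gcongr) hu
    have hbij : ∑ n ∈ (Ico ⌈Y⌉₊ ⌈Y'⌉₊).filter (fun n => n % q = a), f n*((((n:ℝ))⁻¹:ℝ)*ph u (log n)) =
        ∑ n ∈ Ico ⌈Y/q - a/q⌉₊ ⌈Y'/q - a/q⌉₊, f a*((q:ℂ)⁻¹*ph u (log q)*((((n + (a:ℝ)/q)⁻¹:ℝ):ℂ)*ph u (log (n + a/q)))) := by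
      symm
      refine sum_bij (fun n _ => q*n + a) ?_ ?_ ?_ ?_
      · intro n hn
        rw [mem_Ico_ceil] at hn
        rw [mem_filter, mem_Ico_ceil]
        refine ⟨⟨?_, ?_⟩, ?_⟩
        · have := hn.1; rw [← sub_div, div_le_iff₀ hq] at this; push_cast; linarith
        · have := hn.2; rw [← sub_div, lt_div_iff₀ hq] at this; push_cast; linarith
        · rw [Nat.mul_add_mod, Nat.mod_eq_of_lt haq]
      · intro n _ m _ hnm
        exact Nat.eq_of_mul_eq_mul_left hqn (by omega)
      · intro m hm
        rw [mem_filter, mem_Ico_ceil] at hm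
        have hdm := Nat.div_add_mod m q
        rw [hm.2] at hdm
        refine ⟨m / q, ?_, hdm⟩
        have hdm' : (q:ℝ)*((m/q:ℕ):ℝ) + a = m := mod_cast hdm
        rw [mem_Ico_ceil]
        constructor
        · rw [← sub_div, div_le_iff₀ hq]; linarith [hm.1.1]
        · rw [← sub_div, lt_div_iff₀ hq]; linarith [hm.1.2]
      · intro n hn
        rw [mem_Ico_ceil] at hn
        have hpos : (0:ℝ) < n + a/q := by
          have : 1 ≤ Y / q := by rwa [le_div_iff₀ hq, one_mul]
          linarith [hn.1]
        have ecast : ((q*n + a:ℕ):ℝ) = q*(n + a/q) := by push_cast; field_simp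
        rw [ecast, log_mul hq.ne' hpos.ne', ph_add]
        have : ((q*n + a:ℕ) : ZMod q) = (a : ZMod q) := by push_cast; simp
        rw [this]; push_cast; rw [mul_inv]; ring
    rw [hbij, ← mul_sum, ← mul_sum]
    have hJs : J = ph u (log q)*∫ y in (log (Y/q))..(log (Y'/q)), ph u y := by
      rw [log_div (by linarith) hq.ne', log_div (by linarith) hq.ne', ph_int_shift]
    rw [hJs]
    set B := ∑ n ∈ Ico ⌈Y/q - a/q⌉₊ ⌈Y'/q - a/q⌉₊, (((n + (a:ℝ)/q)⁻¹:ℝ):ℂ)*ph u (log (n + a/q))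
    set J' := ∫ y in (log (Y/q))..(log (Y'/q)), ph u y
    have : f a*((q:ℂ)⁻¹*ph u (log q)*B) - f a*((q:ℂ)⁻¹*(ph u (log q)*J')) = f a*((q:ℂ)⁻¹*(ph u (log q)*(B - J'))) := by ring
    rw [this, norm_mul, norm_mul, norm_mul, ph_norm, one_mul, norm_inv, Complex.norm_natCast]
    calc _ ≤ 1*((q:ℝ)⁻¹*(C*(Y/q) ^ (-c))) := by gcongr; exact hf _
      _ = _ := one_mul _
  rw [← sum_fiberwise_of_maps_to (g := fun n => n % q) (t := range q) (fun n _ => mem_range.mpr (Nat.mod_lt _ hqn)), hsumx]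
  have : ((q:ℂ)⁻¹*∑ a ∈ range q, f (a : ZMod q))*J = ∑ a ∈ range q, f a*((q:ℂ)⁻¹*J) := by
    rw [← sum_mul]; ring
  rw [this, ← sum_sub_distrib]
  refine (norm_sum_le_of_le _ hres).trans (le_of_eq ?_)
  rw [sum_const, card_range, nsmul_eq_mul]
  field_simp

lemma ap_main (K:ℝ) (hK : 0 ≤ K) : ∃ c:ℝ, 0 < c ∧ c ≤ 1 ∧ ∃ C:ℝ, 0 < C ∧ ∀ (q:ℕ) [NeZero q] (f : ZMod q → ℂ) (e:ℕ) (N N' u:ℝ), (∀ x, ‖f x‖ ≤ 1) →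
    0 < e → e.Coprime q → q ≤ N / e → N ≤ N' →
    |u| ≤ (N/e/q) ^ K → ‖∑ n ∈ Ico ⌈N⌉₊ ⌈N'⌉₊, (if e ∣ n then f n*((((n:ℝ))⁻¹:ℝ)*ph u (log n)) else 0) - (e:ℂ)⁻¹*(((q:ℂ)⁻¹*∑ x, f x)*∫ y in (log N)..(log N'), ph u y)‖ ≤ (e:ℝ)⁻¹*(C*(N/e/q) ^ (-c)) := by
  obtain ⟨c, hc, hc1, C, hC, h⟩ := ap_per K hK
  refine ⟨c, hc, hc1, C, hC, ?_⟩
  intro q _ f e N N' u hf he heq hN hNN hu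
  have he' : (0:ℝ) < e := mod_cast he
  have hq1 : (1:ℝ) ≤ q := mod_cast NeZero.pos q
  have hNe : 0 < N / e := by linarith
  have hN0 : 0 < N := by rw [lt_div_iff₀ he', zero_mul] at hNe; exact hNe
  have hk := h q (fun x => f (e*x)) (N/e) (N'/e) u (fun x => hf _) hN (by gcongr) hu
  have hsum : ∑ x : ZMod q, f (e*x) = ∑ x, f x := by
    let un := ZMod.unitOfCoprime e heq
    have := Fintype.sum_equiv (Units.mulLeft un) (fun x => f (e*x)) f (fun x => by
      simp [un, Units.mulLeft])
    exact this
  rw [hsum] at hk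
  have hbij : ∑ n ∈ Ico ⌈N⌉₊ ⌈N'⌉₊, (if e ∣ n then f n*((((n:ℝ))⁻¹:ℝ)*ph u (log n)) else 0) =
      (e:ℂ)⁻¹*ph u (log e)*∑ n ∈ Ico ⌈N/e⌉₊ ⌈N'/e⌉₊, f (e*n)*((((n:ℝ))⁻¹:ℝ)*ph u (log n)) := by
    rw [← sum_filter, mul_sum]
    symm
    refine sum_bij (fun n _ => e*n) ?_ ?_ ?_ ?_
    · intro n hn
      rw [mem_Ico_ceil] at hn
      rw [mem_filter, mem_Ico_ceil]
      refine ⟨⟨?_, ?_⟩, Dvd.intro _ rfl⟩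
      · have := hn.1; rw [div_le_iff₀ he'] at this; push_cast; linarith
      · have := hn.2; rw [lt_div_iff₀ he'] at this; push_cast; linarith
    · intro n _ m _ hnm
      exact Nat.eq_of_mul_eq_mul_left he hnm
    · intro m hm
      rw [mem_filter, mem_Ico_ceil] at hm
      obtain ⟨⟨h1, h2⟩, k, rfl⟩ := hm
      push_cast at h1 h2
      refine ⟨k, ?_, rfl⟩
      rw [mem_Ico_ceil, div_le_iff₀ he', lt_div_iff₀ he']
      constructor <;> linarith
    · intro n hn
      rw [mem_Ico_ceil] at hn
      have hn0 : (0:ℝ) < n := by linarith [hn.1]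
      push_cast
      rw [log_mul he'.ne' hn0.ne', ph_add, mul_inv]; ring
  have hJs : ∫ y in (log N)..(log N'), ph u y = ph u (log e)*∫ y in (log (N/e))..(log (N'/e)), ph u y := by
    rw [log_div (by linarith) he'.ne', log_div (by linarith) he'.ne', ph_int_shift]
  rw [hbij, hJs]
  set B := ∑ n ∈ Ico ⌈N/e⌉₊ ⌈N'/e⌉₊, f (e*n)*((((n:ℝ))⁻¹:ℝ)*ph u (log n))
  set J' := ∫ y in (log (N/e))..(log (N'/e)), ph u y
  have : (e:ℂ)⁻¹*ph u (log e)*B - (e:ℂ)⁻¹*(((q:ℂ)⁻¹*∑ x, f x)*(ph u (log e)*J')) = (e:ℂ)⁻¹*(ph u (log e)*(B - ((q:ℂ)⁻¹*∑ x, f x)*J')) := by ring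
  rw [this, norm_mul, norm_mul, ph_norm, one_mul, norm_inv, Complex.norm_natCast]
  gcongr

noncomputable def Fej (K:ℕ) (w:ℂ):ℝ := ‖∑ k ∈ range K, w ^ k‖ ^ 2 / K

lemma Fej_nonneg (K:ℕ) (w:ℂ) : 0 ≤ Fej K w := by unfold Fej; positivity

lemma Fej_pt (K:ℕ) (hK : 1 ≤ K) (w:ℂ) (hw : ‖w‖ = 1) :
    w.re ≤ 1 - 1 / (2*(K:ℝ) ^ 2) + 2 / (K:ℝ) ^ 3*Fej K w := by
  have hK' : (1:ℝ) ≤ K := mod_cast hK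
  by_cases h : ‖w - 1‖ ≤ 1 / K
  · have h1 : ∀ k:ℕ, ‖w ^ k - 1‖ ≤ k / K := by
      intro k
      induction k with
      | zero => simp
      | succ k ih =>
        have : w ^ (k+1) - 1 = w ^ k*(w - 1) + (w ^ k - 1) := by ring
        rw [this]
        refine (norm_add_le _ _).trans ?_
        rw [norm_mul, norm_pow, hw, one_pow, one_mul]
        push_cast
        rw [add_div, add_comm]; gcongr
    have h2 : (K:ℝ) / 2 ≤ ‖∑ k ∈ range K, w ^ k‖ := by
      refine le_trans ?_ (re_le_norm _)
      rw [re_sum]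
      calc (K:ℝ)/2 ≤ ∑ k ∈ range K, (1 - (k:ℝ) / K) := by
            rw [sum_sub_distrib, ← sum_div]
            have : ∑ k ∈ range K, (k:ℝ) = K*(K - 1) / 2 := by
              have := sum_range_id_mul_two K
              have h3 : (∑ k ∈ range K, (k:ℝ))*2 = K*(K - 1) := by
                have := congrArg (fun n:ℕ => (n:ℝ)) this
                simp only [Nat.cast_mul, Nat.cast_sum, Nat.cast_sub hK] at this
                exact_mod_cast this
              linarith
            rw [this]
            simp
            field_simp
            linarith
        _ ≤ _ := by
            refine sum_le_sum fun k _ => ?_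
            have := (abs_re_le_norm (w ^ k - 1)).trans (h1 k)
            rw [sub_re, one_re] at this
            linarith [(abs_le.mp this).1]
    have h3 : (K:ℝ) / 4 ≤ Fej K w := by
      unfold Fej
      rw [le_div_iff₀ (by linarith)]
      nlinarith
    have h4 : w.re ≤ 1 := hw ▸ re_le_norm w
    have h5 : 1 / (2*(K:ℝ) ^ 2) = 2 / (K:ℝ) ^ 3*(K / 4) := by field_simp; norm_num
    have h6 : 2 / (K:ℝ) ^ 3*(K / 4) ≤ 2 / (K:ℝ) ^ 3*Fej K w := by gcongr
    linarith
  · push Not at h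
    have h1 : ‖w - 1‖ ^ 2 = 2 - 2*w.re := by
      have e1 : ‖w - 1‖ ^ 2 = (w.re - 1) ^ 2 + w.im ^ 2 := by
        rw [← normSq_eq_norm_sq, normSq_apply]; simp; ring
      have e2 : w.re ^ 2 + w.im ^ 2 = 1 := by
        have : ‖w‖ ^ 2 = w.re ^ 2 + w.im ^ 2 := by rw [← normSq_eq_norm_sq, normSq_apply]; ring
        rw [← this, hw]; norm_num
      rw [e1]; linarith
    have h2 : (1 / (K:ℝ)) ^ 2 ≤ ‖w - 1‖ ^ 2 := by gcongr
    have h3 : 0 ≤ 2 / (K:ℝ) ^ 3*Fej K w := mul_nonneg (by positivity) (Fej_nonneg _ _)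
    have h4 : 1 / (2*(K:ℝ) ^ 2) = (1 / (K:ℝ)) ^ 2 / 2 := by field_simp
    linarith

lemma Fej_expand (K:ℕ) (w:ℂ) : (Fej K w:ℂ) = (K:ℂ)⁻¹*∑ k ∈ range K, ∑ l ∈ range K, w ^ k*(starRingEnd ℂ w) ^ l := by
  unfold Fej
  push_cast
  rw [← mul_conj', map_sum, sum_mul_sum, div_eq_inv_mul]
  congr 1
  refine sum_congr rfl fun k _ => sum_congr rfl fun l _ => ?_
  rw [map_pow]

lemma ph_pow (t x:ℝ) (k:ℕ) : ph t x ^ k = ph (k*t) x := by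
  unfold ph
  rw [← Complex.exp_nat_mul]; congr 1; push_cast; ring

lemma sieve_inner (Kx:ℝ) (hKx : 0 ≤ Kx) : ∃ c:ℝ, 0 < c ∧ c ≤ 1 ∧ ∃ C:ℝ, 0 < C ∧ ∀ (q:ℕ) [NeZero q] (f : ZMod q → ℂ) (R:ℕ) (N N' u:ℝ), (∀ x, ‖f x‖ ≤ 1) →
    1 ≤ R → 1 ≤ N / (R ^ 2*q) → N ≤ N' → |u| ≤ (N / (R ^ 2*q)) ^ Kx →
    ‖∑ d ∈ Icc 1 R, ∑ e ∈ Icc 1 R, ((lam R q d*lam R q e:ℝ):ℂ)*∑ n ∈ Ico ⌈N⌉₊ ⌈N'⌉₊, (if Nat.lcm d e ∣ n then f n*((((n:ℝ))⁻¹:ℝ)*ph u (log n)) else 0)‖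
      ≤ ‖∫ y in (log N)..(log N'), ph u y‖ / selS R q + (∑ d ∈ Icc 1 R, (d:ℝ)⁻¹) ^ 3*(C*(N / (R ^ 2*q)) ^ (-c)) := by
  obtain ⟨c, hc, hc1, C, hC, h⟩ := ap_main Kx hKx
  refine ⟨c, hc, hc1, C, hC, ?_⟩
  intro q _ f R N N' u hf hR hZ hNN hu
  have hq1 : (1:ℝ) ≤ q := mod_cast NeZero.pos q
  have hR1 : (1:ℝ) ≤ R := mod_cast hR
  set Z := N / (R ^ 2*q) with hZd
  have hNZ : N = Z*(R ^ 2*q) := by rw [hZd]; field_simp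
  set J := ∫ y in (log N)..(log N'), ph u y with hJ
  set fb := (q:ℂ)⁻¹*∑ x, f x with hfb
  have hfb1 : ‖fb‖ ≤ 1 := by
    rw [hfb, norm_mul, norm_inv, Complex.norm_natCast, inv_mul_le_iff₀ (by linarith), mul_one]
    refine (norm_sum_le_of_le _ (fun x _ => hf x)).trans ?_
    simp [ZMod.card]
  set G:ℕ → ℕ → ℂ := fun d e => ∑ n ∈ Ico ⌈N⌉₊ ⌈N'⌉₊, (if Nat.lcm d e ∣ n then f n*((((n:ℝ))⁻¹:ℝ)*ph u (log n)) else 0) with hG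
  have key : ∀ d ∈ Icc 1 R, ∀ e ∈ Icc 1 R, ‖((lam R q d*lam R q e:ℝ):ℂ)*(G d e - ((Nat.lcm d e:ℕ):ℂ)⁻¹*(fb*J))‖ ≤ ((Nat.lcm d e:ℕ):ℝ)⁻¹*(C*Z ^ (-c)) := by
    intro d hd e he
    rw [mem_Icc] at hd he
    by_cases h0 : lam R q d*lam R q e = 0
    · rw [h0]; simp; positivity
    have hd2 := (lam_supp (left_ne_zero_of_mul h0)).2
    have he2 := (lam_supp (right_ne_zero_of_mul h0)).2
    have hlpos : 0 < Nat.lcm d e := Nat.lcm_pos hd.1 he.1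
    have hlpos' : (0:ℝ) < (Nat.lcm d e:ℕ) := mod_cast hlpos
    have hlc : (Nat.lcm d e).Coprime q := Nat.Coprime.coprime_dvd_left (Nat.lcm_dvd_mul d e) (Nat.Coprime.mul_left hd2 he2)
    have hlR : ((Nat.lcm d e:ℕ):ℝ) ≤ R ^ 2 := by
      have : Nat.lcm d e ≤ R ^ 2 := (Nat.le_of_dvd (Nat.mul_pos hd.1 he.1) (Nat.lcm_dvd_mul d e)).trans (by rw [sq]; exact Nat.mul_le_mul hd.2 he.2)
      exact_mod_cast this
    have hZle : Z ≤ N / (Nat.lcm d e:ℕ) / q := by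
      rw [hZd, ← div_div]
      have : 0 ≤ N := by rw [hNZ]; positivity
      gcongr
    have hqN : (q:ℝ) ≤ N / (Nat.lcm d e:ℕ) := by
      have := hZ.trans hZle
      rwa [le_div_iff₀ (by linarith), one_mul] at this
    have := h q f (Nat.lcm d e) N N' u hf hlpos hlc hqN hNN (hu.trans (by gcongr))
    rw [norm_mul, norm_real, norm_eq_abs, abs_mul]
    have l1 := lam_le hR q d
    have l2 := lam_le hR q e
    calc _ ≤ 1*1*(((Nat.lcm d e:ℕ):ℝ)⁻¹*(C*(N / (Nat.lcm d e:ℕ) / q) ^ (-c))) := by gcongr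
      _ ≤ _ := by
        rw [one_mul, one_mul]
        have := rpow_le_rpow_of_nonpos (by linarith : 0 < Z) hZle (by linarith : -c ≤ 0)
        exact mul_le_mul_of_nonneg_left (mul_le_mul_of_nonneg_left this hC.le) (inv_nonneg.mpr hlpos'.le)
  have split : ∑ d ∈ Icc 1 R, ∑ e ∈ Icc 1 R, ((lam R q d*lam R q e:ℝ):ℂ)*G d e =
      ((∑ d ∈ Icc 1 R, ∑ e ∈ Icc 1 R, lam R q d*lam R q e*((Nat.lcm d e:ℕ):ℝ)⁻¹:ℝ):ℂ)*(fb*J) +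
      ∑ d ∈ Icc 1 R, ∑ e ∈ Icc 1 R, ((lam R q d*lam R q e:ℝ):ℂ)*(G d e - ((Nat.lcm d e:ℕ):ℂ)⁻¹*(fb*J)) := by
    rw [ofReal_sum, sum_mul, ← sum_add_distrib]
    refine sum_congr rfl fun d _ => ?_
    rw [ofReal_sum, sum_mul, ← sum_add_distrib]
    refine sum_congr rfl fun e _ => ?_
    push_cast; ring
  rw [split]
  refine (norm_add_le _ _).trans ?_
  gcongr
  · obtain ⟨s1, s2⟩ := sel_quad hR q
    rw [norm_mul, norm_real, norm_of_nonneg s1, norm_mul, div_eq_mul_inv, mul_comm ‖J‖]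
    rw [one_div] at s2
    have : ‖fb‖*‖J‖ ≤ ‖J‖ := mul_le_of_le_one_left (norm_nonneg _) hfb1
    exact mul_le_mul s2 this (by positivity) (inv_nonneg.mpr (selS_pos hR q).le)
  · refine (norm_sum_le_of_le _ fun d hd => norm_sum_le_of_le _ fun e he => key d hd e he).trans ?_
    simp_rw [← sum_mul]
    gcongr
    exact lcm_sum R

lemma ph_zero_int (u a b:ℝ) (hab : a ≤ b) : ‖∫ y in a..b, ph u y‖ ≤ b - a := by
  have := intervalIntegral.norm_integral_le_of_norm_le_const (f := ph u) (a := a) (b := b) (C := 1) (fun y _ => (ph_norm _ _).le)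
  rwa [one_mul, abs_of_nonneg (by linarith)] at this

theorem sieve_bound (Kx:ℝ) (hKx : 0 ≤ Kx) : ∃ c:ℝ, 0 < c ∧ c ≤ 1 ∧ ∃ C:ℝ, 0 < C ∧ ∀ (q:ℕ) [NeZero q] (χ : DirichletCharacter ℂ q) (K R:ℕ) (N N' t:ℝ)
    (ξ:ℂ) (P : Finset ℕ), ‖ξ‖ = 1 → 1 ≤ K → 1 ≤ R → 1 ≤ N / (R ^ 2*q) → N ≤ N' → t ≠ 0 → K * |t| ≤ (N / (R ^ 2*q)) ^ Kx →
    (∀ p ∈ P, p.Prime ∧ R < p ∧ N ≤ p ∧ (p:ℝ) < N') →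
    ∑ p ∈ P, (p:ℝ)⁻¹*Fej K (ξ*(χ p*ph t (log p))) ≤
      (log N' - log N + 2*K / |t|) / selS R q + K*((∑ d ∈ Icc 1 R, (d:ℝ)⁻¹) ^ 3*(C*(N / (R ^ 2*q)) ^ (-c))) := by
  obtain ⟨c, hc, hc1, C, hC, h⟩ := sieve_inner Kx hKx
  refine ⟨c, hc, hc1, C, hC, ?_⟩
  intro q _ χ K R N N' t ξ P hξ hK hR hZ hNN ht htK hP
  have hq1 : (1:ℝ) ≤ q := mod_cast NeZero.pos q
  have hR1 : (1:ℝ) ≤ R := mod_cast hR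
  have hK1 : (1:ℝ) ≤ K := mod_cast hK
  have hN0 : 0 < N := by
    have : (0:ℝ) < R ^ 2*q := by positivity
    rw [le_div_iff₀ this] at hZ; linarith
  have hS := selS_pos hR q
  set I := Ico ⌈N⌉₊ ⌈N'⌉₊ with hI
  set w:ℕ → ℂ := fun m => ξ*(χ m*ph t (log m)) with hw
  set sg:ℕ → ℝ := fun m => ∑ d ∈ Icc 1 R, if d ∣ m then lam R q d else 0 with hsg
  have step1 : ∑ p ∈ P, (p:ℝ)⁻¹*Fej K (w p) ≤ ∑ m ∈ I, (m:ℝ)⁻¹*(sg m) ^ 2*Fej K (w m) := by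
    calc _ = ∑ p ∈ P, (p:ℝ)⁻¹*(sg p) ^ 2*Fej K (w p) := by
          refine sum_congr rfl fun p hp => ?_
          obtain ⟨h1, h2, _⟩ := hP p hp
          have : sg p = 1 := by
            rw [hsg]; simp only
            rw [sum_eq_single 1]
            · simp [lam_one hR]
            · intro d hd hd1
              rw [mem_Icc] at hd
              rw [if_neg]
              intro hdp
              rcases (Nat.dvd_prime h1).mp hdp with h | h <;> omega
            · intro h; exact absurd (mem_Icc.mpr ⟨le_rfl, hR⟩) h
          rw [this]; ring
      _ ≤ _ := by
          refine sum_le_sum_of_subset_of_nonneg ?_ fun m _ _ => mul_nonneg (by positivity) (Fej_nonneg _ _)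
          intro p hp
          obtain ⟨_, _, h3, h4⟩ := hP p hp
          rw [hI, mem_Ico_ceil]; exact ⟨h3, h4⟩
  refine step1.trans ?_
  set f:ℕ → ℕ → ZMod q → ℂ := fun k l x => (χ x) ^ k*(starRingEnd ℂ (χ x)) ^ l with hf
  have hf1 : ∀ k l x, ‖f k l x‖ ≤ 1 := by
    intro k l x
    rw [hf]; simp only
    rw [norm_mul, norm_pow, norm_pow, RCLike.norm_conj]
    have := DirichletCharacter.norm_le_one χ x
    exact mul_le_one₀ (pow_le_one₀ (norm_nonneg _) this) (by positivity) (pow_le_one₀ (norm_nonneg _) this)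
  set In:ℕ → ℕ → ℂ := fun k l => ∑ d ∈ Icc 1 R, ∑ e ∈ Icc 1 R, ((lam R q d*lam R q e:ℝ):ℂ)*∑ n ∈ I, (if Nat.lcm d e ∣ n then f k l n*((((n:ℝ))⁻¹:ℝ)*ph (((k:ℝ) - l)*t) (log n)) else 0) with hIn
  have hwf : ∀ k l m:ℕ, w m ^ k*(starRingEnd ℂ (w m)) ^ l = ξ ^ k*(starRingEnd ℂ ξ) ^ l*(f k l m*ph (((k:ℝ) - l)*t) (log m)) := by
    intro k l m
    rw [hw, hf]; simp only [map_mul, mul_pow]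
    rw [ph_conj, ph_pow, ph_pow, show ((k:ℝ) - l)*t = k*t + l*(-t) by ring, ph_add']
    ring
  have hsq : ∀ m:ℕ, ((sg m:ℂ)) ^ 2 = ∑ d ∈ Icc 1 R, ∑ e ∈ Icc 1 R, if Nat.lcm d e ∣ m then ((lam R q d*lam R q e:ℝ):ℂ) else 0 := by
    intro m
    rw [← ofReal_pow, sq, hsg]; simp only
    rw [sum_mul_sum, ofReal_sum]
    refine sum_congr rfl fun d _ => ?_
    rw [ofReal_sum]
    refine sum_congr rfl fun e _ => ?_
    by_cases h1 : d ∣ m <;> by_cases h2 : e ∣ m <;> simp [h1, h2, Nat.lcm_dvd_iff]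
  have step2 : ((∑ m ∈ I, (m:ℝ)⁻¹*(sg m) ^ 2*Fej K (w m):ℝ):ℂ) = (K:ℂ)⁻¹*∑ k ∈ range K, ∑ l ∈ range K, ξ ^ k*(starRingEnd ℂ ξ) ^ l*In k l := by
    have hInkl : ∀ k l, In k l = ∑ m ∈ I, (sg m:ℂ) ^ 2*(f k l m*((((m:ℝ))⁻¹:ℝ)*ph (((k:ℝ) - l)*t) (log m))) := by
      intro k l
      rw [hIn]; simp only
      simp_rw [hsq, mul_sum, sum_mul]
      rw [sum_comm' (t' := Icc 1 R) (s' := fun _ => Icc 1 R) (by tauto)]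
      conv_rhs => rw [sum_comm]
      rw [sum_comm]
      refine sum_congr rfl fun d _ => ?_
      conv_rhs => rw [sum_comm]
      refine sum_congr rfl fun e _ => ?_
      refine sum_congr rfl fun m _ => ?_
      split_ifs <;> ring
    rw [ofReal_sum]
    have : ∀ m ∈ I, (((m:ℝ)⁻¹*(sg m) ^ 2*Fej K (w m):ℝ):ℂ) = (K:ℂ)⁻¹*∑ k ∈ range K, ∑ l ∈ range K, ξ ^ k*(starRingEnd ℂ ξ) ^ l*((sg m:ℂ) ^ 2*(f k l m*((((m:ℝ))⁻¹:ℝ)*ph (((k:ℝ) - l)*t) (log m)))) := by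
      intro m _
      rw [ofReal_mul, Fej_expand, mul_left_comm, mul_sum]
      congr 1
      refine sum_congr rfl fun k _ => ?_
      rw [mul_sum]
      refine sum_congr rfl fun l _ => ?_
      rw [hwf]; push_cast; ring
    rw [sum_congr rfl this, ← mul_sum, sum_comm]
    congr 1
    refine sum_congr rfl fun k _ => ?_
    rw [sum_comm]
    refine sum_congr rfl fun l _ => ?_
    rw [hInkl, mul_sum]
  set E := (∑ d ∈ Icc 1 R, (d:ℝ)⁻¹) ^ 3*(C*(N / (R ^ 2*q)) ^ (-c)) with hE
  have hlogs : log N ≤ log N' := log_le_log hN0 hNN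
  have hbd : ∀ k ∈ range K, ∀ l ∈ range K, ‖ξ ^ k*(starRingEnd ℂ ξ) ^ l*In k l‖ ≤
      ((if l = k then log N' - log N else 0) + 2 / |t|) / selS R q + E := by
    intro k hk l hl
    rw [mem_range] at hk hl
    rw [norm_mul, norm_mul, norm_pow, norm_pow, RCLike.norm_conj, hξ, one_pow, one_pow, one_mul, one_mul]
    have hkl : |(k:ℝ) - l| ≤ K := by
      have a : (k:ℝ) ≤ K := mod_cast hk.le
      have b : (l:ℝ) ≤ K := mod_cast hl.le
      rw [abs_le]; constructor <;> linarith [(Nat.cast_nonneg k : (0:ℝ) ≤ k), (Nat.cast_nonneg l : (0:ℝ) ≤ l)]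
    have := h q (f k l) R N N' (((k:ℝ) - l)*t) (hf1 k l) hR hZ hNN (by
      rw [abs_mul]; exact le_trans (by gcongr) htK)
    refine this.trans ?_
    gcongr
    split_ifs with hlk
    · have := ph_zero_int (((k:ℝ) - l)*t) _ _ hlogs
      have : 0 ≤ 2 / |t| := by positivity
      linarith
    · rw [zero_add]
      have ht0 : 0 < |t| := abs_pos.mpr ht
      have h1 : (1:ℝ) ≤ |(k:ℝ) - l| := by
        have : (1:ℤ) ≤ |(k:ℤ) - l| := Int.one_le_abs (by omega)
        exact_mod_cast this
      have hne : ((k:ℝ) - l)*t ≠ 0 := mul_ne_zero (by intro h; rw [h] at h1; norm_num at h1) ht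
      refine (ph_int_bound _ _ _ hne).trans ?_
      rw [abs_mul]
      gcongr
      nlinarith
  have step3 : ∑ m ∈ I, (m:ℝ)⁻¹*(sg m) ^ 2*Fej K (w m) = ‖((∑ m ∈ I, (m:ℝ)⁻¹*(sg m) ^ 2*Fej K (w m):ℝ):ℂ)‖ := by
    rw [norm_real, norm_of_nonneg (sum_nonneg fun m _ => mul_nonneg (by positivity) (Fej_nonneg _ _))]
  rw [step3, step2, norm_mul, norm_inv, Complex.norm_natCast, inv_mul_le_iff₀ (by linarith)]
  refine (norm_sum_le_of_le _ fun k hk => norm_sum_le_of_le _ fun l hl => hbd k hk l hl).trans (le_of_eq ?_)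
  have inner : ∀ k ∈ range K, ∑ l ∈ range K, (((if l = k then log N' - log N else 0) + 2 / |t|) / selS R q + E) = (log N' - log N + 2*K / |t|) / selS R q + K*E := by
    intro k hk
    rw [sum_add_distrib, ← sum_div, sum_add_distrib, sum_ite_eq' _ k, if_pos hk]
    simp only [sum_const, card_range, nsmul_eq_mul]
    ring
  rw [sum_congr rfl inner, sum_const, card_range, nsmul_eq_mul]

lemma eventually_poly_exp (B b:ℝ) (hb : 0 < b) (k:ℕ) : ∃ x0:ℝ, 1 ≤ x0 ∧ ∀ x:ℝ, x0 ≤ x → B*x ^ k ≤ exp (b*x) := by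
  have h := (isLittleO_pow_exp_pos_mul_atTop k hb).bound (show (0:ℝ) < 1 / (|B| + 1) by positivity)
  rw [Filter.eventually_atTop] at h
  obtain ⟨x0, h0⟩ := h
  refine ⟨max x0 1, le_max_right _ _, fun x hx => ?_⟩
  have := h0 x ((le_max_left _ _).trans hx)
  have hx1 : 1 ≤ x := (le_max_right _ _).trans hx
  rw [norm_of_nonneg (by positivity), norm_of_nonneg (exp_pos _).le, one_div, ← div_eq_inv_mul, le_div_iff₀ (by positivity)] at this
  have hp : 0 ≤ x ^ k := by positivity
  nlinarith [le_abs_self B, abs_nonneg B]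

lemma harm_le (R:ℕ) (hR : 1 ≤ R) : ∑ d ∈ Icc 1 R, (d:ℝ)⁻¹ ≤ 1 + log R := by
  have := harmonic_le_one_add_log R
  rw [harmonic_eq_sum_Icc] at this
  push_cast at this
  exact this

lemma harm_ge (R:ℕ) : log (R + 1) ≤ ∑ d ∈ Icc 1 R, (d:ℝ)⁻¹ := by
  have := log_add_one_le_harmonic R
  rw [harmonic_eq_sum_Icc] at this
  push_cast at this
  exact this

theorem QQ_bound (Kx:ℝ) (hKx : 0 ≤ Kx) (q:ℕ) [NeZero q] (K H:ℕ) (hK : 1 ≤ K) (hH : 1 ≤ H) :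
    ∃ v0:ℝ, 1 ≤ v0 ∧ ∃ t0:ℝ, 0 < t0 ∧ ∀ (χ : DirichletCharacter ℂ q) (v:ℕ) (t:ℝ) (P : Finset ℕ), v0 ≤ v → t0 ≤ |t| → |t| ≤ exp (Kx*(v / H)) →
      (∀ p ∈ P, p.Prime ∧ (v:ℝ) / H ≤ log p ∧ log p ≤ v / H + 1 / H) →
      ‖QQ P χ t‖ ≤ (1 - 1 / (2*(K:ℝ) ^ 2))*∑ p ∈ P, (p:ℝ)⁻¹ + 2 / (K:ℝ) ^ 3*(25*q / v) := by
  obtain ⟨c, hc, hc1, C, hC, h⟩ := sieve_bound (4*Kx + 4) (by linarith)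
  have hH' : (1:ℝ) ≤ H := mod_cast hH
  have hK' : (1:ℝ) ≤ K := mod_cast hK
  have hq' : (1:ℝ) ≤ q := mod_cast NeZero.pos q
  obtain ⟨x1, hx1, H1⟩ := eventually_poly_exp (K*C*8) (c / (4*H)) (by positivity) 4
  obtain ⟨x2, hx2, H2⟩ := eventually_poly_exp (q*K) (1 / (4*H)) (by positivity) 1
  refine ⟨max x1 x2, hx1.trans (le_max_left _ _), 2*K*H, by positivity, ?_⟩
  intro χ v t P hv ht htu hP
  have hv1 : x1 ≤ v := (le_max_left _ _).trans hv
  have hv2 : x2 ≤ v := (le_max_right _ _).trans hv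
  have hv0 : (1:ℝ) ≤ v := hx1.trans hv1
  have h1 := H1 v hv1
  have h2 := H2 v hv2
  set N := exp (v / H) with hN
  set n4 := exp (v / (4*H)) with hn4
  have hn4N : n4 ^ 4 = N := by rw [hn4, hN, ← exp_nat_mul]; congr 1; push_cast; field_simp
  have hn41 : 1 ≤ n4 := one_le_exp (by positivity)
  have h2' : q*K ≤ n4 := by
    have : exp (1 / (4*H)*v) = n4 := by rw [hn4]; congr 1; ring
    rw [this, pow_one] at h2; nlinarith [mul_nonneg (show (0:ℝ) ≤ q by linarith) (show (0:ℝ) ≤ K by linarith)]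
  set R := ⌊n4⌋₊ with hR
  have hR1 : 1 ≤ R := Nat.one_le_floor_iff _ |>.mpr hn41
  have hRn : (R:ℝ) ≤ n4 := Nat.floor_le (by linarith)
  have hRn' : n4 < R + 1 := Nat.lt_floor_add_one _
  have hR1' : (1:ℝ) ≤ R := mod_cast hR1
  set Z := N / ((R:ℝ) ^ 2*q) with hZ
  have hZn : n4 ≤ Z := by
    rw [hZ, le_div_iff₀ (by positivity), ← hn4N]
    have : (q:ℝ) ≤ n4 := by nlinarith
    calc n4*((R:ℝ) ^ 2*q) ≤ n4*(n4 ^ 2*n4) := by gcongr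
      _ = n4 ^ 4 := by ring
  have hZ1 : 1 ≤ Z := hn41.trans hZn
  have hNN : N ≤ exp (v / H + 2 / H) := by
    rw [hN]; apply exp_le_exp.mpr
    have : (0:ℝ) ≤ 2 / H := by positivity
    linarith
  have ht0 : 0 < |t| := lt_of_lt_of_le (by positivity) ht
  have hKt : K * |t| ≤ Z ^ (4*Kx + 4) := by
    calc K * |t| ≤ n4*exp (Kx*(v / H)) := by
          gcongr
          nlinarith
      _ ≤ n4 ^ (4:ℝ)*n4 ^ (4*Kx) := by
          gcongr
          · calc n4 = n4 ^ (1:ℝ) := (rpow_one _).symm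
              _ ≤ n4 ^ (4:ℝ) := rpow_le_rpow_of_exponent_le hn41 (by norm_num)
          · rw [hn4, ← exp_mul]; apply le_of_eq; congr 1; field_simp
      _ = n4 ^ (4*Kx + 4) := by rw [← rpow_add (by linarith)]; congr 1; ring
      _ ≤ _ := by gcongr
  have hPp : ∀ p ∈ P, p.Prime ∧ R < p ∧ N ≤ p ∧ (p:ℝ) < exp (v / H + 2 / H) := by
    intro p hp
    obtain ⟨a, b, d⟩ := hP p hp
    have hp0 : (0:ℝ) < p := mod_cast a.pos
    have hNp : N ≤ p := by rw [hN, ← le_log_iff_exp_le hp0]; exact b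
    refine ⟨a, ?_, hNp, ?_⟩
    · have : n4 < N := by
        have : 1 < n4 := by rw [hn4]; exact one_lt_exp_iff.mpr (by positivity)
        rw [← hn4N]
        calc n4 = n4 ^ 1 := (pow_one _).symm
          _ < n4 ^ 4 := pow_lt_pow_right₀ this (by norm_num)
      have : (R:ℝ) < p := by linarith
      exact_mod_cast this
    · rw [← log_lt_iff_lt_exp hp0]
      have : (1:ℝ) / H < 2 / H := by gcongr; norm_num
      linarith
  -- choose the phase
  obtain ⟨ξ, hξ1, hξ2⟩ : ∃ ξ:ℂ, ‖ξ‖ = 1 ∧ (ξ*QQ P χ t).re = ‖QQ P χ t‖ := by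
    by_cases h0 : QQ P χ t = 0
    · exact ⟨1, by simp, by simp [h0]⟩
    · refine ⟨starRingEnd ℂ (QQ P χ t) / ‖QQ P χ t‖, ?_, ?_⟩
      · rw [norm_div, RCLike.norm_conj, norm_real, norm_norm, div_self (norm_ne_zero_iff.mpr h0)]
      · rw [div_mul_eq_mul_div, conj_mul']
        have : ((‖QQ P χ t‖ : ℂ) ^ 2 / (‖QQ P χ t‖ : ℂ)) = ((‖QQ P χ t‖ : ℝ):ℂ) := by
          have : (‖QQ P χ t‖ : ℂ) ≠ 0 := mod_cast norm_ne_zero_iff.mpr h0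
          field_simp
        rw [this, ofReal_re]
  have hsv := h q χ K R N (exp (v / H + 2 / H)) t ξ P hξ1 hK hR1 hZ1 hNN (abs_pos.mp ht0) hKt hPp
  set m := ∑ p ∈ P, (p:ℝ)⁻¹ with hm
  set FS := ∑ p ∈ P, (p:ℝ)⁻¹*Fej K (ξ*(χ p*ph t (log p))) with hFS
  have hup : ‖QQ P χ t‖ ≤ (1 - 1 / (2*(K:ℝ) ^ 2))*m + 2 / (K:ℝ) ^ 3*FS := by
    rw [← hξ2, QQ, mul_sum, re_sum, hm, hFS, mul_sum, mul_sum, ← sum_add_distrib]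
    refine sum_le_sum fun p hp => ?_
    have e : ξ*((p:ℂ)⁻¹*(χ p*ph t (log p))) = (((p:ℝ)⁻¹:ℝ):ℂ)*(ξ*(χ p*ph t (log p))) := by push_cast; ring
    rw [e, re_ofReal_mul]
    have hp0 : (0:ℝ) ≤ (p:ℝ)⁻¹ := by positivity
    have hle : (ξ*(χ p*ph t (log p))).re ≤ 1 - 1 / (2*(K:ℝ) ^ 2) + 2 / (K:ℝ) ^ 3*Fej K (ξ*(χ p*ph t (log p))) := by
      by_cases hx : χ (p : ZMod q) = 0
      · rw [hx]; simp
        have a1 : 0 ≤ 2 / (K:ℝ) ^ 3*Fej K 0 := mul_nonneg (by positivity) (Fej_nonneg _ _)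
        have a2 : ((K:ℝ) ^ 2)⁻¹*2⁻¹ ≤ 1 := by
          have : ((K:ℝ) ^ 2)⁻¹ ≤ 1 := inv_le_one_of_one_le₀ (one_le_pow₀ hK')
          linarith
        linarith
      · refine Fej_pt K hK _ ?_
        rw [norm_mul, norm_mul, hξ1, ph_norm, one_mul, mul_one]
        have hu : IsUnit (p : ZMod q) := by
          by_contra hu; exact hx (χ.map_nonunit hu)
        obtain ⟨u, hu⟩ := hu
        rw [← hu]; exact char_unit_norm χ u
    calc _ ≤ (p:ℝ)⁻¹*(1 - 1 / (2*(K:ℝ) ^ 2) + 2 / (K:ℝ) ^ 3*Fej K (ξ*(χ p*ph t (log p)))) := by gcongr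
      _ = _ := by ring
  refine hup.trans ?_
  gcongr
  refine hsv.trans ?_
  have hT := harm_le R hR1
  have hlogR : log R ≤ v := by
    have : log R ≤ v / (4*H) := by
      rw [log_le_iff_le_exp (by linarith)]; exact hRn
    refine this.trans (div_le_self (by linarith) (by linarith))
  have hS0 := selS_pos hR1 q
  have hS : (v:ℝ) / (4*H) ≤ 2*q*selS R q := by
    refine le_trans ?_ ((harm_ge R).trans (selS_lower R (NeZero.pos q)))
    rw [le_log_iff_exp_le (by linarith)]; exact hRn'.le
  have p1 : (log (exp (v / H + 2 / H)) - log N + 2*K / |t|) / selS R q ≤ 24*q / v := by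
    rw [log_exp, hN, log_exp]
    have : 2*K / |t| ≤ 1 / H := by
      rw [div_le_div_iff₀ ht0 (by linarith), one_mul]; exact ht
    rw [div_le_div_iff₀ hS0 (by linarith)]
    have hh : (v:ℝ) / H + 2 / H - v / H + 2*K / |t| ≤ 3 / H := by
      have : (3:ℝ) / H = 2 / H + 1 / H := by ring
      linarith
    calc _ ≤ 3 / H*(v:ℝ) := by gcongr
      _ = 12*(v / (4*H)) := by field_simp; norm_num
      _ ≤ 12*(2*q*selS R q) := by gcongr
      _ = _ := by ring
  have p2 : K*((∑ d ∈ Icc 1 R, (d:ℝ)⁻¹) ^ 3*(C*Z ^ (-c))) ≤ q / v := by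
    have e1 : Z ^ (-c) ≤ (exp (c / (4*H)*v))⁻¹ := by
      rw [rpow_neg (by linarith)]
      apply inv_anti₀ (exp_pos _)
      calc exp (c / (4*H)*v) = n4 ^ c := by rw [hn4, ← exp_mul]; congr 1; ring
        _ ≤ Z ^ c := by gcongr
    have e2 : ∑ d ∈ Icc 1 R, (d:ℝ)⁻¹ ≤ 2*v := by linarith
    have e0 : 0 ≤ ∑ d ∈ Icc 1 R, (d:ℝ)⁻¹ := sum_nonneg fun _ _ => by positivity
    calc _ ≤ K*((2*v) ^ 3*(C*(exp (c / (4*H)*v))⁻¹)) := by gcongr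
      _ = (K*C*8*v ^ 4)*(exp (c / (4*H)*v))⁻¹ / v := by field_simp; norm_num
      _ ≤ 1 / v := by
          gcongr
          rw [← div_eq_mul_inv, div_le_one (exp_pos _)]; exact h1
      _ ≤ q / v := by gcongr
  have : 25*(q:ℝ) / v = 24*q / v + q / v := by ring
  rw [this]
  exact add_le_add p1 p2

/-- Poisson-type weight -/
noncomputable def kern (V:ℝ) (m:ℕ):ℝ := (m:ℝ)⁻¹*(1 + (log m - V)^2)⁻¹

lemma kern_nonneg (V:ℝ) (m:ℕ) : 0 ≤ kern V m := by unfold kern; positivity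

lemma kern_le (V:ℝ) (m:ℕ) (hm : 1 ≤ m) :
    kern V m ≤ 6*(arctan (log (m+1:ℕ) - V) - arctan (log m - V)) := by
  have hm' : (1:ℝ) ≤ m := mod_cast hm
  have hlt : log m - V < log (m+1:ℕ) - V := by
    have : log m < log (m+1:ℕ) := log_lt_log (by linarith) (by push_cast; linarith)
    linarith
  obtain ⟨c, hc, hce⟩ := exists_hasDerivAt_eq_slope arctan (fun x => 1/(1+x^2)) hlt
    continuous_arctan.continuousOn (fun x _ => hasDerivAt_arctan x)
  have h1 : log (m+1:ℕ) - log m = log (1 + 1/m) := by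
    rw [← log_div (by positivity) (by positivity)]
    congr 1; push_cast; field_simp
  have h2 : 1/(2*(m:ℝ)) ≤ log (1+1/m) := by
    have := one_sub_inv_le_log_of_pos (show (0:ℝ) < 1 + 1/m by positivity)
    refine le_trans ?_ this
    have : 1 - (1+1/(m:ℝ))⁻¹ = 1/(m+1) := by field_simp; ring
    rw [this]
    exact one_div_le_one_div_of_le (by positivity) (by linarith)
  have h3 : log (1+1/m) ≤ 1 := by
    have := log_le_sub_one_of_pos (show (0:ℝ) < 1 + 1/m by positivity)
    have h4 : 1/(m:ℝ) ≤ 1 := by rw [div_le_one (by positivity)]; exact hm'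
    linarith
  have hd : log (m+1:ℕ) - V - (log m - V) = log (1+1/m) := by rw [← h1]; ring
  rw [hd, eq_div_iff (by have : 0 < 1/(2*(m:ℝ)) := by positivity
                         linarith)] at hce
  rw [← hce]
  set x := log m - V
  have hcx : (c - x)^2 ≤ 1 := by
    have : 0 ≤ c - x := by linarith [hc.1]
    have : c - x ≤ 1 := by linarith [hc.2]
    nlinarith
  have hc3 : 1 + c^2 ≤ 3*(1+x^2) := by nlinarith [sq_nonneg (c - 2*x)]
  have h5 : (1+x^2)⁻¹ ≤ 3*(1/(1+c^2)) := by
    rw [mul_one_div, inv_eq_one_div, div_le_div_iff₀ (by positivity) (by positivity)]; linarith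
  unfold kern
  calc (m:ℝ)⁻¹*(1+x^2)⁻¹ ≤ (2*(1/(2*(m:ℝ))))*(3*(1/(1+c^2))) := by
        have : (m:ℝ)⁻¹ = 2*(1/(2*(m:ℝ))) := by field_simp
        rw [this]; gcongr
    _ ≤ (2*log (1+1/m))*(3*(1/(1+c^2))) := by gcongr
    _ = _ := by ring

lemma kern_sum (V:ℝ) (n:ℕ) : ∑ m ∈ range n, kern V m ≤ 6*Real.pi := by
  have h : ∀ n:ℕ, ∑ m ∈ range (n+1), kern V m ≤
      6*(arctan (log (n+1:ℕ) - V) - arctan (log 1 - V)) := by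
    intro n
    induction n with
    | zero => simp [kern]
    | succ k ih =>
      rw [sum_range_succ]
      have := kern_le V (k+1) (by omega)
      linarith
  rcases n with _ | n
  · simp; positivity
  · refine (h n).trans ?_
    have := arctan_lt_pi_div_two (log (n+1:ℕ) - V)
    have := neg_pi_div_two_lt_arctan (log 1 - V)
    linarith

lemma kern_summable (V:ℝ) : Summable (kern V) :=
  summable_of_sum_range_le (kern_nonneg V) (kern_sum V)

lemma kern_tsum (V:ℝ) : ∑' m, kern V m ≤ 6*Real.pi :=
  (kern_summable V).tsum_le_of_sum_range_le (kern_sum V)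

section tauber
variable {q:ℕ} [NeZero q]

/-- `μχ` -/
noncomputable def amu (χ : DirichletCharacter ℂ q) (m:ℕ):ℂ :=
  ((ArithmeticFunction.moebius m:ℤ):ℂ)*χ (m : ZMod q)

lemma amu_norm (χ : DirichletCharacter ℂ q) (m:ℕ) : ‖amu χ m‖ ≤ 1 := by
  unfold amu
  rw [norm_mul]
  have h1 : ‖((ArithmeticFunction.moebius m:ℤ):ℂ)‖ ≤ 1 := by
    rw [norm_intCast]
    exact_mod_cast ArithmeticFunction.abs_moebius_le_one
  calc _ ≤ (1:ℝ)*1 := by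
        gcongr
        exact DirichletCharacter.norm_le_one χ _
    _ = 1 := by ring

lemma amu_zero (χ : DirichletCharacter ℂ q) : amu χ 0 = 0 := by simp [amu]

lemma amu_series (χ : DirichletCharacter ℂ q) : ∃ G:ℂ → ℂ, ContinuousOn G {s | 1 ≤ s.re} ∧
    ∀ s:ℂ, 1 < s.re → HasSum (fun m:ℕ => amu χ m*(m:ℂ)^(-s)) (G s) := by
  have key : ∀ s:ℂ, 1 < s.re →
      HasSum (fun m:ℕ => amu χ m*(m:ℂ)^(-s)) (DirichletCharacter.LFunction χ s)⁻¹ := by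
    intro s hs
    have h1 := DirichletCharacter.LSeries.mul_mu_eq_one χ hs
    rw [← DirichletCharacter.LFunction_eq_LSeries χ hs] at h1
    have h2 := eq_inv_of_mul_eq_one_right h1
    rw [← h2]
    have hsum : LSeriesSummable ((fun n:ℕ => χ (n : ZMod q))*(fun n:ℕ => ((ArithmeticFunction.moebius n:ℤ):ℂ))) s :=
      DirichletCharacter.LSeriesSummable_mul χ <| ArithmeticFunction.LSeriesSummable_moebius_iff.mpr hs
    have h3 := hsum.LSeriesHasSum
    unfold LSeriesHasSum at h3
    convert h3 using 1
    funext m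
    rcases Nat.eq_zero_or_pos m with rfl | hm
    · simp [amu]
    · rw [LSeries.term_of_ne_zero hm.ne']
      simp only [amu, Pi.mul_apply]
      rw [cpow_neg]; ring
  by_cases hχ : χ = 1
  · refine ⟨fun s => (s - 1)*(DirichletCharacter.LFunctionTrivChar₁ q s)⁻¹, ?_, ?_⟩
    · refine ContinuousOn.mul (by fun_prop) (ContinuousOn.inv₀
        (DirichletCharacter.differentiable_LFunctionTrivChar₁ q).continuous.continuousOn ?_)
      intro s hs
      rcases eq_or_ne s 1 with rfl | hs1
      · exact DirichletCharacter.LFunctionTrivChar₁_apply_one_ne_zero q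
      · rw [DirichletCharacter.LFunctionTrivChar₁, Function.update_of_ne hs1]
        exact mul_ne_zero (sub_ne_zero_of_ne hs1)
          (DirichletCharacter.LFunction_ne_zero_of_one_le_re _ (Or.inr hs1) hs)
    · intro s hs
      have hs1 : s ≠ 1 := by rintro rfl; simp at hs
      convert key s hs using 1
      show (s - 1)*(DirichletCharacter.LFunctionTrivChar₁ q s)⁻¹ = _
      rw [DirichletCharacter.LFunctionTrivChar₁, Function.update_of_ne hs1, mul_inv, ← mul_assoc,
        mul_inv_cancel₀ (sub_ne_zero_of_ne hs1), one_mul, hχ]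
  · refine ⟨fun s => (DirichletCharacter.LFunction χ s)⁻¹, ?_, key⟩
    exact ContinuousOn.inv₀ (DirichletCharacter.differentiable_LFunction hχ).continuous.continuousOn
      fun s hs => DirichletCharacter.LFunction_ne_zero_of_one_le_re _ (Or.inl hχ) hs

lemma cpow_ph {m:ℕ} (hm : 0 < m) (σ t:ℝ) :
    (m:ℂ)^(-((σ:ℂ) + t*I)) = (((m:ℝ)^(-σ):ℝ):ℂ)*ph t (log m) := by
  have hm' : (0:ℝ) < m := mod_cast hm
  rw [cpow_def_of_ne_zero (mod_cast hm.ne'), rpow_def_of_pos hm', ph,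
    ofReal_exp, ← Complex.exp_add, ← natCast_log]
  congr 1; push_cast; ring

/-- Fourier transform in the local normalisation -/
noncomputable def FT (g:ℝ → ℂ) (x:ℝ):ℂ := ∫ τ, g τ*ph τ x

lemma wiener_sigma (χ : DirichletCharacter ℂ q) (g:ℝ → ℂ) (hg : Integrable g) (t V σ:ℝ) (hσ : 1 < σ)
    (G:ℂ → ℂ) (hG : ∀ s:ℂ, 1 < s.re → HasSum (fun m:ℕ => amu χ m*(m:ℂ)^(-s)) (G s)) :
    HasSum (fun m:ℕ => amu χ m*((((m:ℝ)^(-σ):ℝ):ℂ)*ph t (log m))*FT g (log m - V))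
      (∫ τ, G (σ + ((t + τ:ℝ):ℂ)*I)*(g τ*ph τ (-V))) := by
  set F:ℕ → ℝ → ℂ := fun m τ => (amu χ m*(m:ℂ)^(-((σ:ℂ) + ((t+τ:ℝ):ℂ)*I)))*(g τ*ph τ (-V)) with hF
  have hFe : ∀ m τ, F m τ = (amu χ m*((((m:ℝ)^(-σ):ℝ):ℂ)*ph t (log m))) *
      (g τ*ph τ (log m - V)) := by
    intro m τ
    simp only [hF]
    rcases Nat.eq_zero_or_pos m with rfl | hm
    · simp [amu_zero]
    · rw [cpow_ph hm, ph_add', sub_eq_add_neg, ph_add]; ring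
  have hgi : ∀ x, Integrable (fun τ => g τ*ph τ x) := fun x =>
    hg.mul_bdd (c := 1) (ph_continuous x).aestronglyMeasurable
      (Eventually.of_forall fun τ => (ph_norm _ _).le)
  have hFi : ∀ m, Integrable (F m) := by
    intro m
    have : F m = fun τ => (amu χ m*((((m:ℝ)^(-σ):ℝ):ℂ)*ph t (log m))) *
      (g τ*ph τ (log m - V)) := funext (hFe m)
    rw [this]
    exact (hgi _).const_mul _
  have hFn : ∀ m τ, ‖F m τ‖ ≤ (m:ℝ)^(-σ)*‖g τ‖ := by
    intro m τ
    rw [hFe, norm_mul, norm_mul, norm_mul, norm_mul, ph_norm, ph_norm, mul_one, mul_one,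
      norm_real, norm_of_nonneg (by positivity)]
    have := amu_norm χ m
    have h0 : 0 ≤ (m:ℝ)^(-σ) := by positivity
    calc _ ≤ 1*(m:ℝ)^(-σ)*‖g τ‖ := by gcongr
      _ = _ := by ring
  have hs : Summable (fun m:ℕ => (m:ℝ)^(-σ)) := summable_nat_rpow.mpr (by linarith)
  have hFs : Summable (fun m => ∫ τ, ‖F m τ‖) := by
    refine Summable.of_nonneg_of_le (fun m => integral_nonneg fun τ => norm_nonneg _) (fun m => ?_)
      (hs.mul_right (∫ τ, ‖g τ‖))
    rw [← integral_const_mul]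
    exact integral_mono (hFi m).norm (hg.norm.const_mul _) (hFn m)
  have := hasSum_integral_of_summable_integral_norm hFi hFs
  have e1 : (fun m:ℕ => amu χ m*((((m:ℝ)^(-σ):ℝ):ℂ)*ph t (log m))*FT g (log m - V))
      = fun m => ∫ τ, F m τ := by
    funext m
    rw [integral_congr_ae (Eventually.of_forall (hFe m)), integral_const_mul]; rfl
  rw [e1]
  have e2 : (∫ τ, G (σ + ((t + τ:ℝ):ℂ)*I)*(g τ*ph τ (-V))) = ∫ τ, ∑' m, F m τ := ?_
  · rw [e2]; exact this
  · refine integral_congr_ae (Eventually.of_forall fun τ => ?_)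
    have h1 := hG (σ + ((t + τ:ℝ):ℂ)*I) (by simpa using hσ)
    exact ((h1.mul_right (g τ*ph τ (-V))).tsum_eq).symm

lemma wiener_one (χ : DirichletCharacter ℂ q) (g:ℝ → ℂ) (hg : Continuous g) (D:ℝ)
    (hgD : ∀ τ, D < |τ| → g τ = 0) (C:ℝ) (hC : ∀ x, ‖FT g x‖ ≤ C*(1 + x^2)⁻¹) (t V:ℝ)
    (G:ℂ → ℂ) (hGc : ContinuousOn G {s | 1 ≤ s.re})
    (hG : ∀ s:ℂ, 1 < s.re → HasSum (fun m:ℕ => amu χ m*(m:ℂ)^(-s)) (G s)) :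
    ∑' m:ℕ, amu χ m*(((m:ℝ)⁻¹:ℝ)*ph t (log m))*FT g (log m - V) =
      ∫ τ, G (1 + ((t + τ:ℝ):ℂ)*I)*(g τ*ph τ (-V)) := by
  have hgs : ∀ τ, τ ∉ Set.Icc (-D) D → g τ = 0 := by
    intro τ hτ
    refine hgD τ ?_
    by_contra h
    exact hτ (abs_le.mp (not_lt.mp h))
  have hgcs : HasCompactSupport g := HasCompactSupport.intro isCompact_Icc hgs
  have hgi : Integrable g := hg.integrable_of_hasCompactSupport hgcs
  set R:ℝ → ℂ := fun σ => ∫ τ in Set.Icc (-D) D, G (((1 + |σ - 1| : ℝ):ℂ) + ((t + τ:ℝ):ℂ)*I)*(g τ*ph τ (-V)) with hR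
  have hRc : Continuous R := by
    refine continuous_parametric_integral_of_continuous (f := fun σ τ => G (((1 + |σ - 1| : ℝ):ℂ) + ((t + τ:ℝ):ℂ)*I)*(g τ*ph τ (-V))) ?_ isCompact_Icc
    refine Continuous.mul ?_ ?_
    · refine hGc.comp_continuous (by fun_prop) ?_
      intro x; simp
    · exact (hg.comp continuous_snd).mul ((ph_continuous (-V)).comp continuous_snd)
  have hRe : ∀ σ, 1 ≤ σ → R σ = ∫ τ, G (σ + ((t + τ:ℝ):ℂ)*I)*(g τ*ph τ (-V)) := by
    intro σ hσ
    simp only [hR]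
    rw [abs_of_nonneg (by linarith), setIntegral_eq_integral_of_forall_compl_eq_zero]
    · congr 1; funext τ; congr 2; push_cast; ring
    · intro τ hτ; rw [hgs τ hτ]; simp
  have hlim : Tendsto (fun σ:ℝ => ∑' m:ℕ, amu χ m*((((m:ℝ)^(-σ):ℝ):ℂ)*ph t (log m))*FT g (log m - V))
      (𝓝[>] 1) (𝓝 (∑' m:ℕ, amu χ m*(((m:ℝ)⁻¹:ℝ)*ph t (log m))*FT g (log m - V))) := by
    refine tendsto_tsum_of_dominated_convergence (bound := fun m => C*kern V m) ((kern_summable V).mul_left C) ?_ ?_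
    · intro m
      refine tendsto_nhdsWithin_of_tendsto_nhds ?_
      rcases Nat.eq_zero_or_pos m with rfl | hm
      · simp [amu_zero]
      · have hm' : (0:ℝ) < m := mod_cast hm
        have h1 : Tendsto (fun σ:ℝ => (((m:ℝ)^(-σ):ℝ):ℂ)) (𝓝 1) (𝓝 (((m:ℝ)⁻¹:ℝ):ℂ)) := by
          have h2 : Continuous (fun σ:ℝ => (((m:ℝ)^(-σ):ℝ):ℂ)) :=
            continuous_ofReal.comp (Continuous.rpow continuous_const (by fun_prop) (fun _ => Or.inl hm'.ne'))
          have h3 := h2.tendsto 1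
          rwa [rpow_neg_one] at h3
        exact ((h1.mul_const _).const_mul _).mul_const _
    · filter_upwards [self_mem_nhdsWithin] with σ hσ m
      rcases Nat.eq_zero_or_pos m with rfl | hm
      · simp [amu_zero, kern]
      · have hm' : (1:ℝ) ≤ m := mod_cast hm
        rw [norm_mul, norm_mul, norm_mul, ph_norm, mul_one, norm_real, norm_of_nonneg (by positivity)]
        have h1 : (m:ℝ)^(-σ) ≤ (m:ℝ)⁻¹ := by
          rw [← rpow_neg_one]
          exact rpow_le_rpow_of_exponent_le hm' (by simp only [Set.mem_Ioi] at hσ; linarith)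
        have := amu_norm χ m
        calc _ ≤ 1*(m:ℝ)⁻¹*(C*(1 + (log m - V)^2)⁻¹) := by gcongr; exact hC _
          _ = _ := by unfold kern; ring
  have hlim2 : Tendsto R (𝓝[>] 1) (𝓝 (R 1)) := tendsto_nhdsWithin_of_tendsto_nhds (hRc.tendsto 1)
  have heq : (fun σ:ℝ => ∑' m:ℕ, amu χ m*((((m:ℝ)^(-σ):ℝ):ℂ)*ph t (log m))*FT g (log m - V)) =ᶠ[𝓝[>] 1] R := by
    filter_upwards [self_mem_nhdsWithin] with σ hσ
    rw [hRe σ (le_of_lt hσ)]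
    exact (wiener_sigma χ g hgi t V σ hσ G hG).tsum_eq
  have h := tendsto_nhds_unique (hlim.congr' heq) hlim2
  rw [h, hRe 1 le_rfl]; simp

lemma wiener (χ : DirichletCharacter ℂ q) (g:ℝ → ℂ) (hg : Continuous g) (D:ℝ)
    (hgD : ∀ τ, D < |τ| → g τ = 0) (C:ℝ) (hC : ∀ x, ‖FT g x‖ ≤ C*(1 + x^2)⁻¹) (t:ℝ) :
    Tendsto (fun V:ℝ => ∑' m:ℕ, amu χ m*(((m:ℝ)⁻¹:ℝ)*ph t (log m))*FT g (log m - V))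
      atTop (𝓝 0) := by
  obtain ⟨G, hGc, hG⟩ := amu_series χ
  have h := Real.tendsto_integral_exp_smul_cocompact (fun τ => G (1 + ((t + τ:ℝ):ℂ)*I)*g τ)
  have h2 : Tendsto (fun V:ℝ => -V / (2*Real.pi)) atTop (cocompact ℝ) := by
    have h3 : Tendsto (fun V:ℝ => -V / (2*Real.pi)) atTop atBot :=
      (tendsto_neg_atTop_atBot).atBot_div_const (by positivity)
    exact h3.mono_right atBot_le_cocompact
  refine (h.comp h2).congr fun V => ?_
  rw [wiener_one χ g hg D hgD C hC t V G hGc hG]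
  refine integral_congr_ae (Eventually.of_forall fun τ => ?_)
  simp only [Circle.smul_def, fourierChar_apply, smul_eq_mul]
  have : cexp (((2*Real.pi*-(τ*(-V / (2*Real.pi))):ℝ):ℂ)*I) = ph τ (-V) := by
    unfold ph
    congr 2
    rw [← ofReal_neg]
    congr 1; field_simp
  rw [this]; ring
end tauber

/-- Fejer kernel -/
noncomputable def fejK (D y:ℝ):ℝ := triHat D y / (2*Real.pi*D)

lemma fejK_nonneg {D:ℝ} (hD : 0 < D) (y:ℝ) : 0 ≤ fejK D y :=
  div_nonneg (triHat_nonneg _ _) (by positivity)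

lemma fejK_integrable (D:ℝ) : Integrable (fejK D) := (triHat_integrable D).div_const _

lemma fejK_continuous (D:ℝ) : Continuous (fejK D) := (triHat_continuous D).div_const _

lemma fejK_int {D:ℝ} (hD : 0 < D) : ∫ y, fejK D y = 1 := by
  unfold fejK
  rw [integral_div]
  have h := tri_inv hD.le 0
  simp only [ph_zero, mul_one] at h
  have h2 : tri D 0 = D := by simp [tri, hD.le]
  rw [h2, integral_complex_ofReal] at h
  have h3 : ∫ t, triHat D t = 2*Real.pi*D := mod_cast h
  rw [h3, div_self (by positivity)]

lemma fejK_sq {D:ℝ} (hD : 0 < D) (y:ℝ) : fejK D y*y^2 ≤ 1 / D := by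
  unfold fejK
  rw [div_mul_eq_mul_div, triHat_mul_sq, div_le_div_iff₀ (by positivity) hD]
  have := neg_one_le_cos (D*y)
  have := pi_gt_three
  nlinarith

lemma tri_conv_int (A D x:ℝ) : Integrable (fun y => fejK D y*tri A (x - y)) := by
  refine Integrable.mul_bdd (c := |A|) (fejK_integrable D) ?_ ?_
  · exact ((tri_continuous A).comp (by fun_prop)).aestronglyMeasurable
  · refine Eventually.of_forall fun y => ?_
    rw [norm_of_nonneg (tri_nonneg _ _)]
    unfold tri
    exact max_le (abs_nonneg _) (by linarith [le_abs_self A, abs_nonneg (x - y)])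

lemma fejer_pt {A D κ:ℝ} (hA : 1 ≤ A) (hD : 0 < D) (hκ : 0 < κ) (x y:ℝ) :
    (1 + x^2)*(fejK D y * |tri A (x - y) - tri A x|) ≤
      (1 + 4*A^2)*(κ*fejK D y + A*(1 + (κ^2)⁻¹) / D*(1 + y^2)⁻¹) + 5 / D*tri A (x - y) := by
  have hK := fejK_nonneg hD y
  have hK2 := fejK_sq hD y
  have ht := tri_nonneg A (x - y)
  have hA0 : 0 ≤ A := by linarith
  by_cases hx : |x| ≤ 2*A
  · have h1 : 1 + x^2 ≤ 1 + 4*A^2 := by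
      rw [← sq_abs x]; nlinarith [abs_nonneg x]
    have h2 : fejK D y * |tri A (x - y) - tri A x| ≤ κ*fejK D y + A*(1 + (κ^2)⁻¹) / D*(1 + y^2)⁻¹ := by
      by_cases hy : |y| ≤ κ
      · have h3 := tri_lip A (x - y) x
        rw [show x - y - x = -y by ring, abs_neg] at h3
        have : 0 ≤ A*(1 + (κ^2)⁻¹) / D*(1 + y^2)⁻¹ := by positivity
        nlinarith
      · push Not at hy
        have h3 : |tri A (x - y) - tri A x| ≤ A := by
          rw [abs_le]
          constructor <;> linarith [tri_le hA0 x, tri_le hA0 (x-y), tri_nonneg A x]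
        have hy2 : κ^2 ≤ y^2 := by rw [← sq_abs y]; nlinarith
        have hy0 : 0 < y^2 := lt_of_lt_of_le (by positivity) hy2
        have h4 : fejK D y ≤ (1 + (κ^2)⁻¹) / D*(1 + y^2)⁻¹ := by
          rw [← div_eq_mul_inv, le_div_iff₀ (by positivity)]
          have h5 : 1 ≤ (κ^2)⁻¹*y^2 := by
            rw [inv_mul_eq_div, le_div_iff₀ (by positivity)]; linarith
          calc fejK D y*(1 + y^2) ≤ fejK D y*((κ^2)⁻¹*y^2 + y^2) := by gcongr
            _ = (fejK D y*y^2)*(1 + (κ^2)⁻¹) := by ring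
            _ ≤ (1/D)*(1 + (κ^2)⁻¹) := by gcongr
            _ = _ := by ring
        calc fejK D y * |tri A (x - y) - tri A x| ≤ ((1 + (κ^2)⁻¹) / D*(1 + y^2)⁻¹)*A := by gcongr
          _ = A*(1 + (κ^2)⁻¹) / D*(1 + y^2)⁻¹ := by ring
          _ ≤ _ := by linarith [mul_nonneg hκ.le hK]
    have h6 : 0 ≤ 5 / D*tri A (x - y) := by positivity
    have h7 : (1 + x^2)*(fejK D y * |tri A (x - y) - tri A x|) ≤
      (1 + 4*A^2)*(κ*fejK D y + A*(1 + (κ^2)⁻¹) / D*(1 + y^2)⁻¹) := by gcongr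
    linarith
  · push Not at hx
    have h0 : tri A x = 0 := tri_eq_zero (by linarith)
    rw [h0, sub_zero, abs_of_nonneg ht]
    have h6 : 0 ≤ (1 + 4*A^2)*(κ*fejK D y + A*(1 + (κ^2)⁻¹) / D*(1 + y^2)⁻¹) := by positivity
    by_cases hxy : A ≤ |x - y|
    · rw [tri_eq_zero hxy]; simpa using h6
    · push Not at hxy
      have h1 : |x| - |y| ≤ |x - y| := abs_sub_abs_le_abs_sub x y
      have h2 : |x| ≤ 2 * |y| := by linarith
      have h3 : 1 ≤ |y| := by linarith
      have h4 : 1 + x^2 ≤ 5*y^2 := by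
        rw [← sq_abs x, ← sq_abs y]; nlinarith [abs_nonneg x]
      have : (1 + x^2)*(fejK D y*tri A (x - y)) ≤ 5 / D*tri A (x - y) := by
        calc (1 + x^2)*(fejK D y*tri A (x - y)) ≤ (5*y^2)*(fejK D y*tri A (x - y)) := by gcongr
          _ = 5*(fejK D y*y^2)*tri A (x - y) := by ring
          _ ≤ 5*(1 / D)*tri A (x - y) := by gcongr
          _ = _ := by ring
      linarith

lemma tri_integral_le {A:ℝ} (hA : 0 ≤ A) : ∫ y, tri A y ≤ A^2 := by
  have h := fourier_tri hA 0
  simp only [ph_zero', mul_one] at h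
  rw [integral_complex_ofReal] at h
  have h3 : ∫ t, tri A t = triHat A 0 := mod_cast h
  rw [h3]; exact triHat_le A 0

lemma fejer_err {A D κ:ℝ} (hA : 1 ≤ A) (hD : 0 < D) (hκ : 0 < κ) (x:ℝ) :
    |(∫ y, fejK D y*tri A (x - y)) - tri A x| ≤
      ((1 + 4*A^2)*(κ + A*(1 + (κ^2)⁻¹) / D*Real.pi) + 5 / D*A^2)*(1 + x^2)⁻¹ := by
  have e1 : (∫ y, fejK D y*tri A (x - y)) - tri A x = ∫ y, fejK D y*(tri A (x - y) - tri A x) := by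
    simp_rw [mul_sub]
    rw [integral_sub (tri_conv_int A D x) ((fejK_integrable D).mul_const _), integral_mul_const, fejK_int hD, one_mul]
  have hti : Integrable (fun y => tri A (x - y)) := (tri_integrable A).comp_sub_left x
  have hi : Integrable (fun y => fejK D y*(tri A (x - y) - tri A x)) := by
    simp_rw [mul_sub]
    exact (tri_conv_int A D x).sub ((fejK_integrable D).mul_const _)
  rw [← div_eq_mul_inv, le_div_iff₀ (by positivity), mul_comm, e1]
  have ha : Integrable (fun y => (1 + 4*A^2)*(κ*fejK D y + A*(1 + (κ^2)⁻¹) / D*(1 + y^2)⁻¹)) :=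
    (((fejK_integrable D).const_mul _).add (integrable_inv_one_add_sq.const_mul _)).const_mul _
  calc (1 + x^2) * |∫ y, fejK D y*(tri A (x - y) - tri A x)|
      ≤ (1 + x^2)*∫ y, fejK D y * |tri A (x - y) - tri A x| := by
        gcongr
        rw [← norm_eq_abs]
        refine (norm_integral_le_integral_norm _).trans (le_of_eq ?_)
        congr 1; funext y
        rw [norm_mul, norm_of_nonneg (fejK_nonneg hD y), norm_eq_abs]
    _ = ∫ y, (1 + x^2)*(fejK D y * |tri A (x - y) - tri A x|) := by rw [integral_const_mul]
    _ ≤ ∫ y, ((1 + 4*A^2)*(κ*fejK D y + A*(1 + (κ^2)⁻¹) / D*(1 + y^2)⁻¹) + 5 / D*tri A (x - y)) := by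
        refine integral_mono ?_ (ha.add (hti.const_mul _)) fun y => fejer_pt hA hD hκ x y
        refine Integrable.const_mul ?_ _
        refine hi.norm.congr (Eventually.of_forall fun y => ?_)
        show ‖_‖ = _
        rw [norm_mul, norm_of_nonneg (fejK_nonneg hD y), norm_eq_abs]
    _ = (1 + 4*A^2)*(κ + A*(1 + (κ^2)⁻¹) / D*Real.pi) + 5 / D*∫ y, tri A (x - y) := by
        rw [integral_add ha (hti.const_mul _), integral_const_mul, integral_const_mul,
          integral_add ((fejK_integrable D).const_mul _) (integrable_inv_one_add_sq.const_mul _),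
          integral_const_mul, integral_const_mul, fejK_int hD, integral_univ_inv_one_add_sq, mul_one]
    _ ≤ _ := by
        gcongr
        rw [integral_sub_left_eq_self (fun y => tri A y)]
        exact tri_integral_le (by linarith)

lemma ph_comm (t x:ℝ) : ph t x = ph x t := by unfold ph; rw [mul_comm t x]

lemma FT_fejer {A D:ℝ} (hA : 0 ≤ A) (hD : 0 < D) (x:ℝ) :
    FT (fun τ => ((triHat A τ*tri D τ / (2*Real.pi*D):ℝ):ℂ)) x =
      ((∫ y, fejK D y*tri A (x - y):ℝ):ℂ) := by
  unfold FT
  set F:ℝ → ℝ → ℂ := fun τ y => ((tri D τ:ℂ)*(tri A y:ℂ))*ph τ (x - y) with hF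
  have hInt : Integrable (Function.uncurry F) (volume.prod volume) := by
    have h1 : Integrable (fun z:ℝ × ℝ => (tri D z.1:ℂ)*(tri A z.2:ℂ)) (volume.prod volume) :=
      (tri_integrable D).ofReal.mul_prod (tri_integrable A).ofReal
    refine h1.mul_bdd (c := 1) ?_ (Eventually.of_forall fun z => (ph_norm _ _).le)
    refine Continuous.aestronglyMeasurable ?_
    unfold ph; fun_prop
  have e1 : ∀ τ, ((triHat A τ*tri D τ / (2*Real.pi*D):ℝ):ℂ)*ph τ x =
      (((2*Real.pi*D)⁻¹:ℝ):ℂ)*∫ y, F τ y := by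
    intro τ
    have h := fourier_tri hA (-τ)
    rw [triHat_neg] at h
    have h2 : ∫ y, F τ y = ((tri D τ:ℂ)*ph τ x)*∫ y, (tri A y:ℂ)*ph (-τ) y := by
      rw [← integral_const_mul]
      congr 1; funext y
      simp only [hF]
      have : ph τ (x - y) = ph τ x*ph (-τ) y := by
        unfold ph; rw [← Complex.exp_add]; congr 1; push_cast; ring
      rw [this]; ring
    rw [h2, h]; push_cast; field_simp
  simp_rw [e1]
  rw [integral_const_mul, integral_integral_swap hInt]
  have e2 : ∀ y, ∫ τ, F τ y = (tri A y:ℂ)*triHat D (x - y) := by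
    intro y
    rw [← fourier_tri hD.le (x - y), ← integral_const_mul]
    congr 1; funext τ
    simp only [hF]
    rw [ph_comm τ]; ring
  simp_rw [e2]
  rw [← integral_const_mul]
  rw [← integral_sub_left_eq_self (fun y => (((2*Real.pi*D)⁻¹:ℝ):ℂ)*((tri A y:ℂ)*triHat D (x - y))) volume x,
    ← integral_complex_ofReal]
  congr 1; funext y
  unfold fejK
  rw [show x - (x - y) = y by ring]; push_cast; field_simp

lemma fejer_approx {A κ:ℝ} (hA : 1 ≤ A) (hκ : 0 < κ) : ∃ g:ℝ → ℂ, Continuous g ∧ ∃ D C:ℝ,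
    (∀ τ, D < |τ| → g τ = 0) ∧ (∀ x, ‖FT g x‖ ≤ C*(1 + x^2)⁻¹) ∧
    (∀ x, ‖FT g x - (tri A x:ℂ)‖ ≤ κ*(1 + x^2)⁻¹) := by
  set κ' := κ / (2*(1 + 4*A^2)) with hκ'
  have hκ'0 : 0 < κ' := by positivity
  set R := (1 + 4*A^2)*(A*(1 + (κ'^2)⁻¹)*Real.pi) + 5*A^2 with hR
  have hR0 : 0 < R := by positivity
  set D := 2*R / κ with hD
  have hD0 : 0 < D := by positivity
  have hb : (1 + 4*A^2)*(κ' + A*(1 + (κ'^2)⁻¹) / D*Real.pi) + 5 / D*A^2 = κ := by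
    have e : (1 + 4*A^2)*(κ' + A*(1 + (κ'^2)⁻¹) / D*Real.pi) + 5 / D*A^2 = (1 + 4*A^2)*κ' + R / D := by
      rw [hR]; ring
    have e2 : R / D = κ / 2 := by rw [hD]; field_simp
    have e3 : (1 + 4*A^2)*κ' = κ / 2 := by rw [hκ']; field_simp
    rw [e, e2, e3]; ring
  have herr : ∀ x, ‖FT (fun τ => ((triHat A τ*tri D τ / (2*Real.pi*D):ℝ):ℂ)) x - (tri A x:ℂ)‖ ≤ κ*(1 + x^2)⁻¹ := by
    intro x
    rw [FT_fejer (by linarith) hD0, ← ofReal_sub, norm_real, norm_eq_abs]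
    have := fejer_err hA hD0 hκ'0 x
    rwa [hb] at this
  refine ⟨_, ?_, D, κ + A*(1 + A^2), ?_, ?_, herr⟩
  · have := triHat_continuous A
    have := tri_continuous D
    fun_prop
  · intro τ hτ
    rw [tri_eq_zero hτ.le]; simp
  · intro x
    have h1 : ‖(tri A x:ℂ)‖ ≤ A*(1 + A^2)*(1 + x^2)⁻¹ := by
      rw [norm_real, norm_of_nonneg (tri_nonneg _ _), ← div_eq_mul_inv, le_div_iff₀ (by positivity)]
      by_cases h : A ≤ |x|
      · rw [tri_eq_zero h]; simp; positivity
      · push Not at h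
        have : x^2 ≤ A^2 := by rw [← sq_abs x]; nlinarith [abs_nonneg x]
        have h2 := tri_le (show 0 ≤ A by linarith) x
        gcongr
    have := norm_le_norm_sub_add (FT (fun τ => ((triHat A τ*tri D τ / (2*Real.pi*D):ℝ):ℂ)) x) (tri A x:ℂ)
    have := herr x
    rw [add_mul]; linarith

section tauber2
variable {q:ℕ} [NeZero q]

/-- the smoothed sum of `μχ` -/
noncomputable def SS (χ : DirichletCharacter ℂ q) (A t V:ℝ):ℂ :=
  ∑' m:ℕ, amu χ m*(((m:ℝ)⁻¹:ℝ)*ph t (log m))*(tri A (log m - V):ℂ)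

lemma amu_term_norm (χ : DirichletCharacter ℂ q) (t V κ:ℝ) (z:ℂ) (m:ℕ)
    (hz : ‖z‖ ≤ κ*(1 + (log m - V)^2)⁻¹) :
    ‖amu χ m*(((m:ℝ)⁻¹:ℝ)*ph t (log m))*z‖ ≤ κ*kern V m := by
  rw [norm_mul, norm_mul, norm_mul, ph_norm, mul_one, norm_real, norm_of_nonneg (by positivity)]
  have := amu_norm χ m
  calc _ ≤ 1*(m:ℝ)⁻¹*(κ*(1 + (log m - V)^2)⁻¹) := by gcongr
    _ = _ := by unfold kern; ring

lemma SS_tendsto (χ : DirichletCharacter ℂ q) {A:ℝ} (hA : 1 ≤ A) (t:ℝ) :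
    Tendsto (SS χ A t) atTop (𝓝 0) := by
  rw [Metric.tendsto_atTop]
  intro ε hε
  set κ := ε / (2*(6*Real.pi)) with hκ
  have hκ0 : 0 < κ := by positivity
  obtain ⟨g, hg, D, C, hD, hC, he⟩ := fejer_approx hA hκ0
  obtain ⟨V0, hV0⟩ := Metric.tendsto_atTop.mp (wiener χ g hg D hD C hC t) (ε/2) (by positivity)
  refine ⟨V0, fun V hV => ?_⟩
  have h1 := hV0 V hV
  rw [dist_zero_right] at h1 ⊢
  have hs1 : Summable (fun m:ℕ => amu χ m*(((m:ℝ)⁻¹:ℝ)*ph t (log m))*FT g (log m - V)) :=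
    Summable.of_norm_bounded ((kern_summable V).mul_left C) fun m => amu_term_norm χ t V C _ m (hC _)
  have hb : ∀ m:ℕ, ‖amu χ m*(((m:ℝ)⁻¹:ℝ)*ph t (log m))*(FT g (log m - V) - tri A (log m - V))‖ ≤ κ*kern V m :=
    fun m => amu_term_norm χ t V κ _ m (he _)
  have hs2 : Summable (fun m:ℕ => amu χ m*(((m:ℝ)⁻¹:ℝ)*ph t (log m))*(FT g (log m - V) - tri A (log m - V))) :=
    Summable.of_norm_bounded ((kern_summable V).mul_left κ) hb
  have e : SS χ A t V = (∑' m:ℕ, amu χ m*(((m:ℝ)⁻¹:ℝ)*ph t (log m))*FT g (log m - V)) -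
      ∑' m:ℕ, amu χ m*(((m:ℝ)⁻¹:ℝ)*ph t (log m))*(FT g (log m - V) - tri A (log m - V)) := by
    rw [← hs1.tsum_sub hs2]
    unfold SS
    congr 1; funext m; ring
  have h2 : ‖∑' m:ℕ, amu χ m*(((m:ℝ)⁻¹:ℝ)*ph t (log m))*(FT g (log m - V) - tri A (log m - V))‖ ≤ κ*(6*Real.pi) := by
    refine (tsum_of_norm_bounded ((kern_summable V).mul_left κ).hasSum hb).trans ?_
    rw [tsum_mul_left]
    gcongr
    exact kern_tsum V
  have h3 : κ*(6*Real.pi) = ε / 2 := by rw [hκ]; field_simp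
  rw [e]
  refine (norm_sub_le _ _).trans_lt ?_
  linarith

lemma mu_kk (χ : DirichletCharacter ℂ q) (a : ZMod q) (m:ℕ) (hm : 0 < m) :
    ((ArithmeticFunction.moebius m:ℤ):ℂ)*kk χ a (m : ZMod q) =
      ∑ g ∈ q.divisors, if g ∣ m then ((ArithmeticFunction.moebius g:ℤ):ℂ)*kk χ a (g : ZMod q)*amu χ (m / g) else 0 := by
  have hq : 0 < q := NeZero.pos q
  set g0 := Nat.gcd m q with hg0
  have hterm : ∀ g ∈ q.divisors, (if g ∣ m then ((ArithmeticFunction.moebius g:ℤ):ℂ)*kk χ a (g : ZMod q)*amu χ (m / g) else 0)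
      = if g = g0 then ((ArithmeticFunction.moebius m:ℤ):ℂ)*kk χ a (m : ZMod q) else 0 := by
    intro g hg
    have hgq := Nat.dvd_of_mem_divisors hg
    by_cases hgm : g ∣ m
    · rw [if_pos hgm]
      obtain ⟨k, rfl⟩ := hgm
      have hg1 : 0 < g := Nat.pos_of_mul_pos_right hm
      rw [Nat.mul_div_cancel_left k hg1]
      by_cases hk : k.Coprime q
      · have h1 : g0 = g := by
          rw [hg0, Nat.Coprime.gcd_mul_right_cancel g hk]; exact Nat.gcd_eq_left hgq
        rw [if_pos h1.symm]
        have hgk : Nat.Coprime g k := (hk.symm).coprime_dvd_left hgq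
        rw [ArithmeticFunction.isMultiplicative_moebius.map_mul_of_coprime hgk]
        have := kk_mul χ a hk (g : ZMod q)
        push_cast
        rw [mul_comm (g : ZMod q) (k : ZMod q), this]
        unfold amu; ring
      · have h0 : χ (k : ZMod q) = 0 := by
          refine MulChar.map_nonunit χ ?_
          rwa [ZMod.isUnit_iff_coprime]
        rw [amu, h0]
        simp only [mul_zero]
        split_ifs with h1
        · by_cases hsq : Squarefree (g*k)
          · exfalso
            apply hk
            have hgk : Nat.Coprime g k := Nat.coprime_of_squarefree_mul hsq
            obtain ⟨q', rfl⟩ := hgq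
            rw [hg0, Nat.gcd_mul_left] at h1
            have h2 : Nat.gcd k q' = 1 := by
              have : g*Nat.gcd k q' = g*1 := by rw [mul_one]; exact h1.symm
              exact Nat.eq_of_mul_eq_mul_left hg1 this
            exact Nat.Coprime.mul_right hgk.symm h2
          · rw [ArithmeticFunction.moebius_eq_zero_of_not_squarefree hsq]; simp
        · rfl
    · rw [if_neg hgm, if_neg]
      rintro rfl
      exact hgm (Nat.gcd_dvd_left m q)
  rw [sum_congr rfl hterm, sum_ite_eq' , if_pos]
  exact Nat.mem_divisors.mpr ⟨Nat.gcd_dvd_right m q, hq.ne'⟩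

lemma EE_bV_eq (χ : DirichletCharacter ℂ q) (a : ZMod q) {A:ℝ} (t V:ℝ) :
    EE χ a t (bV A V) = ∑ g ∈ q.divisors, (((ArithmeticFunction.moebius g:ℤ):ℂ)*kk χ a (g : ZMod q) *
      (((g:ℝ)⁻¹:ℝ)*ph t (log g)))*SS χ A t (V - log g) := by
  have hfin : ∀ m ∉ (bV A V).support, bfun A V m*(ph t (log m)*kk χ a (m : ZMod q)) = 0 := by
    intro m hm
    rw [Finsupp.notMem_support_iff, bV_apply] at hm
    rw [hm, zero_mul]
  have e0 : EE χ a t (bV A V) = ∑' m:ℕ, bfun A V m*(ph t (log m)*kk χ a (m : ZMod q)) := by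
    rw [EE_apply, tsum_eq_sum hfin]; rfl
  set T:ℕ → ℕ → ℂ := fun g m => if g ∣ m then (((ArithmeticFunction.moebius g:ℤ):ℂ)*kk χ a (g : ZMod q)*amu χ (m / g)) *
    ((((m:ℝ)⁻¹:ℝ)*ph t (log m))*(tri A (log m - V):ℂ)) else 0 with hT
  have hTfin : ∀ g m, m ∉ Ioc 0 ⌊exp (V + A)⌋₊ → T g m = 0 := by
    intro g m hm
    simp only [hT]
    rcases Nat.eq_zero_or_pos m with rfl | hm0
    · simp
    · have h1 : exp (V + A) < m := by
        by_contra h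
        exact hm (mem_Ioc.mpr ⟨hm0, Nat.le_floor (not_lt.mp h)⟩)
      have h2 : V + A < log m := by
        rw [lt_log_iff_exp_lt (mod_cast hm0)]; exact h1
      rw [tri_eq_zero (by rw [le_abs]; left; linarith)]; simp
  have hTs : ∀ g, Summable (T g) := fun g => summable_of_ne_finset_zero (fun m hm => hTfin g m hm)
  have e1 : ∀ m:ℕ, bfun A V m*(ph t (log m)*kk χ a (m : ZMod q)) = ∑ g ∈ q.divisors, T g m := by
    intro m
    rcases Nat.eq_zero_or_pos m with rfl | hm
    · simp [bfun, hT]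
    · have h := mu_kk χ a m hm
      have : bfun A V m*(ph t (log m)*kk χ a (m : ZMod q)) =
        (((ArithmeticFunction.moebius m:ℤ):ℂ)*kk χ a (m : ZMod q))*((((m:ℝ)⁻¹:ℝ)*ph t (log m))*(tri A (log m - V):ℂ)) := by
        unfold bfun; push_cast; ring
      rw [this, h, sum_mul]
      refine sum_congr rfl fun g _ => ?_
      simp only [hT]
      split_ifs <;> simp
  rw [e0]
  simp_rw [e1]
  rw [Summable.tsum_finsetSum (fun g _ => hTs g)]
  refine sum_congr rfl fun g hg => ?_
  have hg0 : 0 < g := Nat.pos_of_mem_divisors hg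
  have hinj : Function.Injective (fun k:ℕ => g*k) := fun x y h => Nat.eq_of_mul_eq_mul_left hg0 h
  have hsupp : Function.support (T g) ⊆ Set.range (fun k:ℕ => g*k) := by
    intro m hm
    by_contra h
    apply hm
    simp only [hT]
    rw [if_neg]
    rintro ⟨k, rfl⟩
    exact h ⟨k, rfl⟩
  rw [← hinj.tsum_eq hsupp]
  unfold SS
  rw [← tsum_mul_left]
  congr 1; funext k
  simp only [hT]
  rw [if_pos (Dvd.intro k rfl), Nat.mul_div_cancel_left k hg0]
  rcases Nat.eq_zero_or_pos k with rfl | hk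
  · simp [amu_zero]
  · have hl : log ((g*k:ℕ):ℝ) = log g + log k := by
      push_cast; exact log_mul (by positivity) (by positivity)
    rw [hl, ph_add, show log g + log k - V = log k - (V - log g) by ring]
    push_cast
    rw [mul_inv]; ring

lemma EE_bV_tendsto (χ : DirichletCharacter ℂ q) (a : ZMod q) {A:ℝ} (hA : 1 ≤ A) (t:ℝ) :
    Tendsto (fun V => EE χ a t (bV A V)) atTop (𝓝 0) := by
  simp_rw [EE_bV_eq]
  rw [show (0:ℂ) = ∑ g ∈ q.divisors, (((ArithmeticFunction.moebius g:ℤ):ℂ)*kk χ a (g : ZMod q) *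
      (((g:ℝ)⁻¹:ℝ)*ph t (log g)))*0 by simp]
  refine tendsto_finset_sum _ fun g _ => Tendsto.const_mul _ ?_
  exact (SS_tendsto χ hA t).comp (tendsto_atTop_add_const_right _ _ tendsto_id)
end tauber2

lemma bV_card (A V:ℝ) : ((bV A V).support.card:ℝ) ≤ exp (V + A) := by
  have h1 : (bV A V).support ⊆ Ioc 0 ⌊exp (V + A)⌋₊ := Finsupp.support_onFinset_subset
  have h2 := card_le_card h1
  rw [Nat.card_Ioc, Nat.sub_zero] at h2
  calc ((bV A V).support.card:ℝ) ≤ ⌊exp (V + A)⌋₊ := mod_cast h2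
    _ ≤ _ := Nat.floor_le (exp_pos _).le

lemma bV_pt {A V:ℝ} (hA : 0 ≤ A) {m:ℕ} (hm : m ∈ (bV A V).support) : ‖bV A V m‖ ≤ A*exp (A - V) := by
  obtain ⟨h1, h2, h3⟩ := bV_support hm
  refine (bfun_norm hA V m).trans ?_
  gcongr
  rw [show A - V = -(V - A) by ring, exp_neg]
  exact inv_anti₀ (exp_pos _) h2

lemma bV_l2 {A:ℝ} (hA : 0 ≤ A) (V:ℝ) :
    ∑ m ∈ (bV A V).support, ‖bV A V m‖^2 ≤ A^2*exp (3*A)*exp (-V) := by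
  calc _ ≤ ∑ m ∈ (bV A V).support, (A*exp (A - V))^2 :=
        sum_le_sum fun m hm => by gcongr; exact bV_pt hA hm
    _ = (bV A V).support.card*(A*exp (A - V))^2 := by rw [sum_const, nsmul_eq_mul]
    _ ≤ exp (V + A)*(A*exp (A - V))^2 := by gcongr; exact bV_card A V
    _ = _ := by
        rw [mul_pow, ← exp_nat_mul]
        have : A^2*exp (3*A)*exp (-V) = A^2*(exp (V + A)*exp ((2:ℕ)*(A - V))) := by
          rw [mul_assoc, ← exp_add, ← exp_add]; congr 2; push_cast; ring
        rw [this]; ring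

lemma bV_l1 {A:ℝ} (hA : 0 ≤ A) (V:ℝ) : ∑ m ∈ (bV A V).support, ‖bV A V m‖ ≤ A*exp (2*A) := by
  calc _ ≤ ∑ m ∈ (bV A V).support, (A*exp (A - V)) := sum_le_sum fun m hm => bV_pt hA hm
    _ = (bV A V).support.card*(A*exp (A - V)) := by rw [sum_const, nsmul_eq_mul]
    _ ≤ exp (V + A)*(A*exp (A - V)) := by gcongr; exact bV_card A V
    _ = _ := by
        have : A*exp (2*A) = A*(exp (V + A)*exp (A - V)) := by
          rw [← exp_add]; congr 2; ring
        rw [this]; ring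

lemma cls_mem_P {P : Finset ℕ} {H v p:ℕ} (hp : p ∈ cls P H v) : p ∈ P := (mem_filter.mp hp).1

lemma cls_sum_le {P : Finset ℕ} (hP : ∀ p ∈ P, p.Prime) {H:ℕ} (hH : 0 < H) (v:ℕ) :
    ∑ p ∈ cls P H v, (p:ℝ)⁻¹ ≤ 3 := by
  have hH' : (1:ℝ) ≤ H := mod_cast hH
  set N := exp ((v:ℝ)/H) with hN
  have hN1 : 1 ≤ N := one_le_exp (by positivity)
  have hsub : cls P H v ⊆ Icc 1 ⌊N*3⌋₊ := by
    intro p hp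
    have hp0 : (0:ℝ) < p := mod_cast (hP p (cls_mem_P hp)).pos
    rw [mem_Icc]
    refine ⟨(hP p (cls_mem_P hp)).pos, Nat.le_floor ?_⟩
    have h := (cls_log hH hp).2
    have h1 : 1 / (H:ℝ) ≤ 1 := by rw [div_le_one (by linarith)]; exact hH'
    rw [log_le_iff_le_exp hp0, exp_add] at h
    refine h.trans ?_
    gcongr
    calc exp (1/(H:ℝ)) ≤ exp 1 := exp_le_exp.mpr h1
      _ ≤ 3 := by linarith [exp_one_lt_d9]
  calc ∑ p ∈ cls P H v, (p:ℝ)⁻¹ ≤ ∑ p ∈ cls P H v, N⁻¹ := by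
        refine sum_le_sum fun p hp => ?_
        have hp0 : (0:ℝ) < p := mod_cast (hP p (cls_mem_P hp)).pos
        refine inv_anti₀ (by positivity) ?_
        have h := (cls_log hH hp).1
        rwa [le_log_iff_exp_le hp0] at h
    _ = (cls P H v).card*N⁻¹ := by rw [sum_const, nsmul_eq_mul]
    _ ≤ (N*3)*N⁻¹ := by
        gcongr
        have := card_le_card hsub
        rw [Nat.card_Icc] at this
        calc ((cls P H v).card:ℝ) ≤ ((⌊N*3⌋₊ + 1 - 1:ℕ):ℝ) := mod_cast this
          _ = ⌊N*3⌋₊ := by simp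
          _ ≤ N*3 := Nat.floor_le (by positivity)
    _ = 3 := by field_simp

/-- primes coprime to `q` in `(e^y, e^z]` -/
noncomputable def prq (q:ℕ) (y z:ℝ) : Finset ℕ := (prI y z).filter (fun p => ¬ p ∣ q)

lemma prq_prime {q:ℕ} {y z:ℝ} {p:ℕ} (hp : p ∈ prq q y z) : p.Prime :=
  (mem_prI.mp (mem_filter.mp hp).1).1

lemma prq_cop {q:ℕ} {y z:ℝ} {p:ℕ} (hp : p ∈ prq q y z) : 0 < p ∧ p.Coprime q :=
  ⟨(prq_prime hp).pos, (Nat.Prime.coprime_iff_not_dvd (prq_prime hp)).mpr (mem_filter.mp hp).2⟩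

lemma prq_exp {q:ℕ} {y z:ℝ} {p:ℕ} (hp : p ∈ prq q y z) : exp y < p ∧ (p:ℝ) ≤ exp z :=
  (mem_prI.mp (mem_filter.mp hp).1).2

lemma prq_log {q:ℕ} {y z:ℝ} {p:ℕ} (hp : p ∈ prq q y z) : y < log p ∧ log p ≤ z := by
  have hp0 : (0:ℝ) < p := mod_cast (prq_prime hp).pos
  have h := prq_exp hp
  exact ⟨(lt_log_iff_exp_lt hp0).mpr h.1, (log_le_iff_le_exp hp0).mpr h.2⟩

lemma prq_card (q:ℕ) (y z:ℝ) : ((prq q y z).card:ℝ) ≤ exp z := by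
  have hsub : prq q y z ⊆ Icc 1 ⌊exp z⌋₊ := by
    intro p hp
    rw [mem_Icc]
    exact ⟨(prq_prime hp).pos, Nat.le_floor (prq_exp hp).2⟩
  have := card_le_card hsub
  rw [Nat.card_Icc] at this
  calc ((prq q y z).card:ℝ) ≤ ((⌊exp z⌋₊ + 1 - 1:ℕ):ℝ) := mod_cast this
    _ = ⌊exp z⌋₊ := by simp
    _ ≤ _ := Nat.floor_le (exp_pos _).le

lemma prq_vset {q:ℕ} {y z:ℝ} {H v:ℕ} (hH : 0 < H) (hv : v ∈ vset (prq q y z) H) :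
    y - 1 / H ≤ (v:ℝ) / H ∧ (v:ℝ) / H ≤ z := by
  obtain ⟨p, hp, hpv⟩ := mem_image.mp hv
  have hpc : p ∈ cls (prq q y z) H v := mem_filter.mpr ⟨hp, hpv⟩
  have h1 := cls_log hH hpc
  have h2 := prq_log hp
  constructor <;> linarith

lemma prq_vset_card {q:ℕ} {y z:ℝ} {H:ℕ} (hH : 0 < H) (hz : 0 ≤ z) :
    ((vset (prq q y z) H).card:ℝ) ≤ H*z + 1 := by
  have hH' : (0:ℝ) < H := mod_cast hH
  have hsub : vset (prq q y z) H ⊆ range (⌊H*z⌋₊ + 1) := by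
    intro v hv
    rw [mem_range, Nat.lt_succ_iff]
    refine Nat.le_floor ?_
    have := (prq_vset hH hv).2
    rw [div_le_iff₀ hH'] at this; linarith
  have := card_le_card hsub
  rw [card_range] at this
  calc ((vset (prq q y z) H).card:ℝ) ≤ ((⌊H*z⌋₊ + 1:ℕ):ℝ) := mod_cast this
    _ ≤ _ := by push_cast; gcongr; exact Nat.floor_le (by positivity)

lemma prq_sum_lower : ∃ C:ℝ, 0 < C ∧ ∀ (q:ℕ), 0 < q → ∀ y z:ℝ, 1 ≤ y → y ≤ z →
    log (z / y) - C - ∑ p ∈ q.primeFactors, (1:ℝ)/p ≤ ∑ p ∈ prq q y z, (p:ℝ)⁻¹ := by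
  obtain ⟨C, hC, h⟩ := mertens_prI
  refine ⟨C, hC, fun q hq y z hy hz => ?_⟩
  have h1 := (abs_le.mp (h y z hy hz)).1
  have h2 := sum_filter_add_sum_filter_not (prI y z) (fun p => ¬ p ∣ q) (fun p => (p:ℝ)⁻¹)
  have h3 : ∑ p ∈ (prI y z).filter (fun p => ¬ ¬ p ∣ q), (p:ℝ)⁻¹ ≤ ∑ p ∈ q.primeFactors, (1:ℝ)/p := by
    simp_rw [one_div]
    refine sum_le_sum_of_subset_of_nonneg ?_ (fun _ _ _ => by positivity)
    intro p hp
    rw [mem_filter, not_not] at hp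
    exact Nat.mem_primeFactors.mpr ⟨(mem_prI.mp hp.1).1, hp.2, hq.ne'⟩
  unfold prq
  linarith

section goodsec
variable {q:ℕ} [NeZero q]

lemma IS_bV {A:ℝ} (hA : 0 ≤ A) (V:ℝ) {δ:ℝ} (hδ : 0 < δ) (S : DirichletCharacter ℂ q → Set ℝ) :
    IS δ S (bV A V) ≤ (2*exp (V + A) + q / δ)*(A^2*exp (3*A)*exp (-V)) := by
  refine (IS_all hδ (exp_pos (V + A)) (bV A V) (fun m hm => ?_) S).trans ?_
  · have := bV_support hm; exact ⟨this.1, this.2.2⟩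
  · have : 0 ≤ (q:ℝ) / δ := by positivity
    gcongr
    exact bV_l2 hA V

lemma EE_dec (χ : DirichletCharacter ℂ q) (a : ZMod q) (t A V:ℝ) (P : Finset ℕ)
    (hP : ∀ p ∈ P, 0 < p ∧ p.Coprime q) (H:ℕ) :
    EE χ a t (dec A V P H) = ∑ v ∈ vset P H, QQ (cls P H v) χ t*EE χ a t (bV A (V - v / H)) := by
  unfold dec
  rw [map_sum]
  refine sum_congr rfl fun v _ => ?_
  exact EE_Pc _ (fun p hp => hP p (cls_mem_P hp)) χ a t _ (bV_zero _ _)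

lemma EE_bV_split (χ : DirichletCharacter ℂ q) (a : ZMod q) (t A V:ℝ) (P : Finset ℕ) (H:ℕ) :
    EE χ a t (bV A V) = EE χ a t (decErr A V P H) - ((∑ p ∈ P, (p:ℝ)⁻¹:ℝ):ℂ)⁻¹*EE χ a t (dec A V P H) := by
  unfold decErr
  rw [map_add, map_smul, smul_eq_mul]; ring

/-- the set where all prime polynomials are small -/
def goodset (P : Finset ℕ) (H:ℕ) (α:ℝ) (χ : DirichletCharacter ℂ q) : Set ℝ :=
  {t | ∀ v ∈ vset P H, ‖QQ (cls P H v) χ t‖ ≤ exp (-α*(v / H))}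

lemma goodset_closed (P : Finset ℕ) (H:ℕ) (α:ℝ) (χ : DirichletCharacter ℂ q) : IsClosed (goodset P H α χ) := by
  have : goodset P H α χ = ⋂ v ∈ vset P H, {t | ‖QQ (cls P H v) χ t‖ ≤ exp (-α*(v / H))} := by
    ext t; simp [goodset]
  rw [this]
  exact isClosed_biInter fun v _ => isClosed_le (QQ_continuous _ _).norm continuous_const

lemma IS_good {A V δ α:ℝ} (hA : 1 ≤ A) (hδ : 0 < δ) (hqδ : (q:ℝ) / δ ≤ exp V) {y z:ℝ} (hy : 0 ≤ y)
    (hzV : z ≤ V) {H:ℕ} (hH : 0 < H) (hW : 1 ≤ ∑ p ∈ prq q y z, (p:ℝ)⁻¹)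
    {S : DirichletCharacter ℂ q → Set ℝ} (hS : ∀ χ, MeasurableSet (S χ))
    (hSg : ∀ χ, S χ ⊆ goodset (prq q y z) H α χ) :
    IS δ S (bV A V) ≤ 2*(((vset (prq q y z) H).card:ℝ)*∑ v ∈ vset (prq q y z) H,
      exp (-2*α*(v / H))*IS δ S (bV A (V - v / H))) +
      54*A^2*exp (4*A + 4)*(1 / (∑ p ∈ prq q y z, (p:ℝ)⁻¹) + 1 / (H:ℝ)^2 + exp (-y)) := by
  set P := prq q y z with hP
  set W := ∑ p ∈ P, (p:ℝ)⁻¹ with hWdef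
  have hWinv : W⁻¹ ≤ 1 := inv_le_one_of_one_le₀ hW
  have h1 : IS δ S (bV A V) ≤ 2*IS δ S (dec A V P H) + 2*IS δ S (decErr A V P H) := by
    have := IS_dom δ hS (univ : Finset Bool) (fun _ => 2) (bV A V)
      (fun b => if b then dec A V P H else decErr A V P H) ?_
    · simpa using this
    · intro χ t ht a
      simp only [Fintype.sum_bool, if_true, Bool.false_eq_true, if_false]
      rw [EE_bV_split χ a t A V P H]
      have hn := norm_sub_le (EE χ a t (decErr A V P H)) ((W:ℂ)⁻¹*EE χ a t (dec A V P H))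
      have hn2 : ‖(W:ℂ)⁻¹*EE χ a t (dec A V P H)‖ ≤ ‖EE χ a t (dec A V P H)‖ := by
        rw [norm_mul, norm_inv, norm_real, norm_of_nonneg (by linarith)]
        exact mul_le_of_le_one_left (norm_nonneg _) hWinv
      have h0 := norm_nonneg (EE χ a t (decErr A V P H) - (W:ℂ)⁻¹*EE χ a t (dec A V P H))
      have h3 : ‖EE χ a t (decErr A V P H) - (W:ℂ)⁻¹*EE χ a t (dec A V P H)‖ ≤
        ‖EE χ a t (decErr A V P H)‖ + ‖EE χ a t (dec A V P H)‖ := by linarith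
      nlinarith [sq_nonneg (‖EE χ a t (decErr A V P H)‖ - ‖EE χ a t (dec A V P H)‖)]
  have h2 : IS δ S (dec A V P H) ≤ ∑ v ∈ vset P H, (((vset P H).card:ℝ)*exp (-2*α*(v / H)))*IS δ S (bV A (V - v / H)) := by
    refine IS_dom δ hS _ (fun v:ℕ => ((vset P H).card:ℝ)*exp (-2*α*(v / H))) _
      (fun v:ℕ => bV A (V - v / H)) ?_
    intro χ t ht a
    rw [EE_dec χ a t A V P (fun p hp => prq_cop hp)]
    have hb : ‖∑ v ∈ vset P H, QQ (cls P H v) χ t*EE χ a t (bV A (V - v / H))‖ ≤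
        ∑ v ∈ vset P H, exp (-α*(v / H))*‖EE χ a t (bV A (V - v / H))‖ := by
      refine (norm_sum_le _ _).trans (sum_le_sum fun v hv => ?_)
      rw [norm_mul]
      gcongr
      exact hSg χ ht v hv
    calc _ ≤ (∑ v ∈ vset P H, exp (-α*(v / H))*‖EE χ a t (bV A (V - v / H))‖)^2 := by gcongr
      _ ≤ (vset P H).card*∑ v ∈ vset P H, (exp (-α*(v / H))*‖EE χ a t (bV A (V - v / H))‖)^2 :=
          sq_sum_le_card_mul_sum_sq
      _ = _ := by
          rw [mul_sum]
          refine sum_congr rfl fun v _ => ?_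
          rw [mul_pow, ← exp_nat_mul, mul_assoc]
          congr 3; push_cast; ring
  have h3 : IS δ S (decErr A V P H) ≤ 27*A^2*exp (4*A + 4)*(1 / W + 1 / (H:ℝ)^2 + exp (-y)) := by
    have ha := IS_all hδ (exp_pos (V + A + 1)) (decErr A V P H) (fun m hm => by
      have := decErr_support (fun p hp => prq_prime hp) hH hm
      exact ⟨this.1, this.2.2⟩) S
    have hb := decErr_l2 (V := V) hA (fun p hp => prq_prime hp) hH hW (one_le_exp hy)
      (fun p hp => (prq_exp hp).1.le) ((prq_card q y z).trans (exp_le_exp.mpr (by linarith)))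
    have hc : 2*exp (V + A + 1) + q / δ ≤ 3*exp (V + A + 1) := by
      have : exp V ≤ exp (V + A + 1) := exp_le_exp.mpr (by linarith)
      linarith
    refine ha.trans ?_
    calc _ ≤ (3*exp (V + A + 1))*(9*A ^ 2*exp (3*A + 3)*exp (-V)*(1 / W + 1 / (H:ℝ) ^ 2 + 1 / exp y)) :=
          mul_le_mul hc hb (sum_nonneg fun _ _ => by positivity) (by positivity)
      _ = _ := by
          have e : exp (4*A+4) = exp (V + A + 1)*exp (3*A+3)*exp (-V) := by
            rw [← exp_add, ← exp_add]; congr 1; ring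
          rw [e, exp_neg y]; ring
  have e4 : ∑ v ∈ vset P H, (((vset P H).card:ℝ)*exp (-2*α*(v / H)))*IS δ S (bV A (V - v / H)) =
      ((vset P H).card:ℝ)*∑ v ∈ vset P H, exp (-2*α*(v / H))*IS δ S (bV A (V - v / H)) := by
    rw [mul_sum]
    exact sum_congr rfl fun v _ => by ring
  rw [e4] at h2
  calc _ ≤ _ := h1
    _ ≤ 2*(((vset P H).card:ℝ)*∑ v ∈ vset P H, exp (-2*α*(v / H))*IS δ S (bV A (V - v / H))) +
        2*(27*A^2*exp (4*A + 4)*(1 / W + 1 / (H:ℝ)^2 + exp (-y))) := by linarith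
    _ = _ := by ring
end goodsec

section transsec
variable {q:ℕ} [NeZero q]

lemma IS_badpiece {P : Finset ℕ} (hP : ∀ p ∈ P, p.Prime ∧ p.Coprime q) {H:ℕ} (hH : 0 < H) (v:ℕ) {α δ:ℝ} (hδ : 0 < δ)
    {S : DirichletCharacter ℂ q → Set ℝ} (hS : ∀ χ, MeasurableSet (S χ))
    (hSb : ∀ χ, ∀ t ∈ S χ, exp (-α*(v / H)) < ‖QQ (cls P H v) χ t‖)
    {Y1 Y2 B:ℝ} (hY1 : 0 < Y1) (hB : 0 ≤ B) (hY2 : 0 < Y2) (c:ℕ →₀ ℂ)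
    (hc : ∀ n, c n ≠ 0 → 1 ≤ n ∧ Y1 ≤ n ∧ (n:ℝ) ≤ Y2) (hcB : ∀ n, ‖c n‖ ≤ B*(n:ℝ)⁻¹) (l:ℕ)
    (hq : (q:ℝ) / δ ≤ Y2*exp (l*(v / H))) :
    IS δ S c ≤ exp (2*α*l*(v / H))*(3*B ^ 2*((l:ℝ) ^ l) ^ 2 *
      (Y2 / Y1*exp (l / H)) ^ 2*exp (3*exp 2)) := by
  have hH' : (0:ℝ) < H := mod_cast hH
  have hc0 : c 0 = 0 := by
    by_contra h
    have := (hc 0 h).1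
    omega
  have hcop : ∀ p ∈ cls P H v, 0 < p ∧ p.Coprime q := fun p hp =>
    ⟨(hP p (cls_mem_P hp)).1.pos, (hP p (cls_mem_P hp)).2⟩
  have h1 : IS δ S c ≤ ∑ i ∈ (univ : Finset Unit), exp (2*α*l*(v / H))*IS δ S ((Pc (cls P H v))^[l] c) := by
    refine IS_dom δ hS (univ : Finset Unit) (fun _ => exp (2*α*l*(v / H))) c (fun _ => (Pc (cls P H v))^[l] c) ?_
    intro χ t ht a
    simp only [univ_unique, sum_const, card_singleton, one_smul]
    rw [EE_Pc_iter _ hcop χ a t c hc0, norm_mul, norm_pow, mul_pow, ← mul_assoc]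
    refine le_mul_of_one_le_left (by positivity) ?_
    have h2 : exp (-α*(v / H)) ^ (l*2) ≤ ‖QQ (cls P H v) χ t‖ ^ (l*2) :=
      pow_le_pow_left₀ (exp_pos _).le (hSb χ t ht).le _
    rw [← pow_mul]
    calc (1:ℝ) = exp (2*α*l*(v / H))*exp (-α*(v / H)) ^ (l*2) := by
          rw [← exp_nat_mul, ← exp_add, ← exp_zero]; congr 1; push_cast; ring
      _ ≤ _ := by gcongr
  refine h1.trans ?_
  simp only [univ_unique, sum_const, card_singleton, one_smul]
  refine mul_le_mul_of_nonneg_left ?_ (exp_pos _).le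
  have hN : ∀ p ∈ cls P H v, exp (v / H) ≤ p ∧ (p:ℝ) ≤ exp (v / H + 1 / H) := by
    intro p hp
    have hp0 : (0:ℝ) < p := mod_cast (hcop p hp).1
    have := cls_log hH hp
    exact ⟨(le_log_iff_exp_le hp0).mp this.1, (log_le_iff_le_exp hp0).mp this.2⟩
  have h3 := moment_IS (q := q) (cls P H v) (fun p hp => (hP p (cls_mem_P hp)).1) (exp_pos _) hY1 hB hN c hc hcB (exp_pos _) hY2 l hδ
    (hq.trans (by
      rw [← exp_nat_mul]
      gcongr
      have : (0:ℝ) ≤ 1 / H := by positivity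
      linarith)) S
  refine h3.trans ?_
  have e : Y2*exp (v / H + 1 / H) ^ l / (Y1*exp (v / H) ^ l) = Y2 / Y1*exp (l / H) := by
    rw [exp_add, mul_pow, ← exp_nat_mul (1 / (H:ℝ)) l]
    have : exp (v / H) ^ l ≠ 0 := by positivity
    rw [show (l:ℝ)*(1 / H) = l / H by ring]
    field_simp
  rw [e]
  have := cls_sum_le (fun p hp => (hP p hp).1) hH v
  gcongr ?_*exp ?_
  linarith [mul_le_mul_of_nonneg_left this (exp_pos 2).le]

lemma trans_core {A V δ α α':ℝ} (hA : 1 ≤ A) (hδ : 0 < δ) (hqδ : (q:ℝ) / δ ≤ exp V) {y z y' z':ℝ} (hy' : 0 ≤ y')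
    (hzV : z' ≤ V) {H H':ℕ} (hH : 0 < H) (hH' : 0 < H') (hW : 1 ≤ ∑ p ∈ prq q y' z', (p:ℝ)⁻¹) (hy1 : 1 < y)
    {S : DirichletCharacter ℂ q → Set ℝ} (hS : ∀ χ, MeasurableSet (S χ))
    (hSg : ∀ χ, S χ ⊆ goodset (prq q y' z') H' α' χ)
    (hSb : ∀ χ, S χ ⊆ (goodset (prq q y z) H α χ)ᶜ) {R:ℝ}
    (hR : ∀ u u':ℝ, ∀ l:ℕ, y - 1 ≤ u → u ≤ z → y' - 1 ≤ u' → u' ≤ z' → l = ⌈u' / u⌉₊ →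
      exp (-2*α'*u')*(exp (2*α*l*u)*(3*A ^ 2*((l:ℝ) ^ l) ^ 2 *
      (exp (2*A)*exp (l / H)) ^ 2*exp (3*exp 2))) ≤ R) :
    IS δ S (bV A V) ≤ 2*(((vset (prq q y' z') H').card:ℝ)^2*(vset (prq q y z) H).card*R) +
      54*A^2*exp (4*A + 4)*(1 / (∑ p ∈ prq q y' z', (p:ℝ)⁻¹) + 1 / (H':ℝ)^2 + exp (-y')) := by
  have hHr : (1:ℝ) ≤ H := mod_cast hH
  have hHr' : (1:ℝ) ≤ H' := mod_cast hH'
  have h1 := IS_good hA hδ hqδ hy' hzV hH' hW hS hSg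
  refine h1.trans ?_
  have h2 : ∑ v ∈ vset (prq q y' z') H', exp (-2*α'*(v / H'))*IS δ S (bV A (V - v / H')) ≤
      ∑ v ∈ vset (prq q y' z') H', ∑ v0 ∈ vset (prq q y z) H, R := by
    refine sum_le_sum fun v' hv' => ?_
    set S':ℕ → DirichletCharacter ℂ q → Set ℝ := fun v χ => S χ ∩ {t | exp (-α*(v / H)) < ‖QQ (cls (prq q y z) H v) χ t‖} with hS'
    have hS'm : ∀ v χ, MeasurableSet (S' v χ) := fun v χ =>
      (hS χ).inter (isOpen_lt continuous_const (QQ_continuous _ _).norm).measurableSet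
    have h3 := IS_union δ (S := S) (vset (prq q y z) H) S' (fun i _ χ => hS'm i χ) (by
      intro χ t ht
      have := hSb χ ht
      simp only [goodset, Set.mem_compl_iff, Set.mem_setOf_eq, not_forall, not_le] at this
      obtain ⟨v, hv, h⟩ := this
      exact ⟨v, hv, ht, h⟩) (bV A (V - v' / H'))
    refine (mul_le_mul_of_nonneg_left h3 (exp_pos _).le).trans ?_
    rw [mul_sum]
    refine sum_le_sum fun v0 hv0 => ?_
    have hu := prq_vset hH hv0
    have hu' := prq_vset hH' hv'
    have hi : 1 / (H:ℝ) ≤ 1 := by rw [div_le_one (by linarith)]; exact hHr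
    have hi' : 1 / (H':ℝ) ≤ 1 := by rw [div_le_one (by linarith)]; exact hHr'
    have hupos : 0 < (v0:ℝ)/H := by linarith
    set l := ⌈((v':ℝ)/H') / ((v0:ℝ)/H)⌉₊ with hl
    have hle : (v':ℝ)/H' ≤ l*(v0/H) := by
      rw [← div_le_iff₀ hupos]; exact Nat.le_ceil _
    have h4 := IS_badpiece (q := q) (P := prq q y z) (fun p hp => ⟨prq_prime hp, (prq_cop hp).2⟩) hH v0 (α := α) hδ
      (hS'm v0) (fun χ t ht => ht.2) (exp_pos (V - v' / H' - A)) (by linarith : 0 ≤ A) (exp_pos (V - v' / H' + A))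
      (bV A (V - v' / H')) (fun n hn => bV_support (Finsupp.mem_support_iff.mpr hn))
      (fun n => bfun_norm (by linarith) _ n) l (by
        refine hqδ.trans ?_
        rw [← exp_add]
        exact exp_le_exp.mpr (by linarith))
    refine (mul_le_mul_of_nonneg_left h4 (exp_pos _).le).trans ?_
    rw [← exp_sub, show V - v' / H' + A - (V - v' / H' - A) = 2*A by ring]
    exact hR _ _ l (by linarith) hu.2 (by linarith) hu'.2 hl
  rw [sum_const, sum_const, nsmul_eq_mul, nsmul_eq_mul] at h2
  have h3 := mul_le_mul_of_nonneg_left h2 (Nat.cast_nonneg (α := ℝ) (vset (prq q y' z') H').card)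
  nlinarith [h3]

lemma first_core {A V δ α:ℝ} (hA : 1 ≤ A) (hα : 0 ≤ α) (hδ : 0 < δ) {y z:ℝ} (hy : 1 ≤ y) (hyz : y ≤ z)
    (hqδ : (q:ℝ) / δ ≤ exp (V - z))
    (hzV : z ≤ V) {H:ℕ} (hH : 0 < H) (hW : 1 ≤ ∑ p ∈ prq q y z, (p:ℝ)⁻¹)
    {S : DirichletCharacter ℂ q → Set ℝ} (hS : ∀ χ, MeasurableSet (S χ))
    (hSg : ∀ χ, S χ ⊆ goodset (prq q y z) H α χ) :
    IS δ S (bV A V) ≤ 2*((H*z + 1)^2*exp (-2*α*(y - 1))*(3*A^2*exp (4*A))) +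
      54*A^2*exp (4*A + 4)*(1 / (∑ p ∈ prq q y z, (p:ℝ)⁻¹) + 1 / (H:ℝ)^2 + exp (-y)) := by
  have hHr : (1:ℝ) ≤ H := mod_cast hH
  have h1 := IS_good hA hδ (hqδ.trans (exp_le_exp.mpr (by linarith))) (by linarith) hzV hH hW hS hSg
  refine h1.trans ?_
  have hcard := prq_vset_card (q := q) (y := y) (z := z) hH (by linarith)
  have h2 : ∑ v ∈ vset (prq q y z) H, exp (-2*α*(v / H))*IS δ S (bV A (V - v / H)) ≤
      ∑ v ∈ vset (prq q y z) H, exp (-2*α*(y - 1))*(3*A^2*exp (4*A)) := by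
    refine sum_le_sum fun v hv => ?_
    have hu := prq_vset hH hv
    have hi : 1 / (H:ℝ) ≤ 1 := by rw [div_le_one (by linarith)]; exact hHr
    refine mul_le_mul (exp_le_exp.mpr (by nlinarith)) ?_ (IS_nonneg _ _ _) (exp_pos _).le
    refine (IS_bV (by linarith) _ hδ S).trans ?_
    have h3 : (q:ℝ) / δ ≤ exp (V - v / H + A) := hqδ.trans (exp_le_exp.mpr (by linarith))
    calc _ ≤ (2*exp (V - v/H + A) + exp (V - v/H + A))*(A^2*exp (3*A)*exp (-(V - v / H))) := by gcongr
      _ = 3*A^2*(exp (V - v/H + A)*exp (3*A)*exp (-(V - v / H))) := by ring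
      _ = _ := by rw [← exp_add, ← exp_add]; congr 2; ring
  rw [sum_const, nsmul_eq_mul] at h2
  have hK : 0 ≤ exp (-2*α*(y - 1))*(3*A^2*exp (4*A)) := by positivity
  have hc0 : (0:ℝ) ≤ (vset (prq q y z) H).card := Nat.cast_nonneg _
  have h3 : ((vset (prq q y z) H).card:ℝ)*∑ v ∈ vset (prq q y z) H, exp (-2*α*(v / H))*IS δ S (bV A (V - v / H))
      ≤ (H*z + 1)*((H*z + 1)*(exp (-2*α*(y - 1))*(3*A^2*exp (4*A)))) := by
    refine mul_le_mul hcard (h2.trans (by gcongr)) ?_ (by nlinarith)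
    exact sum_nonneg fun v _ => mul_nonneg (exp_pos _).le (IS_nonneg _ _ _)
  nlinarith [h3]
end transsec

lemma pow_help {E:ℝ} (h : 2 ≤ E) : E*E^2 + 1 ≤ E^4 ∧ E*E + 1 ≤ E^3 := by
  have h1 : 1 ≤ E^3 := one_le_pow₀ (by linarith)
  have h2 : 1 ≤ E^2 := one_le_pow₀ (by linarith)
  constructor <;> nlinarith

set_option maxHeartbeats 1000000 in
lemma trans_num_R {A α0 K y s w u u':ℝ} {B H l:ℕ} (hA : 1 ≤ A) (hα0 : 0 < α0) (hH : 0 < H)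
    (hK : 3*A^2*exp (4*A)*exp (3*exp 2) ≤ exp K)
    (hs : 4 ≤ s) (hys : y = s^2) (hw0 : 1 ≤ w) (hws : 48*w ≤ s) (hwα : 1/w ≤ α0)
    (hF : (2*α0 + |K| + 40)*s^(2*B+2) ≤ exp s)
    (hu1 : y - 1 ≤ u) (hu2 : u ≤ y^B) (hu1' : exp s - 1 ≤ u') (hu2' : u' ≤ exp (2*s))
    (hl : l = ⌈u'/u⌉₊) :
    exp (-2*(α0 - 1/s)*u')*(exp (2*(α0 - 1/w)*l*u)*(3*A ^ 2*((l:ℝ) ^ l) ^ 2 *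
      (exp (2*A)*exp (l / H)) ^ 2*exp (3*exp 2))) ≤ exp (-(12*s+w)) := by
  have hHr : (1:ℝ) ≤ H := mod_cast hH
  have hs0 : 0 < s := by linarith
  have hy16 : 16 ≤ y := by rw [hys]; nlinarith
  have hu : 0 < u := by linarith
  have hsB : (1:ℝ) ≤ s^(2*B) := one_le_pow₀ (by linarith)
  have hyB : y^B = s^(2*B) := by rw [hys, ← pow_mul]
  have hF' : (2*α0 + |K| + 40)*(s^(2*B)*s^2) ≤ exp s := by rw [← pow_add]; exact hF
  have hK0 := abs_nonneg K
  have hKl := le_abs_self K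
  have hs2 : s^(2*B) ≤ s^(2*B)*s^2 := le_mul_of_one_le_right (by linarith) (by nlinarith)
  have huu : u ≤ u' := by
    have : 40*(s^(2*B)*s^2) ≤ (2*α0 + |K| + 40)*(s^(2*B)*s^2) := by gcongr; linarith
    linarith
  have hu'0 : 0 < u' := by linarith
  have hl1 : 1 ≤ l := by rw [hl]; exact Nat.one_le_iff_ne_zero.mpr (by rw [← Nat.pos_iff_ne_zero]; exact Nat.ceil_pos.mpr (by positivity))
  have hlr : (1:ℝ) ≤ l := mod_cast hl1
  have hlu : (l:ℝ) < u'/u + 1 := by rw [hl]; exact Nat.ceil_lt_add_one (by positivity)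
  have hlu2 : (l:ℝ)*u ≤ u' + u := by
    have := mul_le_mul_of_nonneg_right hlu.le hu.le
    rw [add_mul, div_mul_cancel₀ _ hu.ne'] at this; linarith
  have hl4 : (l:ℝ) ≤ 4*u' / y := by
    rw [le_div_iff₀ (by linarith)]
    nlinarith
  have hlu' : (l:ℝ) ≤ u' := hl4.trans (by rw [div_le_iff₀ (by linarith)]; nlinarith)
  have hlog : log l ≤ 2*s := (log_le_iff_le_exp (by linarith)).mpr (hlu'.trans hu2')
  have hll : ((l:ℝ)^l)^2 = exp (2*l*log l) := by
    rw [← pow_mul, ← rpow_natCast, rpow_def_of_pos (by linarith)]; congr 1; push_cast; ring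
  have hcost : 2*l*log l + 2*(l / H) ≤ u'/(2*w) := by
    have h1 : (l:ℝ)/H ≤ l := div_le_self (by linarith) hHr
    have h2 : 2*l*log l ≤ 2*l*(2*s) := by gcongr
    have h3 : 2*l*(2*s) + 2*l ≤ 6*s*l := by nlinarith
    have h4 : 6*s*l ≤ 6*s*(4*u' / y) := by gcongr
    have h5 : 6*s*(4*u' / y) = 24*u' / s := by rw [hys]; field_simp; norm_num
    have h6 : 24*u' / s ≤ u' / (2*w) := by
      rw [div_le_div_iff₀ hs0 (by linarith)]; nlinarith
    linarith
  have hα : 0 ≤ α0 - 1/w := by linarith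
  have hgain : -2*(α0 - 1/s)*u' + 2*(α0 - 1/w)*l*u ≤ -(u'/w) + 2*α0*u := by
    have h1 : 2*(α0 - 1/w)*(l*u) ≤ 2*(α0 - 1/w)*(u' + u) := by gcongr
    have h2 : 1/s ≤ 1/(2*w) := one_div_le_one_div_of_le (by linarith) (by linarith)
    have h3 : 1/(2*w)*2 = 1/w := by field_simp
    have h4 : 0 ≤ 1/w := by positivity
    have h6 := mul_le_mul_of_nonneg_right h2 hu'0.le
    have h7 : 0 ≤ 1/w*u := by positivity
    linear_combination h1 + 2*h6 + 2*h7
  have hbig : 2*α0*u + K + 12*s + w ≤ u'/(2*w) := by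
    rw [le_div_iff₀ (by linarith)]
    have h1 : 2*α0*u + K + 12*s + w ≤ (2*α0 + |K| + 13)*(s^(2*B)*s) := by
      have e1 : s ≤ s^(2*B)*s := le_mul_of_one_le_left hs0.le hsB
      have e2 : s^(2*B) ≤ s^(2*B)*s := le_mul_of_one_le_right (by linarith) (by linarith)
      have e3 : 2*α0*u ≤ 2*α0*(s^(2*B)*s) := by gcongr; linarith
      have e4 : |K| ≤ |K| * (s^(2*B)*s) := le_mul_of_one_le_right hK0 (by linarith)
      linarith
    have h2 : (2*α0*u + K + 12*s + w)*(2*w) ≤ (2*α0 + |K| + 13)*(s^(2*B)*s)*s := by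
      refine mul_le_mul h1 (by linarith) (by linarith) (by positivity)
    have h3 : (2*α0 + |K| + 13)*(s^(2*B)*s)*s + 1 ≤ (2*α0 + |K| + 40)*(s^(2*B)*s^2) := by
      linarith
    linarith
  rw [hll]
  calc _ = exp (-2*(α0 - 1/s)*u' + 2*(α0 - 1/w)*l*u)*(exp (2*l*log l + 2*(l / H))) *
        (3*A^2*exp (4*A)*exp (3*exp 2)) := by
        rw [mul_pow, ← exp_nat_mul, ← exp_nat_mul, exp_add, exp_add]
        rw [show ((2:ℕ):ℝ)*(2*A) = 4*A by push_cast; ring, show ((2:ℕ):ℝ)*(l / H) = 2*(l/H) by push_cast; ring]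
        ring
    _ ≤ exp (-(u'/w) + 2*α0*u)*exp (u'/(2*w))*exp K := by gcongr
    _ = exp (-(u'/w) + 2*α0*u + u'/(2*w) + K) := by rw [← exp_add, ← exp_add]
    _ ≤ _ := by
      apply exp_le_exp.mpr
      have : u'/w = u'/(2*w) + u'/(2*w) := by field_simp; norm_num
      linarith

/-- scale-dependent objects -/
noncomputable def Hs (y:ℝ):ℕ := ⌈log y⌉₊
noncomputable def goodS {q:ℕ} [NeZero q] (α0 y z:ℝ) (χ : DirichletCharacter ℂ q) : Set ℝ :=
  goodset (prq q y z) (Hs y) (α0 - 1 / log y) χ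

lemma y_large (A α0:ℝ) (hA : 1 ≤ A) (hα0 : 0 < α0) (B:ℕ) : ∃ K y0:ℝ, 16 ≤ y0 ∧
    3*A^2*exp (4*A)*exp (3*exp 2) ≤ exp K ∧
    ∀ y, y0 ≤ y → 1 ≤ log y ∧ 48*log y ≤ √y ∧ 1 / log y ≤ α0 ∧
      (2*α0 + |K| + 40)*√y^(2*B+2) ≤ exp √y := by
  set K := 3*A^2*exp (4*A)*exp (3*exp 2) with hK
  obtain ⟨x1, h1, H1⟩ := eventually_poly_exp (2*α0 + |K| + 40) 1 one_pos (2*B+2)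
  obtain ⟨x2, h2, H2⟩ := eventually_poly_exp 96 1 one_pos 1
  have hm : 0 ≤ max x1 (max 4 (exp (x2 + 1/α0))) := le_max_of_le_left (by linarith)
  have hm4 : 4 ≤ max x1 (max 4 (exp (x2 + 1/α0))) := le_max_of_le_right (le_max_left _ _)
  refine ⟨K, (max x1 (max 4 (exp (x2 + 1/α0))))^2, by nlinarith, (by linarith [add_one_le_exp K]), ?_⟩
  intro y hy
  have hs : max x1 (max 4 (exp (x2 + 1/α0))) ≤ √y := le_sqrt_of_sq_le hy
  have hs1 : x1 ≤ √y := (le_max_left _ _).trans hs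
  have hs2 : 4 ≤ √y := hm4.trans hs
  have hs3 : exp (x2 + 1/α0) ≤ √y := (le_max_right _ _).trans ((le_max_right _ _).trans hs)
  have hy0 : 0 < y := sqrt_pos.mp (by linarith)
  have hlog : x2 + 1/α0 ≤ log √y := (le_log_iff_exp_le (by linarith)).mpr hs3
  have hl2 : log √y = log y / 2 := log_sqrt hy0.le
  have hα : 0 < 1/α0 := by positivity
  have h3 := H2 (log √y) (by linarith)
  rw [pow_one, one_mul, exp_log (by linarith)] at h3
  have h4 := H1 _ hs1
  rw [one_mul] at h4
  refine ⟨by linarith, by linarith, ?_, h4⟩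
  rw [one_div, inv_le_comm₀ (by linarith) hα0, ← one_div]; linarith

section
variable {q:ℕ} [NeZero q]
lemma goodS_meas (α0 y z:ℝ) (χ : DirichletCharacter ℂ q) : MeasurableSet (goodS α0 y z χ) := (goodset_closed _ _ _ _).measurableSet

set_option maxHeartbeats 1000000 in
/-- one transition between scales, and the basic numerics -/
lemma transition (A α0:ℝ) (hA : 1 ≤ A) (hα0 : 0 < α0) (B:ℕ) (hB : 2 ≤ B) : ∃ C:ℝ, 0 < C ∧ ∃ y0:ℝ, 16 ≤ y0 ∧
    ∀ (q:ℕ) [NeZero q] (y z V δ:ℝ), y0 ≤ y → y ≤ z → z ≤ y^B → 0 < δ → (q:ℝ)/δ ≤ exp V →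
      C + ∑ p ∈ q.primeFactors, (1:ℝ)/p ≤ (B - 1)*log y → exp (2*√y) ≤ V →
      y + 1 ≤ exp √y ∧ 2*log y ≤ √y ∧ 1 ≤ log y ∧ exp √y ≤ y^B*exp √y ∧
      y^B*exp √y ≤ (exp √y)^B ∧ y^B*exp √y ≤ exp (2*√y) ∧
      IS δ (fun χ : DirichletCharacter ℂ q => goodS α0 (exp √y) (y^B*exp √y) χ ∩ (goodS α0 y z χ)ᶜ) (bV A V) ≤
        (1 + 54*A^2*exp (4*A + 4)*3) / log y := by
  obtain ⟨C, hC, hprq⟩ := prq_sum_lower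
  obtain ⟨K, y0, hy0, hK, hL⟩ := y_large A α0 hA hα0 B
  refine ⟨C, hC, y0, hy0, ?_⟩
  intro q _ y z V δ hy hyz hz hδ hqδ hvol hV
  obtain ⟨hw1, hws, hwα, hF⟩ := hL y hy
  have hy16 : 16 ≤ y := by linarith
  set s := √y with hs
  set w := log y with hw
  have hys : y = s^2 := (sq_sqrt (by linarith)).symm
  have hs4 : 4 ≤ s := le_sqrt_of_sq_le (by linarith)
  have hs48 : 48 ≤ s := by linarith
  have hK0 := abs_nonneg K
  have hsB : (1:ℝ) ≤ s^(2*B) := one_le_pow₀ (by linarith)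
  have hyB : y^B = s^(2*B) := by rw [hys, ← pow_mul]
  have hF' : (2*α0 + |K| + 40)*(s^(2*B)*s^2) ≤ exp s := by rw [← pow_add]; exact hF
  have hF2 : 40*(s^(2*B)*s^2) ≤ exp s := le_trans (by gcongr; linarith) hF'
  have hyBe : y^B ≤ exp s := by
    rw [hyB]; refine le_trans ?_ hF2; linarith [le_mul_of_one_le_right (by linarith : 0 ≤ s^(2*B)) (one_le_pow₀ (by linarith) : 1 ≤ s^2)]
  have hyy : y + 1 ≤ exp s := by
    rw [hys]; refine le_trans ?_ hF2; linarith [le_mul_of_one_le_left (sq_nonneg s) hsB, (one_le_pow₀ (by linarith) : 1 ≤ s^2)]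
  have hyB1 : 1 ≤ y^B := one_le_pow₀ (by linarith)
  have hz2 : y^B*exp s ≤ exp (2*s) := by
    rw [two_mul, exp_add]; gcongr
  have hzB : y^B*exp s ≤ (exp s)^B := by
    obtain ⟨b, rfl⟩ := Nat.exists_eq_add_of_le hB
    have h1 : exp (2*s) = exp s ^ 2 := by rw [← exp_nat_mul]; push_cast; rfl
    refine hz2.trans ?_
    rw [h1]
    exact pow_le_pow_right₀ (one_le_exp (by linarith)) (by omega)
  have hyz' : exp s ≤ y^B*exp s := le_mul_of_one_le_left (exp_pos _).le hyB1
  refine ⟨hyy, by linarith, hw1, hyz', hzB, hz2, ?_⟩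
  have hHpos : 0 < Hs y := Nat.ceil_pos.mpr (by linarith)
  have hHs' : Hs (exp s) = ⌈s⌉₊ := by rw [Hs, log_exp]
  have hHpos' : 0 < Hs (exp s) := by rw [hHs']; exact Nat.ceil_pos.mpr (by linarith)
  have hH'1 : s ≤ (Hs (exp s):ℝ) := by rw [hHs']; exact Nat.le_ceil _
  have hH'2 : (Hs (exp s):ℝ) ≤ s + 1 := by rw [hHs']; exact (Nat.ceil_lt_add_one (by linarith)).le
  have hH2 : (Hs y:ℝ) ≤ w + 1 := (Nat.ceil_lt_add_one (by linarith)).le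
  have hW : w ≤ ∑ p ∈ prq q (exp s) (y^B*exp s), (p:ℝ)⁻¹ := by
    have h := hprq q (NeZero.pos q) (exp s) (y^B*exp s) (one_le_exp (by linarith)) hyz'
    rw [mul_div_assoc, div_self (exp_pos _).ne', mul_one, log_pow] at h
    linarith
  have h := trans_core (q := q) (A := A) (V := V) (δ := δ) (α := α0 - 1/w) (α' := α0 - 1/s) hA hδ hqδ (y := y) (z := z) (y' := exp s)
    (z' := y^B*exp s) (exp_pos _).le (by linarith) hHpos hHpos' (by linarith) (by linarith)
    (S := fun χ : DirichletCharacter ℂ q => goodS α0 (exp s) (y^B*exp s) χ ∩ (goodS α0 y z χ)ᶜ)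
    (fun χ => (goodS_meas _ _ _ χ).inter (goodS_meas _ _ _ χ).compl)
    (fun χ t ht => by have := ht.1; rw [goodS, log_exp] at this; exact this)
    (fun χ t ht => ht.2) (R := exp (-(12*s+w)))
    (fun u u' l h1 h2 h3 h4 h5 => trans_num_R (y := y) hA hα0 hHpos hK hs4 hys hw1 hws hwα hF h1 (h2.trans hz) h3 (h4.trans hz2) h5)
  refine h.trans ?_
  have hes : s + 1 ≤ exp s := add_one_le_exp s
  have hes0 := exp_pos s
  have hc1 : ((vset (prq q (exp s) (y^B*exp s)) (Hs (exp s))).card:ℝ) ≤ exp s ^ 4 := by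
    refine (prq_vset_card hHpos' (by positivity)).trans ?_
    have h1 : exp (2*s) = exp s ^ 2 := by rw [← exp_nat_mul]; push_cast; rfl
    have : (Hs (exp s):ℝ)*(y^B*exp s) ≤ exp s*exp s ^ 2 :=
      mul_le_mul (by linarith) (by rw [← h1]; exact hz2) (by positivity) (by positivity)
    have := (pow_help (by linarith : 2 ≤ exp s)).1
    linarith
  have hc2 : ((vset (prq q y z) (Hs y)).card:ℝ) ≤ exp s ^ 3 := by
    refine (prq_vset_card hHpos (by linarith)).trans ?_
    have : (Hs y:ℝ)*z ≤ exp s*exp s :=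
      mul_le_mul (by linarith) (hz.trans hyBe) (by linarith) (by positivity)
    have := (pow_help (by linarith : 2 ≤ exp s)).2
    linarith
  have hfirst : 2*(((vset (prq q (exp s) (y^B*exp s)) (Hs (exp s))).card:ℝ)^2*(vset (prq q y z) (Hs y)).card*exp (-(12*s+w))) ≤ 1 / w := by
    calc _ ≤ exp s*((exp s ^ 4)^2*exp s ^ 3*exp (-(12*s+w))) := by
          refine mul_le_mul (by linarith) (mul_le_mul_of_nonneg_right (mul_le_mul (pow_le_pow_left₀ (Nat.cast_nonneg _) hc1 2) hc2 (Nat.cast_nonneg _) (by positivity)) (exp_pos _).le) (mul_nonneg (mul_nonneg (sq_nonneg _) (Nat.cast_nonneg _)) (exp_pos _).le) hes0.le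
      _ = exp (-w) := by
          rw [← pow_mul, ← exp_nat_mul, ← exp_nat_mul, ← exp_add, ← exp_add, ← exp_add]
          congr 1; push_cast; ring
      _ = 1 / y := by rw [exp_neg, hw, exp_log (by linarith), one_div]
      _ ≤ _ := one_div_le_one_div_of_le (by linarith) (by nlinarith)
  have hw0 : 0 < w := by linarith
  have e1 : 1 / (∑ p ∈ prq q (exp s) (y^B*exp s), (p:ℝ)⁻¹) ≤ 1 / w := one_div_le_one_div_of_le hw0 hW
  have e2 : 1 / (Hs (exp s):ℝ)^2 ≤ 1 / w := one_div_le_one_div_of_le hw0 (by nlinarith)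
  have e3 : exp (-exp s) ≤ 1 / w := by
    rw [exp_neg, ← one_div]
    exact one_div_le_one_div_of_le hw0 (by linarith [add_one_le_exp (exp s)])
  have hfac : 0 ≤ 54*A^2*exp (4*A + 4) := by positivity
  calc _ ≤ 1 / w + 54*A^2*exp (4*A + 4)*(1/w + 1/w + 1/w) := by gcongr
    _ = _ := by field_simp; ring
end

lemma IS_two {q:ℕ} [NeZero q] (δ:ℝ) {S S1 S2 : DirichletCharacter ℂ q → Set ℝ} (h1 : ∀ χ, MeasurableSet (S1 χ))
    (h2 : ∀ χ, MeasurableSet (S2 χ)) (h : ∀ χ, S χ ⊆ S1 χ ∪ S2 χ) (c:ℕ →₀ ℂ) : IS δ S c ≤ IS δ S1 c + IS δ S2 c := by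
  have := IS_union δ (S := S) (univ : Finset Bool) (fun b => if b then S1 else S2) (by
    intro b _ χ; cases b
    · simpa using h2 χ
    · simpa using h1 χ) (by
    intro χ t ht
    rcases h χ ht with h | h
    · exact ⟨true, mem_univ _, by simpa using h⟩
    · exact ⟨false, mem_univ _, by simpa using h⟩) c
  simpa using this

lemma scales (A α0:ℝ) (hA : 1 ≤ A) (hα0 : 0 < α0) (B:ℕ) (hB : 2 ≤ B) : ∃ C:ℝ, 0 < C ∧ ∃ y0:ℝ, 16 ≤ y0 ∧
    ∀ (q:ℕ) [NeZero q] (V δ:ℝ), 0 < δ → (q:ℝ)/δ ≤ exp V → ∀ (n:ℕ) (y z:ℝ), V / 2 ≤ y + n → y0 ≤ y → y ≤ z → z ≤ y^B →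
      z ≤ V / 2 → C + ∑ p ∈ q.primeFactors, (1:ℝ)/p ≤ (B - 1)*log y → 
      ∃ y1 z1:ℝ, y ≤ y1 ∧ y1 ≤ z1 ∧ z1 ≤ y1^B ∧ z1 ≤ V / 2 ∧ V / 2 < exp (2*√y1) ∧
      IS δ (fun χ : DirichletCharacter ℂ q => (goodS α0 y z χ)ᶜ) (bV A V) ≤
        2*(1 + 54*A^2*exp (4*A + 4)*3) / log y + IS δ (fun χ : DirichletCharacter ℂ q => (goodS α0 y1 z1 χ)ᶜ) (bV A V) := by
  obtain ⟨C, hC, y0, hy0, HT⟩ := transition A α0 hA hα0 B hB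
  refine ⟨C, hC, y0, hy0, ?_⟩
  intro q _ V δ hδ hqδ n
  set D := 1 + 54*A^2*exp (4*A + 4)*3 with hD
  have hD0 : 0 < D := by positivity
  induction n with
  | zero =>
    intro y z hn hy hyz hzB hzV hvol
    have hlog : 0 ≤ log y := log_nonneg (by linarith)
    refine ⟨y, z, le_rfl, hyz, hzB, hzV, ?_, le_add_of_nonneg_left (by positivity)⟩
    by_contra hcon
    push Not at hcon
    have h := (HT q y z V δ hy hyz hzB hδ hqδ hvol (by linarith)).1
    have h2 : exp √y ≤ exp (2*√y) := exp_le_exp.mpr (by linarith [sqrt_nonneg y])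
    simp at hn
    linarith
  | succ n ih =>
    intro y z hn hy hyz hzB hzV hvol
    have hlog : 0 ≤ log y := log_nonneg (by linarith)
    by_cases hcon : V / 2 < exp (2*√y)
    · exact ⟨y, z, le_rfl, hyz, hzB, hzV, hcon, le_add_of_nonneg_left (by positivity)⟩
    push Not at hcon
    obtain ⟨h1, h2, h3, h4, h5, h6, h7⟩ := HT q y z V δ hy hyz hzB hδ hqδ hvol (by linarith [exp_pos (2*√y)])
    push_cast at hn
    have hB1 : (0:ℝ) ≤ B - 1 := by have : (2:ℝ) ≤ B := mod_cast hB
                                   linarith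
    obtain ⟨y1, z1, g1, g2, g3, g4, g5, g6⟩ := ih (exp √y) (y^B*exp √y) (by linarith) (by linarith) h4 h5 (by linarith)
      (hvol.trans (mul_le_mul_of_nonneg_left (by rw [log_exp]; linarith) hB1))
    refine ⟨y1, z1, by linarith, g2, g3, g4, g5, ?_⟩
    have h8 := IS_two δ (S := fun χ : DirichletCharacter ℂ q => (goodS α0 y z χ)ᶜ)
      (S1 := fun χ : DirichletCharacter ℂ q => goodS α0 (exp √y) (y^B*exp √y) χ ∩ (goodS α0 y z χ)ᶜ)
      (S2 := fun χ : DirichletCharacter ℂ q => (goodS α0 (exp √y) (y^B*exp √y) χ)ᶜ)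
      (fun χ => (goodS_meas _ _ _ χ).inter (goodS_meas _ _ _ χ).compl) (fun χ => (goodS_meas _ _ _ χ).compl)
      (fun χ t ht => by
        by_cases h : t ∈ goodS α0 (exp √y) (y^B*exp √y) χ
        · exact Or.inl ⟨h, ht⟩
        · exact Or.inr h) (bV A V)
    rw [log_exp] at g6
    have h9 : 2*D / √y ≤ D / log y := by
      rw [div_le_div_iff₀ (by linarith) (by linarith)]; nlinarith
    have h10 : 2*D / log y = D / log y + D / log y := by ring
    linarith

lemma first_num (A α0:ℝ) (hA : 1 ≤ A) (hα0 : 0 < α0) (B:ℕ) : ∃ y0:ℝ, 16 ≤ y0 ∧ ∀ y z:ℝ, y0 ≤ y → y ≤ z → z ≤ y^B →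
    2 ≤ log y ∧ 0 ≤ α0 - 1 / log y ∧ 2*(((Hs y:ℝ)*z + 1)^2*exp (-2*(α0 - 1/log y)*(y - 1))*(3*A^2*exp (4*A))) ≤ 1 / log y := by
  obtain ⟨x1, h1, H1⟩ := eventually_poly_exp (2*(9*exp α0)*(3*A^2*exp (4*A))) α0 hα0 (2*(B+1)+1)
  refine ⟨max x1 (max 16 (exp (2 + 2/α0))), le_max_of_le_right (le_max_left _ _), ?_⟩
  intro y z hy hyz hz
  have hy1 : x1 ≤ y := (le_max_left _ _).trans hy
  have hy16 : 16 ≤ y := (le_max_left _ _).trans ((le_max_right _ _).trans hy)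
  have hye : exp (2 + 2/α0) ≤ y := (le_max_right _ _).trans ((le_max_right _ _).trans hy)
  have hlog : 2 + 2/α0 ≤ log y := (le_log_iff_exp_le (by linarith)).mpr hye
  have hα : 0 < 2/α0 := by positivity
  have hw : 0 < log y := by linarith
  have h2 : 1 / log y ≤ α0/2 := by
    rw [one_div, inv_le_comm₀ hw (by positivity)]
    rw [inv_div]; linarith
  refine ⟨by linarith, by linarith, ?_⟩
  have hH : (Hs y:ℝ) ≤ 2*y := by
    have h3 := (Nat.ceil_lt_add_one hw.le).le
    have h4 := log_le_sub_one_of_pos (by linarith : 0 < y)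
    unfold Hs; linarith
  have hz1 : (Hs y:ℝ)*z + 1 ≤ 3*y^(B+1) := by
    have h3 : (Hs y:ℝ)*z ≤ (2*y)*y^B := mul_le_mul hH hz (by linarith) (by linarith)
    have h4 : (1:ℝ) ≤ y^(B+1) := one_le_pow₀ (by linarith)
    have h5 : y^(B+1) = y*y^B := by ring
    linarith
  have hz0 : 0 ≤ (Hs y:ℝ)*z + 1 := by
    have : (0:ℝ) ≤ Hs y := Nat.cast_nonneg _
    nlinarith
  have hexp : exp (-2*(α0 - 1/log y)*(y - 1)) ≤ exp α0*exp (-(α0*y)) := by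
    rw [← exp_add]
    apply exp_le_exp.mpr
    nlinarith
  have h5 := H1 y hy1
  calc _ ≤ 2*((3*y^(B+1))^2*(exp α0*exp (-(α0*y)))*(3*A^2*exp (4*A))) := by gcongr
    _ = (2*(9*exp α0)*(3*A^2*exp (4*A)))*y^(2*(B+1)+1)*exp (-(α0*y)) / y := by
        have : y ≠ 0 := by linarith
        rw [pow_succ y (2*(B+1)), pow_mul' y 2 (B+1)]
        field_simp; ring
    _ ≤ exp (α0*y)*exp (-(α0*y)) / y := by gcongr
    _ = 1 / y := by rw [← exp_add]; simp
    _ ≤ _ := one_div_le_one_div_of_le hw (by linarith [log_le_sub_one_of_pos (by linarith : 0 < y)])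

lemma IS_reduce (A α0:ℝ) (hA : 1 ≤ A) (hα0 : 0 < α0) (B:ℕ) (hB : 2 ≤ B) : ∃ C2:ℝ, 0 < C2 ∧ ∃ C:ℝ, 0 < C ∧ ∃ y0:ℝ, 16 ≤ y0 ∧
    ∀ (q:ℕ) [NeZero q] (y z V δ:ℝ), 0 < δ → (q:ℝ)/δ ≤ exp (V - z) → y0 ≤ y → y ≤ z → z ≤ y^B →
      z ≤ V / 2 → C + ∑ p ∈ q.primeFactors, (1:ℝ)/p ≤ (B - 1)*log y → 
      log y / 2 ≤ ∑ p ∈ prq q y z, (p:ℝ)⁻¹ →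
      ∃ y1 z1:ℝ, 16 ≤ y1 ∧ y1 ≤ z1 ∧ z1 ≤ y1^B ∧ z1 ≤ V / 2 ∧ V / 2 < exp (2*√y1) ∧
      IS δ (fun χ : DirichletCharacter ℂ q => Set.univ) (bV A V) ≤
        C2 / log y + IS δ (fun χ : DirichletCharacter ℂ q => (goodS α0 y1 z1 χ)ᶜ) (bV A V) := by
  obtain ⟨C, hC, y0, hy0, HT⟩ := scales A α0 hA hα0 B hB
  obtain ⟨y1, hy1, HF⟩ := first_num A α0 hA hα0 B
  set D := 1 + 54*A^2*exp (4*A + 4)*3 with hD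
  have hD0 : 0 < D := by positivity
  refine ⟨1 + 54*A^2*exp (4*A + 4)*4 + 2*D, by positivity, C, hC, max y0 y1, le_max_of_le_left hy0, ?_⟩
  intro q _ y z V δ hδ hqδ hy hyz hzB hzV hvol hW
  have hyy0 : y0 ≤ y := (le_max_left _ _).trans hy
  have hyy1 : y1 ≤ y := (le_max_right _ _).trans hy
  obtain ⟨hw2, hα, hnum⟩ := HF y z hyy1 hyz hzB
  have hw0 : 0 < log y := by linarith
  have hHpos : 0 < Hs y := Nat.ceil_pos.mpr (by linarith)
  have hH1 : log y ≤ (Hs y:ℝ) := Nat.le_ceil _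
  obtain ⟨y2, z2, g1, g2, g3, g4, g5, g6⟩ := HT q V δ hδ (hqδ.trans (exp_le_exp.mpr (by linarith))) ⌈V⌉₊ y z
    (by have := Nat.le_ceil V; have h2 : V/2 ≤ ⌈V⌉₊ := by linarith
        linarith) hyy0 hyz hzB hzV hvol
  refine ⟨y2, z2, by linarith, g2, g3, g4, g5, ?_⟩
  have h1 := IS_two δ (S := fun χ : DirichletCharacter ℂ q => Set.univ)
      (S1 := fun χ : DirichletCharacter ℂ q => goodS α0 y z χ)
      (S2 := fun χ : DirichletCharacter ℂ q => (goodS α0 y z χ)ᶜ)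
      (fun χ => goodS_meas _ _ _ χ) (fun χ => (goodS_meas _ _ _ χ).compl)
      (fun χ t ht => by
        by_cases h : t ∈ goodS α0 y z χ
        · exact Or.inl h
        · exact Or.inr h) (bV A V)
  have h2 := first_core (q := q) (A := A) (V := V) hA hα hδ (by linarith : 1 ≤ y) hyz hqδ (by linarith) hHpos (by linarith)
    (S := fun χ : DirichletCharacter ℂ q => goodS α0 y z χ) (fun χ => goodS_meas _ _ _ χ) (fun χ => subset_rfl)
  have e1 : 1 / (∑ p ∈ prq q y z, (p:ℝ)⁻¹) ≤ 2*(1 / log y) := by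
    refine (one_div_le_one_div_of_le (by linarith) hW).trans (le_of_eq ?_); field_simp
  have e2 : 1 / (Hs y:ℝ)^2 ≤ 1 / log y := one_div_le_one_div_of_le hw0 (by nlinarith)
  have e3 : exp (-y) ≤ 1 / log y := by
    rw [exp_neg, ← one_div]
    exact one_div_le_one_div_of_le hw0 (by linarith [add_one_le_exp y, log_le_sub_one_of_pos (by linarith : 0 < y)])
  have e4 : 54*A^2*exp (4*A + 4)*(1 / (∑ p ∈ prq q y z, (p:ℝ)⁻¹) + 1 / (Hs y:ℝ)^2 + exp (-y)) ≤
    54*A^2*exp (4*A + 4)*(4*(1 / log y)) := by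
    refine mul_le_mul_of_nonneg_left (by linarith) (by positivity)
  have e5 : (1 + 54*A^2*exp (4*A + 4)*4 + 2*D) / log y =
    1 / log y + 54*A^2*exp (4*A + 4)*(4*(1 / log y)) + 2*D / log y := by ring
  linarith

lemma vset_harm {q:ℕ} {y z:ℝ} {H:ℕ} (hH : 0 < H) (hy : 2 ≤ y) (hyz : y ≤ z) :
    ∑ v ∈ vset (prq q y z) H, (1:ℝ) / v ≤ 2 + log (z / y) := by
  have hHr : (1:ℝ) ≤ H := mod_cast hH
  set a := ⌈(H:ℝ)*y - 1⌉₊ with ha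
  set b := ⌊(H:ℝ)*z⌋₊ with hb
  have hHy : 2 ≤ (H:ℝ)*y := by nlinarith
  have ha1 : (H:ℝ)*y / 2 ≤ a := le_trans (by linarith) (Nat.le_ceil _)
  have ha0 : 1 ≤ a := by
    have : (1:ℝ) ≤ a := by linarith
    exact_mod_cast this
  have hb1 : (b:ℝ) ≤ H*z := Nat.floor_le (by nlinarith)
  have hab : a ≤ b + 1 := by
    have h1 : (a:ℝ) < (H:ℝ)*y - 1 + 1 := Nat.ceil_lt_add_one (by linarith)
    have h2 : (H:ℝ)*z < b + 1 := Nat.lt_floor_add_one _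
    have h3 : (H:ℝ)*y ≤ H*z := by gcongr
    have : (a:ℝ) < ((b+1:ℕ):ℝ) := by push_cast; linarith
    exact (mod_cast this : a < b + 1).le
  have hb0 : 1 ≤ b := Nat.le_floor (by push_cast; nlinarith)
  have hsub : vset (prq q y z) H ⊆ Ico a (b+1) := by
    intro v hv
    have h := prq_vset hH hv
    have hH0 : (0:ℝ) < H := by linarith
    rw [mem_Ico]
    constructor
    · apply Nat.ceil_le.mpr
      have := mul_le_mul_of_nonneg_left h.1 hH0.le
      rw [mul_sub, mul_one_div_cancel hH0.ne', mul_div_cancel₀ _ hH0.ne'] at this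
      exact this
    · rw [Nat.lt_succ_iff]; apply Nat.le_floor
      have := h.2
      rw [div_le_iff₀ hH0] at this; linarith
  have h1 : ∑ v ∈ vset (prq q y z) H, (1:ℝ) / v ≤ ∑ v ∈ Ico a (b+1), (v:ℝ)⁻¹ := by
    simp_rw [one_div]
    exact sum_le_sum_of_subset_of_nonneg hsub fun _ _ _ => by positivity
  have h2 := harm_le b hb0
  have h3 := harm_ge (a - 1)
  have h4 : (((a - 1:ℕ):ℝ) + 1) = a := by rw [Nat.cast_sub ha0, Nat.cast_one, sub_add_cancel]
  rw [h4] at h3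
  have h5 : ∑ d ∈ Icc 1 (a-1), (d:ℝ)⁻¹ + ∑ v ∈ Ico a (b+1), (v:ℝ)⁻¹ = ∑ d ∈ Icc 1 b, (d:ℝ)⁻¹ := by
    have e1 : Icc 1 (a-1) = Ico 1 a := by ext x; simp only [mem_Icc, mem_Ico]; omega
    have e2 : Icc 1 b = Ico 1 (b+1) := by ext x; simp only [mem_Icc, mem_Ico]; omega
    rw [e1, e2]
    exact sum_Ico_consecutive _ ha0 hab
  have ha0' : (0:ℝ) < a := mod_cast ha0
  have hb0' : (0:ℝ) < b := mod_cast hb0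
  have hy0 : 0 < y := by linarith
  have hz0 : 0 < z := by linarith
  have h6 : log b - log a ≤ log (z/y) + log 2 := by
    rw [← log_div hb0'.ne' ha0'.ne', ← log_mul (by positivity) (by norm_num)]
    apply log_le_log (by positivity)
    rw [div_le_iff₀ ha0']
    calc (b:ℝ) ≤ H*z := hb1
      _ = z / y*2*(H*y / 2) := by field_simp
      _ ≤ _ := by gcongr
  have h7 : log 2 ≤ 1 := by linarith [log_two_lt_d9]
  linarith

section
variable {q:ℕ} [NeZero q]

lemma EE_intOn {T:ℝ} {U : Set ℝ} (hU : U ⊆ Set.Icc (-T) T) (χ : DirichletCharacter ℂ q) (a : ZMod q) (c:ℕ →₀ ℂ) :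
    IntegrableOn (fun t => ‖EE χ a t c‖^2) U :=
  (((EE_continuous χ a c).norm.pow 2).integrableOn_Icc).mono_set hU

lemma contr_step {A V T c1 M E:ℝ} {P : Finset ℕ} {H:ℕ} {U : Set ℝ} (hU : U ⊆ Set.Icc (-T) T) (hUm : MeasurableSet U)
    (hP : ∀ p ∈ P, 0 < p ∧ p.Coprime q) (χ : DirichletCharacter ℂ q) (a : ZMod q) (hc0 : 0 < c1) (hc1 : c1 ≤ 1)
    (hW : 1 ≤ ∑ p ∈ P, (p:ℝ)⁻¹) (m:ℕ → ℝ) (hm : ∀ v ∈ vset P H, 0 ≤ m v)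
    (hQ : ∀ t ∈ U, ∀ v ∈ vset P H, ‖QQ (cls P H v) χ t‖ ≤ m v)
    (hmsum : ∑ v ∈ vset P H, m v ≤ (1 - c1)*∑ p ∈ P, (p:ℝ)⁻¹) (hM0 : 0 ≤ M)
    (hM : ∀ v ∈ vset P H, ∫ t in U, ‖EE χ a t (bV A (V - v / H))‖^2 ≤ M)
    (hE : ∫ t in U, ‖EE χ a t (decErr A V P H)‖^2 ≤ E) :
    ∫ t in U, ‖EE χ a t (bV A V)‖^2 ≤ (1 - c1)*M + 2 / c1*E := by
  set W := ∑ p ∈ P, (p:ℝ)⁻¹ with hWd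
  set m0 := ∑ v ∈ vset P H, m v with hm0
  have hm0n : 0 ≤ m0 := sum_nonneg hm
  have hpt : ∀ t ∈ U, ‖EE χ a t (bV A V)‖^2 ≤ (1 + c1)*((W^2)⁻¹*(m0*∑ v ∈ vset P H, m v*‖EE χ a t (bV A (V - v/H))‖^2))
      + (1 + 1/c1)*‖EE χ a t (decErr A V P H)‖^2 := by
    intro t ht
    rw [EE_bV_split χ a t A V P H, EE_dec χ a t A V P hP]
    set x := EE χ a t (decErr A V P H)
    set Y := ∑ v ∈ vset P H, QQ (cls P H v) χ t*EE χ a t (bV A (V - v / H))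
    have hY : ‖Y‖ ≤ ∑ v ∈ vset P H, m v*‖EE χ a t (bV A (V - v/H))‖ := by
      refine (norm_sum_le _ _).trans (sum_le_sum fun v hv => ?_)
      rw [norm_mul]; gcongr; exact hQ t ht v hv
    have hY2 : ‖Y‖^2 ≤ m0*∑ v ∈ vset P H, m v*‖EE χ a t (bV A (V - v/H))‖^2 := by
      refine (pow_le_pow_left₀ (norm_nonneg _) hY 2).trans ?_
      have := sum_sq_le_sum_mul_sum_of_sq_eq_mul (vset P H) (r := fun v => m v*‖EE χ a t (bV A (V - v/H))‖)
        (f := fun v => m v) (g := fun v => m v*‖EE χ a t (bV A (V - v/H))‖^2) hm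
        (fun v hv => mul_nonneg (hm v hv) (sq_nonneg _)) (fun v hv => by ring)
      exact this
    have hn : ‖x - (W:ℂ)⁻¹*Y‖ ≤ ‖x‖ + W⁻¹*‖Y‖ := by
      refine (norm_sub_le _ _).trans (le_of_eq ?_)
      rw [norm_mul, norm_inv, norm_real, norm_of_nonneg (by linarith)]
    have h0 : 0 ≤ W⁻¹*‖Y‖ := by positivity
    have hsq : (‖x‖ + W⁻¹*‖Y‖)^2 ≤ (1 + c1)*(W⁻¹*‖Y‖)^2 + (1 + 1/c1)*‖x‖^2 := by
      have h1 : (1 + c1)*(W⁻¹*‖Y‖)^2 + (1 + 1/c1)*‖x‖^2 - (‖x‖ + W⁻¹*‖Y‖)^2 = c1*(W⁻¹*‖Y‖ - ‖x‖/c1)^2 := by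
        field_simp; ring
      have : 0 ≤ c1*(W⁻¹*‖Y‖ - ‖x‖/c1)^2 := by positivity
      linarith
    refine (pow_le_pow_left₀ (norm_nonneg _) hn 2).trans (hsq.trans ?_)
    rw [mul_pow, inv_pow]
    gcongr
  have hi : ∀ c, IntegrableOn (fun t => ‖EE χ a t c‖^2) U := fun c => EE_intOn hU χ a c
  have h1 : ∫ t in U, ‖EE χ a t (bV A V)‖^2 ≤ ∫ t in U, ((1 + c1)*((W^2)⁻¹*(m0*∑ v ∈ vset P H, m v*‖EE χ a t (bV A (V - v/H))‖^2))
      + (1 + 1/c1)*‖EE χ a t (decErr A V P H)‖^2) := by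
    refine setIntegral_mono_on (hi _) ?_ hUm hpt
    refine Integrable.add ?_ ((hi _).const_mul _)
    refine Integrable.const_mul (Integrable.const_mul (Integrable.const_mul ?_ _) _) _
    exact integrable_finset_sum _ fun v _ => (hi _).const_mul _
  refine h1.trans ?_
  rw [integral_add, integral_const_mul, integral_const_mul, integral_const_mul, integral_finset_sum _ fun v _ => (hi _).const_mul _,
    integral_const_mul]
  rotate_left
  · refine Integrable.const_mul (Integrable.const_mul (Integrable.const_mul ?_ _) _) _
    exact integrable_finset_sum _ fun v _ => (hi _).const_mul _
  · exact (hi _).const_mul _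
  simp_rw [integral_const_mul]
  have h2 : ∑ v ∈ vset P H, m v*∫ t in U, ‖EE χ a t (bV A (V - v / H))‖^2 ≤ m0*M := by
    rw [hm0, sum_mul]
    exact sum_le_sum fun v hv => mul_le_mul_of_nonneg_left (hM v hv) (hm v hv)
  have hW0 : 0 < W := by linarith
  have h3 : (W^2)⁻¹*(m0*(m0*M)) ≤ (1 - c1)^2*M := by
    rw [inv_mul_le_iff₀ (by positivity)]
    have : m0^2 ≤ ((1-c1)*W)^2 := pow_le_pow_left₀ hm0n hmsum 2
    nlinarith [mul_le_mul_of_nonneg_right this hM0]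
  have h4 : (1 + 1/c1) ≤ 2/c1 := by
    rw [show 2/c1 = 1/c1 + 1/c1 by ring]
    have : 1 ≤ 1/c1 := by rw [le_div_iff₀ hc0]; linarith
    linarith
  have hE0 : 0 ≤ ∫ t in U, ‖EE χ a t (decErr A V P H)‖^2 := integral_nonneg fun t => sq_nonneg _
  calc _ ≤ (1 + c1)*((W^2)⁻¹*(m0*(m0*M))) + 2/c1*E := by gcongr
    _ ≤ (1 + c1)*((1 - c1)^2*M) + 2/c1*E := by gcongr
    _ ≤ _ := by
      have : (1 + c1)*(1 - c1)^2 ≤ 1 - c1 := by nlinarith [mul_nonneg hc0.le (mul_nonneg hc0.le (by linarith : 0 ≤ 1 - c1))]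
      have := mul_le_mul_of_nonneg_right this hM0
      linarith
end

set_option maxHeartbeats 3000000 in
theorem contraction (A:ℝ) (hA : 1 ≤ A) : ∃ c:ℝ, 0 < c ∧ ∀ (q:ℕ) [NeZero q] (ε:ℝ), 0 < ε → ∃ t0:ℝ, 0 < t0 ∧ ∃ V0:ℝ,
    ∀ V, V0 ≤ V → ∀ (χ : DirichletCharacter ℂ q) (a : ZMod q) (U : Set ℝ), MeasurableSet U →
      (∀ t ∈ U, t0 ≤ |t| ∧ |t| ≤ exp (3*V)) → (volume U).toReal ≤ exp (c / 4*V) →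
      ∫ t in U, ‖EE χ a t (bV A V)‖^2 ≤ ε := by
  obtain ⟨c, hc, C, hC, hHM⟩ := HM_EE (A + 2) 7 (by linarith) (by norm_num)
  obtain ⟨C', hC', hprq⟩ := prq_sum_lower
  refine ⟨c, hc, ?_⟩
  intro q _ ε hε
  have hq1 : (1:ℝ) ≤ q := mod_cast NeZero.pos q
  set CA := (2*Real.pi*(A+2) + C)*exp (A+2) with hCA
  have hCA0 : 0 < CA := by positivity
  set M0 := CA*(A^2*exp (3*A)) with hM0
  have hM00 : 0 < M0 := by positivity
  set CE := CA*(9*A^2*exp (3*A+3)) with hCE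
  have hCE0 : 0 < CE := by positivity
  set K:ℕ := 400*q with hK
  have hKr : (K:ℝ) = 400*q := by rw [hK]; push_cast; ring
  have hKge : (400:ℝ) ≤ K := by rw [hKr]; linarith
  set c1:ℝ := 1 / (4*(K:ℝ)^2) with hc1
  have hc10 : 0 < c1 := by positivity
  have hc11 : c1 ≤ 1 := by
    rw [hc1, div_le_one (by positivity)]; linarith [pow_le_pow_left₀ (by norm_num) hKge 2]
  obtain ⟨k0, hk0⟩ := exists_pow_lt_of_lt_one (show 0 < ε / 2 / M0 by positivity) (show 1 - c1 < 1 by linarith)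
  set k := k0 + 1 with hk
  have hkp : (1 - c1)^k*M0 ≤ ε / 2 := by
    have h1 : (1 - c1)^k ≤ (1 - c1)^k0 := pow_le_pow_of_le_one (by linarith) (by linarith) (by omega)
    have h2 : (1 - c1)^k ≤ ε / 2 / M0 := by linarith
    rw [le_div_iff₀ hM00] at h2; exact h2
  have hk1 : (1:ℝ) ≤ k := by rw [hk]; push_cast; linarith [Nat.cast_nonneg (α := ℝ) k0]
  set κ:ℝ := 1 / (2*k) with hκ
  have hκ0 : 0 < κ := by positivity
  have hκk : k*κ = 1/2 := by rw [hκ]; field_simp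
  have hκ1 : κ ≤ 1/2 := by rw [← hκk]; exact le_mul_of_one_le_left hκ0.le hk1
  set pv := ∑ p ∈ q.primeFactors, (1:ℝ)/p with hpv
  have hpv0 : 0 ≤ pv := sum_nonneg fun _ _ => by positivity
  set Z := 12*CE / (c1^2*ε) + 1 with hZ
  have hZ0 : 1 ≤ Z := by rw [hZ]; have : 0 ≤ 12*CE / (c1^2*ε) := by positivity
                         linarith
  set W0 := C' + pv + 2 + Z with hW0
  set κ' := κ*exp (-(W0 + C' + pv)) with hκ'
  have hκ'0 : 0 < κ' := by positivity
  have hκκ : κ' ≤ κ := by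
    rw [hκ']; exact mul_le_of_le_one_right hκ0.le (exp_le_one_iff.mpr (by linarith))
  set H := ⌈Z⌉₊ with hH
  have hHZ : Z ≤ H := Nat.le_ceil _
  have hHr : (1:ℝ) ≤ H := by linarith
  have hH0 : 0 < H := mod_cast (by linarith : (0:ℝ) < H)
  obtain ⟨v0, hv0, t0, ht0, hQQ⟩ := QQ_bound (6/κ') (by positivity) q K H (mod_cast (by linarith : (1:ℝ) ≤ K)) hH0
  refine ⟨t0, ht0, (Z + 2 + 2*v0) / κ' + 4*A + 20, ?_⟩
  intro V hV χ a U hUm hUt hUv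
  have hVA : 4*A + 20 ≤ V := by
    have : 0 ≤ (Z + 2 + 2*v0) / κ' := by positivity
    linarith
  have hyV : Z + 2 + 2*v0 ≤ κ'*V := by
    have : (Z + 2 + 2*v0) / κ' ≤ V := by linarith
    rw [div_le_iff₀ hκ'0] at this; linarith
  set y := κ'*V with hy
  set z := κ*V with hz
  have hyz : y ≤ z := by rw [hy, hz]; gcongr; linarith
  have hz2 : z ≤ V/2 := by rw [hz]; have := mul_le_mul_of_nonneg_right hκ1 (show 0 ≤ V by linarith); linarith
  have hU : U ⊆ Set.Icc (-exp (3*V)) (exp (3*V)) := fun t ht => abs_le.mp (hUt t ht).2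
  -- mean values over U
  have hmv : ∀ (V':ℝ) (d:ℕ →₀ ℂ), V/2 ≤ V' → (∀ n ∈ d.support, 1 ≤ n ∧ exp (V' - A - 1) ≤ n ∧ (n:ℝ) ≤ exp (V' + A + 1)) →
      ∫ t in U, ‖EE χ a t d‖^2 ≤ CA*exp V'*∑ n ∈ d.support, ‖d n‖^2 := by
    intro V' d hV' hd
    have h := hHM q χ a V' (exp (3*V)) U d (by linarith) hU hUm (by
      calc 2*exp (3*V) ≤ exp 1*exp (3*V) := by
            gcongr; linarith [add_one_le_exp (1:ℝ)]
        _ = exp (1 + 3*V) := by rw [exp_add]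
        _ ≤ _ := exp_le_exp.mpr (by linarith)) (by
      intro n hn
      obtain ⟨h1, h2, h3⟩ := hd n hn
      have hn0 : (0:ℝ) < n := mod_cast h1
      refine ⟨h1, ?_⟩
      have h4 := (le_log_iff_exp_le hn0).mpr h2
      have h5 := (log_le_iff_le_exp hn0).mpr h3
      rw [abs_le]; constructor <;> linarith)
    refine h.trans ?_
    have h1 : C*exp (-c*V')*(volume U).toReal ≤ C := by
      rw [mul_assoc]
      refine mul_le_of_le_one_right hC.le ?_
      calc _ ≤ exp (-c*V')*exp (c/4*V) := by gcongr
        _ = exp (-c*V' + c/4*V) := by rw [exp_add]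
        _ ≤ 1 := exp_le_one_iff.mpr (by
          have := mul_le_mul_of_nonneg_left (show V/4 ≤ V' by linarith) hc.le
          linarith)
    calc _ ≤ (2*Real.pi*(A+2) + C)*exp (V' + (A+2))*∑ n ∈ d.support, ‖d n‖^2 := by gcongr
      _ = _ := by rw [hCA, exp_add]; ring
  have hG : ∀ V', V/2 ≤ V' → ∫ t in U, ‖EE χ a t (bV A V')‖^2 ≤ M0 := by
    intro V' hV'
    refine (hmv V' (bV A V') hV' fun n hn => ?_).trans ?_
    · obtain ⟨h1, h2, h3⟩ := bV_support hn
      exact ⟨h1, (exp_le_exp.mpr (by linarith)).trans h2, h3.trans (exp_le_exp.mpr (by linarith))⟩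
    · calc _ ≤ CA*exp V'*(A^2*exp (3*A)*exp (-V')) := by gcongr; exact bV_l2 (by linarith) V'
        _ = M0*(exp V'*exp (-V')) := by rw [hM0]; ring
        _ = M0 := by rw [← exp_add]; simp
  have hy0 : 2 ≤ y := by linarith
  have hlogzy : log (z / y) = W0 + C' + pv := by
    have : z / y = exp (W0 + C' + pv) := by
      rw [hz, hy, hκ', exp_neg]
      have : V ≠ 0 := by linarith
      field_simp
    rw [this, log_exp]
  set P := prq q y z with hP
  set W := ∑ p ∈ P, (p:ℝ)⁻¹ with hW
  have hWW0 : W0 ≤ W := by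
    have := hprq q (NeZero.pos q) y z (by linarith) hyz
    rw [hlogzy] at this
    linarith
  have hW1 : 1 ≤ W := by linarith
  set m:ℕ → ℝ := fun v => (1 - 1 / (2*(K:ℝ) ^ 2))*∑ p ∈ cls P H v, (p:ℝ)⁻¹ + 2 / (K:ℝ) ^ 3*(25*q / v) with hm
  have hK2 : 0 ≤ 1 - 1 / (2*(K:ℝ) ^ 2) := by
    rw [sub_nonneg, div_le_one (by positivity)]; linarith [pow_le_pow_left₀ (by norm_num) hKge 2]
  have hm0 : ∀ v, 0 ≤ m v := fun v => by
    have : 0 ≤ ∑ p ∈ cls P H v, (p:ℝ)⁻¹ := sum_nonneg fun _ _ => by positivity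
    have h2 : 0 ≤ 2 / (K:ℝ) ^ 3*(25*q / v) := by positivity
    have h3 := mul_nonneg hK2 this
    rw [hm]; linarith
  have hvs : ∀ v ∈ vset P H, y / 2 ≤ (v:ℝ) / H ∧ (v:ℝ)/H ≤ z := fun v hv => by
    have h := prq_vset hH0 hv
    have : 1 / (H:ℝ) ≤ 1 := by rw [div_le_one (by linarith)]; exact hHr
    exact ⟨by linarith, h.2⟩
  have hQ : ∀ t ∈ U, ∀ v ∈ vset P H, ‖QQ (cls P H v) χ t‖ ≤ m v := by
    intro t ht v hv
    obtain ⟨h1, h2⟩ := hvs v hv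
    refine hQQ χ v t (cls P H v) ?_ (hUt t ht).1 ((hUt t ht).2.trans (exp_le_exp.mpr ?_)) ?_
    · have h3 : (v:ℝ)/H ≤ v := div_le_self (Nat.cast_nonneg _) hHr
      linarith
    · calc 3*V = 6 / κ'*(y / 2) := by rw [hy]; field_simp; ring
        _ ≤ _ := by gcongr
    · intro p hp
      exact ⟨prq_prime (cls_mem_P hp), cls_log hH0 hp⟩
  have hmsum : ∑ v ∈ vset P H, m v ≤ (1 - c1)*W := by
    have h1 : ∑ v ∈ vset P H, ∑ p ∈ cls P H v, (p:ℝ)⁻¹ = W := by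
      rw [hW, sum_cls P H (fun v p => (p:ℝ)⁻¹)]
    have h2 := vset_harm (q := q) hH0 hy0 hyz
    rw [hlogzy] at h2
    have h3 : ∑ v ∈ vset P H, m v = (1 - 1 / (2*(K:ℝ) ^ 2))*W + 50*q / (K:ℝ)^3*∑ v ∈ vset P H, (1:ℝ)/v := by
      rw [hm, sum_add_distrib, ← mul_sum, h1, mul_sum]
      congr 1
      rw [mul_sum]
      exact sum_congr rfl fun v _ => by ring
    rw [h3]
    have h4 : ∑ v ∈ vset P H, (1:ℝ)/v ≤ 2*W := by linarith
    have h5 : 50*q / (K:ℝ)^3 = c1 / 2 := by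
      rw [hc1, hKr]; field_simp; norm_num
    have h6 : 1 / (2*(K:ℝ)^2) = 2*c1 := by rw [hc1]; field_simp; norm_num
    rw [h5, h6]
    have h7 := mul_le_mul_of_nonneg_left h4 (show 0 ≤ c1/2 by linarith)
    linear_combination h7
  set E := CE*(3 / Z) with hE
  have hErr : ∀ V', V/2 ≤ V' → ∫ t in U, ‖EE χ a t (decErr A V' P H)‖^2 ≤ E := by
    intro V' hV'
    refine (hmv V' (decErr A V' P H) hV' fun n hn => decErr_support (fun p hp => prq_prime hp) hH0 hn).trans ?_
    have hb := decErr_l2 (V := V') hA (P := P) (fun p hp => prq_prime hp) hH0 hW1 (one_le_exp (by linarith : 0 ≤ y))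
      (fun p hp => (prq_exp hp).1.le) ((prq_card q y z).trans (exp_le_exp.mpr (by linarith)))
    have hZp : 0 < Z := by linarith
    have e1 : 1 / W ≤ 1 / Z := one_div_le_one_div_of_le hZp (by linarith)
    have e2 : 1 / (H:ℝ)^2 ≤ 1 / Z := one_div_le_one_div_of_le hZp (hHZ.trans (le_self_pow₀ hHr two_ne_zero))
    have e3 : 1 / exp y ≤ 1 / Z := one_div_le_one_div_of_le hZp (by linarith [add_one_le_exp y])
    calc _ ≤ CA*exp V'*(9*A ^ 2*exp (3*A + 3)*exp (-V')*(1 / Z + 1 / Z + 1 / Z)) := by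
          refine mul_le_mul_of_nonneg_left (hb.trans ?_) (by positivity)
          refine mul_le_mul_of_nonneg_left (by linarith) (by positivity)
      _ = E*(exp V'*exp (-V')) := by rw [hE, hCE]; ring
      _ = E := by rw [← exp_add]; simp
  have hE0 : 0 ≤ E := by positivity
  have key : ∀ j:ℕ, ∀ V', V/2 + j*z ≤ V' → V' ≤ V → ∫ t in U, ‖EE χ a t (bV A V')‖^2 ≤ (1 - c1)^j*M0 + 2*E / c1^2 := by
    intro j
    induction j with
    | zero =>
      intro V' h1 h2
      simp only [Nat.cast_zero, zero_mul, add_zero] at h1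
      have := hG V' h1
      have h3 : 0 ≤ 2*E / c1^2 := by positivity
      simp; linarith
    | succ j ih =>
      intro V' h1 h2
      push_cast at h1
      have hz0 : 0 ≤ z := by linarith
      have hjz : 0 ≤ (j:ℝ)*z := by positivity
      have h := contr_step (A := A) (V := V') (c1 := c1) (M := (1 - c1)^j*M0 + 2*E / c1^2) (E := E) (P := P) (H := H) hU hUm
        (fun p hp => prq_cop hp) χ a hc10 hc11 hW1 m (fun v _ => hm0 v) hQ hmsum
        (by have : 0 ≤ (1 - c1)^j := pow_nonneg (by linarith) _
            positivity)
        (fun v hv => ih _ (by linarith [(hvs v hv).2]) (by linarith [(hvs v hv).1])) (hErr V' (by linarith))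
      refine h.trans (le_of_eq ?_)
      field_simp; ring
  have hfin := key k V (by
    have : (k:ℝ)*z = V/2 := by rw [hz, ← mul_assoc, hκk]; ring
    linarith) le_rfl
  refine hfin.trans ?_
  have h1 : 2*E / c1^2 ≤ ε/2 := by
    rw [hE, div_le_iff₀ (by positivity)]
    have h2 : 12*CE / (c1^2*ε) ≤ Z := by linarith
    rw [div_le_iff₀ (by positivity)] at h2
    have hZp : 0 < Z := by linarith
    rw [show 2*(CE*(3/Z)) = 6*CE / Z by ring, div_le_iff₀ hZp]
    linear_combination h2 / 2
  linarith

section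
variable {q:ℕ} [NeZero q]

lemma triHat_lower {T t:ℝ} (hT : 0 < T) (ht : |t| ≤ T) : (1/T)^2 / 4 ≤ triHat (1/T) t := by
  have h0 : ∀ x:ℝ, 0 < x → x ≤ 1/2 → (1/2:ℝ) ≤ sinc x := fun x hx hx1 => by
    rw [sinc_of_ne_zero hx.ne', le_div_iff₀ hx]
    have := sin_gt_sub_cube hx
    have h3 : x^3 ≤ x*1 := by rw [pow_succ']; gcongr; nlinarith
    linarith
  have h : (1/2:ℝ) ≤ sinc (1/T*t/2) := by
    have hx : |1/T*t/2| ≤ 1/2 := by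
      rw [abs_div, abs_mul, abs_of_pos (by positivity : 0 < 1/T)]
      have : 1/T*|t| ≤ 1 := by rw [one_div, inv_mul_le_iff₀ hT]; linarith
      rw [abs_two]; linarith
    rcases lt_trichotomy (1/T*t/2) 0 with h | h | h
    · rw [← sinc_neg]; rw [abs_of_neg h] at hx; exact h0 _ (by linarith) hx
    · rw [h, sinc_zero]; norm_num
    · rw [abs_of_pos h] at hx; exact h0 _ h hx
  have h2 : (1/4:ℝ) ≤ sinc (1/T*t/2)^2 := by nlinarith
  unfold triHat
  calc (1/T)^2/4 = (1/T)^2*(1/4) := by ring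
    _ ≤ _ := by gcongr

lemma EE_single (χ : DirichletCharacter ℂ q) (t:ℝ) : (q:ℝ)⁻¹ ≤ ‖EE χ 1 t (Finsupp.single 1 1)‖ := by
  have hk : kk χ 1 1 = (q.totient:ℂ)⁻¹ := by
    unfold kk
    rw [sum_eq_single (1 : (ZMod q)ˣ)]
    · simp
    · intro g _ hg
      rw [if_neg]; rw [mul_one]; intro h; exact hg (Units.ext h)
    · simp
  have : EE χ 1 t (Finsupp.single 1 1) = (q.totient:ℂ)⁻¹ := by
    simp [EE, Finsupp.linearCombination_single, ph_zero, hk]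
  rw [this, norm_inv, Complex.norm_natCast]
  have hp : (0:ℝ) < q.totient := mod_cast totient_pos'
  exact inv_anti₀ hp (mod_cast Nat.totient_le q)

lemma bad_meas {P : Finset ℕ} (hP : ∀ p ∈ P, p.Prime ∧ p.Coprime q) {H:ℕ} (hH : 0 < H) (v:ℕ) {α T:ℝ} (hT : 0 < T)
    (χ : DirichletCharacter ℂ q) (l:ℕ) (hl : q*T ≤ exp (l*(v / H))) :
    volume.real {t:ℝ | |t| ≤ T ∧ exp (-α*(v / H)) < ‖QQ (cls P H v) χ t‖} ≤
      8*Real.pi*q*(exp (2*α*l*(v / H))*(3*((l:ℝ) ^ l) ^ 2*(exp (l / H)) ^ 2*exp (3*exp 2))) := by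
  have hq0 : (0:ℝ) < q := mod_cast NeZero.pos q
  set S : DirichletCharacter ℂ q → Set ℝ := fun χ => {t:ℝ | |t| ≤ T ∧ exp (-α*(v / H)) < ‖QQ (cls P H v) χ t‖} with hS
  have hm : ∀ χ, MeasurableSet (S χ) := fun χ =>
    (isClosed_le continuous_abs continuous_const).measurableSet.inter (isOpen_lt continuous_const (QQ_continuous _ _).norm).measurableSet
  have hb := IS_badpiece hP hH v (α := α) (δ := 1/T) (by positivity) hm (fun χ t ht => ht.2) (Y1 := 1) (Y2 := 1) (B := 1)
    one_pos zero_le_one one_pos (Finsupp.single 1 1)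
    (fun n hn => by
      by_cases h : n = 1
      · subst h; simp
      · simp [Ne.symm h] at hn)
    (fun n => by
      by_cases h : n = 1
      · subst h; simp
      · rw [Finsupp.single_eq_of_ne h]; simp) l
    (by rw [one_mul]; simpa [div_eq_mul_inv] using hl)
  have hlow : (8*Real.pi*q)⁻¹*volume.real (S χ) ≤ IS (1/T) S (Finsupp.single 1 1) := by
    have h1 : ((q:ℝ)⁻¹^2*((1/T)^2/4))*volume.real (S χ) ≤ ∫ t in S χ, ‖EE χ 1 t (Finsupp.single 1 1)‖ ^ 2*triHat (1/T) t := by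
      refine setIntegral_ge_of_const_le_real (hm χ) ?_ (fun t ht => ?_) (EE_int _ _ _ _).integrableOn
      · refine ((measure_mono (fun t ht => abs_le.mp ht.1)).trans_lt (measure_Icc_lt_top (a := -T) (b := T))).ne
      · exact mul_le_mul (pow_le_pow_left₀ (by positivity) (EE_single χ t) 2) (triHat_lower hT ht.1) (by positivity) (by positivity)
    have h2 : ∀ ψ : DirichletCharacter ℂ q, 0 ≤ ∑ a : ZMod q, ∫ t in S ψ, ‖EE ψ a t (Finsupp.single 1 1)‖ ^ 2*triHat (1/T) t :=
      fun ψ => sum_nonneg fun a _ => integral_nonneg fun t => IS_int_nonneg _ _ _ _ _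
    have h3 := single_le_sum (f := fun a : ZMod q => ∫ t in S χ, ‖EE χ a t (Finsupp.single 1 1)‖ ^ 2*triHat (1/T) t)
      (fun a _ => integral_nonneg fun t => IS_int_nonneg _ _ _ _ _) (mem_univ 1)
    have h4 := single_le_sum (fun ψ _ => h2 ψ) (mem_univ χ)
    unfold IS
    calc _ = (q:ℝ) / (2*Real.pi*(1/T)^2)*(((q:ℝ)⁻¹^2*((1/T)^2/4))*volume.real (S χ)) := by
          have := pi_ne_zero
          field_simp; ring
      _ ≤ _ := by
          refine mul_le_mul_of_nonneg_left (h1.trans (h3.trans h4)) (IS_fac_nonneg _)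
  have h5 := hlow.trans hb
  have hp := pi_pos
  rw [inv_mul_le_iff₀ (by positivity)] at h5
  refine h5.trans (le_of_eq ?_)
  norm_num
end

lemma bad_num {α α0 V u y lq:ℝ} {H l:ℕ} (hα : α ≤ α0) (hα0 : 0 < α0) (hH : 1 ≤ H) (hu : y / 2 ≤ u) (hy : 16 ≤ y) (hu2 : u ≤ V/2)
    (hlq : lq ≤ V/2) (hl : (l:ℝ) ≤ (lq + 3*V)/u + 1) (hy2 : 64*(log V + 1) ≤ 4*α0*y) (hV : 1 ≤ V) :
    exp (2*α*l*u)*(((l:ℝ) ^ l) ^ 2*(exp (l / H)) ^ 2) ≤ exp (9*α0*V) := by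
  have hu0 : 0 < u := by linarith
  have hlu : l*u ≤ 4*V := by
    have : (lq + 3*V)/u*u = lq + 3*V := by field_simp
    nlinarith
  have hly : (l:ℝ)*y ≤ 8*V := by
    have := mul_le_mul_of_nonneg_left hu (Nat.cast_nonneg (α := ℝ) l)
    linarith
  have hlV : (l:ℝ) ≤ V := by
    have := mul_le_mul_of_nonneg_left hy (Nat.cast_nonneg (α := ℝ) l)
    linarith
  have hll : (l:ℝ)^l ≤ exp (l*log V) := by
    rw [mul_comm, exp_mul, exp_log (by linarith), rpow_natCast]
    gcongr
  have hlH : (l:ℝ) / H ≤ l := div_le_self (Nat.cast_nonneg _) (mod_cast hH)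
  have h1 : 2*α*l*u ≤ 8*α0*V := by
    have h0 : 0 ≤ (l:ℝ)*u := by positivity
    have h1 := mul_le_mul_of_nonneg_right hα h0
    have h2 := mul_le_mul_of_nonneg_left hlu hα0.le
    linarith
  have h2 : 2*(l*(log V + 1)) ≤ α0*V := by
    have h3 := mul_le_mul_of_nonneg_left hy2 (Nat.cast_nonneg (α := ℝ) l)
    have h4 := mul_le_mul_of_nonneg_left hly hα0.le
    linarith
  calc _ ≤ exp (8*α0*V)*((exp (l*log V))^2*(exp l)^2) := by gcongr
    _ = exp (8*α0*V + 2*(l*(log V + 1))) := by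
        rw [← exp_nat_mul, ← exp_nat_mul, ← exp_add, ← exp_add]; congr 1; push_cast; ring
    _ ≤ _ := exp_le_exp.mpr (by linarith)

set_option maxHeartbeats 1000000 in
lemma bad_total (α0:ℝ) (hα0 : 0 < α0) (q:ℕ) [NeZero q] : ∃ V0:ℝ, ∀ V, V0 ≤ V → ∀ y z:ℝ, 16 ≤ y → y ≤ z → z ≤ V/2 →
    V/2 < exp (2*√y) → ∀ (χ : DirichletCharacter ℂ q) (U : Set ℝ), (∀ t ∈ U, |t| ≤ exp (3*V) ∧ t ∉ goodS α0 y z χ) →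
    (volume U).toReal ≤ exp (10*α0*V) := by
  set C := 24*Real.pi*q*exp (3*exp 2) with hC
  obtain ⟨x0, hx0, hx⟩ := eventually_poly_exp C α0 hα0 2
  set s0 := 1 + 64*3 / α0 with hs0
  have hs01 : 1 ≤ s0 := by rw [hs0]; have : 0 ≤ 64*3 / α0 := by positivity
                           linarith
  refine ⟨x0 + 2*exp s0 + 2*log q + 10, ?_⟩
  intro V hV y z hy hyz hzV hVy χ U hU
  have hq1 : (1:ℝ) ≤ q := mod_cast NeZero.pos q
  have hlq0 : 0 ≤ log q := log_nonneg hq1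
  have hes : 0 < exp s0 := exp_pos _
  have hy0 : 0 < y := by linarith
  have hV1 : 1 ≤ V := by linarith
  set s := log (V/2) with hs
  have hss : s0 ≤ s := (le_log_iff_exp_le (by linarith)).mpr (by linarith)
  have hlogV : log V ≤ s + 1 := by
    have : log V = s + log 2 := by rw [hs, ← log_mul (by linarith) (by norm_num)]; congr 1; ring
    linarith [log_two_lt_d9]
  have hsy : s ≤ 2*√y := by
    rw [hs]; exact (log_le_iff_le_exp (by linarith)).mpr hVy.le
  have hsy2 : s^2 ≤ 4*y := by
    have h1 : s^2 ≤ (2*√y)^2 := pow_le_pow_left₀ (by linarith) hsy 2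
    rw [mul_pow, sq_sqrt hy0.le] at h1; linarith
  have hy2 : 64*(log V + 1) ≤ 4*α0*y := by
    have h1 : 64*3 ≤ α0*s := by
      have : 64*3 / α0 ≤ s := by linarith
      rw [div_le_iff₀ hα0] at this; linarith
    have h2 := mul_le_mul_of_nonneg_right h1 (show 0 ≤ s by linarith)
    have h3 := mul_le_mul_of_nonneg_left hsy2 hα0.le
    linarith
  set H := Hs y with hH
  have hly1 : 1 ≤ log y := by
    rw [le_log_iff_exp_le hy0]; linarith [exp_one_lt_d9]
  have hHy : (H:ℝ) ≤ y := by
    rw [hH, Hs]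
    linarith [(Nat.ceil_lt_add_one (show 0 ≤ log y by linarith)).le, log_le_sub_one_of_pos hy0]
  have hHge : log y ≤ H := Nat.le_ceil _
  have hH1 : (1:ℝ) ≤ H := by linarith
  have hH0 : 0 < H := mod_cast (by linarith : (0:ℝ) < H)
  set α := α0 - 1 / log y with hα
  have hα' : α ≤ α0 := by rw [hα]; have : 0 ≤ 1 / log y := by positivity
                          linarith
  set S:ℕ → Set ℝ := fun v => {t:ℝ | |t| ≤ exp (3*V) ∧ exp (-α*(v / H)) < ‖QQ (cls (prq q y z) H v) χ t‖} with hS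
  have hUS : U ⊆ ⋃ v ∈ vset (prq q y z) H, S v := by
    intro t ht
    obtain ⟨h1, h2⟩ := hU t ht
    simp only [goodS, goodset, Set.mem_setOf_eq, not_forall, not_le] at h2
    obtain ⟨v, hv, h3⟩ := h2
    exact Set.mem_biUnion hv ⟨h1, h3⟩
  have hSv : ∀ v ∈ vset (prq q y z) H, volume.real (S v) ≤ C*exp (9*α0*V) := by
    intro v hv
    obtain ⟨h1, h2⟩ := prq_vset hH0 hv
    have h1H : 1 / (H:ℝ) ≤ 1 := by rw [div_le_one (by linarith)]; exact hH1
    have hu : y/2 ≤ (v:ℝ)/H := by linarith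
    have hu0 : 0 < (v:ℝ)/H := by linarith
    set l := ⌈(log q + 3*V)/((v:ℝ)/H)⌉₊ with hl
    have hl1 : (log q + 3*V)/((v:ℝ)/H) ≤ l := Nat.le_ceil _
    have hl2 : (l:ℝ) ≤ (log q + 3*V)/((v:ℝ)/H) + 1 := (Nat.ceil_lt_add_one (by positivity)).le
    have hb := bad_meas (q := q) (P := prq q y z) (fun p hp => ⟨prq_prime hp, (prq_cop hp).2⟩) hH0 v (α := α)
      (exp_pos (3*V)) χ l (by
        rw [div_le_iff₀ hu0] at hl1
        calc (q:ℝ)*exp (3*V) = exp (log q + 3*V) := by rw [exp_add, exp_log (by linarith)]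
          _ ≤ _ := exp_le_exp.mpr hl1)
    have hn := bad_num (H := H) hα' hα0 hH0 hu hy (h2.trans hzV) (by linarith) hl2 hy2 hV1
    refine hb.trans ?_
    have hC0 : 0 ≤ C := by positivity
    calc _ = C*(exp (2*α*l*(v/H))*(((l:ℝ) ^ l) ^ 2*(exp (l / H)) ^ 2)) := by rw [hC]; ring
      _ ≤ _ := by gcongr
  have hfin : ∀ v, volume (S v) ≠ ⊤ := fun v =>
    ((measure_mono (fun t ht => abs_le.mp ht.1)).trans_lt (measure_Icc_lt_top (a := -exp (3*V)) (b := exp (3*V)))).ne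
  have hcard := prq_vset_card (q := q) (y := y) (z := z) hH0 (by linarith)
  have hc2 : ((vset (prq q y z) H).card:ℝ) ≤ V^2 := by nlinarith
  calc (volume U).toReal ≤ volume.real (⋃ v ∈ vset (prq q y z) H, S v) :=
        measureReal_mono hUS ((measure_biUnion_finset_le _ _).trans_lt (ENNReal.sum_lt_top.mpr fun v _ => (hfin v).lt_top)).ne
    _ ≤ ∑ v ∈ vset (prq q y z) H, volume.real (S v) := measureReal_biUnion_finset_le _ _
    _ ≤ ∑ v ∈ vset (prq q y z) H, C*exp (9*α0*V) := sum_le_sum hSv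
    _ = ((vset (prq q y z) H).card:ℝ)*(C*exp (9*α0*V)) := by rw [sum_const, nsmul_eq_mul]
    _ ≤ V^2*(C*exp (9*α0*V)) := mul_le_mul_of_nonneg_right hc2 (by positivity)
    _ = (C*V^2)*exp (9*α0*V) := by ring
    _ ≤ exp (α0*V)*exp (9*α0*V) := by
        gcongr; exact hx V (by linarith)
    _ = _ := by rw [← exp_add]; congr 1; ring

section
variable {q:ℕ} [NeZero q]

lemma IS_le {δ K:ℝ} (hδ : 0 < δ) (hK : 0 ≤ K) (S : DirichletCharacter ℂ q → Set ℝ) (c:ℕ →₀ ℂ)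
    (h : ∀ χ a, ∫ t in S χ, ‖EE χ a t c‖ ^ 2*triHat δ t ≤ δ^2*K) :
    IS δ S c ≤ (q*(Fintype.card (DirichletCharacter ℂ q)*q))*K := by
  unfold IS
  calc _ ≤ (q:ℝ) / (2*Real.pi*δ ^ 2)*∑ χ : DirichletCharacter ℂ q, ∑ a : ZMod q, δ^2*K :=
        mul_le_mul_of_nonneg_left (sum_le_sum fun χ _ => sum_le_sum fun a _ => h χ a) (IS_fac_nonneg δ)
    _ = (q*(Fintype.card (DirichletCharacter ℂ q)*q))*K / (2*Real.pi) := by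
        simp only [sum_const, card_univ, nsmul_eq_mul, ZMod.card]
        have := pi_ne_zero
        field_simp
    _ ≤ _ := div_le_self (by positivity) (by linarith [pi_gt_three])

lemma EE_bV_bd (χ : DirichletCharacter ℂ q) (a : ZMod q) {A:ℝ} (hA : 1 ≤ A) (V t:ℝ) :
    ‖EE χ a t (bV A V)‖^2 ≤ (A*exp (2*A))^2 :=
  pow_le_pow_left₀ (norm_nonneg _) ((EE_norm_le _ _ _ _).trans (bV_l1 (by linarith) V)) 2

lemma small_t (χ : DirichletCharacter ℂ q) (a : ZMod q) {A:ℝ} (hA : 1 ≤ A) (t0:ℝ) :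
    Tendsto (fun V => ∫ t in Set.Icc (-t0) t0, ‖EE χ a t (bV A V)‖^2) atTop (𝓝 0) := by
  have h := tendsto_integral_filter_of_dominated_convergence (μ := volume.restrict (Set.Icc (-t0) t0)) (l := atTop)
    (F := fun V t => ‖EE χ a t (bV A V)‖^2) (f := fun _ => (0:ℝ)) (fun _ => (A*exp (2*A))^2)
    (Eventually.of_forall fun V => ((EE_continuous χ a (bV A V)).norm.pow 2).aestronglyMeasurable)
    (Eventually.of_forall fun V => Eventually.of_forall fun t => by
      rw [norm_of_nonneg (by positivity)]; exact EE_bV_bd χ a hA V t)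
    (integrable_const _)
    (Eventually.of_forall fun t => by
      have := ((EE_bV_tendsto χ a hA t).norm).pow 2
      simpa using this)
  simpa using h

lemma far_t (χ : DirichletCharacter ℂ q) (a : ZMod q) {A:ℝ} (hA : 1 ≤ A) (V δ:ℝ) {T:ℝ} (hT : 0 < T) :
    ∫ t in {t:ℝ | T < |t|}, ‖EE χ a t (bV A V)‖^2*triHat δ t ≤ (A*exp (2*A))^2*(8*Real.pi / T) := by
  set B := (A*exp (2*A))^2 with hB
  have hg : Integrable (fun t:ℝ => (1 + (t/T)^2)⁻¹) := integrable_inv_one_add_sq.comp_div hT.ne'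
  have hm : MeasurableSet {t:ℝ | T < |t|} := (isOpen_lt continuous_const continuous_abs).measurableSet
  calc _ ≤ ∫ t in {t:ℝ | T < |t|}, (B*(8 / T^2))*(1 + (t/T)^2)⁻¹ := by
        refine setIntegral_mono_on (EE_int _ _ _ _).integrableOn (hg.const_mul _).integrableOn hm fun t ht => ?_
        have ht' : T < |t| := ht
        have ht0 : t ≠ 0 := by rintro rfl; simp at ht'; linarith
        have hsq : T^2 ≤ t^2 := by rw [← sq_abs t]; exact pow_le_pow_left₀ hT.le ht'.le 2
        have h1 : triHat δ t ≤ 8 / T^2*(1 + (t/T)^2)⁻¹ := by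
          refine (triHat_le_inv δ ht0).trans ?_
          have : 8 / T^2*(1 + (t/T)^2)⁻¹ = 8 / (T^2 + t^2) := by field_simp
          rw [this, div_le_div_iff₀ (by positivity) (by positivity)]; linarith
        rw [mul_assoc B]
        exact mul_le_mul (EE_bV_bd χ a hA V t) h1 (triHat_nonneg _ _) (by positivity)
    _ ≤ ∫ t:ℝ, (B*(8 / T^2))*(1 + (t/T)^2)⁻¹ :=
        setIntegral_le_integral (hg.const_mul _) (Eventually.of_forall fun t => by positivity)
    _ = _ := by
        rw [integral_const_mul, Measure.integral_comp_div (fun x:ℝ => (1 + x^2)⁻¹), integral_univ_inv_one_add_sq, abs_of_pos hT, smul_eq_mul]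
        field_simp
end

set_option maxHeartbeats 1000000 in
theorem endgame (A:ℝ) (hA : 1 ≤ A) : ∃ α0:ℝ, 0 < α0 ∧ ∀ (q:ℕ) [NeZero q] (ε:ℝ), 0 < ε → ∃ V0:ℝ, ∀ V, V0 ≤ V →
    ∀ δ:ℝ, 0 < δ → q / δ ≤ exp V → ∀ y z:ℝ, 16 ≤ y → y ≤ z → z ≤ V/2 → V/2 < exp (2*√y) →
    IS δ (fun χ : DirichletCharacter ℂ q => (goodS α0 y z χ)ᶜ) (bV A V) ≤ ε := by
  obtain ⟨c, hc, hcon⟩ := contraction A hA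
  refine ⟨c/40, by positivity, ?_⟩
  intro q _ ε hε
  have hq1 : (1:ℝ) ≤ q := mod_cast NeZero.pos q
  set N:ℝ := q*(Fintype.card (DirichletCharacter ℂ q)*q) with hN
  have hN0 : 0 ≤ N := by positivity
  set ε1 := ε / (3*(N + 1)) with hε1
  have hε10 : 0 < ε1 := by positivity
  have hNε : N*ε1 ≤ ε / 3 := by
    rw [hε1, mul_div_assoc', div_le_iff₀ (by positivity)]; nlinarith
  obtain ⟨t0, ht0, V1, h1⟩ := hcon q ε1 hε10
  obtain ⟨V2, h2⟩ := bad_total (c/40) (by positivity) q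
  have hs : ∀ᶠ V in atTop, ∀ χ : DirichletCharacter ℂ q, ∀ a : ZMod q, ∫ t in Set.Icc (-t0) t0, ‖EE χ a t (bV A V)‖^2 < ε1 := by
    rw [eventually_all]; intro χ
    rw [eventually_all]; intro a
    exact (small_t χ a hA t0).eventually_lt_const hε10
  obtain ⟨V3, h3⟩ := eventually_atTop.mp hs
  set D := (A*exp (2*A))^2*(8*Real.pi) with hD
  have hD0 : 0 < D := by positivity
  refine ⟨max V1 (max V2 (max V3 (D / ε1))), ?_⟩
  intro V hV δ hδ hqδ y z hy hyz hzV hVy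
  simp only [max_le_iff] at hV
  obtain ⟨hV1, hV2, hV3, hV4⟩ := hV
  set T := exp (3*V) with hT
  have hT0 : 0 < T := exp_pos _
  set Bd : DirichletCharacter ℂ q → Set ℝ := fun χ => (goodS (c/40) y z χ)ᶜ with hBd
  have hBm : ∀ χ, MeasurableSet (Bd χ) := fun χ => (goodS_meas _ _ _ _).compl
  have hUm : ∀ χ, MeasurableSet (Bd χ ∩ {t | t0 ≤ |t| ∧ |t| ≤ T}) := fun χ => (hBm χ).inter
    ((isClosed_le continuous_const continuous_abs).inter (isClosed_le continuous_abs continuous_const)).measurableSet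
  have hfm : MeasurableSet {t:ℝ | T < |t|} := (isOpen_lt continuous_const continuous_abs).measurableSet
  have hdom : ∀ (χ : DirichletCharacter ℂ q) (a : ZMod q) (U : Set ℝ) (R:ℝ), MeasurableSet U → U ⊆ Set.Icc (-R) R →
      ∫ t in U, ‖EE χ a t (bV A V)‖^2 ≤ ε1 → ∫ t in U, ‖EE χ a t (bV A V)‖^2*triHat δ t ≤ δ^2*ε1 := by
    intro χ a U R hU hUR h
    calc _ ≤ ∫ t in U, δ^2*‖EE χ a t (bV A V)‖^2 := by
          refine setIntegral_mono_on (EE_int _ _ _ _).integrableOn ((EE_intOn hUR χ a _).const_mul _) hU fun t _ => ?_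
          rw [mul_comm]
          exact mul_le_mul_of_nonneg_right (triHat_le _ _) (by positivity)
      _ = δ^2*∫ t in U, ‖EE χ a t (bV A V)‖^2 := integral_const_mul _ _
      _ ≤ _ := by gcongr
  have k1 : IS δ (fun χ : DirichletCharacter ℂ q => Set.Icc (-t0) t0) (bV A V) ≤ N*ε1 :=
    IS_le hδ hε10.le _ _ fun χ a => hdom χ a _ t0 measurableSet_Icc le_rfl (h3 V hV3 χ a).le
  have k2 : IS δ (fun χ : DirichletCharacter ℂ q => Bd χ ∩ {t | t0 ≤ |t| ∧ |t| ≤ T}) (bV A V) ≤ N*ε1 :=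
    IS_le hδ hε10.le _ _ fun χ a => hdom χ a _ T (hUm χ) (fun t ht => abs_le.mp ht.2.2) (h1 V hV1 χ a _ (hUm χ) (fun t ht => ht.2)
      ((h2 V hV2 y z hy hyz hzV hVy χ _ fun t ht => ⟨ht.2.2, ht.1⟩).trans (le_of_eq (by congr 1; ring))))
  have k3 : IS δ (fun χ : DirichletCharacter ℂ q => {t:ℝ | T < |t|}) (bV A V) ≤ N*ε1 := by
    refine IS_le hδ hε10.le _ _ fun χ a => (far_t χ a hA V δ hT0).trans ?_
    have hδ1 : exp (-V) ≤ δ := by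
      rw [div_le_iff₀ hδ] at hqδ
      rw [exp_neg, inv_le_iff_one_le_mul₀ (exp_pos _)]; linarith
    have hDV : D*exp (-V) ≤ ε1 := by
      rw [div_le_iff₀ hε10] at hV4
      rw [exp_neg, ← div_eq_mul_inv, div_le_iff₀ (exp_pos _)]
      nlinarith [add_one_le_exp V]
    calc _ = exp (-V)^2*(D*exp (-V)) := by
          have hTi : T⁻¹ = exp (-V)^2*exp (-V) := by
            rw [hT, ← exp_neg, ← pow_succ, ← exp_nat_mul]; congr 1; push_cast; ring
          rw [div_eq_mul_inv, hTi, hD]; ring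
      _ ≤ _ := mul_le_mul (pow_le_pow_left₀ (exp_pos _).le hδ1 2) hDV (by positivity) (by positivity)
  have k4 := IS_two δ (S := Bd) (S1 := fun χ => Set.Icc (-t0) t0) (S2 := fun χ => (Bd χ ∩ {t | t0 ≤ |t| ∧ |t| ≤ T}) ∪ {t:ℝ | T < |t|})
    (fun χ => measurableSet_Icc) (fun χ => (hUm χ).union hfm) (fun χ t ht => by
      by_cases h : |t| ≤ t0
      · exact Or.inl (abs_le.mp h)
      · by_cases h' : |t| ≤ T
        · exact Or.inr (Or.inl ⟨ht, (not_le.mp h).le, h'⟩)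
        · exact Or.inr (Or.inr (not_le.mp h'))) (bV A V)
  have k5 := IS_two δ (S := fun χ => (Bd χ ∩ {t | t0 ≤ |t| ∧ |t| ≤ T}) ∪ {t:ℝ | T < |t|}) (fun χ => hUm χ) (fun χ => hfm)
    (fun χ => le_rfl) (bV A V)
  linarith

set_option maxHeartbeats 1000000 in
theorem IS_main (A η ε ε':ℝ) (hA : 1 ≤ A) (hη : 0 < η) (hε : 0 < ε) (hε1 : ε < 1) (hε' : 0 < ε') :
    ∃ L0:ℕ, ∀ L:ℕ, L0 ≤ L → ∀ (q:ℕ) [NeZero q], primeVol q ≤ (1 - ε)*primeSumUpToNat L →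
    ∃ V0:ℝ, ∀ V, V0 ≤ V → IS (η*L*q*exp (-V)) (fun χ : DirichletCharacter ℂ q => Set.univ) (bV A V) ≤ ε' := by
  obtain ⟨α0, hα0, hend⟩ := endgame A hA
  obtain ⟨Cm, hCm, hmer⟩ := mertens_nat
  obtain ⟨Cp, hCp, hprq⟩ := prq_sum_lower
  set B:ℕ := ⌈4/ε⌉₊ + 1 with hB
  have hBr : 4/ε ≤ (B:ℝ) - 1 := by rw [hB]; push_cast; linarith [Nat.le_ceil (4/ε)]
  have hBε : 4 ≤ ((B:ℝ) - 1)*ε := by rwa [div_le_iff₀ hε] at hBr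
  have hB2 : 2 ≤ B := by
    have : (4:ℝ) ≤ (B:ℝ) - 1 := le_trans ((le_div_iff₀ hε).2 (by linarith)) hBr
    exact_mod_cast (by linarith : (2:ℝ) ≤ B)
  obtain ⟨C2, hC2, C, hC, y0, hy0, hred⟩ := IS_reduce A α0 hA hα0 B hB2
  set X0:ℝ := 2 + 2*y0 / ε + 2 / η + (C + Cm) + 4*(1 + Cp + Cm) / ε + 4*C2 / (ε*ε') with hX0
  refine ⟨⌈exp (exp X0)⌉₊ + 2, ?_⟩
  intro L hL q _ hvol
  have hq1 : (1:ℝ) ≤ q := mod_cast NeZero.pos q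
  have hLr : exp (exp X0) ≤ L := (Nat.le_ceil _).trans (mod_cast (by omega : ⌈exp (exp X0)⌉₊ ≤ L))
  have hL0 : (0:ℝ) < L := (exp_pos _).trans_le hLr
  have hlL : exp X0 ≤ log L := (le_log_iff_exp_le hL0).mpr hLr
  have hlL0 : 0 < log L := (exp_pos _).trans_le hlL
  set x := log (log L) with hx
  have hxX : X0 ≤ x := (le_log_iff_exp_le hlL0).mpr hlL
  have hex : exp x = log L := exp_log hlL0
  have b1 : 0 ≤ 2*y0 / ε := by positivity
  have b2 : 0 ≤ 2 / η := by positivity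
  have b3 : 0 ≤ 4*(1 + Cp + Cm) / ε := by positivity
  have b4 : 0 ≤ 4*C2 / (ε*ε') := by positivity
  have x2 : 2 ≤ x := by linarith
  have xy : 2*y0 ≤ x*ε := by rw [← div_le_iff₀ hε]; linarith
  have xη : 2 ≤ x*η := by rw [← div_le_iff₀ hη]; linarith
  have xC : C + Cm ≤ x := by linarith
  have xP : 4*(1 + Cp + Cm) ≤ x*ε := by rw [← div_le_iff₀ hε]; linarith
  have x5 : 4*C2 ≤ x*(ε*ε') := by rw [← div_le_iff₀ (by positivity)]; linarith
  have hps : primeSumUpToNat L ≤ x + Cm := by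
    have h1 := hmer L (by omega)
    have h2 : primeSumUpToNat L = ∑ p ∈ (Ioc 0 L).filter Nat.Prime, (p:ℝ)⁻¹ := by
      unfold primeSumUpToNat
      refine sum_congr ?_ fun p _ => one_div _
      ext p
      simp only [mem_filter, mem_Iic, mem_Ioc]
      exact ⟨fun h => ⟨⟨h.2.pos, h.1⟩, h.2⟩, fun h => ⟨h.1.2, h.2⟩⟩
    rw [h2]; linarith [(abs_le.mp h1).2]
  have hpv : primeVol q ≤ (1 - ε)*(x + Cm) := hvol.trans (mul_le_mul_of_nonneg_left hps (by linarith))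
  have hεC : 0 ≤ ε*(x + Cm) := by positivity
  set y := exp (ε/2*x) with hy
  set z := exp x / 2 with hz
  have hly : log y = ε/2*x := log_exp _
  have hyy : y0 ≤ y := by linarith [add_one_le_exp (ε/2*x)]
  have hyz : y ≤ z := by
    rw [hy, hz, le_div_iff₀ two_pos]
    calc exp (ε/2*x)*2 ≤ exp (ε/2*x)*exp 1 := by
          gcongr; linarith [add_one_le_exp (1:ℝ)]
      _ = exp (ε/2*x+1) := by rw [exp_add]
      _ ≤ _ := exp_le_exp.mpr (by linarith [mul_le_mul_of_nonneg_right hε1.le (by linarith : 0 ≤ x)])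
  have hx0 : 0 ≤ x := by linarith
  have hBx := mul_le_mul_of_nonneg_right hBε hx0
  have hzB : z ≤ y^B := by
    rw [hy, ← exp_nat_mul]
    have : x ≤ B*(ε/2*x) := by linarith [mul_nonneg hε.le hx0]
    have := exp_le_exp.mpr this
    have := exp_pos x
    linarith
  have hC1 : C + ∑ p ∈ q.primeFactors, (1:ℝ)/p ≤ ((B:ℝ) - 1)*log y := by
    have h1 : ∑ p ∈ q.primeFactors, (1:ℝ)/p ≤ x + Cm := by
      have := hpv; unfold primeVol at this; linarith
    rw [hly]
    linarith
  have hWl : log y / 2 ≤ ∑ p ∈ prq q y z, (p:ℝ)⁻¹ := by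
    have h1 := hprq q (NeZero.pos q) y z (by linarith) hyz
    have h2 : log (z/y) = x - log 2 - ε/2*x := by
      rw [log_div (by positivity) (by positivity), hly, hz, log_div (by positivity) (by norm_num), log_exp]
    have h3 := hpv
    unfold primeVol at h3
    rw [h2] at h1
    rw [hly]
    have h4 : 0 ≤ ε*Cm := by positivity
    linarith [log_two_lt_d9]
  obtain ⟨V1, hV1⟩ := hend q (ε'/2) (by positivity)
  refine ⟨max V1 (2*z), ?_⟩
  intro V hV
  obtain ⟨hV2, hV3⟩ := max_le_iff.mp hV
  set δ := η*L*q*exp (-V) with hδ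
  have hδ0 : 0 < δ := by positivity
  have hqδ : q / δ ≤ exp (V - z) := by
    have hLz : (L:ℝ) = exp z*exp z := by
      rw [← exp_add, hz, add_halves, hex, exp_log hL0]
    have hz1 : 1 ≤ η*exp z := by
      have h1 := add_one_le_exp x
      have h2 := add_one_le_exp z
      linarith [mul_le_mul_of_nonneg_left (show x/2 ≤ exp z by linarith) hη.le]
    rw [div_le_iff₀ hδ0, hδ, hLz]
    calc (q:ℝ) = 1*q := by ring
      _ ≤ (η*exp z)*q := by gcongr
      _ = exp (V - z)*exp (-V)*exp z*(η*exp z)*q := by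
          rw [← exp_add, ← exp_add, show V - z + -V + z = 0 by ring, exp_zero, one_mul]
      _ = _ := by ring
  obtain ⟨y1, z1, hy1, hyz1, hzb1, hzV1, hVy1, hIS⟩ := hred q y z V δ hδ0 hqδ hyy hyz hzB (by linarith) hC1 hWl
  have hqV : q / δ ≤ exp V := hqδ.trans (exp_le_exp.mpr (by linarith [show 0 < z by positivity]))
  have h1 := hV1 V hV2 δ hδ0 hqV y1 z1 hy1 hyz1 hzV1 hVy1
  have h2 : C2 / log y ≤ ε'/2 := by
    rw [hly, div_le_iff₀ (by positivity)]; linarith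
  linarith

section
variable {q:ℕ} [NeZero q]

noncomputable def GG (c:ℕ →₀ ℂ) (δ:ℝ) (b : ZMod q) (u:ℝ):ℂ :=
  ∑ m ∈ c.support with ((m:ℕ) : ZMod q) = b, (if log m - δ ≤ u ∧ u < log m then c m else 0)

lemma IS_GG {δ:ℝ} (hδ : 0 < δ) (c:ℕ →₀ ℂ) :
    IS δ (fun χ : DirichletCharacter ℂ q => Set.univ) c = q / δ^2*∑ b : ZMod q, ∫ u, ‖GG c δ b u‖^2 := by
  unfold IS
  simp only [Measure.restrict_univ]
  rw [IS_parseval]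
  unfold XX GG
  simp_rw [plancherel_window _ _ _ hδ]
  rw [← mul_sum]
  have := pi_ne_zero
  field_simp

lemma GG_ind (c:ℕ →₀ ℂ) (δ:ℝ) (b : ZMod q) : GG c δ b = fun u =>
    ∑ m ∈ c.support with ((m:ℕ) : ZMod q) = b, (Set.Ico (log m - δ) (log m)).indicator (fun _ => c m) u := by
  ext u; unfold GG
  refine sum_congr rfl fun m _ => ?_
  simp [Set.indicator, Set.mem_Ico]

lemma ind_int (x y:ℝ) (c:ℂ) : Integrable ((Set.Ico x y).indicator (fun _ => c)) :=
  (integrableOn_const (by simp)).integrable_indicator measurableSet_Ico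

lemma GG_int (c:ℕ →₀ ℂ) (δ:ℝ) (b : ZMod q) : Integrable (GG c δ b) := by
  rw [GG_ind]
  exact integrable_finset_sum _ fun m _ => ind_int _ _ _

lemma GG_sq_int (c:ℕ →₀ ℂ) (δ:ℝ) (b : ZMod q) : Integrable (fun u => ‖GG c δ b u‖^2) := by
  simp_rw [pow_two]
  refine (GG_int c δ b).norm.bdd_mul (c := ∑ m ∈ c.support with ((m:ℕ) : ZMod q) = b, ‖c m‖)
    (GG_int c δ b).norm.aestronglyMeasurable (Eventually.of_forall fun u => ?_)
  rw [norm_norm]; unfold GG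
  refine (norm_sum_le _ _).trans (sum_le_sum fun m _ => ?_)
  split_ifs <;> simp

lemma block_le {δ:ℝ} (hδ : 0 < δ) (c:ℕ →₀ ℂ) (hc : ∀ m ∈ c.support, 1 ≤ m) (b : ZMod q) {P R:ℝ} (hP : 0 < P) (hPR : P ≤ R) :
    ‖∑ m ∈ c.support with ((m:ℕ) : ZMod q) = b, (if P ≤ m ∧ (m:ℝ) < R then c m else 0)‖ ≤
      δ⁻¹*(∫ u in Set.Ico (log P) (log R), ‖GG c δ b u‖) +
      ∑ m ∈ c.support with ((m:ℕ) : ZMod q) = b, ((if P ≤ m ∧ (m:ℝ) < P*exp δ then ‖c m‖ else 0) +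
        (if R ≤ m ∧ (m:ℝ) < R*exp δ then ‖c m‖ else 0)) := by
  set lam:ℕ → ℝ := fun m => volume.real (Set.Ico (log m - δ) (log m) ∩ Set.Ico (log P) (log R)) with hlam
  have hI : ∫ u in Set.Ico (log P) (log R), GG c δ b u = ∑ m ∈ c.support with ((m:ℕ) : ZMod q) = b, lam m*c m := by
    rw [GG_ind, integral_finset_sum _ fun m _ => (ind_int _ _ _).integrableOn]
    refine sum_congr rfl fun m _ => ?_
    rw [integral_indicator measurableSet_Ico, Measure.restrict_restrict measurableSet_Ico, setIntegral_const]
    simp [hlam]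
  have hn : ‖∫ u in Set.Ico (log P) (log R), GG c δ b u‖ ≤ ∫ u in Set.Ico (log P) (log R), ‖GG c δ b u‖ :=
    norm_integral_le_integral_norm _
  have hl0 : ∀ m, 0 ≤ lam m := fun m => measureReal_nonneg
  have hl1 : ∀ m, lam m ≤ δ := fun m => by
    refine (measureReal_mono Set.inter_subset_left (by simp)).trans (le_of_eq ?_)
    rw [volume_real_Ico_of_le (by linarith)]; ring
  have hδl : ∀ m, δ⁻¹*lam m ≤ 1 := fun m => by rw [inv_mul_le_iff₀ hδ]; linarith [hl1 m]
  have hδl0 : ∀ m, 0 ≤ δ⁻¹*lam m := fun m => mul_nonneg (by positivity) (hl0 m)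
  have hpt : ∀ m ∈ c.support, ‖(if P ≤ m ∧ (m:ℝ) < R then c m else 0) - (δ⁻¹*lam m:ℝ)*c m‖ ≤
      (if P ≤ m ∧ (m:ℝ) < P*exp δ then ‖c m‖ else 0) + (if R ≤ m ∧ (m:ℝ) < R*exp δ then ‖c m‖ else 0) := by
    intro m hm
    have hm0 : (0:ℝ) < m := mod_cast hc m hm
    have hR : 0 < R := hP.trans_le hPR
    have nn : ∀ (p : Prop) [Decidable p], 0 ≤ (if p then ‖c m‖ else 0) := fun p _ => by split_ifs <;> simp
    have hlz : (m:ℝ) < P ∨ R*exp δ ≤ m → lam m = 0 := by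
      intro h
      have : Set.Ico (log m - δ) (log m) ∩ Set.Ico (log P) (log R) = ∅ := by
        ext u
        simp only [Set.mem_inter_iff, Set.mem_Ico, Set.mem_empty_iff_false, iff_false]
        rintro ⟨⟨h1, h2⟩, h3, h4⟩
        rcases h with h | h
        · linarith [log_lt_log hm0 h]
        · have := log_le_log (by positivity) h
          rw [log_mul hR.ne' (exp_pos _).ne', log_exp] at this
          linarith
      rw [hlam]; simp only; rw [this]; simp
    by_cases h1 : (m:ℝ) < P
    · rw [hlz (Or.inl h1), if_neg (fun h => absurd h.1 (not_le.mpr h1))]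
      simpa using add_nonneg (nn _) (nn _)
    push Not at h1
    by_cases h2 : (m:ℝ) < R
    · rw [if_pos ⟨h1, h2⟩]
      by_cases h3 : (m:ℝ) < P*exp δ
      · rw [if_pos ⟨h1, h3⟩]
        have e : c m - (δ⁻¹*lam m:ℝ)*c m = ((1 - δ⁻¹*lam m:ℝ):ℂ)*c m := by push_cast; ring
        rw [e, norm_mul, norm_real, norm_of_nonneg (by linarith [hδl m])]
        have := mul_le_of_le_one_left (norm_nonneg (c m)) (show 1 - δ⁻¹*lam m ≤ 1 by linarith [hδl0 m])
        linarith [nn (R ≤ m ∧ (m:ℝ) < R*exp δ)]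
      · push Not at h3
        have hle : lam m = δ := by
          have hsub : Set.Ico (log m - δ) (log m) ⊆ Set.Ico (log P) (log R) := by
            intro u hu
            have := log_le_log (by positivity) h3
            rw [log_mul hP.ne' (exp_pos _).ne', log_exp] at this
            exact ⟨by linarith [hu.1], hu.2.trans (log_lt_log hm0 h2)⟩
          rw [hlam]; simp only
          rw [Set.inter_eq_left.mpr hsub, volume_real_Ico_of_le (by linarith)]; ring
        rw [hle, inv_mul_cancel₀ hδ.ne']
        simpa using add_nonneg (nn _) (nn _)
    · rw [if_neg (fun h => h2 h.2), zero_sub, norm_neg, norm_mul, norm_real, norm_of_nonneg (hδl0 m)]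
      push Not at h2
      by_cases h3 : (m:ℝ) < R*exp δ
      · rw [if_pos (⟨h2, h3⟩ : R ≤ m ∧ (m:ℝ) < R*exp δ)]
        have := mul_le_of_le_one_left (norm_nonneg (c m)) (hδl m)
        linarith [nn (P ≤ m ∧ (m:ℝ) < P*exp δ)]
      · rw [hlz (Or.inr (not_lt.mp h3))]
        simpa using add_nonneg (nn _) (nn _)
  have hsum : ∑ m ∈ c.support with ((m:ℕ) : ZMod q) = b, (if P ≤ m ∧ (m:ℝ) < R then c m else 0) =
      (δ⁻¹:ℝ)*(∫ u in Set.Ico (log P) (log R), GG c δ b u) +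
      ∑ m ∈ c.support with ((m:ℕ) : ZMod q) = b, ((if P ≤ m ∧ (m:ℝ) < R then c m else 0) - (δ⁻¹*lam m:ℝ)*c m) := by
    rw [hI, mul_sum, ← sum_add_distrib]
    refine sum_congr rfl fun m _ => ?_
    push_cast; ring
  rw [hsum]
  refine (norm_add_le _ _).trans (add_le_add ?_ ?_)
  · rw [norm_mul, norm_real, norm_of_nonneg (by positivity)]
    gcongr
  · exact (norm_sum_le _ _).trans (sum_le_sum fun m hm => hpt m (mem_filter.mp hm).1)

lemma near_le {δ A:ℝ} (hδ : 0 < δ) (hδ1 : δ ≤ 1) (hA : 0 ≤ A) (c:ℕ →₀ ℂ) (hc : ∀ m, ‖c m‖ ≤ A*(m:ℝ)⁻¹) {P:ℕ} (hP : 0 < P) :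
    ∑ m ∈ c.support, (if (P:ℝ) ≤ m ∧ (m:ℝ) < P*exp δ then ‖c m‖ else 0) ≤ 2*A*δ + A / P := by
  have hP' : (0:ℝ) < P := mod_cast hP
  have he : exp δ - 1 ≤ 2*δ := by
    have := abs_exp_sub_one_le (x := δ) (by rw [abs_of_pos hδ]; exact hδ1)
    rw [abs_of_pos hδ] at this; exact (le_abs_self _).trans this
  have he0 : 0 ≤ P*(exp δ - 1) := mul_nonneg hP'.le (by linarith [add_one_le_exp δ])
  set K := ⌈(P:ℝ)*(exp δ - 1)⌉₊ with hK
  rw [← sum_filter]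
  have hsub : c.support.filter (fun m:ℕ => (P:ℝ) ≤ m ∧ (m:ℝ) < P*exp δ) ⊆ Ico P (P + K) := by
    intro m hm
    obtain ⟨_, h1, h2⟩ := mem_filter.mp hm
    rw [mem_Ico]
    refine ⟨by exact_mod_cast h1, ?_⟩
    have : (m:ℝ) < P + K := by linarith [Nat.le_ceil ((P:ℝ)*(exp δ - 1))]
    exact_mod_cast this
  have hcard := card_le_card hsub
  rw [Nat.card_Ico, Nat.add_sub_cancel_left] at hcard
  calc _ ≤ ∑ m ∈ c.support.filter (fun m:ℕ => (P:ℝ) ≤ m ∧ (m:ℝ) < P*exp δ), A*(P:ℝ)⁻¹ :=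
        sum_le_sum fun m hm => (hc m).trans (mul_le_mul_of_nonneg_left (inv_anti₀ hP' (mem_filter.mp hm).2.1) hA)
    _ = ((c.support.filter (fun m:ℕ => (P:ℝ) ≤ m ∧ (m:ℝ) < P*exp δ)).card:ℝ)*(A*(P:ℝ)⁻¹) := by
        rw [sum_const, nsmul_eq_mul]
    _ ≤ (K:ℝ)*(A*(P:ℝ)⁻¹) := mul_le_mul_of_nonneg_right (mod_cast hcard) (by positivity)
    _ ≤ (P*(2*δ) + 1)*(A*(P:ℝ)⁻¹) := by
        refine mul_le_mul_of_nonneg_right ?_ (by positivity)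
        have := (Nat.ceil_lt_add_one he0).le
        have := mul_le_mul_of_nonneg_left he hP'.le
        linarith
    _ = _ := by field_simp

lemma blocks_le {δ A ρ:ℝ} (hδ : 0 < δ) (hδ1 : δ ≤ 1) (hA : 0 ≤ A) (hρ : 0 < ρ) (c:ℕ →₀ ℂ) (hcs : ∀ m ∈ c.support, 1 ≤ m)
    (hc : ∀ m, ‖c m‖ ≤ A*(m:ℝ)⁻¹) {h j0 n:ℕ} (hh : 0 < h) (hj0 : 0 < j0) (hjn : j0 ≤ n) :
    ∑ j ∈ Ico j0 n, ∑ b : ZMod q, ‖∑ m ∈ c.support with ((m:ℕ) : ZMod q) = b,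
      (if ((j*h:ℕ):ℝ) ≤ m ∧ (m:ℝ) < (((j+1)*h:ℕ):ℝ) then c m else 0)‖ ≤
    IS δ (fun χ : DirichletCharacter ℂ q => Set.univ) c / (2*ρ) + ρ / 2*(log ((n*h:ℕ):ℝ) - log ((j0*h:ℕ):ℝ)) +
      n*(2*(2*A*δ + A / ((j0*h:ℕ):ℝ))) := by
  have hq0 : (0:ℝ) < q := mod_cast NeZero.pos q
  set x:ℕ → ℝ := fun j => log ((j*h:ℕ):ℝ) with hx
  have hPp : ∀ j, j0 ≤ j → 0 < j*h := fun j hj => Nat.mul_pos (by omega) hh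
  have hmon : ∀ i j, j0 ≤ i → i ≤ j → x i ≤ x j := fun i j hi hij =>
    log_le_log (mod_cast hPp i hi) (mod_cast Nat.mul_le_mul_right h hij)
  have hnear : ∀ j, j0 ≤ j → ∑ m ∈ c.support, (if ((j*h:ℕ):ℝ) ≤ m ∧ (m:ℝ) < ((j*h:ℕ):ℝ)*exp δ then ‖c m‖ else 0) ≤
      2*A*δ + A / ((j0*h:ℕ):ℝ) := fun j hj => by
    refine (near_le hδ hδ1 hA c hc (hPp j hj)).trans ?_
    have h1 : (0:ℝ) < ((j0*h:ℕ):ℝ) := mod_cast hPp j0 le_rfl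
    have h2 : ((j0*h:ℕ):ℝ) ≤ ((j*h:ℕ):ℝ) := mod_cast Nat.mul_le_mul_right h hj
    gcongr
  have hE0 : 0 ≤ 2*A*δ + A / ((j0*h:ℕ):ℝ) := by positivity
  have hj : ∀ j ∈ Ico j0 n, ∑ b : ZMod q, ‖∑ m ∈ c.support with ((m:ℕ) : ZMod q) = b,
      (if ((j*h:ℕ):ℝ) ≤ m ∧ (m:ℝ) < (((j+1)*h:ℕ):ℝ) then c m else 0)‖ ≤
      (∑ b : ZMod q, ∫ u in (x j)..(x (j+1)), δ⁻¹*‖GG c δ b u‖) + 2*(2*A*δ + A / ((j0*h:ℕ):ℝ)) := by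
    intro j hj
    have hj1 := (mem_Ico.mp hj).1
    have h1 := sum_le_sum fun (b : ZMod q) (_ : b ∈ univ) => block_le hδ c hcs b (P := ((j*h:ℕ):ℝ)) (R := (((j+1)*h:ℕ):ℝ))
      (mod_cast hPp j hj1) (mod_cast Nat.mul_le_mul_right h (Nat.le_succ j))
    refine h1.trans ?_
    rw [sum_add_distrib, sum_fiberwise c.support (fun m:ℕ => (m : ZMod q)), sum_add_distrib]
    refine add_le_add (sum_le_sum fun b _ => le_of_eq ?_) (by linarith [hnear j hj1, hnear (j+1) (by omega)])
    rw [intervalIntegral.integral_of_le (hmon j (j+1) hj1 (Nat.le_succ j)), ← integral_Ico_eq_integral_Ioc, integral_const_mul]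
  refine (sum_le_sum hj).trans ?_
  rw [sum_add_distrib, sum_const, Nat.card_Ico, nsmul_eq_mul, sum_comm]
  refine add_le_add ?_ (mul_le_mul_of_nonneg_right (mod_cast Nat.sub_le n j0) (by positivity))
  have hInt : ∀ b : ZMod q, Integrable (fun u => δ⁻¹*‖GG c δ b u‖) := fun b => (GG_int c δ b).norm.const_mul _
  have hb : ∀ b : ZMod q, ∑ j ∈ Ico j0 n, ∫ u in (x j)..(x (j+1)), δ⁻¹*‖GG c δ b u‖ ≤
      (q / δ^2 / (2*ρ))*(∫ u, ‖GG c δ b u‖^2) + ρ / (2*q)*(x n - x j0) := fun b => by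
    rw [intervalIntegral.sum_integral_adjacent_intervals_Ico hjn fun k _ => (hInt b).intervalIntegrable,
      intervalIntegral.integral_of_le (hmon j0 n le_rfl hjn)]
    calc _ ≤ ∫ u in Set.Ioc (x j0) (x n), ((q / δ^2 / (2*ρ))*‖GG c δ b u‖^2 + ρ / (2*q)) := by
          refine setIntegral_mono_on (hInt b).integrableOn (((GG_sq_int c δ b).const_mul _).integrableOn.add (integrableOn_const (by simp))) measurableSet_Ioc fun u _ => ?_
          have := sq_nonneg (q*‖GG c δ b u‖ / δ - ρ)
          have e : (q / δ^2 / (2*ρ))*‖GG c δ b u‖^2 + ρ / (2*q) - δ⁻¹*‖GG c δ b u‖ = (q*‖GG c δ b u‖ / δ - ρ)^2 / (2*ρ*q) := by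
            field_simp; ring
          have h3 : 0 ≤ (q*‖GG c δ b u‖ / δ - ρ)^2 / (2*ρ*q) := by positivity
          linarith
      _ = (q / δ^2 / (2*ρ))*(∫ u in Set.Ioc (x j0) (x n), ‖GG c δ b u‖^2) + ρ / (2*q)*(x n - x j0) := by
          rw [integral_add ((GG_sq_int c δ b).const_mul _).integrableOn (integrableOn_const (by simp)), integral_const_mul, setIntegral_const,
            volume_real_Ioc_of_le (hmon j0 n le_rfl hjn), smul_eq_mul, mul_comm (x n - x j0)]
      _ ≤ _ := by
          refine add_le_add (mul_le_mul_of_nonneg_left ?_ (by positivity)) le_rfl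
          exact setIntegral_le_integral (GG_sq_int c δ b) (Eventually.of_forall fun u => by positivity)
  refine (sum_le_sum fun b _ => hb b).trans (le_of_eq ?_)
  rw [sum_add_distrib, ← mul_sum, IS_GG hδ, sum_const, card_univ, ZMod.card, nsmul_eq_mul]
  field_simp
  rfl
end

lemma w_diff {A V:ℝ} (hA : 1 ≤ A) {h P m:ℕ} (hP : 0 < P) (h1 : P ≤ m) (h2 : m < P + h) :
    |tri A (log m - V)*(m:ℝ)⁻¹ - tri A (log P - V)*(P:ℝ)⁻¹| ≤ 2*A*h/(P:ℝ)^2 := by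
  have hP' : (0:ℝ) < P := mod_cast hP
  have h1' : (P:ℝ) ≤ m := mod_cast h1
  have h2' : (m:ℝ) ≤ P + h := mod_cast h2.le
  have hm : (0:ℝ) < m := by linarith
  have e1 : |tri A (log m - V) - tri A (log P - V)| ≤ h/(P:ℝ) := by
    refine (tri_lip _ _ _).trans ?_
    rw [show log m - V - (log P - V) = log m - log P by ring,
      ← log_div hm.ne' hP'.ne', abs_of_nonneg (log_nonneg (by rwa [one_le_div hP']))]
    refine (log_le_sub_one_of_pos (by positivity)).trans ?_
    rw [div_sub_one hP'.ne']
    gcongr; linarith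
  have e2 : |(m:ℝ)⁻¹ - (P:ℝ)⁻¹| ≤ h/(P:ℝ)^2 := by
    rw [abs_sub_comm, abs_of_nonneg (sub_nonneg.2 (inv_anti₀ hP' h1')), inv_sub_inv hP'.ne' hm.ne']
    apply div_le_div₀ (by positivity) (by linarith) (by positivity)
    rw [sq]; gcongr
  rw [show tri A (log m - V)*(m:ℝ)⁻¹ - tri A (log P - V)*(P:ℝ)⁻¹
    = (tri A (log m - V) - tri A (log P - V))*(m:ℝ)⁻¹
      + tri A (log P - V)*((m:ℝ)⁻¹ - (P:ℝ)⁻¹) by ring]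
  refine (abs_add_le _ _).trans ?_
  rw [abs_mul, abs_mul, abs_of_nonneg (tri_nonneg _ _), abs_of_pos (inv_pos.2 hm)]
  have e3 : |tri A (log m - V) - tri A (log P - V)| * (m:ℝ)⁻¹ ≤ h/(P:ℝ)*(P:ℝ)⁻¹ := by
    gcongr
  have e4 : tri A (log P - V) * |(m:ℝ)⁻¹ - (P:ℝ)⁻¹| ≤ A*(h/(P:ℝ)^2) := by
    gcongr
    exact tri_le (by linarith) _
  have e5 : (h:ℝ)/(P:ℝ)^2 ≤ A*(h/(P:ℝ)^2) := le_mul_of_one_le_left (by positivity) hA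
  have e6 : h/(P:ℝ)*(P:ℝ)⁻¹ = (h:ℝ)/(P:ℝ)^2 := by field_simp
  have e7 : 2*A*h/(P:ℝ)^2 = 2*(A*(h/(P:ℝ)^2)) := by ring
  linarith

lemma mob_abs (m:ℕ) : |mobius m| ≤ 1 := by
  have := mu_norm_le m
  rw [norm_intCast] at this
  exact this

lemma res_card {q:ℕ} (hq : 0 < q) (s : Finset ℕ) :
    ∑ a ∈ range q, (((s.filter (fun m => m % q = a)).card:ℕ):ℝ) = s.card := by
  rw [← Nat.cast_sum, ← card_eq_sum_card_fiberwise]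
  intro m _
  simpa using Nat.mod_lt m hq

lemma triv_block {q:ℕ} (hq : 0 < q) (s : Finset ℕ) :
    ∑ a ∈ range q, |∑ m ∈ s.filter (fun m => m % q = a), mobius m| ≤ s.card := by
  rw [← res_card hq s]
  refine sum_le_sum fun a _ => (abs_sum_le_sum_abs _ _).trans ?_
  refine (sum_le_sum fun m _ => mob_abs m).trans ?_
  simp

lemma fin_block {A V:ℝ} (hA : 1 ≤ A) {q h P:ℕ} [NeZero q] (hP : 0 < P)
    (ht : A/2 ≤ tri A (log P - V)) :
    ∑ a ∈ range q, |∑ m ∈ (Ico P (P+h)).filter (fun m => m % q = a), mobius m|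
      ≤ 2*P/A*(∑ b : ZMod q, ‖∑ m ∈ (bV A V).support with ((m:ℕ) : ZMod q) = b,
        (if ((P:ℕ):ℝ) ≤ m ∧ (m:ℝ) < ((P+h:ℕ):ℝ) then bV A V m else 0)‖) + 4*(h:ℝ)^2/P := by
  have hq : 0 < q := Nat.pos_of_ne_zero (NeZero.ne q)
  have hP' : (0:ℝ) < P := mod_cast hP
  have hA0 : 0 < A := by linarith
  set F : ZMod q → ℝ := fun b => ‖∑ m ∈ (bV A V).support with ((m:ℕ) : ZMod q) = b,
        (if ((P:ℕ):ℝ) ≤ m ∧ (m:ℝ) < ((P+h:ℕ):ℝ) then bV A V m else 0)‖ with hF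
  set s := Ico P (P+h) with hs
  have key : ∀ a ∈ range q, |∑ m ∈ s.filter (fun m => m % q = a), mobius m|
      ≤ 2*P/A*(F (a:ZMod q) + ((s.filter (fun m => m % q = a)).card:ℕ)*(2*A*h/(P:ℝ)^2)) := by
    intro a ha
    set wP := tri A (log P - V)*(P:ℝ)⁻¹ with hwP
    set S := ∑ m ∈ s.filter (fun m => m % q = a), mobius m with hS
    have hFa : F (a:ZMod q) = |∑ m ∈ s.filter (fun m => m % q = a), mobius m*(tri A (log m - V)*(m:ℝ)⁻¹)| := by
      have : (∑ m ∈ (bV A V).support with ((m:ℕ) : ZMod q) = (a:ZMod q),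
        (if ((P:ℕ):ℝ) ≤ m ∧ (m:ℝ) < ((P+h:ℕ):ℝ) then bV A V m else 0))
        = ((∑ m ∈ s.filter (fun m => m % q = a), mobius m*(tri A (log m - V)*(m:ℝ)⁻¹):ℝ):ℂ) := by
        rw [ofReal_sum, ← sum_filter, filter_filter]
        have e : ∀ m:ℕ, ((mobius m*(tri A (log m - V)*(m:ℝ)⁻¹):ℝ):ℂ) = bV A V m := by
          intro m
          rw [bV_apply, bfun, mobius]; push_cast; ring
        rw [sum_congr rfl (fun m _ => e m)]
        apply sum_subset_zero_on_sdiff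
        · intro m hm
          simp only [mem_filter, Nat.cast_le, Nat.cast_lt] at hm
          rw [mem_filter, hs, mem_Ico]
          refine ⟨hm.2.2, ?_⟩
          have := (ZMod.natCast_eq_natCast_iff' m a q).1 hm.2.1
          rwa [Nat.mod_eq_of_lt (mem_range.1 ha)] at this
        · intro m hm
          rw [Finset.mem_sdiff, mem_filter, mem_filter, hs, mem_Ico] at hm
          by_contra hne
          apply hm.2
          refine ⟨Finsupp.mem_support_iff.2 hne, ?_, ?_⟩
          · rw [ZMod.natCast_eq_natCast_iff', Nat.mod_eq_of_lt (mem_range.1 ha)]; exact hm.1.2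
          · exact ⟨by exact_mod_cast hm.1.1.1, by exact_mod_cast hm.1.1.2⟩
        · intro m _; rfl
      rw [hF]; simp only []
      rw [this, norm_real, norm_eq_abs]
    have h1 : wP*S = (∑ m ∈ s.filter (fun m => m % q = a), mobius m*(tri A (log m - V)*(m:ℝ)⁻¹))
        - ∑ m ∈ s.filter (fun m => m % q = a), mobius m*(tri A (log m - V)*(m:ℝ)⁻¹ - wP) := by
      rw [hS, mul_sum, ← sum_sub_distrib]
      exact sum_congr rfl fun m _ => by ring
    have h2 : |∑ m ∈ s.filter (fun m => m % q = a), mobius m*(tri A (log m - V)*(m:ℝ)⁻¹ - wP)|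
        ≤ ((s.filter (fun m => m % q = a)).card:ℕ)*(2*A*h/(P:ℝ)^2) := by
      refine (abs_sum_le_sum_abs _ _).trans ?_
      rw [← nsmul_eq_mul]
      refine sum_le_card_nsmul _ _ _ fun m hm => ?_
      rw [mem_filter, hs, mem_Ico] at hm
      rw [abs_mul]
      have := w_diff (V := V) hA hP hm.1.1 hm.1.2
      have h3 := mob_abs m
      calc _ ≤ 1 * |tri A (log m - V)*(m:ℝ)⁻¹ - wP| := by gcongr
        _ ≤ _ := by rw [one_mul]; exact this
    have h3 : |wP*S| ≤ F (a:ZMod q) + ((s.filter (fun m => m % q = a)).card:ℕ)*(2*A*h/(P:ℝ)^2) := by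
      rw [h1, hFa]
      refine (abs_sub _ _).trans ?_
      linarith
    have h4 : A/2*(P:ℝ)⁻¹ * |S| ≤ |wP*S| := by
      rw [abs_mul, abs_of_nonneg (mul_nonneg (tri_nonneg _ _) (by positivity))]
      gcongr
    calc |S| = 2*P/A*(A/2*(P:ℝ)⁻¹ * |S|) := by field_simp
      _ ≤ _ := by gcongr; exact h4.trans h3
  refine (sum_le_sum key).trans ?_
  rw [← mul_sum, sum_add_distrib, ← sum_mul, res_card hq, mul_add]
  have hc : (s.card:ℝ) = h := by simp [hs]
  rw [hc]
  have h5 : ∑ a ∈ range q, F (a:ZMod q) ≤ ∑ b : ZMod q, F b := by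
    rw [← sum_image (f := F) (g := fun a:ℕ => (a:ZMod q))]
    · exact sum_le_sum_of_subset_of_nonneg (subset_univ _) fun b _ _ => norm_nonneg _
    · intro a ha b hb hab
      have := (ZMod.natCast_eq_natCast_iff' a b q).1 hab
      rwa [Nat.mod_eq_of_lt (mem_range.1 ha), Nat.mod_eq_of_lt (mem_range.1 hb)] at this
  have h6 : 2*P/A*((h:ℝ)*(2*A*h/(P:ℝ)^2)) = 4*(h:ℝ)^2/P := by field_simp; ring
  rw [h6]
  gcongr

set_option maxHeartbeats 1000000 in
lemma final_fixed {ε κ η A ρ:ℝ} (hε : 0 < ε) (hε1 : ε < 1/100) (hA : A = 8/ε) (hκ : κ = exp (-(A/2)))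
    (hρ : ρ = ε/16) (hη : η = ε*κ/320) {q h M:ℕ} [NeZero q] (hh : 0 < h) (hhη : 1/η ≤ h)
    (hM1 : h ≤ M) (hM2 : 4*(h + 8*h/κ)/ε ≤ M)
    (hIS : IS (η*h/M) (fun χ : DirichletCharacter ℂ q => Set.univ) (bV A (log M)) ≤ ρ^2) :
    ∑ j ∈ range (M / h + 1), ∑ a ∈ range q,
      |∑ m ∈ (Ico (j*h) ((j + 1)*h)).filter (fun m => m % q = a), mobius m| ≤ ε*M := by
  have hq : 0 < q := Nat.pos_of_ne_zero (NeZero.ne q)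
  have hA1 : 800 ≤ A := by
    rw [hA, le_div_iff₀ hε]; linarith
  have hκ0 : 0 < κ := hκ ▸ exp_pos _
  have hκ1 : κ ≤ ε/4 := by
    have h1 := add_one_le_exp (A/2)
    have h2 : κ*exp (A/2) = 1 := by rw [hκ, ← exp_add]; simp
    have h3 : κ*(A/2) ≤ 1 := by rw [← h2]; gcongr; linarith
    have h4 : ε*A = 8 := by rw [hA]; field_simp
    have h5 : κ*(A/2)*ε ≤ 1*ε := by gcongr
    have h6 : κ*(A/2)*ε = 4*κ := by linear_combination κ/2*h4
    linarith
  have hη0 : 0 < η := by rw [hη]; positivity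
  have hη1 : η ≤ 1 := by
    rw [hη]
    have : ε*κ ≤ 1*1 := by gcongr <;> linarith
    linarith
  have hρ0 : 0 < ρ := by rw [hρ]; positivity
  have hh' : (0:ℝ) < h := mod_cast hh
  have hM0 : 0 < M := lt_of_lt_of_le hh hM1
  have hM' : (0:ℝ) < M := mod_cast hM0
  have hM1' : (h:ℝ) ≤ M := mod_cast hM1
  set n := M / h + 1 with hn
  set j0 := ⌈κ*M/h⌉₊ with hj0
  have hj0p : 0 < j0 := Nat.ceil_pos.2 (by positivity)
  have hj0l : κ*M ≤ j0*h := by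
    have := Nat.le_ceil (κ*M/h)
    rwa [div_le_iff₀ hh'] at this
  have hj0u : (j0:ℝ)*h ≤ κ*M + h := by
    have := (Nat.ceil_lt_add_one (a := κ*M/h) (by positivity)).le
    calc (j0:ℝ)*h ≤ (κ*M/h + 1)*h := by gcongr
      _ = _ := by field_simp
  have hnh : (n:ℝ)*h ≤ 2*M := by
    have h1 : M / h*h ≤ M := Nat.div_mul_le_self M h
    have h2 : n*h ≤ M + h := by rw [hn, add_mul]; omega
    have h3 : (n:ℝ)*h ≤ M + h := mod_cast h2
    linarith
  have hMn : (M:ℝ) ≤ n*h := by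
    have : M ≤ n*h := (Nat.lt_div_mul_add hh (a := M)).le.trans (by rw [hn, add_mul]; omega)
    exact_mod_cast this
  have hjn : j0 ≤ n := by
    rw [hj0, Nat.ceil_le, div_le_iff₀ hh']
    refine le_trans ?_ hMn
    have : κ*M ≤ 1*M := by gcongr; linarith
    linarith
  have hsplit := sum_range_add_sum_Ico (fun j => ∑ a ∈ range q,
      |∑ m ∈ (Ico (j*h) ((j + 1)*h)).filter (fun m => m % q = a), mobius m|) hjn
  rw [← hsplit]
  have hfirst : ∑ j ∈ range j0, ∑ a ∈ range q,
      |∑ m ∈ (Ico (j*h) ((j + 1)*h)).filter (fun m => m % q = a), mobius m| ≤ κ*M + h := by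
    refine le_trans ?_ hj0u
    have := sum_le_card_nsmul (range j0) (fun j => ∑ a ∈ range q,
      |∑ m ∈ (Ico (j*h) ((j + 1)*h)).filter (fun m => m % q = a), mobius m|) (h:ℝ) ?_
    · simpa using this
    · intro j _
      refine (triv_block hq _).trans ?_
      rw [Nat.card_Ico, add_mul]; simp
  set T:ℕ → ℝ := fun j => ∑ b : ZMod q, ‖∑ m ∈ (bV A (log M)).support with ((m:ℕ) : ZMod q) = b,
      (if ((j*h:ℕ):ℝ) ≤ m ∧ (m:ℝ) < (((j+1)*h:ℕ):ℝ) then bV A (log M) m else 0)‖ with hT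
  have hδ0 : 0 < η*h/M := by positivity
  have hδ1 : η*h/M ≤ 1 := by
    rw [div_le_one hM']
    have : η*h ≤ 1*M := by gcongr
    linarith
  have hTs := blocks_le (q := q) hδ0 hδ1 (by linarith : 0 ≤ A) hρ0 (bV A (log M)) (fun m hm => (bV_support hm).1)
    (fun m => bfun_norm (by linarith) _ m) hh hj0p hjn
  have hj0h : (0:ℝ) < (j0:ℝ)*h := by positivity
  have hlogκ : log (κ*M) = -(A/2) + log M := by
    rw [log_mul hκ0.ne' hM'.ne', hκ, log_exp]
  have hTs' : ∑ j ∈ Ico j0 n, T j ≤ ρ/2*A + 12*A*η/κ := by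
    refine hTs.trans ?_
    have e1 : IS (η*h/M) (fun χ : DirichletCharacter ℂ q => Set.univ) (bV A (log M)) / (2*ρ) ≤ ρ/2 := by
      rw [div_le_iff₀ (by positivity)]; linarith
    have e2 : log ((n*h:ℕ):ℝ) - log ((j0*h:ℕ):ℝ) ≤ A - 1 := by
      push_cast
      have a1 : log ((n:ℝ)*h) ≤ log 2 + log M := by
        rw [← log_mul (by norm_num) hM'.ne']
        exact log_le_log (by positivity) hnh
      have a2 : -(A/2) + log M ≤ log ((j0:ℝ)*h) := by
        rw [← hlogκ]; exact log_le_log (by positivity) hj0l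
      have a3 := log_two_lt_d9
      linarith
    have e3 : ρ/2*(log ((n*h:ℕ):ℝ) - log ((j0*h:ℕ):ℝ)) ≤ ρ/2*(A-1) := by gcongr
    have e4 : (n:ℝ)*(η*h/M) ≤ 2*η := by
      rw [show (n:ℝ)*(η*h/M) = (n*h)*η/M by ring, div_le_iff₀ hM']
      calc (n*h)*η ≤ (2*M)*η := by gcongr
        _ = _ := by ring
    have e5 : (n:ℝ)*(A / ((j0*h:ℕ):ℝ)) ≤ 2*A*η/κ := by
      push_cast
      have b1 : (1:ℝ) ≤ η*h := by rwa [div_le_iff₀' hη0] at hhη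
      calc (n:ℝ)*(A / ((j0:ℝ)*h)) ≤ n*(A/(κ*M)) := by gcongr
        _ ≤ n*(A/(κ*M))*(η*h) := le_mul_of_one_le_right (by positivity) b1
        _ = (n*h)*(A*η)/(κ*M) := by ring
        _ ≤ (2*M)*(A*η)/(κ*M) := by gcongr
        _ = _ := by field_simp
    have e6 : (n:ℝ)*(2*(2*A*(η*h/M) + A / ((j0*h:ℕ):ℝ)))
        = 4*A*(n*(η*h/M)) + 2*(n*(A / ((j0*h:ℕ):ℝ))) := by ring
    have e7 : 4*A*((n:ℝ)*(η*h/M)) ≤ 4*A*(2*η) := by gcongr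
    have e8 : A*η ≤ A*η/κ := by
      rw [le_div_iff₀ hκ0]
      exact mul_le_of_le_one_right (by positivity) (by linarith)
    have e9 : 12*A*η/κ = 12*(A*η/κ) := by ring
    have e10 : 2*A*η/κ = 2*(A*η/κ) := by ring
    rw [e6]
    linarith
  have hblk : ∀ j ∈ Ico j0 n, ∑ a ∈ range q,
      |∑ m ∈ (Ico (j*h) ((j + 1)*h)).filter (fun m => m % q = a), mobius m|
      ≤ 2*M/A*T j + 4*(h:ℝ)^2/(κ*M) := by
    intro j hj
    rw [mem_Ico] at hj
    have c1 : 0 < j*h := Nat.mul_pos (by omega) hh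
    have c1' : (0:ℝ) < ((j*h:ℕ):ℝ) := mod_cast c1
    have c2 : ((j*h:ℕ):ℝ) ≤ M := by
      have : j*h ≤ M := (Nat.mul_le_mul_right h (by omega : j ≤ M / h)).trans (Nat.div_mul_le_self M h)
      exact_mod_cast this
    have c3 : κ*M ≤ ((j*h:ℕ):ℝ) := by
      refine hj0l.trans ?_
      push_cast; gcongr; exact hj.1
    have c4 : A/2 ≤ tri A (log ((j*h:ℕ):ℝ) - log M) := by
      have d1 : log ((j*h:ℕ):ℝ) ≤ log M := log_le_log c1' c2
      have d2 := log_le_log (by positivity) c3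
      rw [hlogκ] at d2
      rw [tri, abs_of_nonpos (by linarith)]
      exact le_max_of_le_right (by linarith)
    have := fin_block (h := h) (q := q) (by linarith) c1 c4
    rw [← Nat.succ_mul, Nat.succ_eq_add_one] at this
    refine this.trans ?_
    have hT0 : 0 ≤ T j := sum_nonneg fun _ _ => norm_nonneg _
    apply add_le_add
    · exact mul_le_mul_of_nonneg_right (by gcongr) hT0
    · gcongr
  have hsec := sum_le_sum hblk
  rw [sum_add_distrib, ← mul_sum, sum_const, Nat.card_Ico, nsmul_eq_mul] at hsec
  have f1 : ((n - j0:ℕ):ℝ)*(4*(h:ℝ)^2/(κ*M)) ≤ 8*h/κ := by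
    have : ((n - j0:ℕ):ℝ) ≤ n := mod_cast Nat.sub_le _ _
    calc ((n - j0:ℕ):ℝ)*(4*(h:ℝ)^2/(κ*M)) ≤ n*(4*(h:ℝ)^2/(κ*M)) := by gcongr
      _ = (n*h)*(4*h)/(κ*M) := by ring
      _ ≤ (2*M)*(4*h)/(κ*M) := by gcongr
      _ = _ := by field_simp; ring
  have f2 : 2*M/A*∑ j ∈ Ico j0 n, T j ≤ 2*M/A*(ρ/2*A + 12*A*η/κ) := by gcongr
  have f3 : 2*M/A*(ρ/2*A + 12*A*η/κ) = M*(ρ + 24*(ε/320)) := by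
    have : η/κ = ε/320 := by rw [hη]; field_simp
    rw [← this]; field_simp; ring
  have f4 : h + 8*h/κ ≤ ε/4*M := by
    rw [div_le_iff₀ hε] at hM2; linarith
  have f5 : κ*M ≤ ε/4*M := by gcongr
  rw [f3, hρ] at f2
  linarith [mul_pos hε hM']

end MR

/-- Möbius cancellation on blocks of arithmetic progressions, after a shift `z`. -/
theorem mobius_blocks_progressions
    (ε : ℝ) (hε : ε ∈ Set.Ioo (0 : ℝ) (1 / 100)) :
    ∃ L₀ : ℕ, ∀ L : ℕ, L₀ ≤ L → ∀ q : ℕ, 0 < q →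
      primeVol q ≤ (1 - ε) * primeSumUpToNat L →
      ∃ M₀ : ℕ, ∀ M : ℕ, M₀ ≤ M →
        ∃ z : ℕ, z < L * q ∧
          ∑ j ∈ Finset.range (M / (L * q) + 1), ∑ a ∈ Finset.range q,
            |∑ m ∈ (Finset.Ico (z + j * (L * q)) (z + (j + 1) * (L * q))).filter
                (fun m => m % q = a), mobius m|
            ≤ ε * M := by
  obtain ⟨h0, h1⟩ := hε
  obtain ⟨A, hA⟩ : ∃ A, A = 8/ε := ⟨_, rfl⟩
  obtain ⟨κ, hκ⟩ : ∃ κ, κ = Real.exp (-(A/2)) := ⟨_, rfl⟩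
  obtain ⟨ρ, hρ⟩ : ∃ ρ, ρ = ε/16 := ⟨_, rfl⟩
  obtain ⟨η, hη⟩ : ∃ η, η = ε*κ/320 := ⟨_, rfl⟩
  have hκ0 : 0 < κ := hκ ▸ Real.exp_pos _
  have hη0 : 0 < η := by rw [hη]; positivity
  have hA1 : 1 ≤ A := by rw [hA, le_div_iff₀ h0]; linarith
  have hρ0 : 0 < ρ^2 := by rw [hρ]; positivity
  obtain ⟨L1, hL1⟩ := IS_main A η ε (ρ^2) hA1 hη0 h0 (by linarith) hρ0
  refine ⟨L1 + ⌈1/η⌉₊ + 1, fun L hL q hq hpq => ?_⟩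
  haveI : NeZero q := ⟨hq.ne'⟩
  obtain ⟨V0, hV0⟩ := hL1 L (by omega) q hpq
  have hh : 0 < L * q := Nat.mul_pos (by omega) hq
  refine ⟨L * q + ⌈Real.exp V0⌉₊ + ⌈4*(((L*q : ℕ):ℝ) + 8*((L*q : ℕ):ℝ)/κ)/ε⌉₊, fun M hM => ⟨0, hh, ?_⟩⟩
  simp only [zero_add]
  have hM0 : (0:ℝ) < M := by exact_mod_cast (by omega : 0 < M)
  refine final_fixed h0 h1 hA hκ hρ hη hh ?_ (by omega) (Nat.ceil_le.1 (by omega)) ?_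
  · refine Nat.ceil_le.1 ((by omega : ⌈1/η⌉₊ ≤ L).trans (Nat.le_mul_of_pos_right L hq))
  · have hV := hV0 (Real.log M) ((Real.le_log_iff_exp_le hM0).2 (Nat.ceil_le.1 (by omega)))
    rw [Real.exp_neg, Real.exp_log hM0] at hV
    convert hV using 2
    push_cast; ring
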